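/- Let Ω ⊆ ℂⁿ be a bounded domain with C² strongly pseudoconvex boundary: there is a C² function ρ : ℂⁿ → ℝ with Ω = {ρ < 0}, ∂Ω = {ρ = 0}, Dρ(x) ≠ 0 for x ∈ ∂Ω, and for every x ∈ ∂Ω and every w ∈ ℂⁿ \ {0} lying in the complex tangent space (Dρ(x)(w) = 0 and Dρ(x)(i·w) = 0), the Levi form L(w) = (1/4)·(D²ρ(x)(w,w) + D²ρ(x)(i·w, i·w)) is strictly positive. Then lim_{Ω ∋ z → ∂Ω} σ_Ω(z) = 1: for every ε > 0 there is a compact set K ⊆ Ω such that σ_Ω(z) > 1 − ε for all z ∈ Ω \ K. -/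

import Mathlib

open Metric Set

/-- The squeezing function of a domain `Ω ⊆ ℂⁿ` at a point `p`. -/
noncomputable def squeezingFun (n : ℕ) (Ω : Set (EuclideanSpace ℂ (Fin n)))
    (p : EuclideanSpace ℂ (Fin n)) : ℝ :=
  sSup { r : ℝ | 0 < r ∧ ∃ f : EuclideanSpace ℂ (Fin n) → EuclideanSpace ℂ (Fin n),
    DifferentiableOn ℂ f Ω ∧ InjOn f Ω ∧ f '' Ω ⊆ ball 0 1 ∧ f p = 0 ∧ ball 0 r ⊆ f '' Ω }

section StronglyPseudoconvex

open MeasureTheory Complex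

lemma MeasureTheory.Integrable.subFun {α F : Type*} [MeasurableSpace α] {μ : Measure α}
    [NormedAddCommGroup F] {f g : α → F} (hf : Integrable f μ) (hg : Integrable g μ) :
    Integrable (fun x => f x - g x) μ := hf.sub hg

section Wirtinger

variable {n : ℕ}

local notation "𝔼" => EuclideanSpace ℂ (Fin n)

/-- The `j`-th standard basis vector. -/
noncomputable def stdVec (j : Fin n) : 𝔼 := EuclideanSpace.single j 1

/-- The Wirtinger derivative `∂/∂z_j`. -/
noncomputable def wirt (j : Fin n) (f : 𝔼 → ℂ) (x : 𝔼) : ℂ :=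
  (1 / 2) * (fderiv ℝ f x (stdVec j) - I * fderiv ℝ f x (I • stdVec j))

/-- The Wirtinger derivative `∂/∂z̄_j`. -/
noncomputable def wirtBar (j : Fin n) (f : 𝔼 → ℂ) (x : 𝔼) : ℂ :=
  (1 / 2) * (fderiv ℝ f x (stdVec j) + I * fderiv ℝ f x (I • stdVec j))

lemma ContDiff.fderiv_apply_const {F : Type*} [NormedAddCommGroup F] [NormedSpace ℝ F]
    {f : 𝔼 → F} (hf : ContDiff ℝ 2 f) (v : 𝔼) :
    ContDiff ℝ 1 (fun x => fderiv ℝ f x v) :=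
  (hf.fderiv_right (m := 1) (by norm_num)).clm_apply contDiff_const

lemma ContDiff.continuous_fderiv_apply_const {F : Type*} [NormedAddCommGroup F]
    [NormedSpace ℝ F] {f : 𝔼 → F} (hf : ContDiff ℝ 1 f) (v : 𝔼) :
    Continuous (fun x => fderiv ℝ f x v) :=
  (hf.continuous_fderiv (by norm_num)).clm_apply continuous_const

lemma contDiff_wirt {f : 𝔼 → ℂ} (hf : ContDiff ℝ 2 f) (j : Fin n) :
    ContDiff ℝ 1 (wirt j f) :=
  contDiff_const.mul ((hf.fderiv_apply_const _).sub
    (contDiff_const.mul (hf.fderiv_apply_const _)))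

lemma contDiff_wirtBar {f : 𝔼 → ℂ} (hf : ContDiff ℝ 2 f) (j : Fin n) :
    ContDiff ℝ 1 (wirtBar j f) :=
  contDiff_const.mul ((hf.fderiv_apply_const _).add
    (contDiff_const.mul (hf.fderiv_apply_const _)))

lemma continuous_wirt {f : 𝔼 → ℂ} (hf : ContDiff ℝ 1 f) (j : Fin n) :
    Continuous (wirt j f) :=
  continuous_const.mul ((hf.continuous_fderiv_apply_const _).sub
    (continuous_const.mul (hf.continuous_fderiv_apply_const _)))

lemma continuous_wirtBar {f : 𝔼 → ℂ} (hf : ContDiff ℝ 1 f) (j : Fin n) :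
    Continuous (wirtBar j f) :=
  continuous_const.mul ((hf.continuous_fderiv_apply_const _).add
    (continuous_const.mul (hf.continuous_fderiv_apply_const _)))

lemma wirtBar_mul {f g : 𝔼 → ℂ} {x : 𝔼} (hf : DifferentiableAt ℝ f x)
    (hg : DifferentiableAt ℝ g x) (j : Fin n) :
    wirtBar j (fun y => f y * g y) x = wirtBar j f x * g x + f x * wirtBar j g x := by
  simp only [wirtBar]
  rw [fderiv_fun_mul hf hg]
  simp; ring

lemma wirt_mul {f g : 𝔼 → ℂ} {x : 𝔼} (hf : DifferentiableAt ℝ f x)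
    (hg : DifferentiableAt ℝ g x) (j : Fin n) :
    wirt j (fun y => f y * g y) x = wirt j f x * g x + f x * wirt j g x := by
  simp only [wirt]
  rw [fderiv_fun_mul hf hg]
  simp; ring

lemma wirtBar_sub {f g : 𝔼 → ℂ} {x : 𝔼} (hf : DifferentiableAt ℝ f x)
    (hg : DifferentiableAt ℝ g x) (j : Fin n) :
    wirtBar j (fun y => f y - g y) x = wirtBar j f x - wirtBar j g x := by
  simp only [wirtBar]
  rw [fderiv_fun_sub hf hg]
  simp; ring

lemma fderiv_conj {f : 𝔼 → ℂ} {x : 𝔼} (hf : DifferentiableAt ℝ f x) (v : 𝔼) :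
    fderiv ℝ (fun y => (starRingEnd ℂ) (f y)) x v = (starRingEnd ℂ) (fderiv ℝ f x v) := by
  have := (conjCLE.toContinuousLinearMap.hasFDerivAt (x := f x)).comp x hf.hasFDerivAt
  have h2 : HasFDerivAt (fun y => (starRingEnd ℂ) (f y))
    (conjCLE.toContinuousLinearMap.comp (fderiv ℝ f x)) x := this
  rw [h2.fderiv]; simp

lemma wirtBar_conj {f : 𝔼 → ℂ} {x : 𝔼} (hf : DifferentiableAt ℝ f x) (j : Fin n) :
    wirtBar j (fun y => (starRingEnd ℂ) (f y)) x = (starRingEnd ℂ) (wirt j f x) := by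
  simp [wirtBar, wirt, fderiv_conj hf, Complex.conj_ofNat]

lemma wirt_conj {f : 𝔼 → ℂ} {x : 𝔼} (hf : DifferentiableAt ℝ f x) (j : Fin n) :
    wirt j (fun y => (starRingEnd ℂ) (f y)) x = (starRingEnd ℂ) (wirtBar j f x) := by
  simp [wirtBar, wirt, fderiv_conj hf, Complex.conj_ofNat]
  ring

lemma fderiv_fderiv_apply {F : Type*} [NormedAddCommGroup F] [NormedSpace ℝ F]
    {f : 𝔼 → F} (hf : ContDiff ℝ 2 f) (x v w : 𝔼) :
    fderiv ℝ (fun y => fderiv ℝ f y v) x w = fderiv ℝ (fderiv ℝ f) x w v := by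
  have h : DifferentiableAt ℝ (fderiv ℝ f) x :=
    ((hf.fderiv_right (m := 1) (by norm_num)).differentiable (by norm_num)).differentiableAt
  rw [fderiv_clm_apply h (differentiableAt_const v)]
  simp

lemma fderiv_fderiv_comm {F : Type*} [NormedAddCommGroup F] [NormedSpace ℝ F]
    {f : 𝔼 → F} (hf : ContDiff ℝ 2 f) (x v w : 𝔼) :
    fderiv ℝ (fderiv ℝ f) x v w = fderiv ℝ (fderiv ℝ f) x w v := by
  exact (hf.contDiffAt.isSymmSndFDerivAt (by simp)) v w

lemma fderiv_wirt {f : 𝔼 → ℂ} (hf : ContDiff ℝ 2 f) (x w : 𝔼) (j : Fin n) :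
    fderiv ℝ (wirt j f) x w = (1 / 2) * (fderiv ℝ (fderiv ℝ f) x w (stdVec j)
      - I * fderiv ℝ (fderiv ℝ f) x w (I • stdVec j)) := by
  have h1 := ((hf.fderiv_apply_const (stdVec j)).differentiable (by norm_num)) x
  have h2 := ((hf.fderiv_apply_const (I • stdVec j)).differentiable (by norm_num)) x
  have : wirt j f = fun x => (1 / 2 : ℂ) * (fderiv ℝ f x (stdVec j)
    - I * fderiv ℝ f x (I • stdVec j)) := rfl
  rw [this, fderiv_const_mul (h1.fun_sub (h2.const_mul I)), fderiv_fun_sub h1 (h2.const_mul I),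
    fderiv_const_mul h2]
  simp only [_root_.smul_apply, _root_.sub_apply, smul_eq_mul,
    fderiv_fderiv_apply hf]

lemma fderiv_wirtBar {f : 𝔼 → ℂ} (hf : ContDiff ℝ 2 f) (x w : 𝔼) (j : Fin n) :
    fderiv ℝ (wirtBar j f) x w = (1 / 2) * (fderiv ℝ (fderiv ℝ f) x w (stdVec j)
      + I * fderiv ℝ (fderiv ℝ f) x w (I • stdVec j)) := by
  have h1 := ((hf.fderiv_apply_const (stdVec j)).differentiable (by norm_num)) x
  have h2 := ((hf.fderiv_apply_const (I • stdVec j)).differentiable (by norm_num)) x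
  have : wirtBar j f = fun x => (1 / 2 : ℂ) * (fderiv ℝ f x (stdVec j)
    + I * fderiv ℝ f x (I • stdVec j)) := rfl
  rw [this, fderiv_const_mul (h1.fun_add (h2.const_mul I)), fderiv_fun_add h1 (h2.const_mul I),
    fderiv_const_mul h2]
  simp only [_root_.smul_apply, _root_.add_apply, smul_eq_mul,
    fderiv_fderiv_apply hf]

lemma wirtBar_wirt_comm {f : 𝔼 → ℂ} (hf : ContDiff ℝ 2 f) (x : 𝔼) (j k : Fin n) :
    wirtBar k (wirt j f) x = wirt j (wirtBar k f) x := by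
  rw [wirtBar, wirt, fderiv_wirt hf, fderiv_wirt hf, fderiv_wirtBar hf, fderiv_wirtBar hf,
    fderiv_fderiv_comm hf x (stdVec k), fderiv_fderiv_comm hf x (stdVec k),
    fderiv_fderiv_comm hf x (I • stdVec k), fderiv_fderiv_comm hf x (I • stdVec k)]
  ring

lemma integral_fderiv_apply_eq_zero {g : 𝔼 → ℂ} (hg : ContDiff ℝ 1 g)
    (hc : HasCompactSupport g) (v : 𝔼) : ∫ x, fderiv ℝ g x v = 0 := by
  have hintg : Integrable (fun x => fderiv ℝ g x v) :=
    (hg.continuous_fderiv_apply_const v).integrable_of_hasCompactSupport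
      (hc.fderiv_apply ℝ v)
  have hgi : Integrable g := hg.continuous.integrable_of_hasCompactSupport hc
  have := integral_mul_fderiv_eq_neg_fderiv_mul_of_integrable (𝕜 := ℂ) (μ := volume)
    (f := fun _ : 𝔼 => (1 : ℂ)) (g := g) (v := v) (by simp) (by simpa using hintg)
    (by simpa using hgi) (fun x _ => by fun_prop)
    (fun x _ => hg.differentiable (by norm_num) x)
  simpa using this

lemma integral_wirtBar_eq_zero {g : 𝔼 → ℂ} (hg : ContDiff ℝ 1 g)
    (hc : HasCompactSupport g) (j : Fin n) : ∫ x, wirtBar j g x = 0 := by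
  have hintg : ∀ v : 𝔼, Integrable (fun x => fderiv ℝ g x v) := fun v =>
    (hg.continuous_fderiv_apply_const v).integrable_of_hasCompactSupport
      (hc.fderiv_apply ℝ v)
  simp only [wirtBar]
  rw [integral_const_mul, integral_add (hintg _) ((hintg _).const_mul I), integral_const_mul,
    integral_fderiv_apply_eq_zero hg hc, integral_fderiv_apply_eq_zero hg hc]
  simp

lemma hasCompactSupport_wirt {f : 𝔼 → ℂ} (hf : HasCompactSupport f) (j : Fin n) :
    HasCompactSupport (wirt j f) := by
  refine (hf.fderiv ℝ).mono' ?_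
  refine (Function.support_subset_iff'.2 fun x hx => ?_).trans subset_closure
  have : fderiv ℝ f x = 0 := by simpa using hx
  simp [wirt, this]

lemma hasCompactSupport_wirtBar {f : 𝔼 → ℂ} (hf : HasCompactSupport f) (j : Fin n) :
    HasCompactSupport (wirtBar j f) := by
  refine (hf.fderiv ℝ).mono' ?_
  refine (Function.support_subset_iff'.2 fun x hx => ?_).trans subset_closure
  have : fderiv ℝ f x = 0 := by simpa using hx
  simp [wirtBar, this]

/-- The weighted adjoint derivative `∂_j - ∂_j φ`. -/
noncomputable def wirtAdj (φ : 𝔼 → ℝ) (j : Fin n) (f : 𝔼 → ℂ) (x : 𝔼) : ℂ :=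
  wirt j f x - wirt j (fun y => (φ y : ℂ)) x * f x

lemma contDiff_ofReal_comp {φ : 𝔼 → ℝ} {m : WithTop ℕ∞} (hφ : ContDiff ℝ m φ) :
    ContDiff ℝ m (fun y => (φ y : ℂ)) := ofRealCLM.contDiff.comp hφ

lemma fderiv_ofReal_comp {φ : 𝔼 → ℝ} {x : 𝔼} (hφ : DifferentiableAt ℝ φ x) (v : 𝔼) :
    fderiv ℝ (fun y => (φ y : ℂ)) x v = (fderiv ℝ φ x v : ℂ) := by
  have h2 : HasFDerivAt (fun y => (φ y : ℂ)) (ofRealCLM.comp (fderiv ℝ φ x)) x :=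
    (ofRealCLM.hasFDerivAt (x := φ x)).comp x hφ.hasFDerivAt
  rw [h2.fderiv]; simp

lemma wirtBar_exp_neg {φ : 𝔼 → ℝ} {x : 𝔼} (hφ : DifferentiableAt ℝ φ x) (j : Fin n) :
    wirtBar j (fun y => ((Real.exp (-φ y) : ℝ) : ℂ)) x =
      -(starRingEnd ℂ) (wirt j (fun y => (φ y : ℂ)) x) * ((Real.exp (-φ x) : ℝ) : ℂ) := by
  have h : HasFDerivAt (fun y => Real.exp (-φ y)) (Real.exp (-φ x) • -fderiv ℝ φ x) x :=
    hφ.hasFDerivAt.neg.exp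
  simp only [wirtBar, wirt]
  rw [fderiv_ofReal_comp h.differentiableAt, fderiv_ofReal_comp h.differentiableAt,
    fderiv_ofReal_comp hφ, fderiv_ofReal_comp hφ, h.fderiv]
  simp [Complex.conj_ofNat]
  ring

lemma integral_wirtBar_mul_conj {φ : 𝔼 → ℝ} (hφ : ContDiff ℝ 1 φ) {f g : 𝔼 → ℂ}
    (hf : ContDiff ℝ 1 f) (hg : ContDiff ℝ 1 g) (hfc : HasCompactSupport f) (k : Fin n) :
    ∫ x, wirtBar k f x * (starRingEnd ℂ) (g x) * ((Real.exp (-φ x) : ℝ) : ℂ) =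
      -∫ x, f x * (starRingEnd ℂ) (wirtAdj φ k g x) * ((Real.exp (-φ x) : ℝ) : ℂ) := by
  have hgc : ContDiff ℝ 1 (fun x => (starRingEnd ℂ) (g x)) :=
    conjCLE.contDiff.comp hg
  have hW : ContDiff ℝ 1 (fun x => ((Real.exp (-φ x) : ℝ) : ℂ)) :=
    contDiff_ofReal_comp (hφ.neg.exp)
  have hd : ∀ {u : 𝔼 → ℂ}, ContDiff ℝ 1 u → ∀ x, DifferentiableAt ℝ u x :=
    fun hu x => hu.differentiable (by norm_num) x
  have h0 := integral_wirtBar_eq_zero ((hf.mul hgc).mul hW) (hfc.mul_right.mul_right) k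
  have hpt : ∀ x, wirtBar k (fun x => f x * (starRingEnd ℂ) (g x) *
      ((Real.exp (-φ x) : ℝ) : ℂ)) x =
      wirtBar k f x * (starRingEnd ℂ) (g x) * ((Real.exp (-φ x) : ℝ) : ℂ) +
      f x * (starRingEnd ℂ) (wirtAdj φ k g x) * ((Real.exp (-φ x) : ℝ) : ℂ) := by
    intro x
    rw [wirtBar_mul (hd (hf.mul hgc) x) (hd hW x), wirtBar_mul (hd hf x) (hd hgc x),
      wirtBar_conj (hd hg x), wirtBar_exp_neg (hφ.differentiable (by norm_num) x), wirtAdj]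
    simp only [map_sub, map_mul]
    ring
  have h1 := integral_congr_ae (μ := volume) (Filter.Eventually.of_forall hpt)
  rw [h0, integral_add] at h1
  · linear_combination -h1
  · exact (((continuous_wirtBar hf k).mul hgc.continuous).mul
      hW.continuous).integrable_of_hasCompactSupport
        (hasCompactSupport_wirtBar hfc k).mul_right.mul_right
  · refine Continuous.integrable_of_hasCompactSupport ?_ hfc.mul_right.mul_right
    refine (hf.continuous.mul (continuous_conj.comp ?_)).mul hW.continuous
    exact (continuous_wirt hg k).sub
      ((continuous_wirt (contDiff_ofReal_comp hφ) k).mul hg.continuous)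

lemma wirtBar_wirtAdj {φ : 𝔼 → ℝ} (hφ : ContDiff ℝ 2 φ) {f : 𝔼 → ℂ} (hf : ContDiff ℝ 2 f)
    (j k : Fin n) (x : 𝔼) :
    wirtBar k (wirtAdj φ j f) x = wirtAdj φ j (wirtBar k f) x -
      wirtBar k (wirt j (fun y => (φ y : ℂ))) x * f x := by
  have hd : ∀ {u : 𝔼 → ℂ}, ContDiff ℝ 1 u → ∀ x, DifferentiableAt ℝ u x :=
    fun hu x => hu.differentiable (by norm_num) x
  have hφc := contDiff_ofReal_comp hφ
  have : wirtAdj φ j f = fun x => wirt j f x - wirt j (fun y => (φ y : ℂ)) x * f x := rfl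
  have hf1 : ContDiff ℝ 1 f := hf.of_le (by norm_num)
  rw [this, wirtBar_sub (hd (contDiff_wirt hf j) x)
    (hd ((contDiff_wirt hφc j).mul hf1) x),
    wirtBar_mul (hd (contDiff_wirt hφc j) x) (hd hf1 x), wirtBar_wirt_comm hf, wirtAdj]
  ring

lemma integral_wirtAdj_mul_conj {φ : 𝔼 → ℝ} (hφ : ContDiff ℝ 2 φ) {f g : 𝔼 → ℂ}
    (hf : ContDiff ℝ 2 f) (hg : ContDiff ℝ 2 g) (hfc : HasCompactSupport f)
    (hgc : HasCompactSupport g) (j k : Fin n) :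
    ∫ x, (wirtAdj φ j f x * (starRingEnd ℂ) (wirtAdj φ k g x)
      - wirtBar k f x * (starRingEnd ℂ) (wirtBar j g x)
      - wirtBar k (wirt j (fun y => (φ y : ℂ))) x * f x * (starRingEnd ℂ) (g x))
        * ((Real.exp (-φ x) : ℝ) : ℂ) = 0 := by
  have hf1 : ContDiff ℝ 1 f := hf.of_le (by norm_num)
  have hg1 : ContDiff ℝ 1 g := hg.of_le (by norm_num)
  have hφ1 : ContDiff ℝ 1 φ := hφ.of_le (by norm_num)
  have hφc := contDiff_ofReal_comp hφ
  have hW : Continuous (fun x => ((Real.exp (-φ x) : ℝ) : ℂ)) :=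
    (contDiff_ofReal_comp (hφ1.neg.exp)).continuous
  have hA : ContDiff ℝ 1 (wirtAdj φ j f) :=
    (contDiff_wirt hf j).sub ((contDiff_wirt hφc j).mul hf1)
  have hAs : HasCompactSupport (wirtAdj φ j f) :=
    (hasCompactSupport_wirt hfc j).sub hfc.mul_left
  have hB : ContDiff ℝ 1 (wirtAdj φ k g) :=
    (contDiff_wirt hg k).sub ((contDiff_wirt hφc k).mul hg1)
  have e1 := integral_wirtBar_mul_conj hφ1 hA hg1 hAs k
  have e2 := integral_wirtBar_mul_conj hφ1 hg1 (contDiff_wirtBar hf k) hgc j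
  have e3 := congrArg (starRingEnd ℂ) e2
  rw [map_neg, ← integral_conj, ← integral_conj] at e3
  simp only [map_mul, conj_conj, conj_ofReal] at e3
  have i1 : Integrable (fun x => wirtAdj φ j f x * (starRingEnd ℂ) (wirtAdj φ k g x)
      * ((Real.exp (-φ x) : ℝ) : ℂ)) :=
    ((hA.continuous.mul (continuous_conj.comp hB.continuous)).mul
      hW).integrable_of_hasCompactSupport hAs.mul_right.mul_right
  have i2 : Integrable (fun x => wirtBar k f x * (starRingEnd ℂ) (wirtBar j g x)
      * ((Real.exp (-φ x) : ℝ) : ℂ)) :=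
    (((continuous_wirtBar hf1 k).mul (continuous_conj.comp (continuous_wirtBar hg1 j))).mul
      hW).integrable_of_hasCompactSupport
        (hasCompactSupport_wirtBar hfc k).mul_right.mul_right
  have i3 : Integrable (fun x => wirtBar k (wirt j (fun y => (φ y : ℂ))) x * f x *
      (starRingEnd ℂ) (g x) * ((Real.exp (-φ x) : ℝ) : ℂ)) :=
    ((((continuous_wirtBar (contDiff_wirt hφc j) k).mul hf.continuous).mul
      (continuous_conj.comp hg.continuous)).mul hW).integrable_of_hasCompactSupport
        hfc.mul_left.mul_right.mul_right
  have i4 : Integrable (fun x => (starRingEnd ℂ) (g x) * wirtAdj φ j (wirtBar k f) x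
      * ((Real.exp (-φ x) : ℝ) : ℂ)) :=
    (((continuous_conj.comp hg.continuous).mul
      ((continuous_wirt (contDiff_wirtBar hf k) j).sub
        ((continuous_wirt (hφc.of_le (by norm_num)) j).mul
          (continuous_wirtBar hf1 k)))).mul hW).integrable_of_hasCompactSupport
        (hgc.comp_left (map_zero (starRingEnd ℂ))).mul_right.mul_right
  have hsplit : (fun x => wirtBar k (wirtAdj φ j f) x * (starRingEnd ℂ) (g x)
      * ((Real.exp (-φ x) : ℝ) : ℂ)) = fun x =>
      (starRingEnd ℂ) (g x) * wirtAdj φ j (wirtBar k f) x * ((Real.exp (-φ x) : ℝ) : ℂ) -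
      wirtBar k (wirt j (fun y => (φ y : ℂ))) x * f x *
      (starRingEnd ℂ) (g x) * ((Real.exp (-φ x) : ℝ) : ℂ) := by
    funext x; rw [wirtBar_wirtAdj hφ hf]; ring
  rw [hsplit, integral_sub i4 i3] at e1
  have e3' : ∫ x, wirtBar k f x * (starRingEnd ℂ) (wirtBar j g x)
      * ((Real.exp (-φ x) : ℝ) : ℂ) = -∫ x, (starRingEnd ℂ) (g x) *
        wirtAdj φ j (wirtBar k f) x * ((Real.exp (-φ x) : ℝ) : ℂ) := by
    rw [← e3]; congr 1; funext x; ring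
  simp only [sub_mul]
  rw [integral_sub (i1.subFun i2) i3, integral_sub i1 i2]
  linear_combination e1 - e3'

/-- The basic (Morrey–Kohn–Hörmander) inequality for compactly supported forms. -/
theorem basic_inequality {φ : 𝔼 → ℝ} (hφ : ContDiff ℝ 2 φ) {f : Fin n → 𝔼 → ℂ}
    (hf : ∀ j, ContDiff ℝ 2 (f j)) (hfc : ∀ j, HasCompactSupport (f j)) :
    ∫ x, (∑ j, ∑ k, wirtBar k (wirt j (fun y => (φ y : ℂ))) x * f j x *
        (starRingEnd ℂ) (f k x)).re * Real.exp (-φ x) ≤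
      (∫ x, ‖∑ j, wirtAdj φ j (f j) x‖ ^ 2 * Real.exp (-φ x)) +
      ∫ x, (1 / 2 * ∑ j, ∑ k, ‖wirtBar k (f j) x - wirtBar j (f k) x‖ ^ 2)
        * Real.exp (-φ x) := by
  have hf1 : ∀ j, ContDiff ℝ 1 (f j) := fun j => (hf j).of_le (by norm_num)
  have hφ1 : ContDiff ℝ 1 φ := hφ.of_le (by norm_num)
  have hφc := contDiff_ofReal_comp hφ
  have hW : Continuous (fun x => Real.exp (-φ x)) := hφ1.neg.exp.continuous
  have hA : ∀ j, Continuous (wirtAdj φ j (f j)) := fun j =>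
    ((contDiff_wirt (hf j) j).sub ((contDiff_wirt hφc j).mul (hf1 j))).continuous
  have hAs : ∀ j, HasCompactSupport (wirtAdj φ j (f j)) := fun j =>
    (hasCompactSupport_wirt (hfc j) j).sub (hfc j).mul_left
  have hB : ∀ j k, Continuous (wirtBar k (f j)) := fun j k => continuous_wirtBar (hf1 j) k
  have hH : ∀ j k, Continuous (wirtBar k (wirt j (fun y => (φ y : ℂ)))) := fun j k =>
    continuous_wirtBar (contDiff_wirt hφc j) k
  have key : ∀ j k, ∫ x, ((wirtAdj φ j (f j) x * (starRingEnd ℂ) (wirtAdj φ k (f k) x)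
      - wirtBar k (f j) x * (starRingEnd ℂ) (wirtBar j (f k) x)
      - wirtBar k (wirt j (fun y => (φ y : ℂ))) x * f j x * (starRingEnd ℂ) (f k x))
        * ((Real.exp (-φ x) : ℝ) : ℂ)).re = 0 := by
    intro j k
    have := integral_wirtAdj_mul_conj hφ (hf j) (hf k) (hfc j) (hfc k) j k
    have h2 := congrArg Complex.re this
    rw [Complex.zero_re] at h2
    rw [← h2]
    refine integral_re (𝕜 := ℂ) (f := fun x => (wirtAdj φ j (f j) x *
      (starRingEnd ℂ) (wirtAdj φ k (f k) x)
      - wirtBar k (f j) x * (starRingEnd ℂ) (wirtBar j (f k) x)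
      - wirtBar k (wirt j (fun y => (φ y : ℂ))) x * f j x * (starRingEnd ℂ) (f k x))
        * ((Real.exp (-φ x) : ℝ) : ℂ)) ?_
    refine Continuous.integrable_of_hasCompactSupport ?_ ?_
    · exact ((((hA j).mul (continuous_conj.comp (hA k))).sub
        ((hB j k).mul (continuous_conj.comp (hB k j)))).sub
        (((hH j k).mul (hf j).continuous).mul (continuous_conj.comp (hf k).continuous))).mul
        (continuous_ofReal.comp hW)
    · exact (((hAs j).mul_right.sub (hasCompactSupport_wirtBar (hfc j) k).mul_right).sub
        (hfc j).mul_left.mul_right).mul_right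
  have cint : ∀ j k, Integrable (fun x => ((wirtAdj φ j (f j) x *
      (starRingEnd ℂ) (wirtAdj φ k (f k) x)
      - wirtBar k (f j) x * (starRingEnd ℂ) (wirtBar j (f k) x)
      - wirtBar k (wirt j (fun y => (φ y : ℂ))) x * f j x * (starRingEnd ℂ) (f k x))
        * ((Real.exp (-φ x) : ℝ) : ℂ)).re) := by
    intro j k
    refine Continuous.integrable_of_hasCompactSupport ?_ ?_
    · exact continuous_re.comp (((((hA j).mul (continuous_conj.comp (hA k))).sub
        ((hB j k).mul (continuous_conj.comp (hB k j)))).sub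
        (((hH j k).mul (hf j).continuous).mul (continuous_conj.comp (hf k).continuous))).mul
        (continuous_ofReal.comp hW))
    · exact (((((hAs j).mul_right.sub (hasCompactSupport_wirtBar (hfc j) k).mul_right).sub
        (hfc j).mul_left.mul_right).mul_right)).comp_left Complex.zero_re
  have hsum : ∫ x, ∑ j, ∑ k, ((wirtAdj φ j (f j) x *
      (starRingEnd ℂ) (wirtAdj φ k (f k) x)
      - wirtBar k (f j) x * (starRingEnd ℂ) (wirtBar j (f k) x)
      - wirtBar k (wirt j (fun y => (φ y : ℂ))) x * f j x * (starRingEnd ℂ) (f k x))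
        * ((Real.exp (-φ x) : ℝ) : ℂ)).re = 0 := by
    rw [integral_finsetSum _ fun j _ => integrable_finsetSum _ fun k _ => cint j k]
    refine Finset.sum_eq_zero fun j _ => ?_
    rw [integral_finsetSum _ fun k _ => cint j k]
    exact Finset.sum_eq_zero fun k _ => key j k
  have hcs : ∀ u : 𝔼 → ℝ, (∀ x, (∀ j, f j x = 0) → (∀ j, wirtAdj φ j (f j) x = 0) →
      (∀ j k, wirtBar k (f j) x = 0) → u x = 0) → HasCompactSupport u := by
    intro u hu
    refine HasCompactSupport.of_support_subset_isCompact
      (K := ⋃ j, tsupport (f j)) (isCompact_iUnion fun j => hfc j) ?_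
    intro x hx
    by_contra hcon
    simp only [mem_iUnion, not_exists] at hcon
    apply hx
    have h0 : ∀ j, f j x = 0 := fun j => image_eq_zero_of_notMem_tsupport (hcon j)
    have h1 : ∀ j, fderiv ℝ (f j) x = 0 := fun j => by
      by_contra hne
      exact hcon j (tsupport_fderiv_subset ℝ (subset_tsupport _ hne))
    exact hu x h0 (fun j => by simp [wirtAdj, wirt, h0, h1]) (fun j k => by simp [wirtBar, h1])
  have I1 : Integrable (fun x => (∑ j, ∑ k, wirtBar k (wirt j (fun y => (φ y : ℂ))) x *
      f j x * (starRingEnd ℂ) (f k x)).re * Real.exp (-φ x)) := by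
    refine Continuous.integrable_of_hasCompactSupport ?_ (hcs _ fun x h0 _ _ => by simp [h0])
    refine (continuous_re.comp (continuous_finsetSum _ fun j _ =>
      continuous_finsetSum _ fun k _ => ?_)).mul hW
    exact ((hH j k).mul (hf j).continuous).mul (continuous_conj.comp (hf k).continuous)
  have I2 : Integrable (fun x => ‖∑ j, wirtAdj φ j (f j) x‖ ^ 2 * Real.exp (-φ x)) := by
    refine Continuous.integrable_of_hasCompactSupport ?_ (hcs _ fun x _ h0 _ => by simp [h0])
    exact ((continuous_finsetSum _ fun j _ => hA j).norm.pow 2).mul hW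
  have I3 : Integrable (fun x => (1 / 2 * ∑ j, ∑ k, ‖wirtBar k (f j) x -
      wirtBar j (f k) x‖ ^ 2) * Real.exp (-φ x)) := by
    refine Continuous.integrable_of_hasCompactSupport ?_ (hcs _ fun x _ _ h0 => by simp [h0])
    refine (continuous_const.mul (continuous_finsetSum _ fun j _ =>
      continuous_finsetSum _ fun k _ => ?_)).mul hW
    exact ((hB j k).sub (hB k j)).norm.pow 2
  have I4 := integrable_finsetSum Finset.univ fun j _ =>
    integrable_finsetSum Finset.univ fun k _ => cint j k
  rw [← sub_nonneg, ← integral_add I2 I3, ← integral_sub (I2.fun_add I3) I1, ← hsum]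
  refine integral_mono I4 ((I2.fun_add I3).subFun I1) fun x => ?_
  have hpos := (Real.exp_pos (-φ x)).le
  simp only [← add_mul, ← sub_mul, re_mul_ofReal]
  simp only [← Finset.sum_mul]
  refine mul_le_mul_of_nonneg_right ?_ hpos
  have n1 : ‖∑ j, wirtAdj φ j (f j) x‖ ^ 2 = ∑ j, ∑ k, (wirtAdj φ j (f j) x *
      (starRingEnd ℂ) (wirtAdj φ k (f k) x)).re := by
    rw [← Complex.normSq_eq_norm_sq, ← Complex.ofReal_re (Complex.normSq _),
      ← Complex.mul_conj, map_sum, Finset.sum_mul_sum]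
    simp only [Complex.re_sum]
  have n2 : ∀ a b : ℂ, -(1 / 2) * ‖a - b‖ ^ 2 = (a * (starRingEnd ℂ) b).re
      - 1 / 2 * ‖a‖ ^ 2 - 1 / 2 * ‖b‖ ^ 2 := by
    intro a b
    simp only [← Complex.normSq_eq_norm_sq, Complex.normSq_apply]
    simp; ring
  rw [n1, Complex.re_sum]
  simp only [Complex.re_sum, Complex.sub_re, Finset.sum_sub_distrib]
  have n3 : -(1 / 2 * ∑ j, ∑ k, ‖wirtBar k (f j) x - wirtBar j (f k) x‖ ^ 2) ≤
      ∑ j, ∑ k, (wirtBar k (f j) x * (starRingEnd ℂ) (wirtBar j (f k) x)).re := by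
    rw [← neg_mul, Finset.mul_sum]
    refine Finset.sum_le_sum fun j _ => ?_
    rw [Finset.mul_sum]
    refine Finset.sum_le_sum fun k _ => ?_
    have := n2 (wirtBar k (f j) x) (wirtBar j (f k) x)
    nlinarith [sq_nonneg ‖wirtBar k (f j) x‖, sq_nonneg ‖wirtBar j (f k) x‖]
  linarith

end Wirtinger

section Mollification

variable {n : ℕ}

local notation "𝔼" => EuclideanSpace ℂ (Fin n)

/-- A radial mollifier supported in the ball of radius `δ`. -/
structure IsMollifier (ρ : 𝔼 → ℝ) (δ : ℝ) : Prop where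
  smooth : ContDiff ℝ 2 ρ
  nonneg : ∀ t, 0 ≤ ρ t
  zero : ∀ t, δ ≤ ‖t‖ → ρ t = 0
  integral : ∫ t, ρ t = 1
  radial : ∀ s t, ‖s‖ = ‖t‖ → ρ s = ρ t

lemma IsMollifier.hasCompactSupport {ρ : 𝔼 → ℝ} {δ : ℝ} (h : IsMollifier ρ δ) :
    HasCompactSupport ρ := by
  refine HasCompactSupport.of_support_subset_isCompact (isCompact_closedBall 0 δ) ?_
  intro x hx
  by_contra hcon
  rw [mem_closedBall_zero_iff, not_le] at hcon
  exact hx (h.zero x hcon.le)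

lemma exists_isMollifier {δ : ℝ} (hδ : 0 < δ) : ∃ ρ : 𝔼 → ℝ, IsMollifier ρ δ := by
  set k : 𝔼 → ℝ := fun t => Real.smoothTransition (1 - ‖t‖ ^ 2 / δ ^ 2) with hk
  have hkc : ContDiff ℝ 2 k := by
    refine (Real.smoothTransition.contDiff (n := 2)).comp ?_
    exact contDiff_const.sub ((contDiff_norm_sq ℝ).div_const _)
  have hk0 : ∀ t, 0 ≤ k t := fun t => Real.smoothTransition.nonneg _
  have hkz : ∀ t, δ ≤ ‖t‖ → k t = 0 := fun t ht => by
    refine Real.smoothTransition.zero_of_nonpos ?_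
    have : 1 ≤ ‖t‖ ^ 2 / δ ^ 2 := by
      rw [le_div_iff₀ (by positivity)]; nlinarith
    linarith
  have hks : HasCompactSupport k := by
    refine HasCompactSupport.of_support_subset_isCompact (isCompact_closedBall 0 δ) ?_
    intro x hx
    by_contra hcon
    rw [mem_closedBall_zero_iff, not_le] at hcon
    exact hx (hkz x hcon.le)
  have hpos : 0 < ∫ t, k t := by
    refine hkc.continuous.integral_pos_of_hasCompactSupport_nonneg_nonzero hks hk0 (x := 0) ?_
    simp [hk]
  refine ⟨fun t => (∫ t, k t)⁻¹ * k t, contDiff_const.mul hkc,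
    fun t => mul_nonneg (inv_nonneg.2 hpos.le) (hk0 t), fun t ht => by simp [hkz t ht], ?_, ?_⟩
  · rw [integral_const_mul, inv_mul_cancel₀ hpos.ne']
  · intro s t hst
    simp [hk, hst]

/-- The mollification `u * ρ`. -/
noncomputable def smear (ρ : 𝔼 → ℝ) (u : 𝔼 → ℂ) (x : 𝔼) : ℂ := ∫ y, u y * (ρ (x - y) : ℂ)

lemma smear_eq (ρ : 𝔼 → ℝ) (u : 𝔼 → ℂ) (x : 𝔼) :
    smear ρ u x = ∫ t, u (x - t) * (ρ t : ℂ) := by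
  rw [smear, ← integral_sub_left_eq_self _ _ x]
  simp

lemma smear_eq_convolution (ρ : 𝔼 → ℝ) (u : 𝔼 → ℂ) :
    smear ρ u = convolution u (fun y => (ρ y : ℂ)) (ContinuousLinearMap.mul ℝ ℂ) volume := by
  rfl

variable {ρ : EuclideanSpace ℂ (Fin n) → ℝ} {δ : ℝ} {u : EuclideanSpace ℂ (Fin n) → ℂ}

lemma IsMollifier.hasCompactSupport_ofReal (h : IsMollifier ρ δ) :
    HasCompactSupport (fun y => (ρ y : ℂ)) := h.hasCompactSupport.comp_left ofReal_zero

lemma contDiff_smear (h : IsMollifier ρ δ) (hu : LocallyIntegrable u) :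
    ContDiff ℝ 2 (smear ρ u) := by
  rw [smear_eq_convolution]
  exact h.hasCompactSupport_ofReal.contDiff_convolution_right (n := 2) _ hu
    (contDiff_ofReal_comp h.smooth)

lemma fderiv_smear (h : IsMollifier ρ δ) (hu : LocallyIntegrable u) (x w : 𝔼) :
    fderiv ℝ (smear ρ u) x w = ∫ y, u y * fderiv ℝ (fun y => (ρ y : ℂ)) (x - y) w := by
  have hρ : ContDiff ℝ 1 (fun y => (ρ y : ℂ)) :=
    (contDiff_ofReal_comp h.smooth).of_le (by norm_num)
  have := h.hasCompactSupport_ofReal.hasFDerivAt_convolution_right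
    (ContinuousLinearMap.mul ℝ ℂ) hu hρ x
  rw [smear_eq_convolution, this.fderiv,
    convolution_precompR_apply _ hu (h.hasCompactSupport_ofReal.fderiv ℝ)
      (hρ.continuous_fderiv (by norm_num))]
  rfl

lemma fderiv_comp_sub_left {g : 𝔼 → ℂ} (hg : ContDiff ℝ 1 g) (x y w : 𝔼) :
    fderiv ℝ (fun z => g (x - z)) y w = - fderiv ℝ g (x - y) w := by
  have h1 : HasFDerivAt (fun z : 𝔼 => x - z) (-ContinuousLinearMap.id ℝ 𝔼) y :=
    (hasFDerivAt_id y).const_sub x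
  have h2 := ((hg.differentiable (by norm_num)) (x - y)).hasFDerivAt.comp y h1
  have : fderiv ℝ (fun z => g (x - z)) y = _ := h2.fderiv
  rw [this]; simp

lemma integrable_mul_of_hasCompactSupport (hu : LocallyIntegrable u) {v : 𝔼 → ℂ}
    (hv : Continuous v) (hvc : HasCompactSupport v) : Integrable (fun y => u y * v y) := by
  have := hu.integrable_smul_right_of_hasCompactSupport hv hvc
  simpa [mul_comm] using this

lemma wirtBar_smear (h : IsMollifier ρ δ) (hu : LocallyIntegrable u) (k : Fin n) (x : 𝔼) :
    wirtBar k (smear ρ u) x = -∫ y, u y * wirtBar k (fun z => (ρ (x - z) : ℂ)) y := by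
  have hρ : ContDiff ℝ 1 (fun y => (ρ y : ℂ)) :=
    (contDiff_ofReal_comp h.smooth).of_le (by norm_num)
  have hintg : ∀ w, Integrable (fun y => u y * fderiv ℝ (fun y => (ρ y : ℂ)) (x - y) w) :=
    fun w => integrable_mul_of_hasCompactSupport hu
      ((hρ.continuous_fderiv_apply_const w).comp (continuous_const.sub continuous_id))
      ((h.hasCompactSupport_ofReal.fderiv_apply ℝ w).comp_homeomorph (Homeomorph.subLeft x))
  simp only [wirtBar, fderiv_smear h hu, fderiv_comp_sub_left hρ]
  rw [← integral_const_mul, ← integral_add (hintg _) ((hintg _).const_mul _),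
    ← integral_const_mul, ← integral_neg]
  congr 1; funext y; ring

lemma wirt_smear (h : IsMollifier ρ δ) (hu : LocallyIntegrable u) (k : Fin n) (x : 𝔼) :
    wirt k (smear ρ u) x = -∫ y, u y * wirt k (fun z => (ρ (x - z) : ℂ)) y := by
  have hρ : ContDiff ℝ 1 (fun y => (ρ y : ℂ)) :=
    (contDiff_ofReal_comp h.smooth).of_le (by norm_num)
  have hintg : ∀ w, Integrable (fun y => u y * fderiv ℝ (fun y => (ρ y : ℂ)) (x - y) w) :=
    fun w => integrable_mul_of_hasCompactSupport hu
      ((hρ.continuous_fderiv_apply_const w).comp (continuous_const.sub continuous_id))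
      ((h.hasCompactSupport_ofReal.fderiv_apply ℝ w).comp_homeomorph (Homeomorph.subLeft x))
  simp only [wirt, fderiv_smear h hu, fderiv_comp_sub_left hρ]
  rw [← integral_const_mul, ← integral_sub (hintg _) ((hintg _).const_mul _),
    ← integral_const_mul, ← integral_neg]
  congr 1; funext y; ring

lemma smear_eq_zero (h : IsMollifier ρ δ) {x : 𝔼} (hx : ∀ y ∈ ball x δ, u y = 0) :
    smear ρ u x = 0 := by
  rw [smear]
  convert integral_zero 𝔼 ℂ with y
  by_cases hy : y ∈ ball x δ
  · simp [hx y hy]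
  · rw [h.zero, ofReal_zero, mul_zero]
    rwa [mem_ball, not_lt, dist_comm, dist_eq_norm] at hy

lemma exists_eLpNorm_translate_le (hu : MemLp u 2 volume) {ε : ℝ} (hε : 0 < ε) :
    ∃ δ > 0, ∀ t : 𝔼, ‖t‖ < δ →
      eLpNorm (fun x => u (x - t) - u x) 2 volume ≤ ENNReal.ofReal ε := by
  let g : 𝔼 → C(𝔼, 𝔼) := fun t => ⟨fun x => x - t, by fun_prop⟩
  have hg : Continuous g := by
    refine ContinuousMap.continuous_of_continuous_uncurry _ ?_
    exact continuous_snd.sub continuous_fst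
  have hgm : ∀ t, MeasurePreserving (g t) (volume : Measure 𝔼) volume :=
    fun t => measurePreserving_sub_right volume t
  have hc := (continuous_const (y := hu.toLp u)).compMeasurePreservingLp hg hgm (by simp)
  have hc0 := Metric.continuous_iff.1 hc 0 ε hε
  obtain ⟨δ, hδ, h⟩ := hc0
  refine ⟨δ, hδ, fun t ht => ?_⟩
  have h1 := h t (by simpa using ht)
  rw [Lp.toLp_compMeasurePreserving, Lp.toLp_compMeasurePreserving, dist_eq_norm,
    ← MemLp.toLp_sub, Lp.norm_toLp] at h1
  have hfin := (((hu.comp_measurePreserving (hgm t)).sub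
    (hu.comp_measurePreserving (hgm 0))).eLpNorm_lt_top).ne
  have h2 := (ENNReal.le_ofReal_iff_toReal_le hfin hε.le).2 h1.le
  convert h2 using 2
  funext x
  simp [g]

lemma exists_eLpNorm_smear_sub_le (hum : Measurable u) (hu : MemLp u 2 volume) {ε : ℝ}
    (hε : 0 < ε) : ∃ δ₀ > 0, ∀ (ρ : 𝔼 → ℝ) (δ : ℝ), δ ≤ δ₀ → IsMollifier ρ δ →
      ∫⁻ x, ‖smear ρ u x - u x‖ₑ ^ 2 ≤ ENNReal.ofReal ε ^ 2 := by
  obtain ⟨δ₀, hδ₀, hδ⟩ := exists_eLpNorm_translate_le hu hε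
  refine ⟨δ₀, hδ₀, fun ρ δ hle h => ?_⟩
  have hloc : LocallyIntegrable u := hu.locallyIntegrable (by norm_num)
  have hρc : Continuous (fun y => (ρ y : ℂ)) := (contDiff_ofReal_comp h.smooth).continuous
  have hρi : Integrable ρ :=
    h.smooth.continuous.integrable_of_hasCompactSupport h.hasCompactSupport
  have hρ1 : ∫⁻ t, ENNReal.ofReal (ρ t) = 1 := by
    rw [← ofReal_integral_eq_lintegral_ofReal hρi (Filter.Eventually.of_forall h.nonneg),
      h.integral, ENNReal.ofReal_one]
  have hρm : Measurable (fun t => ENNReal.ofReal (ρ t)) :=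
    h.smooth.continuous.measurable.ennreal_ofReal
  have hpt : ∀ x, ‖smear ρ u x - u x‖ₑ ^ 2 ≤
      ∫⁻ t, ENNReal.ofReal (ρ t) * ‖u (x - t) - u x‖ₑ ^ 2 := by
    intro x
    have hi : Integrable (fun t => u (x - t) * (ρ t : ℂ)) := by
      have := (integrable_mul_of_hasCompactSupport hloc
        (hρc.comp (continuous_const.sub continuous_id))
        (h.hasCompactSupport_ofReal.comp_homeomorph (Homeomorph.subLeft x))).comp_sub_left x
      refine this.congr (Filter.Eventually.of_forall fun t => ?_)
      simp
    have e1 : smear ρ u x - u x = ∫ t, (u (x - t) - u x) * (ρ t : ℂ) := by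
      have e2 : ∫ t, u x * (ρ t : ℂ) = u x := by
        have e0 : ∫ t, (ρ t : ℂ) = ((∫ t, ρ t : ℝ) : ℂ) := integral_ofReal
        rw [integral_const_mul, e0, h.integral]; simp
      rw [smear_eq]
      calc _ = (∫ t, u (x - t) * (ρ t : ℂ)) - ∫ t, u x * (ρ t : ℂ) := by rw [e2]
        _ = _ := by
          have hi2 : Integrable (fun t => u x * (ρ t : ℂ)) := hρi.ofReal.const_mul _
          rw [← integral_sub hi hi2]
          simp only [sub_mul]
    have e3 : ‖smear ρ u x - u x‖ₑ ≤ ∫⁻ t, ENNReal.ofReal (ρ t) * ‖u (x - t) - u x‖ₑ := by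
      rw [e1]
      refine (enorm_integral_le_lintegral_enorm _).trans (le_of_eq ?_)
      congr 1; funext t
      rw [enorm_mul, mul_comm]
      congr 1
      rw [← ofReal_norm, Complex.norm_real, Real.norm_of_nonneg (h.nonneg t)]
    set ν : Measure 𝔼 := volume.withDensity (fun t => ENNReal.ofReal (ρ t)) with hν
    haveI : IsProbabilityMeasure ν := ⟨by rw [hν, withDensity_apply _ MeasurableSet.univ]; simpa⟩
    have hm : Measurable (fun t => u (x - t) - u x) := by fun_prop
    have e4 : ∫⁻ t, ENNReal.ofReal (ρ t) * ‖u (x - t) - u x‖ₑ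
        = eLpNorm (fun t => u (x - t) - u x) 1 ν := by
      rw [eLpNorm_one_eq_lintegral_enorm, hν,
        lintegral_withDensity_eq_lintegral_mul _ hρm hm.enorm]
      rfl
    have e5 : ∫⁻ t, ENNReal.ofReal (ρ t) * ‖u (x - t) - u x‖ₑ ^ 2
        = eLpNorm (fun t => u (x - t) - u x) 2 ν ^ 2 := by
      have := eLpNorm_nnreal_pow_eq_lintegral (f := fun t => u (x - t) - u x) (μ := ν)
        (p := 2) (by norm_num)
      simp only [NNReal.coe_ofNat, ENNReal.rpow_ofNat, ENNReal.coe_ofNat] at this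
      rw [this, hν, lintegral_withDensity_eq_lintegral_mul _ hρm (hm.enorm.pow_const 2)]
      rfl
    rw [e5]
    refine pow_le_pow_left' (e3.trans (e4.le.trans ?_)) 2
    exact eLpNorm_le_eLpNorm_of_exponent_le (by norm_num) hm.aestronglyMeasurable
  calc ∫⁻ x, ‖smear ρ u x - u x‖ₑ ^ 2
      ≤ ∫⁻ x, ∫⁻ t, ENNReal.ofReal (ρ t) * ‖u (x - t) - u x‖ₑ ^ 2 := lintegral_mono hpt
    _ = ∫⁻ t, ∫⁻ x, ENNReal.ofReal (ρ t) * ‖u (x - t) - u x‖ₑ ^ 2 := by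
        refine lintegral_lintegral_swap (Measurable.aemeasurable ?_)
        refine (hρm.comp measurable_snd).mul (Measurable.pow_const (Measurable.enorm ?_) 2)
        exact (hum.comp (measurable_fst.sub measurable_snd)).sub (hum.comp measurable_fst)
    _ ≤ ∫⁻ t, ENNReal.ofReal (ρ t) * ENNReal.ofReal ε ^ 2 := by
        refine lintegral_mono fun t => ?_
        have hm : Measurable (fun x => u (x - t) - u x) := by fun_prop
        rw [lintegral_const_mul _ (hm.enorm.pow_const 2)]
        by_cases ht : δ ≤ ‖t‖
        · simp [h.zero t ht]
        · gcongr
          have := eLpNorm_nnreal_pow_eq_lintegral (f := fun x => u (x - t) - u x)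
            (μ := volume) (p := 2) (by norm_num)
          simp only [NNReal.coe_ofNat, ENNReal.rpow_ofNat, ENNReal.coe_ofNat] at this
          rw [← this]
          exact pow_le_pow_left' (hδ t (by linarith [not_le.1 ht])) 2
    _ = ENNReal.ofReal ε ^ 2 := by
        rw [lintegral_mul_const _ hρm, hρ1, one_mul]

lemma integral_comp_smul_of_norm_eq_one (F : 𝔼 → ℂ) {z : ℂ} (hz : ‖z‖ = 1) :
    ∫ t, F (z • t) = ∫ t, F t := by
  have hz0 : z ≠ 0 := by rintro rfl; simp at hz
  let e : 𝔼 ≃ₗᵢ[ℝ] 𝔼 :=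
    { toLinearEquiv := (LinearEquiv.smulOfNeZero ℂ 𝔼 z hz0).restrictScalars ℝ
      norm_map' := fun t => by
        change ‖z • t‖ = ‖t‖
        rw [norm_smul, hz, one_mul] }
  exact e.measurePreserving.integral_comp e.toHomeomorph.measurableEmbedding F

lemma smear_eq_self_of_differentiableOn (h : IsMollifier ρ δ) {δ' : ℝ} (hδ : δ < δ')
    {x : 𝔼} {f : 𝔼 → ℂ} (hf : DifferentiableOn ℂ f (ball x δ')) : smear ρ f x = f x := by
  have hρc : Continuous (fun y => (ρ y : ℂ)) := (contDiff_ofReal_comp h.smooth).continuous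
  have hFc : Continuous (fun t => f (x - t) * (ρ t : ℂ)) := by
    rw [continuous_iff_continuousAt]
    intro t
    by_cases ht : ‖t‖ < δ'
    · have : x - t ∈ ball x δ' := by simpa [dist_eq_norm] using ht
      exact ((((hf _ this).differentiableAt (isOpen_ball.mem_nhds this)).continuousAt).comp
        (f := fun t => x - t) (by fun_prop)).mul hρc.continuousAt
    · have : (fun t => f (x - t) * (ρ t : ℂ)) =ᶠ[nhds t] fun _ => 0 := by
        have ho : IsOpen {t : 𝔼 | δ < ‖t‖} := isOpen_lt continuous_const continuous_norm
        filter_upwards [ho.mem_nhds (hδ.trans_le (not_lt.1 ht))] with s hs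
        rw [h.zero s hs.le]; simp
      exact continuousAt_const.congr this.symm
  have hmean : ∀ t, (∫ θ in (0 : ℝ)..2 * Real.pi,
      f (x - circleMap 0 1 θ • t) * (ρ (circleMap 0 1 θ • t) : ℂ)) =
        (2 * Real.pi : ℂ) * (f x * (ρ t : ℂ)) := by
    intro t
    have hr : ∀ θ, ρ (circleMap 0 1 θ • t) = ρ t := fun θ => h.radial _ _ (by simp [norm_smul])
    simp only [hr]
    by_cases ht : δ ≤ ‖t‖
    · simp [h.zero t ht]
    · have hg : DiffContOnCl ℂ (fun z : ℂ => f (x - z • t)) (ball 0 |1|) := by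
        refine DifferentiableOn.diffContOnCl ?_
        refine hf.comp (Differentiable.differentiableOn (by fun_prop)) ?_
        intro z hz
        have hz1 : ‖z‖ ≤ 1 := by
          have := closure_ball_subset_closedBall hz
          simpa using this
        simp only [mem_ball, dist_eq_norm, sub_sub_cancel_left, norm_neg, norm_smul]
        nlinarith [norm_nonneg t, norm_nonneg z]
      have hm := hg.circleAverage
      simp only [Real.circleAverage, zero_smul, sub_zero] at hm
      rw [intervalIntegral.integral_mul_const, ← mul_assoc, ← hm, Complex.real_smul]
      push_cast
      rw [← mul_assoc, mul_inv_cancel₀ (by simp [Real.pi_ne_zero]), one_mul]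
  have hrot : ∀ θ, ∫ t, f (x - circleMap 0 1 θ • t) * (ρ (circleMap 0 1 θ • t) : ℂ) =
      smear ρ f x := fun θ => by
    rw [smear_eq]
    exact integral_comp_smul_of_norm_eq_one (fun t => f (x - t) * (ρ t : ℂ)) (by simp)
  have hintg : Integrable (Function.uncurry fun (θ : ℝ) (t : 𝔼) =>
      f (x - circleMap 0 1 θ • t) * (ρ (circleMap 0 1 θ • t) : ℂ))
      ((volume.restrict (uIoc 0 (2 * Real.pi))).prod volume) := by
    have hc : Continuous (Function.uncurry fun (θ : ℝ) (t : 𝔼) =>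
        f (x - circleMap 0 1 θ • t) * (ρ (circleMap 0 1 θ • t) : ℂ)) := by
      refine hFc.comp (g := fun t => f (x - t) * (ρ t : ℂ)) ?_
      exact ((continuous_circleMap 0 1).comp continuous_fst).smul continuous_snd
    have hi := hc.continuousOn.integrableOn_compact (μ := (volume : Measure ℝ).prod volume)
      ((isCompact_uIcc (a := (0 : ℝ)) (b := 2 * Real.pi)).prod (isCompact_closedBall (0 : 𝔼) δ))
    have h2 : IntegrableOn (Function.uncurry fun (θ : ℝ) (t : 𝔼) =>
        f (x - circleMap 0 1 θ • t) * (ρ (circleMap 0 1 θ • t) : ℂ))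
        (uIcc (0 : ℝ) (2 * Real.pi) ×ˢ univ) ((volume : Measure ℝ).prod volume) := by
      refine hi.of_forall_sdiff_eq_zero
        ((isCompact_uIcc.measurableSet).prod MeasurableSet.univ) ?_
      rintro ⟨θ, t⟩ ⟨h1, h3⟩
      have : δ ≤ ‖t‖ := by
        by_contra hcon
        exact h3 ⟨h1.1, by simpa using (not_le.1 hcon).le⟩
      simp only [Function.uncurry_apply_pair]
      rw [h.zero _ (by simpa [norm_smul] using this)]; simp
    have h3 := h2.mono_set (prod_mono uIoc_subset_uIcc (subset_refl (univ : Set 𝔼)))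
    rwa [IntegrableOn, ← Measure.prod_restrict, Measure.restrict_univ] at h3
  have hswap := intervalIntegral_integral_swap hintg
  simp only [hrot, hmean] at hswap
  have e0 : ∫ t, (ρ t : ℂ) = ((∫ t, ρ t : ℝ) : ℂ) := integral_ofReal
  rw [intervalIntegral.integral_const, integral_const_mul, integral_const_mul, e0, h.integral]
    at hswap
  simp only [sub_zero, Complex.real_smul, ofReal_mul, ofReal_ofNat, ofReal_one, mul_one] at hswap
  exact mul_left_cancel₀ (by simp [Real.pi_ne_zero]) hswap

end Mollification

section Levi

variable {n : ℕ}

local notation "𝔼" => EuclideanSpace ℂ (Fin n)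

/-- The Levi form of a real function, through real second derivatives. -/
noncomputable def leviForm (φ : 𝔼 → ℝ) (x w : 𝔼) : ℝ :=
  (1 / 4) * (fderiv ℝ (fderiv ℝ φ) x w w + fderiv ℝ (fderiv ℝ φ) x (I • w) (I • w))

lemma fderiv_ofReal_fun {φ : 𝔼 → ℝ} (hφ : ContDiff ℝ 2 φ) (x v w : 𝔼) :
    fderiv ℝ (fderiv ℝ (fun y => (φ y : ℂ))) x v w = (fderiv ℝ (fderiv ℝ φ) x v w : ℂ) := by
  rw [← fderiv_fderiv_apply (contDiff_ofReal_comp hφ), ← fderiv_fderiv_apply hφ]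
  have hd : Differentiable ℝ φ := hφ.differentiable (by norm_num)
  have : (fun y => fderiv ℝ (fun y => (φ y : ℂ)) y w) = fun y => ((fderiv ℝ φ y w : ℝ) : ℂ) := by
    funext y; exact fderiv_ofReal_comp (hd y) w
  rw [this, fderiv_ofReal_comp ((hφ.fderiv_apply_const w).differentiable (by norm_num) x)]

/-- The sesquilinear form whose quadratic form is the Levi form. -/
noncomputable def leviSesq (B : 𝔼 →L[ℝ] 𝔼 →L[ℝ] ℝ) (v w : 𝔼) : ℂ :=
  (1 / 4) * ((B v w + B (I • v) (I • w) : ℝ) + I * (B v (I • w) - B (I • v) w : ℝ))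

lemma wirtBar_wirt_ofReal {φ : 𝔼 → ℝ} (hφ : ContDiff ℝ 2 φ) (x : 𝔼) (j k : Fin n) :
    wirtBar k (wirt j (fun y => (φ y : ℂ))) x =
      leviSesq (fderiv ℝ (fderiv ℝ φ) x) (stdVec j) (stdVec k) := by
  simp only [wirtBar, fderiv_wirt (contDiff_ofReal_comp hφ), fderiv_ofReal_fun hφ, leviSesq]
  rw [fderiv_fderiv_comm hφ x (stdVec k) (stdVec j),
    fderiv_fderiv_comm hφ x (I • stdVec k) (stdVec j),
    fderiv_fderiv_comm hφ x (stdVec k) (I • stdVec j),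
    fderiv_fderiv_comm hφ x (I • stdVec k) (I • stdVec j)]
  push_cast
  ring_nf
  simp only [I_sq]
  ring

lemma leviSesq_add_left (B : 𝔼 →L[ℝ] 𝔼 →L[ℝ] ℝ) (u v w : 𝔼) :
    leviSesq B (u + v) w = leviSesq B u w + leviSesq B v w := by
  simp only [leviSesq, smul_add, map_add, _root_.add_apply]
  push_cast; ring

lemma leviSesq_smul_left (B : 𝔼 →L[ℝ] 𝔼 →L[ℝ] ℝ) (c : ℂ) (v w : 𝔼) :
    leviSesq B (c • v) w = c * leviSesq B v w := by
  have hc : ∀ u : 𝔼, c • u = c.re • u + c.im • (I • u) := fun u => by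
    conv_lhs => rw [← re_add_im c]
    rw [add_smul, mul_smul]; rfl
  have hI : I • (c • v) = c.re • (I • v) - c.im • v := by
    rw [smul_comm, hc, ← smul_assoc I I v, smul_eq_mul, I_mul_I]; module
  simp only [leviSesq, hI]
  simp only [hc, map_add, map_sub, map_smul, _root_.add_apply, _root_.sub_apply,
    _root_.smul_apply, smul_eq_mul]
  push_cast
  conv_rhs => rw [← re_add_im c]
  ring_nf
  simp only [I_sq]
  ring

lemma leviSesq_conj {B : 𝔼 →L[ℝ] 𝔼 →L[ℝ] ℝ} (hB : ∀ v w, B v w = B w v) (v w : 𝔼) :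
    (starRingEnd ℂ) (leviSesq B v w) = leviSesq B w v := by
  simp only [leviSesq, map_mul, map_add, conj_ofReal, conj_I, hB w, hB (I • w)]
  have : (starRingEnd ℂ) (1 / 4) = 1 / 4 := by
    rw [show (1 / 4 : ℂ) = ((1 / 4 : ℝ) : ℂ) by push_cast; ring, conj_ofReal]
  rw [this]
  push_cast; ring

lemma leviSesq_sum_left (B : 𝔼 →L[ℝ] 𝔼 →L[ℝ] ℝ) (v w : 𝔼) :
    leviSesq B v w = ∑ j, v j * leviSesq B (stdVec j) w := by
  let L : 𝔼 →ₗ[ℂ] ℂ :=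
    { toFun := fun v => leviSesq B v w
      map_add' := fun u v => leviSesq_add_left B u v w
      map_smul' := fun c v => leviSesq_smul_left B c v w }
  have hv : v = ∑ j, v j • (stdVec j : 𝔼) := by
    ext i
    simp [stdVec, Pi.single_apply]
  have : L v = ∑ j, v j * L (stdVec j) := by
    conv_lhs => rw [hv]
    simp
  exact this

lemma leviSesq_self {B : 𝔼 →L[ℝ] 𝔼 →L[ℝ] ℝ} (hB : ∀ v w, B v w = B w v) (w : 𝔼) :
    leviSesq B w w = ((1 / 4 * (B w w + B (I • w) (I • w)) : ℝ) : ℂ) := by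
  simp only [leviSesq, hB (I • w) w]
  push_cast; ring

lemma sum_wirtBar_wirt_eq_leviForm {φ : 𝔼 → ℝ} (hφ : ContDiff ℝ 2 φ) (x w : 𝔼) :
    ∑ j, ∑ k, wirtBar k (wirt j (fun y => (φ y : ℂ))) x * w j * (starRingEnd ℂ) (w k) =
      (leviForm φ x w : ℂ) := by
  have hB := fderiv_fderiv_comm hφ x
  rw [leviForm, ← leviSesq_self hB, leviSesq_sum_left]
  refine Finset.sum_congr rfl fun j _ => ?_
  rw [← leviSesq_conj hB, leviSesq_sum_left, map_sum, Finset.mul_sum]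
  refine Finset.sum_congr rfl fun k _ => ?_
  rw [map_mul, leviSesq_conj hB, wirtBar_wirt_ofReal hφ]
  ring

lemma fderiv_fderiv_real_comp {φ : 𝔼 → ℝ} (hφ : ContDiff ℝ 2 φ) {g g' : ℝ → ℝ} {g'' : ℝ}
    {x : 𝔼} (hg : ∀ᶠ t in nhds (φ x), HasDerivAt g (g' t) t) (hg' : HasDerivAt g' g'' (φ x))
    (v w : 𝔼) : fderiv ℝ (fderiv ℝ (fun y => g (φ y))) x v w =
      g' (φ x) * fderiv ℝ (fderiv ℝ φ) x v w + g'' * (fderiv ℝ φ x v * fderiv ℝ φ x w) := by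
  have hd : Differentiable ℝ φ := hφ.differentiable (by norm_num)
  have h1 : fderiv ℝ (fun y => g (φ y)) =ᶠ[nhds x] fun y => g' (φ y) • fderiv ℝ φ y := by
    filter_upwards [hφ.continuous.continuousAt.eventually hg] with y hy
    exact (hy.comp_hasFDerivAt y (hd y).hasFDerivAt).fderiv
  have hdd : DifferentiableAt ℝ (fderiv ℝ φ) x :=
    (hφ.fderiv_right (m := 1) (by norm_num)).differentiable (by norm_num) x
  have h2 : HasFDerivAt (fun y => g' (φ y)) (g'' • fderiv ℝ φ x) x :=
    hg'.comp_hasFDerivAt x (hd x).hasFDerivAt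
  have h3 := h2.smul hdd.hasFDerivAt
  rw [h1.fderiv_eq]
  have h4 : fderiv ℝ (fun y => g' (φ y) • fderiv ℝ φ y) x = _ := h3.fderiv
  rw [h4]
  simp [mul_assoc]

lemma leviForm_real_comp {φ : 𝔼 → ℝ} (hφ : ContDiff ℝ 2 φ) {g g' : ℝ → ℝ} {g'' : ℝ}
    {x : 𝔼} (hg : ∀ᶠ t in nhds (φ x), HasDerivAt g (g' t) t) (hg' : HasDerivAt g' g'' (φ x))
    (w : 𝔼) : leviForm (fun y => g (φ y)) x w = g' (φ x) * leviForm φ x w +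
      g'' / 4 * ((fderiv ℝ φ x w) ^ 2 + (fderiv ℝ φ x (I • w)) ^ 2) := by
  simp only [leviForm, fderiv_fderiv_real_comp hφ hg hg']
  ring

lemma fderiv_fderiv_congr {F : Type*} [NormedAddCommGroup F] [NormedSpace ℝ F] {φ ψ : 𝔼 → F}
    {x : 𝔼} (h : φ =ᶠ[nhds x] ψ) :
    fderiv ℝ (fderiv ℝ φ) x = fderiv ℝ (fderiv ℝ ψ) x :=
  (Filter.EventuallyEq.fderiv h).fderiv_eq

lemma leviForm_congr {φ ψ : 𝔼 → ℝ} {x : 𝔼} (h : φ =ᶠ[nhds x] ψ) (w : 𝔼) :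
    leviForm φ x w = leviForm ψ x w := by
  simp only [leviForm, fderiv_fderiv_congr h]

end Levi

section L2Limits

variable {n : ℕ}

local notation "𝔼" => EuclideanSpace ℂ (Fin n)

/-- Convergence in `L²` of a sequence of square integrable functions. -/
structure L2Lim (u : ℕ → 𝔼 → ℂ) (v : 𝔼 → ℂ) : Prop where
  memLp : ∀ ν, MemLp (u ν) 2
  memLp_lim : MemLp v 2
  tendsto : Filter.Tendsto (fun ν => eLpNorm (fun x => u ν x - v x) 2 volume) Filter.atTop (nhds 0)

lemma L2Lim.sub {u u' : ℕ → 𝔼 → ℂ} {v v' : 𝔼 → ℂ} (h : L2Lim u v) (h' : L2Lim u' v') :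
    L2Lim (fun ν x => u ν x - u' ν x) (fun x => v x - v' x) := by
  refine ⟨fun ν => (h.memLp ν).sub (h'.memLp ν), h.memLp_lim.sub h'.memLp_lim, ?_⟩
  have h0 := h.tendsto.add h'.tendsto
  rw [add_zero] at h0
  refine tendsto_of_tendsto_of_tendsto_of_le_of_le tendsto_const_nhds h0 (fun _ => zero_le) ?_
  intro ν
  have h1 : AEStronglyMeasurable (fun x => u ν x - v x) volume :=
    ((h.memLp ν).sub h.memLp_lim).aestronglyMeasurable
  have h2 : AEStronglyMeasurable (fun x => u' ν x - v' x) volume :=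
    ((h'.memLp ν).sub h'.memLp_lim).aestronglyMeasurable
  have h3 : (fun x => u ν x - u' ν x - (v x - v' x)) =
      (fun x => u ν x - v x) - (fun x => u' ν x - v' x) := by
    funext x; simp only [Pi.sub_apply]; ring
  simp only [h3]
  exact eLpNorm_sub_le h1 h2 (by norm_num)

lemma L2Lim.zero : L2Lim (n := n) (fun _ _ => 0) (fun _ => 0) :=
  ⟨fun _ => MemLp.zero', MemLp.zero', by simp⟩

lemma L2Lim.add {u u' : ℕ → 𝔼 → ℂ} {v v' : 𝔼 → ℂ} (h : L2Lim u v) (h' : L2Lim u' v') :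
    L2Lim (fun ν x => u ν x + u' ν x) (fun x => v x + v' x) := by
  simpa using h.sub (L2Lim.zero.sub h')

lemma L2Lim.sum {ι : Type*} (s : Finset ι) {u : ι → ℕ → 𝔼 → ℂ} {v : ι → 𝔼 → ℂ}
    (h : ∀ i, L2Lim (u i) (v i)) :
    L2Lim (fun ν x => ∑ i ∈ s, u i ν x) (fun x => ∑ i ∈ s, v i x) := by
  classical
  induction s using Finset.induction_on with
  | empty => simpa using L2Lim.zero
  | insert a s ha ih => simpa only [Finset.sum_insert ha] using (h a).add ih

lemma L2Lim.mul {u : ℕ → 𝔼 → ℂ} {v b : 𝔼 → ℂ} (h : L2Lim u v) (hb : Continuous b)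
    {C : ℝ} (hC : ∀ x, ‖b x‖ ≤ C) :
    L2Lim (fun ν x => b x * u ν x) (fun x => b x * v x) := by
  have hbd : ∀ᵐ x ∂(volume : Measure 𝔼), ‖b x‖ ≤ C := Filter.Eventually.of_forall hC
  have key : ∀ {w : 𝔼 → ℂ}, MemLp w 2 → MemLp (fun x => b x * w x) 2 := fun hw =>
    MemLp.of_le_mul hw (hb.aestronglyMeasurable.mul hw.aestronglyMeasurable)
      (Filter.Eventually.of_forall fun x => by
        rw [norm_mul]; exact mul_le_mul_of_nonneg_right (hC x) (norm_nonneg _))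
  refine ⟨fun ν => key (h.memLp ν), key h.memLp_lim, ?_⟩
  have h0 := ENNReal.Tendsto.const_mul (a := ENNReal.ofReal C) h.tendsto
    (Or.inr ENNReal.ofReal_ne_top)
  rw [mul_zero] at h0
  refine tendsto_of_tendsto_of_tendsto_of_le_of_le tendsto_const_nhds h0 (fun _ => zero_le) ?_
  intro ν
  refine eLpNorm_le_mul_eLpNorm_of_ae_le_mul (Filter.Eventually.of_forall fun x => ?_) 2
  rw [← mul_sub, norm_mul]
  exact mul_le_mul_of_nonneg_right (hC x) (norm_nonneg _)

lemma L2Lim.tendsto_integral {u : ℕ → 𝔼 → ℂ} {v : 𝔼 → ℂ} (h : L2Lim u v) :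
    Filter.Tendsto (fun ν => ∫ x, ‖u ν x‖ ^ 2) Filter.atTop (nhds (∫ x, ‖v x‖ ^ 2)) := by
  have key : ∀ {w : 𝔼 → ℂ} (hw : MemLp w 2), ∫ x, ‖w x‖ ^ 2 = ‖hw.toLp w‖ ^ 2 := fun {w} hw => by
    have h1 : (inner ℂ (hw.toLp w) (hw.toLp w) : ℂ) = ((‖hw.toLp w‖ ^ 2 : ℝ) : ℂ) := by
      rw [inner_self_eq_norm_sq_to_K]; push_cast; rfl
    rw [L2.inner_def] at h1
    have h2 : ∫ x, (inner ℂ (hw.toLp w x) (hw.toLp w x) : ℂ) = ∫ x, ((‖w x‖ ^ 2 : ℝ) : ℂ) := by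
      refine integral_congr_ae ?_
      filter_upwards [hw.coeFn_toLp] with x hx
      rw [hx, inner_self_eq_norm_sq_to_K]; push_cast; rfl
    rw [h2] at h1
    have h3 : ∫ x, ((‖w x‖ ^ 2 : ℝ) : ℂ) = ((∫ x, ‖w x‖ ^ 2 : ℝ) : ℂ) := integral_ofReal
    rw [h3] at h1
    exact_mod_cast h1
  simp only [fun ν => key (h.memLp ν), key h.memLp_lim]
  have ht : Filter.Tendsto (fun ν => (h.memLp ν).toLp (u ν)) Filter.atTop
      (nhds (h.memLp_lim.toLp v)) :=
    (Lp.tendsto_Lp_iff_tendsto_eLpNorm'' _ h.memLp _ h.memLp_lim).2 h.tendsto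
  exact ht.norm.pow 2

lemma exists_mollifier_seq {δ₀ : ℝ} (hδ₀ : 0 < δ₀) : ∃ (ρ : ℕ → 𝔼 → ℝ) (δ : ℕ → ℝ),
    (∀ ν, IsMollifier (ρ ν) (δ ν)) ∧ (∀ ν, δ ν ≤ δ₀) ∧
    ∀ (u : 𝔼 → ℂ) (K : Set 𝔼), Measurable u → MemLp u 2 → IsCompact K →
      (∀ x ∉ K, u x = 0) → L2Lim (fun ν => smear (ρ ν) u) u := by
  have hpos : ∀ ν : ℕ, 0 < δ₀ / (ν + 1) := fun ν => by positivity
  choose ρ hρ using fun ν => exists_isMollifier (n := n) (hpos ν)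
  refine ⟨ρ, fun ν => δ₀ / (ν + 1), hρ, fun ν => ?_, ?_⟩
  · exact div_le_self hδ₀.le (by simp)
  · intro u K hum hu hK h0
    have hloc : LocallyIntegrable u := hu.locallyIntegrable (by norm_num)
    refine ⟨fun ν => ?_, hu, ?_⟩
    · refine (contDiff_smear (hρ ν) hloc).continuous.memLp_of_hasCompactSupport ?_
      refine HasCompactSupport.of_support_subset_isCompact
        (hK.cthickening (r := δ₀ / (ν + 1))) ?_
      intro x hx
      by_contra hcon
      refine hx (smear_eq_zero (hρ ν) fun y hy => h0 y fun hyK => hcon ?_)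
      exact mem_cthickening_of_dist_le x y _ K hyK (by rw [dist_comm]; exact (mem_ball.1 hy).le)
    · rw [ENNReal.tendsto_nhds_zero]
      intro ε hε
      by_cases htop : ε = ⊤
      · simp [htop]
      have hε' : 0 < ε.toReal := ENNReal.toReal_pos hε.ne' htop
      obtain ⟨d, hd, h⟩ := exists_eLpNorm_smear_sub_le hum hu hε'
      have : Filter.Tendsto (fun ν : ℕ => δ₀ / ((ν : ℝ) + 1)) Filter.atTop (nhds 0) :=
by
        simpa [div_eq_mul_inv] using (tendsto_one_div_add_atTop_nhds_zero_nat (𝕜 := ℝ)).const_mul δ₀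
      filter_upwards [this.eventually (Iio_mem_nhds hd)] with ν hν
      have h1 := h (ρ ν) _ (le_of_lt hν) (hρ ν)
      have h2 := eLpNorm_nnreal_pow_eq_lintegral (f := fun x => smear (ρ ν) u x - u x)
        (μ := volume) (p := 2) (by norm_num)
      simp only [NNReal.coe_ofNat, ENNReal.rpow_ofNat, ENNReal.coe_ofNat] at h2
      rw [← h2, ENNReal.ofReal_toReal htop] at h1
      exact (ENNReal.pow_le_pow_left_iff (by norm_num)).1 h1

lemma contDiff_ofReal_comp_sub {ρ : 𝔼 → ℝ} {δ : ℝ} (h : IsMollifier ρ δ) (x : 𝔼) :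
    ContDiff ℝ 2 (fun z => (ρ (x - z) : ℂ)) :=
  (contDiff_ofReal_comp h.smooth).comp (contDiff_const.sub contDiff_id)

lemma hasCompactSupport_ofReal_comp_sub {ρ : 𝔼 → ℝ} {δ : ℝ} (h : IsMollifier ρ δ) (x : 𝔼) :
    HasCompactSupport (fun z => (ρ (x - z) : ℂ)) :=
  h.hasCompactSupport_ofReal.comp_homeomorph (Homeomorph.subLeft x)

lemma wirtBar_smear_sub {G G' W : 𝔼 → ℂ} (hG : LocallyIntegrable G) (hG' : LocallyIntegrable G')
    (j k : Fin n) (hcl : ∀ v : 𝔼 → ℂ, ContDiff ℝ 2 v → HasCompactSupport v →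
      ∫ x, (G x * wirtBar k v x - G' x * wirtBar j v x) = -∫ x, W x * v x)
    {ρ : 𝔼 → ℝ} {δ : ℝ} (h : IsMollifier ρ δ) (x : 𝔼) :
    wirtBar k (smear ρ G) x - wirtBar j (smear ρ G') x = smear ρ W x := by
  have hv := contDiff_ofReal_comp_sub h x
  have hvc := hasCompactSupport_ofReal_comp_sub h x
  have hi : ∀ {G : 𝔼 → ℂ}, LocallyIntegrable G → ∀ k, Integrable
      (fun y => G y * wirtBar k (fun z => (ρ (x - z) : ℂ)) y) := fun hG k =>
    integrable_mul_of_hasCompactSupport hG (contDiff_wirtBar hv k).continuous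
      (hasCompactSupport_wirtBar hvc k)
  rw [wirtBar_smear h hG, wirtBar_smear h hG', smear]
  have := hcl _ hv hvc
  rw [integral_sub (hi hG k) (hi hG' j)] at this
  linear_combination -this

lemma sum_wirt_smear {G : Fin n → 𝔼 → ℂ} {H : 𝔼 → ℂ} (hG : ∀ j, LocallyIntegrable (G j))
    (hadj : ∀ v : 𝔼 → ℂ, ContDiff ℝ 2 v → HasCompactSupport v →
      ∫ x, ∑ j, G j x * wirt j v x = -∫ x, H x * v x)
    {ρ : 𝔼 → ℝ} {δ : ℝ} (h : IsMollifier ρ δ) (x : 𝔼) :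
    ∑ j, wirt j (smear ρ (G j)) x = smear ρ H x := by
  have hv := contDiff_ofReal_comp_sub h x
  have hvc := hasCompactSupport_ofReal_comp_sub h x
  have hi : ∀ j, Integrable
      (fun y => G j y * wirt j (fun z => (ρ (x - z) : ℂ)) y) := fun j =>
    integrable_mul_of_hasCompactSupport (hG j) (contDiff_wirt hv j).continuous
      (hasCompactSupport_wirt hvc j)
  have := hadj _ hv hvc
  rw [integral_finsetSum _ fun j _ => hi j] at this
  simp only [fun j => wirt_smear h (hG j) j x, Finset.sum_neg_distrib]
  rw [this, smear, neg_neg]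

/-- The basic inequality with the Levi form bounded below. -/
lemma basic_inequality_of_le_leviForm {φ : 𝔼 → ℝ} (hφ : ContDiff ℝ 2 φ) {f : Fin n → 𝔼 → ℂ}
    (hf : ∀ j, ContDiff ℝ 2 (f j)) (hfc : ∀ j, HasCompactSupport (f j))
    {c : 𝔼 → ℝ} (hc : Continuous c)
    (hlevi : ∀ x, c x * ∑ j, ‖f j x‖ ^ 2 ≤ leviForm φ x (WithLp.toLp 2 fun j => f j x)) :
    ∑ j, ∫ x, c x * ‖f j x‖ ^ 2 * Real.exp (-φ x) ≤
      (∫ x, ‖∑ j, wirt j (f j) x - ∑ j, wirt j (fun y => (φ y : ℂ)) x * f j x‖ ^ 2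
        * Real.exp (-φ x)) +
      1 / 2 * ∑ j, ∑ k, ∫ x, ‖wirtBar k (f j) x - wirtBar j (f k) x‖ ^ 2
        * Real.exp (-φ x) := by
  have hexp : Continuous fun x => Real.exp (-φ x) := by
    have := hφ.continuous
    fun_prop
  have hf1 : ∀ j, ContDiff ℝ 1 (f j) := fun j => (hf j).of_le (by norm_num)
  have hsq : ∀ {s : 𝔼 → ℝ} {u : 𝔼 → ℂ}, Continuous s → Continuous u → HasCompactSupport u →
      Integrable (fun x => s x * ‖u x‖ ^ 2 * Real.exp (-φ x)) := fun {s u} hs hu huc => by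
    refine ((hs.mul (hu.norm.pow 2)).mul hexp).integrable_of_hasCompactSupport ?_
    exact HasCompactSupport.intro huc fun x hx => by
      simp [image_eq_zero_of_notMem_tsupport hx]
  have i1 : ∀ j, Integrable (fun x => c x * ‖f j x‖ ^ 2 * Real.exp (-φ x)) :=
    fun j => hsq hc (hf j).continuous (hfc j)
  have i3 : ∀ j k, Integrable (fun x => ‖wirtBar k (f j) x - wirtBar j (f k) x‖ ^ 2
      * Real.exp (-φ x)) := fun j k => by
    have h1 : Continuous (fun x => wirtBar k (f j) x - wirtBar j (f k) x) :=
      (continuous_wirtBar (hf1 j) k).sub (continuous_wirtBar (hf1 k) j)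
    have h2 : HasCompactSupport (fun x => wirtBar k (f j) x - wirtBar j (f k) x) :=
      HasCompactSupport.sub (f := wirtBar k (f j)) (f' := wirtBar j (f k))
        (hasCompactSupport_wirtBar (hfc j) k) (hasCompactSupport_wirtBar (hfc k) j)
    have := hsq (s := fun _ => 1) continuous_const h1 h2
    simpa only [one_mul] using this
  have hb := basic_inequality hφ hf hfc
  simp only [wirtAdj, Finset.sum_sub_distrib] at hb
  have e3 : ∫ x, (1 / 2 * ∑ j, ∑ k, ‖wirtBar k (f j) x - wirtBar j (f k) x‖ ^ 2)
        * Real.exp (-φ x) =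
      1 / 2 * ∑ j, ∑ k, ∫ x, ‖wirtBar k (f j) x - wirtBar j (f k) x‖ ^ 2
        * Real.exp (-φ x) := by
    have : ∀ j, ∑ k, ∫ x, ‖wirtBar k (f j) x - wirtBar j (f k) x‖ ^ 2 * Real.exp (-φ x) =
        ∫ x, ∑ k, ‖wirtBar k (f j) x - wirtBar j (f k) x‖ ^ 2 * Real.exp (-φ x) := fun j =>
      (integral_finsetSum _ fun k _ => i3 j k).symm
    simp only [this]
    rw [← integral_finsetSum _ fun j _ => integrable_finsetSum _ fun k _ => i3 j k,
      ← integral_const_mul]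
    congr 1; funext x
    simp only [← Finset.sum_mul]; ring
  rw [e3] at hb
  refine le_trans ?_ hb
  rw [← integral_finsetSum _ fun j _ => i1 j]
  have elev : ∀ x, ∑ j, ∑ k, wirtBar k (wirt j (fun y => (φ y : ℂ))) x *
      f j x * (starRingEnd ℂ) (f k x) =
      (leviForm φ x (WithLp.toLp 2 fun j => f j x) : ℂ) := fun x =>
    sum_wirtBar_wirt_eq_leviForm hφ x (WithLp.toLp 2 fun j => f j x)
  refine integral_mono (integrable_finsetSum _ fun j _ => i1 j) ?_ fun x => ?_
  · have hcw : ∀ j k, Continuous (wirtBar k (wirt j (fun y => (φ y : ℂ)))) := fun j k =>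
      continuous_wirtBar (contDiff_wirt (contDiff_ofReal_comp hφ) j) k
    refine Continuous.integrable_of_hasCompactSupport ?_ ?_
    · refine (continuous_re.comp ?_).mul hexp
      refine continuous_finsetSum _ fun j _ => continuous_finsetSum _ fun k _ => ?_
      exact ((hcw j k).mul (hf j).continuous).mul (continuous_conj.comp (hf k).continuous)
    · refine HasCompactSupport.mul_right ?_
      refine HasCompactSupport.intro (isCompact_iUnion fun j => hfc j) fun x hx => ?_
      have h0 : ∀ j, f j x = 0 := fun j =>
        image_eq_zero_of_notMem_tsupport fun h => hx (mem_iUnion.2 ⟨j, h⟩)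
      simp [h0]
  · dsimp only
    rw [elev, ofReal_re]
    calc _ = (c x * ∑ j, ‖f j x‖ ^ 2) * Real.exp (-φ x) := by
          simp only [Finset.mul_sum, Finset.sum_mul]
      _ ≤ _ := mul_le_mul_of_nonneg_right (hlevi x) (Real.exp_pos _).le

/-- The basic inequality for compactly supported square integrable forms whose `∂̄` and formal
adjoint are square integrable in the sense of distributions. -/
theorem weak_basic_inequality {φ : 𝔼 → ℝ} (hφ : ContDiff ℝ 2 φ) {G : Fin n → 𝔼 → ℂ} {H : 𝔼 → ℂ}
    {W : Fin n → Fin n → 𝔼 → ℂ} {K U : Set 𝔼} (hK : IsCompact K) (hU : IsOpen U) (hKU : K ⊆ U)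
    (hGm : ∀ j, Measurable (G j)) (hG : ∀ j, MemLp (G j) 2) (hG0 : ∀ j, ∀ x ∉ K, G j x = 0)
    (hHm : Measurable H) (hH : MemLp H 2) (hH0 : ∀ x ∉ K, H x = 0)
    (hWm : ∀ j k, Measurable (W j k)) (hW : ∀ j k, MemLp (W j k) 2)
    (hW0 : ∀ j k, ∀ x ∉ K, W j k x = 0)
    (hcl : ∀ j k, ∀ v : 𝔼 → ℂ, ContDiff ℝ 2 v → HasCompactSupport v →
      ∫ x, (G j x * wirtBar k v x - G k x * wirtBar j v x) = -∫ x, W j k x * v x)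
    (hadj : ∀ v : 𝔼 → ℂ, ContDiff ℝ 2 v → HasCompactSupport v →
      ∫ x, ∑ j, G j x * wirt j v x = -∫ x, H x * v x)
    {c : 𝔼 → ℝ} (hc : Continuous c) (hc0 : ∀ x, 0 ≤ c x)
    (hlevi : ∀ x ∈ U, ∀ w, c x * ‖w‖ ^ 2 ≤ leviForm φ x w) :
    ∑ j, ∫ x, c x * ‖G j x‖ ^ 2 * Real.exp (-φ x) ≤
      (∫ x, ‖H x - ∑ j, wirt j (fun y => (φ y : ℂ)) x * G j x‖ ^ 2 * Real.exp (-φ x)) +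
      1 / 2 * ∑ j, ∑ k, ∫ x, ‖W j k x‖ ^ 2 * Real.exp (-φ x) := by
  obtain ⟨δ₀, hδ₀, hδU⟩ := hK.exists_cthickening_subset_open hU hKU
  obtain ⟨ρ, δ, hρ, hδ, hlim⟩ := exists_mollifier_seq (n := n) hδ₀
  set K₁ := cthickening δ₀ K with hK₁
  have hK₁c : IsCompact K₁ := hK.cthickening
  have hKK₁ : K ⊆ K₁ := self_subset_cthickening K
  have hloc : ∀ {u : 𝔼 → ℂ}, MemLp u 2 → LocallyIntegrable u := fun hu =>
    hu.locallyIntegrable (by norm_num)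
  have hs0 : ∀ {u : 𝔼 → ℂ}, (∀ x ∉ K, u x = 0) → ∀ ν, ∀ x ∉ K₁, smear (ρ ν) u x = 0 := by
    intro u hu ν x hx
    refine smear_eq_zero (hρ ν) fun y hy => hu y fun hyK => hx ?_
    exact mem_cthickening_of_dist_le x y _ K hyK
      (by rw [dist_comm]; exact (mem_ball.1 hy).le.trans (hδ ν))
  have hsc : ∀ {u : 𝔼 → ℂ}, (∀ x ∉ K, u x = 0) → ∀ ν, HasCompactSupport (smear (ρ ν) u) :=
    fun hu ν => HasCompactSupport.intro hK₁c (hs0 hu ν)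
  obtain ⟨χ, hχ1, -, hχc, -⟩ := exists_continuous_one_zero_of_isCompact hK₁c
    isClosed_empty (disjoint_empty _)
  have hφc : Continuous φ := hφ.continuous
  have hbd : ∀ {b : 𝔼 → ℂ}, Continuous b → ∃ C, ∀ x, ‖(χ x : ℂ) * b x‖ ≤ C := fun {b} hb => by
    have h1 : HasCompactSupport (fun x => (χ x : ℂ) * b x) :=
      (hχc.comp_left (g := fun t : ℝ => (t : ℂ)) ofReal_zero).mul_right
    exact h1.exists_bound_of_continuous ((continuous_ofReal.comp χ.continuous).mul hb)
  have hmul : ∀ {b v : 𝔼 → ℂ} {u : ℕ → 𝔼 → ℂ}, Continuous b → L2Lim u v →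
      L2Lim (fun ν x => ((χ x : ℂ) * b x) * u ν x) (fun x => ((χ x : ℂ) * b x) * v x) := by
    intro b v u hb h
    obtain ⟨C, hC⟩ := hbd hb
    exact h.mul ((continuous_ofReal.comp χ.continuous).mul hb) hC
  have hpt : ∀ {s : 𝔼 → ℝ} {t : 𝔼 → ℂ}, (∀ x, 0 ≤ s x) → (∀ x ∉ K₁, t x = 0) → ∀ x,
      ‖((χ x : ℂ) * (Real.sqrt (s x) : ℂ)) * t x‖ ^ 2 = s x * ‖t x‖ ^ 2 := by
    intro s t hs ht x
    by_cases hx : x ∈ K₁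
    · rw [hχ1 hx]
      simp only [Pi.one_apply, ofReal_one, one_mul, norm_mul, norm_real, mul_pow,
        Real.norm_eq_abs, sq_abs, Real.sq_sqrt (hs x)]
    · simp [ht x hx]
  have hpt2 : ∀ {t : 𝔼 → ℂ}, (∀ x ∉ K₁, t x = 0) → ∀ x,
      ‖((χ x : ℂ) * (Real.sqrt (Real.exp (-φ x)) : ℂ)) * t x‖ ^ 2 =
        ‖t x‖ ^ 2 * Real.exp (-φ x) := fun ht x => by
    rw [mul_comm (‖_‖ ^ 2)]
    exact hpt (s := fun x => Real.exp (-φ x)) (fun x => (Real.exp_pos _).le) ht x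
  have hoff : ∀ {u : 𝔼 → ℂ}, (∀ x ∉ K, u x = 0) → ∀ x ∉ K₁, u x = 0 := fun hu x hx =>
    hu x fun h => hx (hKK₁ h)
  have hs1 : ∀ x, 0 ≤ c x * Real.exp (-φ x) := fun x => mul_nonneg (hc0 x) (Real.exp_pos _).le
  have hexp : Continuous fun x => Real.exp (-φ x) := by fun_prop
  have hc1 : Continuous fun x => ((Real.sqrt (c x * Real.exp (-φ x)) : ℝ) : ℂ) := by fun_prop
  have hc2 : Continuous fun x => ((Real.sqrt (Real.exp (-φ x)) : ℝ) : ℂ) := by fun_prop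
  have hwφ : ∀ j, Continuous (wirt j (fun y => (φ y : ℂ))) := fun j =>
    (contDiff_wirt (contDiff_ofReal_comp hφ) j).continuous
  have lG : ∀ j, L2Lim (fun ν => smear (ρ ν) (G j)) (G j) := fun j =>
    hlim _ K (hGm j) (hG j) hK (hG0 j)
  have lW : ∀ j k, L2Lim (fun ν => smear (ρ ν) (W j k)) (W j k) := fun j k =>
    hlim _ K (hWm j k) (hW j k) hK (hW0 j k)
  have lH : L2Lim (fun ν => smear (ρ ν) H) H := hlim _ K hHm hH hK hH0
  have t1 : Filter.Tendsto
      (fun ν => ∑ j, ∫ x, c x * ‖smear (ρ ν) (G j) x‖ ^ 2 * Real.exp (-φ x))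
      Filter.atTop (nhds (∑ j, ∫ x, c x * ‖G j x‖ ^ 2 * Real.exp (-φ x))) := by
    refine tendsto_finsetSum _ fun j _ => ?_
    have := (hmul hc1 (lG j)).tendsto_integral
    have e : ∀ {t : 𝔼 → ℂ} x, c x * Real.exp (-φ x) * ‖t x‖ ^ 2 =
      c x * ‖t x‖ ^ 2 * Real.exp (-φ x) := fun x => by ring
    simpa only [hpt hs1 (hoff (hG0 j)), fun ν => hpt hs1 (hs0 (hG0 j) ν), e] using this
  have t3 : Filter.Tendsto
      (fun ν => ∑ j, ∑ k, ∫ x, ‖smear (ρ ν) (W j k) x‖ ^ 2 * Real.exp (-φ x))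
      Filter.atTop (nhds (∑ j, ∑ k, ∫ x, ‖W j k x‖ ^ 2 * Real.exp (-φ x))) := by
    refine tendsto_finsetSum _ fun j _ => tendsto_finsetSum _ fun k _ => ?_
    have := (hmul hc2 (lW j k)).tendsto_integral
    simpa only [hpt2 (hoff (hW0 j k)), fun ν => hpt2 (hs0 (hW0 j k) ν)] using this
  have t2 : Filter.Tendsto
      (fun ν => ∫ x, ‖smear (ρ ν) H x -
        ∑ j, wirt j (fun y => (φ y : ℂ)) x * smear (ρ ν) (G j) x‖ ^ 2 * Real.exp (-φ x))
      Filter.atTop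
      (nhds (∫ x, ‖H x - ∑ j, wirt j (fun y => (φ y : ℂ)) x * G j x‖ ^ 2
        * Real.exp (-φ x))) := by
    have e : ∀ (h : ℂ) (g : Fin n → ℂ) x,
        ((χ x : ℂ) * ((Real.sqrt (Real.exp (-φ x)) : ℝ) : ℂ)) *
          (h - ∑ j, wirt j (fun y => (φ y : ℂ)) x * g j) =
        (χ x : ℂ) * ((Real.sqrt (Real.exp (-φ x)) : ℝ) : ℂ) * h -
          ∑ j, (χ x : ℂ) * (((Real.sqrt (Real.exp (-φ x)) : ℝ) : ℂ) *
            wirt j (fun y => (φ y : ℂ)) x) * g j := by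
      intro h g x
      rw [mul_sub, Finset.mul_sum]
      congr 1
      exact Finset.sum_congr rfl fun j _ => by ring
    have l : L2Lim (fun ν x => ((χ x : ℂ) * ((Real.sqrt (Real.exp (-φ x)) : ℝ) : ℂ)) *
          (smear (ρ ν) H x - ∑ j, wirt j (fun y => (φ y : ℂ)) x * smear (ρ ν) (G j) x))
        (fun x => ((χ x : ℂ) * ((Real.sqrt (Real.exp (-φ x)) : ℝ) : ℂ)) *
          (H x - ∑ j, wirt j (fun y => (φ y : ℂ)) x * G j x)) := by
      have l0 := (hmul hc2 lH).sub (L2Lim.sum Finset.univ fun j =>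
        hmul (hc2.mul (hwφ j)) (lG j))
      refine (congrArg₂ L2Lim ?_ ?_).mpr l0
      · funext ν x; exact e _ _ x
      · funext x; exact e _ _ x
    have l2 := l.tendsto_integral
    have z1 : ∀ ν, ∀ x ∉ K₁, smear (ρ ν) H x -
        ∑ j, wirt j (fun y => (φ y : ℂ)) x * smear (ρ ν) (G j) x = 0 := fun ν x hx => by
      simp [hs0 hH0 ν x hx, fun j => hs0 (hG0 j) ν x hx]
    have z2 : ∀ x ∉ K₁, H x - ∑ j, wirt j (fun y => (φ y : ℂ)) x * G j x = 0 := fun x hx => by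
      simp [hoff hH0 x hx, fun j => hoff (hG0 j) x hx]
    simpa only [hpt2 z2, fun ν => hpt2 (z1 ν)] using l2
  refine le_of_tendsto_of_tendsto' t1 (t2.add (t3.const_mul (1 / 2))) fun ν => ?_
  have hf2 : ∀ j, ContDiff ℝ 2 (smear (ρ ν) (G j)) := fun j =>
    contDiff_smear (hρ ν) (hloc (hG j))
  have hb := basic_inequality_of_le_leviForm hφ hf2 (fun j => hsc (hG0 j) ν) hc fun x => by
    have hn : ‖(WithLp.toLp 2 fun j => smear (ρ ν) (G j) x : 𝔼)‖ ^ 2 =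
        ∑ j, ‖smear (ρ ν) (G j) x‖ ^ 2 := EuclideanSpace.norm_sq_eq _
    by_cases hx : x ∈ K₁
    · rw [← hn]; exact hlevi x (hδU hx) _
    · simp only [fun j => hs0 (hG0 j) ν x hx]
      simp [leviForm, show (WithLp.toLp 2 fun _ : Fin n => (0 : ℂ)) = (0 : 𝔼) from rfl]
  have eW : ∀ j k x, wirtBar k (smear (ρ ν) (G j)) x - wirtBar j (smear (ρ ν) (G k)) x =
      smear (ρ ν) (W j k) x := fun j k x =>
    wirtBar_smear_sub (hloc (hG j)) (hloc (hG k)) j k (hcl j k) (hρ ν) x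
  have eH : ∀ x, ∑ j, wirt j (smear (ρ ν) (G j)) x = smear (ρ ν) H x :=
    sum_wirt_smear (fun j => hloc (hG j)) hadj (hρ ν)
  simpa only [eW, eH] using hb

end L2Limits

section Weighted

variable {n : ℕ}

local notation "𝔼" => EuclideanSpace ℂ (Fin n)

/-- Test functions on an open set. -/
structure IsTest (D : Set 𝔼) (v : 𝔼 → ℂ) : Prop where
  contDiff : ContDiff ℝ 2 v
  compact : HasCompactSupport v
  subset : tsupport v ⊆ D

lemma norm_stdVec (j : Fin n) : ‖(stdVec j : 𝔼)‖ = 1 := by simp [stdVec]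

lemma wirt_real_comp {φ : 𝔼 → ℝ} {g : ℝ → ℝ} {g' : ℝ} {x : 𝔼} (hφ : DifferentiableAt ℝ φ x)
    (hg : HasDerivAt g g' (φ x)) (j : Fin n) :
    wirt j (fun y => (g (φ y) : ℂ)) x = g' * wirt j (fun y => (φ y : ℂ)) x := by
  have h := hg.comp_hasFDerivAt x hφ.hasFDerivAt
  have hd : DifferentiableAt ℝ (fun y => g (φ y)) x := h.differentiableAt
  have h1 : fderiv ℝ (fun y => g (φ y)) x = g' • fderiv ℝ φ x := h.fderiv
  simp only [wirt, fderiv_ofReal_comp hφ, fderiv_ofReal_comp hd, h1, _root_.smul_apply,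
    smul_eq_mul]
  push_cast; ring

lemma norm_wirt_ofReal_le {f : 𝔼 → ℝ} {x : 𝔼} (hf : DifferentiableAt ℝ f x) (j : Fin n) :
    ‖wirt j (fun y => (f y : ℂ)) x‖ ≤ ‖fderiv ℝ f x‖ := by
  have h1 : ‖fderiv ℝ f x (stdVec j)‖ ≤ ‖fderiv ℝ f x‖ := by
    simpa [norm_stdVec] using (fderiv ℝ f x).le_opNorm (stdVec j)
  have h2 : ‖fderiv ℝ f x (I • stdVec j)‖ ≤ ‖fderiv ℝ f x‖ := by
    simpa [norm_stdVec, norm_smul] using (fderiv ℝ f x).le_opNorm (I • stdVec j)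
  simp only [wirt, fderiv_ofReal_comp hf]
  rw [norm_mul]
  have h3 := norm_sub_le ((fderiv ℝ f x (stdVec j) : ℝ) : ℂ)
    (I * ((fderiv ℝ f x (I • stdVec j) : ℝ) : ℂ))
  rw [norm_mul, norm_I, one_mul, norm_real, norm_real] at h3
  have h4 : ‖(1 / 2 : ℂ)‖ = 1 / 2 := by norm_num
  rw [h4]; linarith

lemma wirtBar_ofReal {f : 𝔼 → ℝ} {x : 𝔼} (hf : DifferentiableAt ℝ f x) (j : Fin n) :
    wirtBar j (fun y => (f y : ℂ)) x = (starRingEnd ℂ) (wirt j (fun y => (f y : ℂ)) x) := by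
  have h : DifferentiableAt ℝ (fun y => (f y : ℂ)) x :=
    (ofRealCLM.hasFDerivAt (x := f x)).comp x hf.hasFDerivAt |>.differentiableAt
  rw [← wirtBar_conj h]
  simp

lemma sum_norm_wirt_sq_le {f : 𝔼 → ℝ} {x : 𝔼} (hf : DifferentiableAt ℝ f x) :
    ∑ j, ‖wirt j (fun y => (f y : ℂ)) x‖ ^ 2 ≤ n * ‖fderiv ℝ f x‖ ^ 2 := by
  calc _ ≤ ∑ _j : Fin n, ‖fderiv ℝ f x‖ ^ 2 := Finset.sum_le_sum fun j _ =>
        pow_le_pow_left₀ (norm_nonneg _) (norm_wirt_ofReal_le hf j) 2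
    _ = _ := by simp

lemma norm_sum_mul_sq_le {ι : Type*} (s : Finset ι) (a b : ι → ℂ) :
    ‖∑ j ∈ s, a j * b j‖ ^ 2 ≤ (∑ j ∈ s, ‖a j‖ ^ 2) * ∑ j ∈ s, ‖b j‖ ^ 2 := by
  calc _ ≤ (∑ j ∈ s, ‖a j‖ * ‖b j‖) ^ 2 := by
        refine pow_le_pow_left₀ (norm_nonneg _) ((norm_sum_le _ _).trans (le_of_eq ?_)) 2
        exact Finset.sum_congr rfl fun j _ => norm_mul _ _
    _ ≤ _ := Finset.sum_mul_sq_le_sq_mul_sq s _ _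

/-- The weight `A / r + 2 log r`. -/
noncomputable def weight (A : ℝ) (r : 𝔼 → ℝ) (x : 𝔼) : ℝ := A * (r x)⁻¹ + 2 * Real.log (r x)

lemma contDiff_weight {A : ℝ} {r : 𝔼 → ℝ} (hr : ContDiff ℝ 2 r) (hr0 : ∀ x, 0 < r x) :
    ContDiff ℝ 2 (weight A r) :=
  (contDiff_const.mul (hr.inv fun x => (hr0 x).ne')).add
    (contDiff_const.mul (hr.log fun x => (hr0 x).ne'))

lemma wirt_inv {A : ℝ} {r : 𝔼 → ℝ} (hr : ContDiff ℝ 2 r) (hr0 : ∀ x, 0 < r x) (j : Fin n)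
    (x : 𝔼) : wirt j (fun y => ((A * (r y)⁻¹ : ℝ) : ℂ)) x =
      -(A * (r x)⁻¹ ^ 2 : ℝ) * wirt j (fun y => (r y : ℂ)) x := by
  have h1 := ((hasDerivAt_inv (hr0 x).ne').const_mul A)
  rw [wirt_real_comp (hr.differentiable (by norm_num) x) (g := fun t => A * t⁻¹) h1]
  congr 1
  push_cast
  ring

lemma wirt_weight {A : ℝ} {r : 𝔼 → ℝ} (hr : ContDiff ℝ 2 r) (hr0 : ∀ x, 0 < r x) (j : Fin n)
    (x : 𝔼) : wirt j (fun y => (weight A r y : ℂ)) x =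
      (-(A * (r x)⁻¹ ^ 2 : ℝ) + (2 * (r x)⁻¹ : ℝ)) * wirt j (fun y => (r y : ℂ)) x := by
  have h1 := ((hasDerivAt_inv (hr0 x).ne').const_mul A).add
    ((Real.hasDerivAt_log (hr0 x).ne').const_mul 2)
  have := wirt_real_comp (hr.differentiable (by norm_num) x)
    (g := fun t => A * t⁻¹ + 2 * Real.log t) h1 j
  simp only [weight]
  rw [this]
  congr 1
  push_cast
  ring

lemma le_leviForm_inv {A ε : ℝ} (hA : 0 ≤ A) {r : 𝔼 → ℝ} (hr : ContDiff ℝ 2 r) {x : 𝔼}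
    (hr0 : 0 < r x) {w : 𝔼} (h : leviForm r x w ≤ -ε * ‖w‖ ^ 2) :
    A * ε * (r x)⁻¹ ^ 2 * ‖w‖ ^ 2 ≤ leviForm (fun y => A * (r y)⁻¹) x w := by
  have h1 : ∀ᶠ t in nhds (r x), HasDerivAt (fun t => A * t⁻¹) (A * -(t ^ 2)⁻¹) t := by
    filter_upwards [lt_mem_nhds hr0] with t ht
    exact (hasDerivAt_inv ht.ne').const_mul A
  have h2 : HasDerivAt (fun t : ℝ => A * -(t ^ 2)⁻¹) (2 * A * (r x)⁻¹ ^ 3) (r x) := by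
    have := (((hasDerivAt_pow 2 (r x)).fun_inv (by positivity)).fun_neg).const_mul A
    refine this.congr_deriv ?_
    field_simp
    norm_num
    ring
  rw [leviForm_real_comp hr h1 h2]
  have h3 : 0 ≤ 2 * A * (r x)⁻¹ ^ 3 / 4 *
      ((fderiv ℝ r x w) ^ 2 + (fderiv ℝ r x (I • w)) ^ 2) := by positivity
  have h4 : A * (r x)⁻¹ ^ 2 * leviForm r x w ≤ A * (r x)⁻¹ ^ 2 * (-ε * ‖w‖ ^ 2) :=
    mul_le_mul_of_nonneg_left h (by positivity)
  have h5 : A * -(r x ^ 2)⁻¹ * leviForm r x w = -(A * (r x)⁻¹ ^ 2 * leviForm r x w) := by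
    rw [inv_pow]; ring
  rw [h5]
  linarith

end Weighted

section Local

variable {n : ℕ}

local notation "𝔼" => EuclideanSpace ℂ (Fin n)

lemma memLp_mul_of_hasCompactSupport {b u : 𝔼 → ℂ} (hb : Continuous b) (hbc : HasCompactSupport b)
    (hu : MemLp u 2) : MemLp (fun x => b x * u x) 2 := by
  obtain ⟨C, hC⟩ := hb.bounded_above_of_compact_support hbc
  exact MemLp.of_le_mul (c := C) hu (hb.aestronglyMeasurable.mul hu.aestronglyMeasurable)
    (Filter.Eventually.of_forall fun x => by
      rw [norm_mul]; exact mul_le_mul_of_nonneg_right (hC x) (norm_nonneg _))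

lemma integrable_mul_norm_sq {b : 𝔼 → ℝ} {u : 𝔼 → ℂ} (hb : Continuous b)
    (hbc : HasCompactSupport b) (hu : MemLp u 2) : Integrable (fun x => b x * ‖u x‖ ^ 2) := by
  obtain ⟨C, hC⟩ := hb.bounded_above_of_compact_support hbc
  have h1 : Integrable (fun x => ‖u x‖ ^ 2) := by
    simpa using hu.integrable_norm_pow (p := 2) (by norm_num)
  exact h1.bdd_mul (c := C) hb.aestronglyMeasurable (Filter.Eventually.of_forall hC)

lemma IsTest.mul_real {D : Set 𝔼} {v : 𝔼 → ℂ} {η : 𝔼 → ℝ} (hη : ContDiff ℝ 2 η)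
    (hηc : HasCompactSupport η) (hηD : tsupport η ⊆ D) (hv : ContDiff ℝ 2 v) :
    IsTest D (fun x => (η x : ℂ) * v x) := by
  have h0 : tsupport (fun x => (η x : ℂ) * v x) ⊆ tsupport η :=
    closure_mono fun x hx => by
      simp only [Function.mem_support, ne_eq, mul_eq_zero, not_or, ofReal_eq_zero] at hx ⊢
      exact hx.1
  exact ⟨(contDiff_ofReal_comp hη).mul hv, hηc.of_isClosed_subset (isClosed_tsupport _) h0,
    h0.trans hηD⟩

lemma norm_add_three_sq_le (a b c : ℂ) :
    ‖a + b + c‖ ^ 2 ≤ 3 * (‖a‖ ^ 2 + ‖b‖ ^ 2 + ‖c‖ ^ 2) := by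
  have h := norm_add₃_le (a := a) (b := b) (c := c)
  have h2 := pow_le_pow_left₀ (norm_nonneg _) h 2
  nlinarith [sq_nonneg (‖a‖ - ‖b‖), sq_nonneg (‖a‖ - ‖c‖), sq_nonneg (‖b‖ - ‖c‖)]

lemma norm_sub_sq_le_two (a b : ℂ) : ‖a - b‖ ^ 2 ≤ 2 * (‖a‖ ^ 2 + ‖b‖ ^ 2) := by
  have h2 := pow_le_pow_left₀ (norm_nonneg _) (norm_sub_le a b) 2
  nlinarith [sq_nonneg (‖a‖ - ‖b‖)]

lemma wirt_exp_weight {A : ℝ} {r : 𝔼 → ℝ} (hr : ContDiff ℝ 2 r) (hr0 : ∀ x, 0 < r x) (j : Fin n)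
    (x : 𝔼) : wirt j (fun y => ((Real.exp (weight A r y) : ℝ) : ℂ)) x =
      Real.exp (weight A r x) * wirt j (fun y => (weight A r y : ℂ)) x :=
  wirt_real_comp ((contDiff_weight hr hr0).differentiable (by norm_num) x) (Real.hasDerivAt_exp _) j

theorem local_estimate {A ε M : ℝ} (hA : 0 ≤ A) (hε : 0 ≤ ε) {r : 𝔼 → ℝ}
    (hr : ContDiff ℝ 2 r) (hr0 : ∀ x, 0 < r x) {U : Set 𝔼} (hU : IsOpen U)
    (hlevi : ∀ x ∈ U, ∀ w, leviForm r x w ≤ -ε * ‖w‖ ^ 2) (hM : ∀ x ∈ U, ‖fderiv ℝ r x‖ ≤ M)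
    {g : Fin n → 𝔼 → ℂ} (hgm : ∀ j, Measurable (g j)) (hg : ∀ j, MemLp (g j) 2)
    {η : 𝔼 → ℝ} (hη : ContDiff ℝ 2 η) (hηc : HasCompactSupport η) (hηU : tsupport η ⊆ U)
    {H₁ : 𝔼 → ℂ} (hH₁ : Continuous H₁)
    (hcl : ∀ j k v, IsTest U v → ∫ x, (Real.exp (weight A r x / 2) : ℂ) *
      (g j x * wirtBar k v x - g k x * wirtBar j v x) = 0)
    (hadj : ∀ v, IsTest U v → ∫ x, ∑ j, g j x / (Real.exp (weight A r x / 2) : ℂ) * wirt j v x =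
      -∫ x, H₁ x * v x) :
    (A * ε - 12 * n * M ^ 2) * ∫ x, η x ^ 2 * ∑ j, ‖g j x‖ ^ 2 ≤
      5 * n * (∫ x, ‖fderiv ℝ η x‖ ^ 2 * r x ^ 2 * ∑ j, ‖g j x‖ ^ 2) +
      3 * ∫ x, η x ^ 2 * (r x ^ 2 * Real.exp (weight A r x) * ‖H₁ x‖ ^ 2) := by
  set φ : 𝔼 → ℝ := fun x => A * (r x)⁻¹ with hφdef
  have hφ : ContDiff ℝ 2 φ := contDiff_const.mul (hr.inv fun x => (hr0 x).ne')
  have hw : ContDiff ℝ 2 (weight A r) := contDiff_weight hr hr0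
  set m : 𝔼 → ℝ := fun x => Real.exp (weight A r x / 2) with hm
  have hmC : ContDiff ℝ 2 m := (hw.div_const 2).exp
  have hm0 : ∀ x, 0 < m x := fun x => Real.exp_pos _
  have hm2 : ∀ x, m x * m x = Real.exp (weight A r x) := fun x => by
    simp only [hm]; rw [← Real.exp_add]; congr 1; ring
  have hmφ : ∀ x, Real.exp (weight A r x) * Real.exp (-φ x) = r x ^ 2 := fun x => by
    rw [← Real.exp_add]
    have : weight A r x + -φ x = Real.log (r x) + Real.log (r x) := by
      simp only [weight, hφdef]; ring
    rw [this, Real.exp_add, Real.exp_log (hr0 x), sq]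
  have hEC : ContDiff ℝ 2 (fun x => Real.exp (weight A r x)) := hw.exp
  have hηd : ∀ x, DifferentiableAt ℝ η x := hη.differentiable (by norm_num)
  have hηC : ContDiff ℝ 2 (fun x => (η x : ℂ)) := contDiff_ofReal_comp hη
  have hηcC : HasCompactSupport (fun x => (η x : ℂ)) := hηc.comp_left ofReal_zero
  have hηdC : ∀ x, DifferentiableAt ℝ (fun x => (η x : ℂ)) x := hηC.differentiable (by norm_num)
  have hmcC : ContDiff ℝ 2 (fun x => (m x : ℂ)) := contDiff_ofReal_comp hmC
  have hwb : ∀ j, Continuous (wirtBar j (fun x => (η x : ℂ))) := fun j =>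
    continuous_wirtBar (hηC.of_le (by norm_num)) j
  have hwn : ∀ j, Continuous (wirt j (fun x => (η x : ℂ))) := fun j =>
    continuous_wirt (hηC.of_le (by norm_num)) j
  have hwbc : ∀ j, HasCompactSupport (wirtBar j (fun x => (η x : ℂ))) := fun j =>
    hasCompactSupport_wirtBar hηcC j
  have hwnc : ∀ j, HasCompactSupport (wirt j (fun x => (η x : ℂ))) := fun j =>
    hasCompactSupport_wirt hηcC j
  set K := tsupport η with hKdef
  have hKη : ∀ x ∉ K, η x = 0 := fun x hx => image_eq_zero_of_notMem_tsupport hx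
  have hKw : ∀ x ∉ K, fderiv ℝ η x = 0 := fun x hx =>
    image_eq_zero_of_notMem_tsupport fun h => hx (tsupport_fderiv_subset ℝ h)
  have hKwn : ∀ j, ∀ x ∉ K, wirt j (fun x => (η x : ℂ)) x = 0 := fun j x hx => by
    simp [wirt, fderiv_ofReal_comp (hηd x), hKw x hx]
  have hKwb : ∀ j, ∀ x ∉ K, wirtBar j (fun x => (η x : ℂ)) x = 0 := fun j x hx => by
    simp [wirtBar, fderiv_ofReal_comp (hηd x), hKw x hx]
  -- the localized data
  set G : Fin n → 𝔼 → ℂ := fun j x => ((η x : ℂ) * m x) * g j x with hG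
  set W : Fin n → Fin n → 𝔼 → ℂ := fun j k x =>
    (m x * wirtBar k (fun x => (η x : ℂ)) x) * g j x -
      (m x * wirtBar j (fun x => (η x : ℂ)) x) * g k x with hW
  set H : 𝔼 → ℂ := fun x => ∑ j, (m x * (wirt j (fun x => (η x : ℂ)) x +
      η x * wirt j (fun x => (weight A r x : ℂ)) x)) * g j x +
      η x * Real.exp (weight A r x) * H₁ x with hH
  have hwwt : ∀ j, Continuous (wirt j (fun x => (weight A r x : ℂ))) := fun j =>
    continuous_wirt ((contDiff_ofReal_comp hw).of_le (by norm_num)) j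
  have hcs : ∀ {b : 𝔼 → ℂ}, (∀ x ∉ K, b x = 0) → HasCompactSupport b := fun hb =>
    HasCompactSupport.intro hηc hb
  have cη := hηC.continuous
  have cm := hmcC.continuous
  have cE : Continuous (fun x => ((Real.exp (weight A r x) : ℝ) : ℂ)) :=
    continuous_ofReal.comp hEC.continuous
  have hb1 : Continuous (fun x => (η x : ℂ) * m x) := cη.mul cm
  have hb2 : ∀ k, Continuous (fun x => m x * wirtBar k (fun x => (η x : ℂ)) x) := fun k =>
    cm.mul (hwb k)
  have hb3 : ∀ j, Continuous (fun x => (m x * (wirt j (fun x => (η x : ℂ)) x +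
      η x * wirt j (fun x => (weight A r x : ℂ)) x))) := fun j =>
    cm.mul ((hwn j).add (cη.mul (hwwt j)))
  have hb4 : Continuous (fun x => η x * Real.exp (weight A r x) * H₁ x) := (cη.mul cE).mul hH₁
  have hEd : ∀ x, DifferentiableAt ℝ (fun x => ((Real.exp (weight A r x) : ℝ) : ℂ)) x :=
    (contDiff_ofReal_comp hEC).differentiable (by norm_num)
  have hloc : ∀ {u : 𝔼 → ℂ}, MemLp u 2 → LocallyIntegrable u := fun hu =>
    hu.locallyIntegrable (by norm_num)
  have hGL : ∀ j, MemLp (G j) 2 := fun j =>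
    memLp_mul_of_hasCompactSupport hb1 (hcs fun x hx => by simp [hKη x hx]) (hg j)
  have hWL : ∀ j k, MemLp (W j k) 2 := fun j k => (memLp_mul_of_hasCompactSupport (hb2 k)
      (hcs fun x hx => by simp [hKwb k x hx]) (hg j)).sub (memLp_mul_of_hasCompactSupport (hb2 j)
      (hcs fun x hx => by simp [hKwb j x hx]) (hg k))
  have hHL : MemLp H 2 := (memLp_finsetSum _ fun j _ => memLp_mul_of_hasCompactSupport (hb3 j)
      (hcs fun x hx => by simp [hKη x hx, hKwn j x hx]) (hg j)).add
      (hb4.memLp_of_hasCompactSupport (hcs fun x hx => by simp [hKη x hx]))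
  have hGloc := fun j => hloc (hGL j)
  have hWloc := fun j k => hloc (hWL j k)
  have hHloc := hloc hHL
  have hbasic := weak_basic_inequality hφ (G := G) (H := H) (W := W) (K := K) (U := U)
    (c := fun x => A * ε * (r x)⁻¹ ^ 2) hηc hU hηU
    (fun j => hb1.measurable.mul (hgm j))
    hGL
    (fun j x hx => by simp [hG, hKη x hx])
    ((Finset.measurable_fun_sum _ fun j _ => (hb3 j).measurable.mul (hgm j)).add hb4.measurable)
    hHL
    (fun x hx => by simp [hH, hKη x hx, hKwn _ x hx])
    (fun j k => ((hb2 k).measurable.mul (hgm j)).sub ((hb2 j).measurable.mul (hgm k)))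
    hWL
    (fun j k x hx => by simp [hW, hKwb j x hx, hKwb k x hx])
    ?_ ?_ (continuous_const.mul ((hr.continuous.inv₀ fun x => (hr0 x).ne').pow 2))
    (fun x => by positivity)
    (fun x hx w => le_leviForm_inv hA hr (hr0 x) (hlevi x hx w))
  rotate_left
  · intro j k v hv hvc
    have hvd : ∀ x, DifferentiableAt ℝ v x := hv.differentiable (by norm_num)
    have h1 := hcl j k _ (IsTest.mul_real hη hηc hηU hv)
    have i1 : Integrable (fun x => G j x * wirtBar k v x - G k x * wirtBar j v x) :=
      (integrable_mul_of_hasCompactSupport (hGloc j) (continuous_wirtBar (hv.of_le (by norm_num)) k)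
        (hasCompactSupport_wirtBar hvc k)).subFun
      (integrable_mul_of_hasCompactSupport (hGloc k) (continuous_wirtBar (hv.of_le (by norm_num)) j)
        (hasCompactSupport_wirtBar hvc j))
    have i2 : Integrable (fun x => W j k x * v x) :=
      integrable_mul_of_hasCompactSupport (hWloc j k) hv.continuous hvc
    rw [eq_neg_iff_add_eq_zero, ← integral_add i1 i2, ← h1]
    refine integral_congr_ae (Filter.Eventually.of_forall fun x => ?_)
    simp only [wirtBar_mul (hηdC x) (hvd x), hG, hW, hm]
    ring
  · intro v hv hvc
    have hvd : ∀ x, DifferentiableAt ℝ v x := hv.differentiable (by norm_num)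
    have h1 := hadj _ (IsTest.mul_real hη hηc hηU ((contDiff_ofReal_comp hEC).mul hv))
    have i1 : Integrable (fun x => ∑ j, G j x * wirt j v x) :=
      integrable_finsetSum _ fun j _ => integrable_mul_of_hasCompactSupport (hGloc j)
        (continuous_wirt (hv.of_le (by norm_num)) j) (hasCompactSupport_wirt hvc j)
    have i2 : Integrable (fun x => H x * v x) :=
      integrable_mul_of_hasCompactSupport hHloc hv.continuous hvc
    have i3 : Integrable (fun x => H₁ x * ((η x : ℂ) * (((Real.exp (weight A r x) : ℝ) : ℂ) * v x))) :=
      (hH₁.mul (cη.mul (cE.mul hv.continuous))).integrable_of_hasCompactSupport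
        (hcs fun x hx => by simp [hKη x hx])
    rw [eq_neg_iff_add_eq_zero] at h1 ⊢
    rw [← integral_add i1 i2, ← h1, ← integral_add ?_ i3]
    · refine integral_congr_ae (Filter.Eventually.of_forall fun x => ?_)
      simp only [wirt_mul (hηdC x) ((hEd x).fun_mul (hvd x)), wirt_mul (hEd x) (hvd x),
        wirt_exp_weight hr hr0, hG, hH]
      simp only [← hm2, add_mul, Finset.sum_mul]
      rw [← add_assoc, ← Finset.sum_add_distrib]
      congr 1
      · refine Finset.sum_congr rfl fun j _ => ?_
        have : (m x : ℂ) ≠ 0 := ofReal_ne_zero.2 (hm0 x).ne'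
        change _ = g j x / (m x : ℂ) * _
        rw [div_mul_eq_mul_div, eq_div_iff this]
        push_cast
        ring
      · push_cast; ring
    · have ht := IsTest.mul_real hη hηc hηU ((contDiff_ofReal_comp hEC).mul hv)
      refine integrable_finsetSum _ fun j _ => ?_
      have := integrable_mul_of_hasCompactSupport (hloc (hg j))
        (v := fun x => (m x : ℂ)⁻¹ * wirt j (fun x => (η x : ℂ) *
          (((Real.exp (weight A r x) : ℝ) : ℂ) * v x)) x)
        ((cm.inv₀ fun x => ofReal_ne_zero.2 (hm0 x).ne').mul
          (continuous_wirt (ht.contDiff.of_le (by norm_num)) j))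
        (hasCompactSupport_wirt ht.compact j).mul_left
      simp only [hm, div_eq_mul_inv, mul_assoc] at this ⊢
      exact this
  set S : 𝔼 → ℝ := fun x => ∑ j, ‖g j x‖ ^ 2 with hS
  have hS0 : ∀ x, 0 ≤ S x := fun x => Finset.sum_nonneg fun j _ => by positivity
  have hSi : ∀ {b : 𝔼 → ℝ}, Continuous b → (∀ x ∉ K, b x = 0) →
      Integrable (fun x => b x * S x) := by
    intro b hb hb0
    simp only [hS, Finset.mul_sum]
    exact integrable_finsetSum _ fun j _ =>
      integrable_mul_norm_sq hb (HasCompactSupport.intro hηc hb0) (hg j)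
  have cr := hr.continuous
  have cDη : Continuous (fun x => ‖fderiv ℝ η x‖) := (hη.continuous_fderiv (by norm_num)).norm
  have i1 : Integrable (fun x => η x ^ 2 * S x) :=
    hSi (hη.continuous.pow 2) fun x hx => by simp [hKη x hx]
  have i2 : Integrable (fun x => ‖fderiv ℝ η x‖ ^ 2 * r x ^ 2 * S x) :=
    hSi ((cDη.pow 2).mul (cr.pow 2)) fun x hx => by simp [hKw x hx]
  have i3 : Integrable (fun x => η x ^ 2 * (r x ^ 2 * Real.exp (weight A r x) * ‖H₁ x‖ ^ 2)) :=
    ((hη.continuous.pow 2).mul (((cr.pow 2).mul hEC.continuous).mul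
      (hH₁.norm.pow 2))).integrable_of_hasCompactSupport
      (HasCompactSupport.intro hηc fun x hx => by simp [hKη x hx])
  have hφ1 : ∀ x, ‖Real.exp (-φ x)‖ ≤ 1 := fun x => by
    rw [Real.norm_eq_abs, abs_of_pos (Real.exp_pos _), Real.exp_le_one_iff, neg_nonpos]
    exact mul_nonneg hA (inv_nonneg.2 (hr0 x).le)
  have hL : ∑ j, ∫ x, A * ε * (r x)⁻¹ ^ 2 * ‖G j x‖ ^ 2 * Real.exp (-φ x) =
      A * ε * ∫ x, η x ^ 2 * S x := by
    have : ∀ j x, A * ε * (r x)⁻¹ ^ 2 * ‖G j x‖ ^ 2 * Real.exp (-φ x) =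
        A * ε * (η x ^ 2 * ‖g j x‖ ^ 2) := fun j x => by
      have h1 := hmφ x
      have h2 := (hr0 x).ne'
      have h3 : ‖G j x‖ ^ 2 = η x ^ 2 * Real.exp (weight A r x) * ‖g j x‖ ^ 2 := by
        simp only [hG, norm_mul, norm_real, Real.norm_eq_abs, mul_pow, sq_abs, ← hm2]
        ring
      calc _ = A * ε * (η x ^ 2 * ‖g j x‖ ^ 2) * ((r x)⁻¹ ^ 2 *
            (Real.exp (weight A r x) * Real.exp (-φ x))) := by rw [h3]; ring
        _ = _ := by rw [h1]; field_simp
    simp only [this, integral_const_mul, ← Finset.mul_sum]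
    rw [← integral_finsetSum]
    · simp only [hS, Finset.mul_sum]
    · exact fun j _ => integrable_mul_norm_sq (hη.continuous.pow 2)
        (HasCompactSupport.intro hηc fun x hx => by simp [hKη x hx]) (hg j)
  have hW' : ∑ j, ∑ k, ∫ x, ‖W j k x‖ ^ 2 * Real.exp (-φ x) ≤
      4 * n * ∫ x, ‖fderiv ℝ η x‖ ^ 2 * r x ^ 2 * S x := by
    have iW : ∀ j k, Integrable (fun x => ‖W j k x‖ ^ 2 * Real.exp (-φ x)) := fun j k => by
      have h1 : Integrable (fun x => ‖W j k x‖ ^ 2) := by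
        simpa using (hWL j k).integrable_norm_pow (p := 2) (by norm_num)
      exact h1.mul_bdd (c := 1) hφ.neg.exp.continuous.aestronglyMeasurable
        (Filter.Eventually.of_forall hφ1)
    have : ∑ j, ∑ k, ∫ x, ‖W j k x‖ ^ 2 * Real.exp (-φ x) =
        ∫ x, ∑ j, ∑ k, ‖W j k x‖ ^ 2 * Real.exp (-φ x) := by
      rw [integral_finsetSum _ fun j _ => integrable_finsetSum _ fun k _ => iW j k]
      exact Finset.sum_congr rfl fun j _ => (integral_finsetSum _ fun k _ => iW j k).symm
    rw [this, ← integral_const_mul]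
    refine integral_mono (integrable_finsetSum _ fun j _ => integrable_finsetSum _ fun k _ => iW j k)
      (i2.const_mul _) fun x => ?_
    have h4 := sum_norm_wirt_sq_le (hηd x)
    have h5 : ∀ j, ‖wirtBar j (fun x => (η x : ℂ)) x‖ = ‖wirt j (fun x => (η x : ℂ)) x‖ :=
      fun j => by rw [wirtBar_ofReal (hηd x), RCLike.norm_conj]
    have h6 : ∀ j k, ‖W j k x‖ ^ 2 * Real.exp (-φ x) ≤
        2 * r x ^ 2 * (‖wirt k (fun x => (η x : ℂ)) x‖ ^ 2 * ‖g j x‖ ^ 2 +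
          ‖wirt j (fun x => (η x : ℂ)) x‖ ^ 2 * ‖g k x‖ ^ 2) := fun j k => by
      have h7 := norm_sub_sq_le_two (wirtBar k (fun x => (η x : ℂ)) x * g j x)
        (wirtBar j (fun x => (η x : ℂ)) x * g k x)
      have h8 : ‖W j k x‖ ^ 2 = Real.exp (weight A r x) *
          ‖wirtBar k (fun x => (η x : ℂ)) x * g j x - wirtBar j (fun x => (η x : ℂ)) x * g k x‖ ^ 2
          := by
        have : W j k x = (m x : ℂ) * (wirtBar k (fun x => (η x : ℂ)) x * g j x -
          wirtBar j (fun x => (η x : ℂ)) x * g k x) := by simp only [hW]; ring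
        rw [this, norm_mul, mul_pow, norm_real, Real.norm_eq_abs, sq_abs, sq, hm2]
      rw [h8, mul_right_comm, hmφ]
      simp only [norm_mul, mul_pow, h5] at h7
      nlinarith [mul_le_mul_of_nonneg_left h7 (sq_nonneg (r x))]
    calc _ ≤ _ := Finset.sum_le_sum fun j _ => Finset.sum_le_sum fun k _ => h6 j k
      _ = 4 * r x ^ 2 * ((∑ j, ‖wirt j (fun x => (η x : ℂ)) x‖ ^ 2) * S x) := by
        simp only [← Finset.mul_sum, Finset.sum_add_distrib, ← Finset.sum_mul, hS]
        ring
      _ ≤ 4 * r x ^ 2 * ((n * ‖fderiv ℝ η x‖ ^ 2) * S x) := by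
        have := hS0 x
        gcongr
      _ = _ := by ring
  have hH' : (∫ x, ‖H x - ∑ j, wirt j (fun y => (φ y : ℂ)) x * G j x‖ ^ 2 * Real.exp (-φ x)) ≤
      3 * n * (∫ x, ‖fderiv ℝ η x‖ ^ 2 * r x ^ 2 * S x) +
      12 * n * M ^ 2 * (∫ x, η x ^ 2 * S x) +
      3 * ∫ x, η x ^ 2 * (r x ^ 2 * Real.exp (weight A r x) * ‖H₁ x‖ ^ 2) := by
    rw [← integral_const_mul, ← integral_const_mul, ← integral_const_mul,
      ← integral_add (i2.const_mul _) (i1.const_mul _),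
      ← integral_add ((i2.const_mul _).fun_add (i1.const_mul _)) (i3.const_mul _)]
    refine integral_mono_of_nonneg (Filter.Eventually.of_forall fun x => by positivity)
      (((i2.const_mul _).fun_add (i1.const_mul _)).fun_add (i3.const_mul _))
      (Filter.Eventually.of_forall fun x => ?_)
    have h1 : H x - ∑ j, wirt j (fun y => (φ y : ℂ)) x * G j x =
        m x * ((∑ j, wirt j (fun x => (η x : ℂ)) x * g j x) +
        (2 * η x / r x : ℝ) * (∑ j, wirt j (fun x => (r x : ℂ)) x * g j x) +
        η x * m x * H₁ x) := by
      simp only [hH, hG, wirt_weight hr hr0, hφdef, wirt_inv hr hr0, ← hm2, Finset.mul_sum,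
        mul_add]
      rw [add_sub_right_comm, ← Finset.sum_sub_distrib, ← Finset.sum_add_distrib]
      congr 1
      · refine Finset.sum_congr rfl fun j _ => ?_
        push_cast
        ring
      · push_cast; ring
    have h2 : ‖H x - ∑ j, wirt j (fun y => (φ y : ℂ)) x * G j x‖ ^ 2 * Real.exp (-φ x) =
        r x ^ 2 * ‖(∑ j, wirt j (fun x => (η x : ℂ)) x * g j x) +
        (2 * η x / r x : ℝ) * (∑ j, wirt j (fun x => (r x : ℂ)) x * g j x) +
        η x * m x * H₁ x‖ ^ 2 := by
      rw [h1, norm_mul, mul_pow, norm_real, Real.norm_eq_abs, sq_abs, sq (m x), hm2,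
        mul_right_comm, hmφ]
    have h3 := norm_add_three_sq_le (∑ j, wirt j (fun x => (η x : ℂ)) x * g j x)
      ((2 * η x / r x : ℝ) * (∑ j, wirt j (fun x => (r x : ℂ)) x * g j x)) (η x * m x * H₁ x)
    have h4 : ‖∑ j, wirt j (fun x => (η x : ℂ)) x * g j x‖ ^ 2 ≤ n * ‖fderiv ℝ η x‖ ^ 2 * S x :=
      (norm_sum_mul_sq_le _ _ _).trans
        (mul_le_mul_of_nonneg_right (sum_norm_wirt_sq_le (hηd x)) (hS0 x))
    have h5 : η x ^ 2 * ‖∑ j, wirt j (fun x => (r x : ℂ)) x * g j x‖ ^ 2 ≤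
        η x ^ 2 * (n * M ^ 2 * S x) := by
      by_cases hx : x ∈ U
      · refine mul_le_mul_of_nonneg_left ((norm_sum_mul_sq_le _ _ _).trans
          (mul_le_mul_of_nonneg_right ((sum_norm_wirt_sq_le
            (hr.differentiable (by norm_num) x)).trans ?_) (hS0 x))) (sq_nonneg _)
        have := hM x hx
        gcongr
      · simp [hKη x fun h => hx (hηU h)]
    have h6 : ‖((2 * η x / r x : ℝ) : ℂ) * (∑ j, wirt j (fun x => (r x : ℂ)) x * g j x)‖ ^ 2 =
        4 * (r x ^ 2)⁻¹ * (η x ^ 2 * ‖∑ j, wirt j (fun x => (r x : ℂ)) x * g j x‖ ^ 2) := by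
      rw [norm_mul, mul_pow, norm_real, Real.norm_eq_abs, sq_abs]
      ring
    have h7 : ‖(η x : ℂ) * m x * H₁ x‖ ^ 2 = η x ^ 2 * (Real.exp (weight A r x) * ‖H₁ x‖ ^ 2) := by
      rw [norm_mul, norm_mul, mul_pow, mul_pow, norm_real, norm_real, Real.norm_eq_abs, sq_abs,
        Real.norm_eq_abs, sq_abs, sq (m x), hm2]
      ring
    beta_reduce
    rw [h2]
    have hr2 : 0 < r x ^ 2 := pow_pos (hr0 x) 2
    rw [h6, h7] at h3
    have h8 := mul_le_mul_of_nonneg_left h3 hr2.le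
    have h9 := mul_le_mul_of_nonneg_left h4 hr2.le
    have h10 : r x ^ 2 * (4 * (r x ^ 2)⁻¹ *
        (η x ^ 2 * ‖∑ j, wirt j (fun x => (r x : ℂ)) x * g j x‖ ^ 2)) =
        4 * (η x ^ 2 * ‖∑ j, wirt j (fun x => (r x : ℂ)) x * g j x‖ ^ 2) := by
      have : r x ^ 2 * (4 * (r x ^ 2)⁻¹) = 4 := by
        rw [mul_left_comm, mul_inv_cancel₀ hr2.ne', mul_one]
      rw [← mul_assoc, this]
    linarith
  rw [hL] at hbasic
  linarith

end Local

section Global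

variable {n : ℕ}

local notation "𝔼" => EuclideanSpace ℂ (Fin n)

/-- A cutoff supported in the superlevel set `{t r ≥ 1}` and equal to one on `{t r ≥ 2}`. -/
noncomputable def levelCut (D : Set 𝔼) (r : 𝔼 → ℝ) (t : ℝ) : 𝔼 → ℝ :=
  D.indicator fun x => Real.smoothTransition (t * r x - 1)

/-- A strictly plurisuperharmonic defining function of a bounded open set. -/
structure IsDefining (D : Set 𝔼) (r : 𝔼 → ℝ) (ε M : ℝ) : Prop where
  isOpen : IsOpen D
  contDiff : ContDiff ℝ 2 r
  pos : ∀ x ∈ D, 0 < r x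
  compact : ∀ c > 0, IsCompact {x | x ∈ D ∧ c ≤ r x}
  eps_pos : 0 < ε
  levi : ∀ x ∈ D, ∀ w, leviForm r x w ≤ -ε * ‖w‖ ^ 2
  fderiv_le : ∀ x ∈ D, ‖fderiv ℝ r x‖ ≤ M

variable {D : Set (EuclideanSpace ℂ (Fin n))} {r : EuclideanSpace ℂ (Fin n) → ℝ} {ε M t : ℝ}

lemma levelCut_of_mem {x : 𝔼} (hx : x ∈ D) :
    levelCut D r t x = Real.smoothTransition (t * r x - 1) := by
  simp [levelCut, hx]

lemma levelCut_nonneg (x : 𝔼) : 0 ≤ levelCut D r t x :=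
  indicator_nonneg (fun _ _ => Real.smoothTransition.nonneg _) x

lemma levelCut_le_one (x : 𝔼) : levelCut D r t x ≤ 1 :=
  indicator_le' (fun _ _ => Real.smoothTransition.le_one _) (fun _ _ => zero_le_one) x

lemma levelCut_eq_zero {x : 𝔼} (ht : 0 < t) (hx : x ∉ {x | x ∈ D ∧ t⁻¹ ≤ r x}) :
    levelCut D r t x = 0 := by
  by_cases hxD : x ∈ D
  · rw [levelCut_of_mem hxD]
    refine Real.smoothTransition.zero_of_nonpos ?_
    have : r x < t⁻¹ := by by_contra! h; exact hx ⟨hxD, h⟩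
    have := mul_lt_mul_of_pos_left this ht
    rw [mul_inv_cancel₀ ht.ne'] at this
    linarith
  · simp [levelCut, hxD]

lemma levelCut_eq_one {x : 𝔼} (hxD : x ∈ D) (hx : 2 ≤ t * r x) : levelCut D r t x = 1 := by
  rw [levelCut_of_mem hxD]
  exact Real.smoothTransition.one_of_one_le (by linarith)

lemma contDiff_of_contDiffAt_tsupport {E F : Type*} [NormedAddCommGroup E] [NormedSpace ℝ E]
    [NormedAddCommGroup F] [NormedSpace ℝ F] {m : WithTop ℕ∞} {f : E → F}
    (hf : ∀ x ∈ tsupport f, ContDiffAt ℝ m f x) : ContDiff ℝ m f := by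
  refine contDiff_iff_contDiffAt.2 fun x => ?_
  by_cases hx : x ∈ tsupport f
  · exact hf x hx
  · exact contDiffAt_const.congr_of_eventuallyEq (notMem_tsupport_iff_eventuallyEq.1 hx)

namespace IsDefining

lemma hasCompactSupport_levelCut (h : IsDefining D r ε M) (ht : 0 < t) :
    HasCompactSupport (levelCut D r t) :=
  HasCompactSupport.intro (h.compact _ (inv_pos.2 ht)) fun _ hx => levelCut_eq_zero ht hx

lemma tsupport_levelCut (h : IsDefining D r ε M) (ht : 0 < t) :
    tsupport (levelCut D r t) ⊆ {x | x ∈ D ∧ t⁻¹ ≤ r x} :=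
  closure_minimal (fun x hx => by
    by_contra hx'
    exact hx (levelCut_eq_zero ht hx')) (h.compact _ (inv_pos.2 ht)).isClosed

lemma levelCut_eventuallyEq (h : IsDefining D r ε M) {x : 𝔼} (hx : x ∈ D) :
    levelCut D r t =ᶠ[nhds x] fun x => Real.smoothTransition (t * r x - 1) := by
  filter_upwards [h.isOpen.mem_nhds hx] with y hy using levelCut_of_mem hy

lemma contDiff_levelCut (h : IsDefining D r ε M) (ht : 0 < t) : ContDiff ℝ 2 (levelCut D r t) := by
  refine contDiff_of_contDiffAt_tsupport fun x hx => ?_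
  have hxD := (h.tsupport_levelCut ht hx).1
  refine ContDiffAt.congr_of_eventuallyEq ?_ (h.levelCut_eventuallyEq hxD)
  exact (Real.smoothTransition.contDiff.comp
    ((contDiff_const.mul h.contDiff).sub contDiff_const)).contDiffAt

lemma exists_fderiv_levelCut_le (h : IsDefining D r ε M) : ∃ C : ℝ, ∀ t > 0, ∀ x ∈ D,
    ‖fderiv ℝ (levelCut D r t) x‖ ^ 2 * r x ^ 2 ≤ C ∧
      (2 < t * r x → fderiv ℝ (levelCut D r t) x = 0) := by
  have hc : Continuous (deriv Real.smoothTransition) :=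
    (Real.smoothTransition.contDiff (n := 1)).continuous_deriv le_rfl
  obtain ⟨C, hC⟩ := (isCompact_Icc (a := (0 : ℝ)) (b := 1)).exists_bound_of_continuousOn
    hc.continuousOn
  refine ⟨(C * (2 * M)) ^ 2, fun t ht x hx => ?_⟩
  have hd : HasFDerivAt (levelCut D r t)
      (deriv Real.smoothTransition (t * r x - 1) • (t • fderiv ℝ r x)) x := by
    refine HasFDerivAt.congr_of_eventuallyEq ?_ (h.levelCut_eventuallyEq hx)
    have h1 : HasFDerivAt (fun x => t * r x - 1) (t • fderiv ℝ r x) x :=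
      ((h.contDiff.differentiable (by norm_num) x).hasFDerivAt.const_mul t).sub_const 1
    exact ((Real.smoothTransition.contDiff (n := 1)).differentiable (by norm_num)
      _).hasDerivAt.comp_hasFDerivAt x h1
  have hzero : 2 < t * r x → fderiv ℝ (levelCut D r t) x = 0 := fun h2 => by
    have : levelCut D r t =ᶠ[nhds x] fun _ => 1 := by
      filter_upwards [h.isOpen.mem_nhds hx, (continuous_const.mul h.contDiff.continuous).continuousAt
        (lt_mem_nhds h2)] with y hy h2y using levelCut_eq_one hy (le_of_lt h2y)
    rw [this.fderiv_eq]; simp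
  have hzero' : t * r x < 1 → fderiv ℝ (levelCut D r t) x = 0 := fun h2 => by
    have : levelCut D r t =ᶠ[nhds x] fun _ => 0 := by
      filter_upwards [h.isOpen.mem_nhds hx, (continuous_const.mul h.contDiff.continuous).continuousAt
        (gt_mem_nhds h2)] with y hy h2y
      have h3 : t * r y < 1 := h2y
      rw [levelCut_of_mem hy]
      exact Real.smoothTransition.zero_of_nonpos (by linarith)
    rw [this.fderiv_eq]; simp
  refine ⟨?_, hzero⟩
  by_cases h2 : 2 < t * r x
  · rw [hzero h2]; simp; positivity
  by_cases h3 : t * r x < 1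
  · rw [hzero' h3]; simp; positivity
  push Not at h2 h3
  rw [← mul_pow]
  have hr := h.pos x hx
  refine pow_le_pow_left₀ (by positivity) ?_ 2
  have hC' := hC (t * r x - 1) ⟨by linarith, by linarith⟩
  rw [hd.fderiv, norm_smul, norm_smul, Real.norm_eq_abs t, abs_of_pos ht]
  have hM := h.fderiv_le x hx
  have hM0 : 0 ≤ M := (norm_nonneg _).trans hM
  calc _ = ‖deriv Real.smoothTransition (t * r x - 1)‖ * ((t * r x) * ‖fderiv ℝ r x‖) := by ring
    _ ≤ _ := by
      refine mul_le_mul hC' (mul_le_mul h2 hM (norm_nonneg _) zero_le_two) (by positivity)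
        ((norm_nonneg _).trans hC')

end IsDefining

lemma IsTest.mono {U D : Set 𝔼} {v : 𝔼 → ℂ} (h : IsTest U v) (hU : U ⊆ D) : IsTest D v :=
  ⟨h.contDiff, h.compact, h.subset.trans hU⟩

lemma wirt_eq_zero_of_notMem_tsupport {v : 𝔼 → ℂ} {x : 𝔼} (hx : x ∉ tsupport v) (j : Fin n) :
    wirt j v x = 0 := by
  have : fderiv ℝ v x = 0 :=
    image_eq_zero_of_notMem_tsupport fun h => hx (tsupport_fderiv_subset ℝ h)
  simp [wirt, this]

lemma wirtBar_eq_zero_of_notMem_tsupport {v : 𝔼 → ℂ} {x : 𝔼} (hx : x ∉ tsupport v) (j : Fin n) :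
    wirtBar j v x = 0 := by
  have : fderiv ℝ v x = 0 :=
    image_eq_zero_of_notMem_tsupport fun h => hx (tsupport_fderiv_subset ℝ h)
  simp [wirtBar, this]

lemma levelCut_estimate {A : ℝ} (hA : 0 ≤ A) (h : IsDefining D r ε M)
    {g : Fin n → 𝔼 → ℂ} (hgm : ∀ j, Measurable (g j)) (hg : ∀ j, MemLp (g j) 2)
    {H₁ : 𝔼 → ℂ} (hH₁ : Continuous H₁)
    (hcl : ∀ j k v, IsTest D v → ∫ x, (Real.exp (weight A r x / 2) : ℂ) *
      (g j x * wirtBar k v x - g k x * wirtBar j v x) = 0)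
    (hadj : ∀ v, IsTest D v → ∫ x, ∑ j, g j x / (Real.exp (weight A r x / 2) : ℂ) * wirt j v x =
      -∫ x, H₁ x * v x) {t : ℝ} (ht : 0 < t) :
    (A * ε - 12 * n * M ^ 2) * ∫ x, levelCut D r t x ^ 2 * ∑ j, ‖g j x‖ ^ 2 ≤
      5 * n * (∫ x, ‖fderiv ℝ (levelCut D r t) x‖ ^ 2 * r x ^ 2 * ∑ j, ‖g j x‖ ^ 2) +
      3 * ∫ x, levelCut D r t x ^ 2 * (r x ^ 2 * Real.exp (weight A r x) * ‖H₁ x‖ ^ 2) := by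
  have ht3 : 0 < 3 * t := by positivity
  set χ := levelCut D r (3 * t) with hχ
  have hχC : ContDiff ℝ 2 χ := h.contDiff_levelCut ht3
  set r' : 𝔼 → ℝ := fun x => χ x * r x + (1 - χ x) with hr'
  have hr'C : ContDiff ℝ 2 r' := (hχC.mul h.contDiff).add (contDiff_const.sub hχC)
  have hr'0 : ∀ x, 0 < r' x := fun x => by
    have h0 : 0 ≤ χ x := levelCut_nonneg x
    have h1 : χ x ≤ 1 := levelCut_le_one x
    by_cases hx : x ∈ D
    · have := h.pos x hx
      rcases h1.lt_or_eq with h1 | h1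
      · have : 0 < 1 - χ x := by linarith
        positivity
      · simp only [hr', h1]; linarith
    · have : χ x = 0 := by simp [hχ, levelCut, hx]
      simp [hr', this]
  set U : Set 𝔼 := D ∩ {x | 2 < 3 * t * r x} with hU
  have hUo : IsOpen U :=
    h.isOpen.inter (isOpen_lt continuous_const (continuous_const.mul h.contDiff.continuous))
  have hUr : ∀ x ∈ U, r' x = r x := fun x hx => by
    have : χ x = 1 := levelCut_eq_one hx.1 (le_of_lt hx.2)
    simp [hr', this]
  have hUr' : ∀ x ∈ U, r' =ᶠ[nhds x] r := fun x hx => by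
    filter_upwards [hUo.mem_nhds hx] with y hy using hUr y hy
  have hUw : ∀ x ∈ U, weight A r' x = weight A r x := fun x hx => by
    simp only [weight, hUr x hx]
  have hsU : tsupport (levelCut D r t) ⊆ U := fun x hx => by
    have := h.tsupport_levelCut ht hx
    refine ⟨this.1, ?_⟩
    have h2 := mul_le_mul_of_nonneg_left this.2 ht.le
    rw [mul_inv_cancel₀ ht.ne'] at h2
    change 2 < 3 * t * r x
    linarith
  have hloc := local_estimate hA h.eps_pos.le hr'C hr'0 hUo (M := M) (ε := ε)
    (fun x hx w => by rw [leviForm_congr (hUr' x hx)]; exact h.levi x hx.1 w)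
    (fun x hx => by rw [(hUr' x hx).fderiv_eq]; exact h.fderiv_le x hx.1) hgm hg
    (h.contDiff_levelCut ht) (h.hasCompactSupport_levelCut ht) hsU hH₁
    (fun j k v hv => by
      rw [← hcl j k v (hv.mono inter_subset_left)]
      refine integral_congr_ae (Filter.Eventually.of_forall fun x => ?_)
      by_cases hx : x ∈ tsupport v
      · simp only [hUw x (hv.subset hx)]
      · simp [wirtBar_eq_zero_of_notMem_tsupport hx])
    (fun v hv => by
      rw [← hadj v (hv.mono inter_subset_left)]
      refine integral_congr_ae (Filter.Eventually.of_forall fun x => ?_)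
      by_cases hx : x ∈ tsupport v
      · simp only [hUw x (hv.subset hx)]
      · simp [wirt_eq_zero_of_notMem_tsupport hx])
  convert hloc using 4
  · refine funext fun x => ?_
    by_cases hx : x ∈ U
    · rw [hUr x hx]
    · have : fderiv ℝ (levelCut D r t) x = 0 := image_eq_zero_of_notMem_tsupport fun h' =>
        hx (hsU (tsupport_fderiv_subset ℝ h'))
      simp [this]
  · refine funext fun x => ?_
    by_cases hx : x ∈ U
    · rw [hUr x hx, hUw x hx]
    · have : levelCut D r t x = 0 := image_eq_zero_of_notMem_tsupport fun h' => hx (hsU h')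
      simp [this]

theorem global_estimate {A : ℝ} (hA : 0 ≤ A) (h : IsDefining D r ε M)
    {g : Fin n → 𝔼 → ℂ} (hgm : ∀ j, Measurable (g j)) (hg : ∀ j, MemLp (g j) 2)
    {H₁ : 𝔼 → ℂ} (hH₁ : Continuous H₁)
    (hH₁i : Integrable (fun x => r x ^ 2 * Real.exp (weight A r x) * ‖H₁ x‖ ^ 2))
    (hcl : ∀ j k v, IsTest D v → ∫ x, (Real.exp (weight A r x / 2) : ℂ) *
      (g j x * wirtBar k v x - g k x * wirtBar j v x) = 0)
    (hadj : ∀ v, IsTest D v → ∫ x, ∑ j, g j x / (Real.exp (weight A r x / 2) : ℂ) * wirt j v x =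
      -∫ x, H₁ x * v x) :
    (A * ε - 12 * n * M ^ 2) * ∫ x in D, ∑ j, ‖g j x‖ ^ 2 ≤
      3 * ∫ x, (r x ^ 2 * Real.exp (weight A r x) * ‖H₁ x‖ ^ 2) := by
  set S : 𝔼 → ℝ := fun x => ∑ j, ‖g j x‖ ^ 2 with hS
  have hS0 : ∀ x, 0 ≤ S x := fun x => Finset.sum_nonneg fun j _ => by positivity
  have hSm : Measurable S := Finset.measurable_fun_sum _ fun j _ => (hgm j).norm.pow_const 2
  have hSi : Integrable S := integrable_finsetSum _ fun j _ => by
    simpa using (hg j).integrable_norm_pow (p := 2) (by norm_num)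
  obtain ⟨C, hC⟩ := h.exists_fderiv_levelCut_le
  have hC0 : ∀ x ∈ D, 0 ≤ C := fun x hx => le_trans (by positivity) (hC 1 one_pos x hx).1
  have hpos : ∀ ν : ℕ, (0 : ℝ) < ν + 1 := fun ν => by positivity
  have hlarge : ∀ x ∈ D, ∀ᶠ ν : ℕ in Filter.atTop, 2 < ((ν : ℝ) + 1) * r x := fun x hx => by
    have : Filter.Tendsto (fun ν : ℕ => ((ν : ℝ) + 1) * r x) Filter.atTop Filter.atTop :=
      (Filter.tendsto_atTop_add_const_right _ _ tendsto_natCast_atTop_atTop).atTop_mul_const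
        (h.pos x hx)
    exact this.eventually_gt_atTop 2
  have h1 : Filter.Tendsto (fun ν : ℕ => ∫ x, levelCut D r (ν + 1) x ^ 2 * S x) Filter.atTop
      (nhds (∫ x in D, S x)) := by
    rw [← integral_indicator h.isOpen.measurableSet]
    refine tendsto_integral_of_dominated_convergence S (fun ν => ?_) hSi (fun ν => ?_) ?_
    · exact ((h.contDiff_levelCut (hpos ν)).continuous.measurable.pow_const 2 |>.mul
        hSm).aestronglyMeasurable
    · refine Filter.Eventually.of_forall fun x => ?_
      rw [norm_mul, Real.norm_of_nonneg (hS0 x), norm_pow, Real.norm_of_nonneg (levelCut_nonneg x)]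
      exact mul_le_of_le_one_left (hS0 x) (pow_le_one₀ (levelCut_nonneg x) (levelCut_le_one x))
    · refine Filter.Eventually.of_forall fun x => ?_
      refine tendsto_const_nhds.congr' ?_
      by_cases hx : x ∈ D
      · filter_upwards [hlarge x hx] with ν hν
        simp [hx, levelCut_eq_one hx hν.le]
      · simp [levelCut, hx]
  have h2 : Filter.Tendsto (fun ν : ℕ => ∫ x, ‖fderiv ℝ (levelCut D r (ν + 1)) x‖ ^ 2 * r x ^ 2 *
      S x) Filter.atTop (nhds 0) := by
    rw [← integral_zero 𝔼 ℝ (μ := volume)]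
    have hz : ∀ (ν : ℕ), ∀ x ∉ D, fderiv ℝ (levelCut D r (ν + 1)) x = 0 := fun ν x hx =>
      image_eq_zero_of_notMem_tsupport fun h' =>
        hx (h.tsupport_levelCut (hpos ν) (tsupport_fderiv_subset ℝ h')).1
    refine tendsto_integral_of_dominated_convergence (fun x => |C| * S x) (fun ν => ?_)
      (hSi.const_mul _) (fun ν => ?_) ?_
    · exact (((((h.contDiff_levelCut (hpos ν)).continuous_fderiv (by norm_num)).norm.pow 2).mul
        (h.contDiff.continuous.pow 2)).measurable.mul hSm).aestronglyMeasurable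
    · refine Filter.Eventually.of_forall fun x => ?_
      rw [norm_mul, Real.norm_of_nonneg (hS0 x), Real.norm_of_nonneg (by positivity)]
      refine mul_le_mul_of_nonneg_right ?_ (hS0 x)
      by_cases hx : x ∈ D
      · exact (hC _ (hpos ν) x hx).1.trans (le_abs_self _)
      · simp [hz ν x hx]
    · refine Filter.Eventually.of_forall fun x => ?_
      refine tendsto_const_nhds.congr' ?_
      by_cases hx : x ∈ D
      · filter_upwards [hlarge x hx] with ν hν
        simp [(hC _ (hpos ν) x hx).2 hν]
      · simp [hz _ x hx]
  have h3 : ∀ ν : ℕ, ∫ x, levelCut D r (ν + 1) x ^ 2 *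
      (r x ^ 2 * Real.exp (weight A r x) * ‖H₁ x‖ ^ 2) ≤
      ∫ x, (r x ^ 2 * Real.exp (weight A r x) * ‖H₁ x‖ ^ 2) := fun ν => by
    refine integral_mono_of_nonneg (Filter.Eventually.of_forall fun x => ?_) hH₁i
      (Filter.Eventually.of_forall fun x => ?_)
    · have := levelCut_nonneg (D := D) (r := r) (t := ν + 1) x
      change 0 ≤ levelCut D r (ν + 1) x ^ 2 * _
      positivity
    · exact mul_le_of_le_one_left (by positivity)
        (pow_le_one₀ (levelCut_nonneg x) (levelCut_le_one x))
  have h4 := (h2.const_mul (5 * (n : ℝ))).add_const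
    (3 * ∫ x, (r x ^ 2 * Real.exp (weight A r x) * ‖H₁ x‖ ^ 2))
  rw [mul_zero, zero_add] at h4
  refine le_of_tendsto_of_tendsto' (h1.const_mul (A * ε - 12 * n * M ^ 2)) h4 fun ν => ?_
  have h5 := levelCut_estimate hA h hgm hg hH₁ hcl hadj (hpos ν)
  linarith [h3 ν]

end Global

/-- Representation of a linear functional dominated by a linear map into a Hilbert space. -/
lemma exists_inner_eq_of_norm_le {X H : Type*} [AddCommGroup X] [Module ℂ X]
    [NormedAddCommGroup H] [InnerProductSpace ℂ H] [CompleteSpace H] (T : X →ₗ[ℂ] H)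
    (l : X →ₗ[ℂ] ℂ) (C : ℝ) (h : ∀ x, ‖l x‖ ≤ C * ‖T x‖) : ∃ u : H, ∀ x, l x = inner ℂ u (T x) := by
  obtain ⟨s, hs⟩ := T.rangeRestrict.exists_rightInverse_of_surjective T.range_rangeRestrict
  have hs' : ∀ y : T.range, T (s y) = y := fun y => congrArg Subtype.val (LinearMap.congr_fun hs y)
  let f : StrongDual ℂ T.range := (l.comp s).mkContinuous C fun y => by
    have := h (s y)
    rw [hs' y] at this
    exact this
  obtain ⟨g, hg, -⟩ := exists_extension_norm_eq T.range f
  refine ⟨(InnerProductSpace.toDual ℂ H).symm g, fun x => ?_⟩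
  rw [InnerProductSpace.toDual_symm_apply]
  have h1 := hg ⟨T x, x, rfl⟩
  have h2 : f ⟨T x, x, rfl⟩ = l (s ⟨T x, x, rfl⟩) := rfl
  have h3 := h (x - s ⟨T x, x, rfl⟩)
  rw [map_sub T, hs', sub_self, norm_zero, mul_zero, norm_le_zero_iff, map_sub, sub_eq_zero] at h3
  rw [h3, ← h2, ← h1]

section Solve

variable {n : ℕ}

local notation "𝔼" => EuclideanSpace ℂ (Fin n)

lemma wirtBar_wirtBar_comm {f : 𝔼 → ℂ} (hf : ContDiff ℝ 2 f) (x : 𝔼) (j k : Fin n) :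
    wirtBar k (wirtBar j f) x = wirtBar j (wirtBar k f) x := by
  rw [wirtBar, wirtBar, fderiv_wirtBar hf, fderiv_wirtBar hf, fderiv_wirtBar hf, fderiv_wirtBar hf,
    fderiv_fderiv_comm hf x (stdVec k), fderiv_fderiv_comm hf x (stdVec k),
    fderiv_fderiv_comm hf x (I • stdVec k), fderiv_fderiv_comm hf x (I • stdVec k)]
  ring

variable {D : Set (EuclideanSpace ℂ (Fin n))}

lemma IsTest.zero : IsTest D (0 : 𝔼 → ℂ) :=
  ⟨contDiff_const, HasCompactSupport.zero, by simp [tsupport]⟩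

lemma IsTest.add {v w : 𝔼 → ℂ} (hv : IsTest D v) (hw : IsTest D w) : IsTest D (v + w) :=
  ⟨hv.contDiff.add hw.contDiff, hv.compact.add hw.compact,
    (tsupport_add v w).trans (union_subset hv.subset hw.subset)⟩

lemma IsTest.smul {v : 𝔼 → ℂ} (hv : IsTest D v) (c : ℂ) : IsTest D (c • v) :=
  ⟨contDiff_const.smul hv.contDiff, hv.compact.smul_left (f := fun _ => c),
    (tsupport_smul_subset_right (fun _ => c) v).trans hv.subset⟩

lemma IsTest.conj {v : 𝔼 → ℂ} (hv : IsTest D v) : IsTest D (fun x => (starRingEnd ℂ) (v x)) := by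
  have h : tsupport (fun x => (starRingEnd ℂ) (v x)) ⊆ tsupport v := closure_mono fun x hx => by
    simpa using hx
  exact ⟨conjCLE.contDiff.comp hv.contDiff,
    hv.compact.of_isClosed_subset (isClosed_tsupport _) h, h.trans hv.subset⟩

lemma contDiff_mul_test {a v : 𝔼 → ℂ} (hD : IsOpen D) (ha : ContDiffOn ℝ 1 a D) (hv : IsTest D v) :
    ContDiff ℝ 1 (fun x => a x * v x) := by
  refine contDiff_of_contDiffAt_tsupport fun x hx => ?_
  have hx' : x ∈ D := hv.subset (tsupport_mul_subset_right hx)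
  exact (ha.contDiffAt (hD.mem_nhds hx')).mul (hv.contDiff.of_le (by norm_num)).contDiffAt

lemma integral_wirtBar_mul_test {a v : 𝔼 → ℂ} (hD : IsOpen D) (ha : ContDiffOn ℝ 1 a D)
    (hv : IsTest D v) (j : Fin n) : ∫ x, wirtBar j (fun x => a x * v x) x = 0 :=
  integral_wirtBar_eq_zero (contDiff_mul_test hD ha hv)
    (HasCompactSupport.intro hv.compact fun x hx => by
      simp [image_eq_zero_of_notMem_tsupport hx]) j

lemma integrable_mul_test {a v : 𝔼 → ℂ} (hD : IsOpen D) (ha : ContinuousOn a D)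
    (hv : Continuous v) (hvc : HasCompactSupport v) (hvD : tsupport v ⊆ D) :
    Continuous (fun x => a x * v x) ∧ HasCompactSupport (fun x => a x * v x) := by
  refine ⟨continuous_of_tsupport fun x hx => ?_, HasCompactSupport.intro hvc fun x hx => by
      simp [image_eq_zero_of_notMem_tsupport hx]⟩
  exact (ha.continuousAt (hD.mem_nhds (hvD (tsupport_mul_subset_right hx)))).mul hv.continuousAt

lemma tsupport_wirtBar_subset {v : 𝔼 → ℂ} (j : Fin n) : tsupport (wirtBar j v) ⊆ tsupport v :=
  closure_minimal (fun x hx => by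
    by_contra h
    exact hx (wirtBar_eq_zero_of_notMem_tsupport h j)) (isClosed_tsupport _)

lemma integral_mul_wirtBar_test {a v : 𝔼 → ℂ} (hD : IsOpen D) (ha : ContDiffOn ℝ 1 a D)
    (hv : IsTest D v) (j : Fin n) :
    ∫ x, a x * wirtBar j v x = -∫ x, wirtBar j a x * v x := by
  have h1 := integral_wirtBar_mul_test hD ha hv j
  have hc : ContinuousOn (wirtBar j a) D := by
    have := ha.continuousOn_fderiv_of_isOpen hD le_rfl
    exact continuousOn_const.mul ((this.clm_apply continuousOn_const).add
      (continuousOn_const.mul (this.clm_apply continuousOn_const)))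
  have i1 := integrable_mul_test hD ha.continuousOn (continuous_wirtBar
    (hv.contDiff.of_le (by norm_num)) j) (hasCompactSupport_wirtBar hv.compact j)
    ((tsupport_wirtBar_subset j).trans hv.subset)
  have i2 := integrable_mul_test hD hc hv.contDiff.continuous hv.compact hv.subset
  rw [eq_neg_iff_add_eq_zero, ← integral_add (i1.1.integrable_of_hasCompactSupport i1.2)
    (i2.1.integrable_of_hasCompactSupport i2.2), ← h1]
  refine integral_congr_ae (Filter.Eventually.of_forall fun x => ?_)
  by_cases hx : x ∈ tsupport v
  · beta_reduce
    rw [wirtBar_mul ((ha.contDiffAt (hD.mem_nhds (hv.subset hx))).differentiableAt (by norm_num))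
      (hv.contDiff.differentiable (by norm_num) x)]
    ring
  · have : x ∉ tsupport (fun x => a x * v x) := fun h => hx (tsupport_mul_subset_right h)
    simp [wirtBar_eq_zero_of_notMem_tsupport hx, wirtBar_eq_zero_of_notMem_tsupport this,
      image_eq_zero_of_notMem_tsupport hx]

/-- Compatible data are weakly closed. -/
lemma integral_compat {a b v : 𝔼 → ℂ} (hD : IsOpen D) (ha : ContDiffOn ℝ 1 a D)
    (hb : ContDiffOn ℝ 1 b D) (hv : IsTest D v) {j k : Fin n}
    (hab : ∀ x ∈ D, wirtBar k a x = wirtBar j b x) :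
    ∫ x, (a x * wirtBar k v x - b x * wirtBar j v x) = 0 := by
  have key : ∀ {a : 𝔼 → ℂ} (_ : ContDiffOn ℝ 1 a D) (k : Fin n),
      Integrable (fun x => a x * wirtBar k v x) := fun ha k => by
    have i1 := integrable_mul_test hD ha.continuousOn (continuous_wirtBar
      (hv.contDiff.of_le (by norm_num)) k) (hasCompactSupport_wirtBar hv.compact k)
      ((tsupport_wirtBar_subset k).trans hv.subset)
    exact i1.1.integrable_of_hasCompactSupport i1.2
  rw [integral_sub (key ha k) (key hb j), integral_mul_wirtBar_test hD ha hv,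
    integral_mul_wirtBar_test hD hb hv, sub_eq_zero]
  congr 2
  funext x
  by_cases hx : x ∈ tsupport v
  · rw [hab x (hv.subset hx)]
  · simp [image_eq_zero_of_notMem_tsupport hx]

end Solve

section Projection

variable {H : Type*} [NormedAddCommGroup H] [InnerProductSpace ℂ H] [CompleteSpace H]

lemma exists_mem_orthogonal_inner_eq (S : Submodule ℂ H) (f : H) :
    ∃ g ∈ Sᗮ, ∀ w ∈ Sᗮ, inner ℂ f w = inner ℂ g w := by
  haveI : CompleteSpace Sᗮ := S.isClosed_orthogonal.completeSpace_coe
  refine ⟨Sᗮ.starProjection f, Sᗮ.starProjection_apply_mem f, fun w hw => ?_⟩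
  have := Sᗮ.starProjection_inner_eq_zero f w hw
  rwa [inner_sub_left, sub_eq_zero] at this

end Projection

section Solve

variable {n : ℕ}

local notation "𝔼" => EuclideanSpace ℂ (Fin n)

/-- Tuples of square integrable functions as elements of a Hilbert space. -/
noncomputable def l2Tuple (F : Fin n → 𝔼 → ℂ) (hF : ∀ j, MemLp (F j) 2) :
    PiLp 2 (fun _ : Fin n => Lp ℂ 2 (volume : Measure 𝔼)) :=
  WithLp.toLp 2 fun j => (hF j).toLp (F j)

lemma inner_toLp {u v : 𝔼 → ℂ} (hu : MemLp u 2) (hv : MemLp v 2) :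
    inner ℂ (hu.toLp u) (hv.toLp v) = ∫ x, (starRingEnd ℂ) (u x) * v x := by
  rw [L2.inner_def]
  refine integral_congr_ae ?_
  filter_upwards [hu.coeFn_toLp, hv.coeFn_toLp] with x h1 h2
  rw [h1, h2, RCLike.inner_apply, mul_comm]

lemma inner_l2Tuple {F G : Fin n → 𝔼 → ℂ} (hF : ∀ j, MemLp (F j) 2) (hG : ∀ j, MemLp (G j) 2) :
    inner ℂ (l2Tuple F hF) (l2Tuple G hG) = ∑ j, ∫ x, (starRingEnd ℂ) (F j x) * G j x := by
  simp only [PiLp.inner_apply, l2Tuple, inner_toLp]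

lemma exists_eq_l2Tuple (f : PiLp 2 (fun _ : Fin n => Lp ℂ 2 (volume : Measure 𝔼))) :
    ∃ (F : Fin n → 𝔼 → ℂ) (hF : ∀ j, MemLp (F j) 2), (∀ j, Measurable (F j)) ∧
      f = l2Tuple F hF := by
  refine ⟨fun j => f j, fun j => Lp.memLp _, fun j => (Lp.stronglyMeasurable _).measurable, ?_⟩
  ext1 j
  simp [l2Tuple]

lemma norm_toLp_sq {u : 𝔼 → ℂ} (hu : MemLp u 2) : ‖hu.toLp u‖ ^ 2 = ∫ x, ‖u x‖ ^ 2 := by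
  have h : inner ℂ (hu.toLp u) (hu.toLp u) = ((∫ x, ‖u x‖ ^ 2 : ℝ) : ℂ) := by
    rw [inner_toLp]
    have : ∫ x, ((‖u x‖ ^ 2 : ℝ) : ℂ) = ((∫ x, ‖u x‖ ^ 2 : ℝ) : ℂ) := integral_ofReal
    rw [← this]
    refine integral_congr_ae (Filter.Eventually.of_forall fun x => ?_)
    beta_reduce
    rw [mul_comm, mul_conj, normSq_eq_norm_sq]
  have h1 : inner ℂ (hu.toLp u) (hu.toLp u) = ((‖hu.toLp u‖ ^ 2 : ℝ) : ℂ) := by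
    rw [inner_self_eq_norm_sq_to_K]; push_cast; rfl
  exact ofReal_injective (h1.symm.trans h)

lemma norm_l2Tuple_sq {F : Fin n → 𝔼 → ℂ} (hF : ∀ j, MemLp (F j) 2) :
    ‖l2Tuple F hF‖ ^ 2 = ∑ j, ∫ x, ‖F j x‖ ^ 2 := by
  rw [PiLp.norm_sq_eq_of_L2]
  simp only [l2Tuple, norm_toLp_sq]

variable {D : Set (EuclideanSpace ℂ (Fin n))} {r : EuclideanSpace ℂ (Fin n) → ℝ} {ε M : ℝ}

/-- The vectors orthogonal to the weakly closed forms. -/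
noncomputable def closedTest (m : 𝔼 → ℝ) (j k : Fin n) (v : 𝔼 → ℂ) : Fin n → 𝔼 → ℂ := fun i x =>
  (if i = j then (starRingEnd ℂ) (m x * wirtBar k v x) else 0) -
    (if i = k then (starRingEnd ℂ) (m x * wirtBar j v x) else 0)

/-- Square integrable forms that are weakly closed with respect to the density `m`. -/
noncomputable def closedForms (D : Set 𝔼) (m : 𝔼 → ℝ) :
    Submodule ℂ (PiLp 2 (fun _ : Fin n => Lp ℂ 2 (volume : Measure 𝔼))) :=
  (Submodule.span ℂ {u | ∃ j k v, IsTest D v ∧ ∃ h : ∀ i, MemLp (closedTest m j k v i) 2,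
    u = l2Tuple _ h})ᗮ

lemma continuous_ofReal_mul {b : 𝔼 → ℝ} {v : 𝔼 → ℂ} (hD : IsOpen D) (hb : ContinuousOn b D)
    (hv : Continuous v) (hvc : HasCompactSupport v) (hvD : tsupport v ⊆ D) :
    Continuous (fun x => (b x : ℂ) * v x) ∧ HasCompactSupport (fun x => (b x : ℂ) * v x) :=
  integrable_mul_test hD (continuous_ofReal.comp_continuousOn hb) hv hvc hvD

lemma IsTest.mul_wirtBar {b : 𝔼 → ℝ} {v : 𝔼 → ℂ} (hD : IsOpen D) (hb : ContinuousOn b D)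
    (hv : IsTest D v) (j : Fin n) : Continuous (fun x => (b x : ℂ) * wirtBar j v x) ∧
      HasCompactSupport (fun x => (b x : ℂ) * wirtBar j v x) :=
  continuous_ofReal_mul hD hb (continuous_wirtBar
    (hv.contDiff.of_le (by norm_num)) j) (hasCompactSupport_wirtBar hv.compact j)
    ((tsupport_wirtBar_subset j).trans hv.subset)

lemma memLp_closedTest {m : 𝔼 → ℝ} (hD : IsOpen D) (hm : ContinuousOn m D) {v : 𝔼 → ℂ}
    (hv : IsTest D v) (j k i : Fin n) : MemLp (closedTest m j k v i) 2 := by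
  have key : ∀ k : Fin n, MemLp (fun x => (starRingEnd ℂ) (m x * wirtBar k v x)) 2 := fun k => by
    have h := hv.mul_wirtBar hD hm k
    exact (continuous_conj.comp h.1).memLp_of_hasCompactSupport
      (h.2.comp_left (g := starRingEnd ℂ) (map_zero _))
  refine MemLp.sub ?_ ?_
  · split_ifs
    · exact key k
    · exact MemLp.zero'
  · split_ifs
    · exact key j
    · exact MemLp.zero'

lemma inner_closedTest {m : 𝔼 → ℝ} (hD : IsOpen D) (hm : ContinuousOn m D) {v : 𝔼 → ℂ}
    (hv : IsTest D v) (j k : Fin n) {F : Fin n → 𝔼 → ℂ} (hF : ∀ j, MemLp (F j) 2) :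
    inner ℂ (l2Tuple _ (memLp_closedTest hD hm hv j k)) (l2Tuple F hF) =
      ∫ x, (m x : ℂ) * (F j x * wirtBar k v x - F k x * wirtBar j v x) := by
  rw [inner_l2Tuple]
  have i1 : ∀ j k, Integrable (fun x => F j x * ((m x : ℂ) * wirtBar k v x)) := fun j k =>
    integrable_mul_of_hasCompactSupport ((hF j).locallyIntegrable (by norm_num))
      (hv.mul_wirtBar hD hm k).1 (hv.mul_wirtBar hD hm k).2
  have h1 : ∀ i, ∫ x, (starRingEnd ℂ) (closedTest m j k v i x) * F i x =
      (if i = j then ∫ x, F j x * ((m x : ℂ) * wirtBar k v x) else 0) -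
      (if i = k then ∫ x, F k x * ((m x : ℂ) * wirtBar j v x) else 0) := fun i => by
    have e1 : ∀ (j k : Fin n), (if i = j then ∫ x, F j x * ((m x : ℂ) * wirtBar k v x) else 0) =
        ∫ x, (if i = j then F j x * ((m x : ℂ) * wirtBar k v x) else 0) := fun j k => by
      split_ifs <;> simp
    have e2 : ∀ (j k : Fin n), Integrable
        (fun x => (if i = j then F j x * ((m x : ℂ) * wirtBar k v x) else 0)) := fun j k => by
      split_ifs
      · exact i1 j k
      · simp
    rw [e1, e1, ← integral_sub (e2 j k) (e2 k j)]
    refine integral_congr_ae (Filter.Eventually.of_forall fun x => ?_)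
    simp only [closedTest, map_sub, sub_mul]
    congr 1
    · split_ifs with h
      · rw [conj_conj, h, mul_comm]
      · simp
    · split_ifs with h
      · rw [conj_conj, h, mul_comm]
      · simp
  simp only [h1, Finset.sum_sub_distrib, Finset.sum_ite_eq', Finset.mem_univ, if_true]
  rw [← integral_sub (i1 j k) (i1 k j)]
  refine integral_congr_ae (Filter.Eventually.of_forall fun x => ?_)
  ring

lemma mem_closedForms_iff {m : 𝔼 → ℝ} (hD : IsOpen D) (hm : ContinuousOn m D)
    {F : Fin n → 𝔼 → ℂ} (hF : ∀ j, MemLp (F j) 2) : l2Tuple F hF ∈ closedForms D m ↔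
      ∀ j k v, IsTest D v → ∫ x, (m x : ℂ) * (F j x * wirtBar k v x - F k x * wirtBar j v x) = 0 := by
  rw [closedForms, Submodule.mem_orthogonal]
  constructor
  · intro h j k v hv
    rw [← inner_closedTest hD hm hv]
    exact h _ (Submodule.subset_span ⟨j, k, v, hv, _, rfl⟩)
  · intro h u hu
    induction hu using Submodule.span_induction with
    | mem u hu =>
      obtain ⟨j, k, v, hv, h', rfl⟩ := hu
      exact (inner_closedTest hD hm hv j k hF).trans (h j k v hv)
    | zero => simp
    | add u v _ _ hu hv => rw [inner_add_left, hu, hv, add_zero]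
    | smul c u _ hu => rw [inner_smul_left, hu, mul_zero]

lemma exists_projection_closedForms (D : Set 𝔼) (m : 𝔼 → ℝ)
    (f : PiLp 2 (fun _ : Fin n => Lp ℂ 2 (volume : Measure 𝔼))) :
    ∃ (F : Fin n → 𝔼 → ℂ) (hF : ∀ j, MemLp (F j) 2), (∀ j, Measurable (F j)) ∧
      l2Tuple F hF ∈ closedForms D m ∧
      ∀ w ∈ closedForms D m, inner ℂ f w = inner ℂ (l2Tuple F hF) w := by
  have key : ∃ g ∈ closedForms D m, ∀ w ∈ closedForms D m, inner ℂ f w = inner ℂ g w :=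
    exists_mem_orthogonal_inner_eq _ f
  obtain ⟨g, hg, hg'⟩ := key
  obtain ⟨F, hF, hFm, rfl⟩ := exists_eq_l2Tuple g
  exact ⟨F, hF, hFm, hg, hg'⟩

end Solve

section Solve

variable {n : ℕ}

local notation "𝔼" => EuclideanSpace ℂ (Fin n)

variable {D : Set (EuclideanSpace ℂ (Fin n))} {r : EuclideanSpace ℂ (Fin n) → ℝ} {ε M : ℝ}

lemma IsDefining.contDiffOn_weight (h : IsDefining D r ε M) (A : ℝ) :
    ContDiffOn ℝ 2 (weight A r) D :=
  (contDiffOn_const.mul (h.contDiff.contDiffOn.inv fun x hx => (h.pos x hx).ne')).add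
    (contDiffOn_const.mul (h.contDiff.contDiffOn.log fun x hx => (h.pos x hx).ne'))

set_option maxHeartbeats 1000000 in
lemma duality_bound (h : IsDefining D r ε M) {A : ℝ} (hA : 0 ≤ A)
    (hAε : 1 ≤ A * ε - 12 * n * M ^ 2) {α : Fin n → 𝔼 → ℂ} (hα : ∀ j, MemLp (α j) 2)
    (hα0 : ∀ j, ∀ x ∉ D, α j x = 0)
    (hαc : l2Tuple α hα ∈ closedForms D fun x => Real.exp (weight A r x / 2))
    {V : Fin n → 𝔼 → ℂ} (hV : ∀ j, IsTest D (V j)) :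
    ‖∑ j, ∫ x, α j x * (Real.exp (weight A r x / 2) : ℂ) * V j x‖ ^ 2 ≤
      3 * ‖l2Tuple α hα‖ ^ 2 *
        ∫ x, r x ^ 2 * Real.exp (weight A r x) * ‖∑ j, wirtBar j (V j) x‖ ^ 2 := by
  set m : 𝔼 → ℝ := fun x => Real.exp (weight A r x / 2) with hm
  have hm0 : ∀ x, (m x : ℂ) ≠ 0 := fun x => ofReal_ne_zero.2 (Real.exp_pos _).ne'
  have hmc : ContinuousOn m D := ((h.contDiffOn_weight A).continuousOn.div_const 2).rexp
  have hD := h.isOpen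
  have hmi : ContinuousOn (fun x => (m x)⁻¹) D := hmc.inv₀ fun x _ => (Real.exp_pos _).ne'
  have hf' : ∀ j, MemLp (fun x => (m x : ℂ) * (starRingEnd ℂ) (V j x)) 2 := fun j => by
    have hc := (hV j).conj
    have := continuous_ofReal_mul hD hmc hc.contDiff.continuous hc.compact hc.subset
    exact this.1.memLp_of_hasCompactSupport this.2
  set N := closedForms D m with hN
  obtain ⟨F, hF, hFm, hFN, hproj⟩ := exists_projection_closedForms D m (l2Tuple _ hf')
  have hVd : ∀ j, Continuous (wirtBar j (V j)) := fun j =>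
    continuous_wirtBar ((hV j).contDiff.of_le (by norm_num)) j
  set H₁ : 𝔼 → ℂ := fun x => (starRingEnd ℂ) (∑ j, wirtBar j (V j) x) with hH₁
  have hS : Continuous fun x => ∑ j, wirtBar j (V j) x := continuous_finsetSum _ fun j _ => hVd j
  have hSs : ∀ x ∉ ⋃ j, tsupport (V j), ∑ j, wirtBar j (V j) x = 0 := fun x hx =>
    Finset.sum_eq_zero fun j _ => wirtBar_eq_zero_of_notMem_tsupport
      (fun hj => hx (mem_iUnion.2 ⟨j, hj⟩)) j
  have hcK : IsCompact (⋃ j, tsupport (V j)) := isCompact_iUnion fun j => (hV j).compact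
  have hH₁c : Continuous H₁ := continuous_conj.comp hS
  have hn : ∀ x, ‖H₁ x‖ = ‖∑ j, wirtBar j (V j) x‖ := fun x => RCLike.norm_conj _
  have hest := global_estimate hA h hFm hF hH₁c ?_ ((mem_closedForms_iff hD hmc hF).1 hFN) ?_
  rotate_left
  · have hc : Continuous (fun x => r x ^ 2 * Real.exp (weight A r x) * ‖H₁ x‖ ^ 2) := by
      refine continuous_of_tsupport fun x hx => ?_
      have hx' : x ∈ ⋃ j, tsupport (V j) := closure_minimal (fun y hy => by
        by_contra hy'
        refine hy ?_
        simp only [hn, hSs y hy']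
        simp) hcK.isClosed hx
      obtain ⟨j, hj⟩ := mem_iUnion.1 hx'
      have hxD := (hV j).subset hj
      exact ((h.contDiff.continuous.continuousAt.pow 2).mul
        ((h.contDiffOn_weight A).continuousOn.rexp.continuousAt (hD.mem_nhds hxD))).mul
        (hH₁c.norm.continuousAt.pow 2)
    exact hc.integrable_of_hasCompactSupport (HasCompactSupport.intro hcK fun x hx => by
      simp [hn, hSs x hx])
  · intro v hv
    have hw := hv.conj
    set w : 𝔼 → ℂ := fun x => (starRingEnd ℂ) (v x) with hwdef
    have hP := fun j => hw.mul_wirtBar hD hmi j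
    have hPL : ∀ j, MemLp (fun x => (((m x)⁻¹ : ℝ) : ℂ) * wirtBar j w x) 2 := fun j =>
      (hP j).1.memLp_of_hasCompactSupport (hP j).2
    have hPN : l2Tuple _ hPL ∈ N := (mem_closedForms_iff hD hmc hPL).2 fun j k u hu => by
      rw [← integral_compat hD (contDiff_wirtBar hw.contDiff j).contDiffOn
        (contDiff_wirtBar hw.contDiff k).contDiffOn hu
        (fun x _ => wirtBar_wirtBar_comm hw.contDiff x j k)]
      refine integral_congr_ae (Filter.Eventually.of_forall fun x => ?_)
      beta_reduce
      push_cast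
      rw [mul_sub]
      congr 1
      · rw [← mul_assoc, ← mul_assoc, mul_inv_cancel₀ (hm0 x), one_mul]
      · rw [← mul_assoc, ← mul_assoc, mul_inv_cancel₀ (hm0 x), one_mul]
    have h1 := hproj _ hPN
    rw [inner_l2Tuple, inner_l2Tuple] at h1
    have iF : ∀ j, Integrable (fun x => F j x / (m x : ℂ) * wirt j v x) := fun j => by
      have h2 := integrable_mul_of_hasCompactSupport ((hF j).locallyIntegrable (by norm_num))
        (continuous_conj.comp (hP j).1)
        ((hP j).2.comp_left (g := starRingEnd ℂ) (map_zero _))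
      refine h2.congr (Filter.Eventually.of_forall fun x => ?_)
      have h3 := wirt_conj (hw.contDiff.differentiable (by norm_num) x) j
      simp only [hwdef, conj_conj] at h3
      simp only [Function.comp, map_mul, ← h3, conj_ofReal, hwdef]
      push_cast
      ring
    have h2 : ∀ j, ∫ x, (starRingEnd ℂ) (F j x) * ((((m x)⁻¹ : ℝ) : ℂ) * wirtBar j w x) =
        (starRingEnd ℂ) (∫ x, F j x / (m x : ℂ) * wirt j v x) := fun j => by
      rw [← integral_conj]
      refine integral_congr_ae (Filter.Eventually.of_forall fun x => ?_)
      beta_reduce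
      rw [hwdef, wirtBar_conj (hv.contDiff.differentiable (by norm_num) x)]
      simp only [map_mul, map_div₀, conj_ofReal]
      push_cast
      ring
    have h3 : ∀ j, ∫ x, (starRingEnd ℂ) ((m x : ℂ) * (starRingEnd ℂ) (V j x)) *
        ((((m x)⁻¹ : ℝ) : ℂ) * wirtBar j w x) =
        (starRingEnd ℂ) (-∫ x, (starRingEnd ℂ) (wirtBar j (V j) x) * v x) := fun j => by
      rw [map_neg, ← integral_conj]
      have h4 := integral_mul_wirtBar_test hD ((hV j).contDiff.of_le (by norm_num)).contDiffOn hw j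
      simp only [map_mul, conj_conj]
      rw [← h4]
      refine integral_congr_ae (Filter.Eventually.of_forall fun x => ?_)
      have := hm0 x
      beta_reduce
      simp only [conj_ofReal]
      push_cast
      field_simp
    simp only [h2, h3, ← map_sum] at h1
    have h5 := (starRingEnd ℂ).injective h1
    rw [integral_finsetSum _ fun j _ => iF j, ← h5, Finset.sum_neg_distrib, ← integral_finsetSum]
    · congr 2
      funext x
      simp only [hH₁, map_sum, Finset.sum_mul]
    · intro j _
      exact ((continuous_conj.comp (hVd j)).mul hv.contDiff.continuous).integrable_of_hasCompactSupport
        (HasCompactSupport.intro hv.compact fun x hx => by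
          simp [image_eq_zero_of_notMem_tsupport hx])
  set J := ∫ x, r x ^ 2 * Real.exp (weight A r x) * ‖∑ j, wirtBar j (V j) x‖ ^ 2 with hJ
  simp only [hn] at hest
  have hFD : ∀ j, MemLp (D.indicator (F j)) 2 := fun j => (hF j).indicator hD.measurableSet
  have hnF : ‖l2Tuple _ hFD‖ ^ 2 = ∫ x in D, ∑ j, ‖F j x‖ ^ 2 := by
    rw [norm_l2Tuple_sq, integral_finsetSum]
    · refine Finset.sum_congr rfl fun j _ => ?_
      rw [← integral_indicator hD.measurableSet]
      congr 1
      funext x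
      by_cases hx : x ∈ D <;> simp [hx]
    · intro j _
      have : Integrable (fun x => ‖F j x‖ ^ 2) := by
        simpa using (hF j).integrable_norm_pow (p := 2) (by norm_num)
      exact this.integrableOn
  have hle : ‖l2Tuple _ hFD‖ ^ 2 ≤ 3 * J := by
    rw [hnF]
    refine le_trans ?_ hest
    exact le_mul_of_one_le_left (integral_nonneg fun x => Finset.sum_nonneg fun j _ => by positivity)
      hAε
  have hval : ∑ j, ∫ x, α j x * (m x : ℂ) * V j x = inner ℂ (l2Tuple _ hFD) (l2Tuple α hα) := by
    have h1 := hproj _ hαc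
    rw [inner_l2Tuple, inner_l2Tuple] at h1
    rw [inner_l2Tuple]
    calc _ = _ := Finset.sum_congr rfl fun j _ =>
          integral_congr_ae (Filter.Eventually.of_forall fun x => by
            simp only [map_mul, conj_conj, conj_ofReal]; ring)
      _ = _ := h1
      _ = _ := Finset.sum_congr rfl fun j _ =>
          integral_congr_ae (Filter.Eventually.of_forall fun x => by
            by_cases hx : x ∈ D
            · simp [hx]
            · simp [hα0 j x hx])
  rw [hval]
  have := norm_inner_le_norm (𝕜 := ℂ) (l2Tuple _ hFD) (l2Tuple α hα)
  calc _ ≤ (‖l2Tuple _ hFD‖ * ‖l2Tuple α hα‖) ^ 2 := pow_le_pow_left₀ (norm_nonneg _) this 2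
    _ = ‖l2Tuple α hα‖ ^ 2 * ‖l2Tuple _ hFD‖ ^ 2 := by ring
    _ ≤ ‖l2Tuple α hα‖ ^ 2 * (3 * J) := mul_le_mul_of_nonneg_left hle (sq_nonneg _)
    _ = _ := by ring

end Solve

section Solve

lemma exists_nonneg_bound {X E : Type*} [TopologicalSpace X] [SeminormedAddCommGroup E]
    {K : Set X} (hK : IsCompact K) {f : X → E} (hf : ContinuousOn f K) :
    ∃ B : ℝ, 0 ≤ B ∧ ∀ x ∈ K, ‖f x‖ ≤ B := by
  obtain ⟨B, hB⟩ := hK.exists_bound_of_continuousOn hf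
  exact ⟨max B 0, le_max_right _ _, fun x hx => (hB x hx).trans (le_max_left _ _)⟩

variable {n : ℕ}

local notation "𝔼" => EuclideanSpace ℂ (Fin n)

variable {D : Set (EuclideanSpace ℂ (Fin n))} {r : EuclideanSpace ℂ (Fin n) → ℝ} {ε M : ℝ}

lemma le_exp_weight {A : ℝ} (hA : 0 ≤ A) {x : 𝔼} (hx : 0 < r x) :
    A / 2 ≤ Real.exp (weight A r x / 2) := by
  have h1 : weight A r x / 2 = A / 2 * (r x)⁻¹ + Real.log (r x) := by rw [weight]; ring
  rw [h1, Real.exp_add, Real.exp_log hx]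
  have h2 := Real.add_one_le_exp (A / 2 * (r x)⁻¹)
  calc A / 2 = A / 2 * (r x)⁻¹ * r x := by field_simp
    _ ≤ _ := mul_le_mul_of_nonneg_right (by linarith) hx.le

/-- Tuples of test functions. -/
def testTuples (D : Set 𝔼) : Submodule ℂ (Fin n → 𝔼 → ℂ) where
  carrier := {V | ∀ j, IsTest D (V j)}
  add_mem' hV hW j := (hV j).add (hW j)
  zero_mem' _ := IsTest.zero
  smul_mem' c _ hV j := (hV j).smul c

lemma wirtBar_add_fun {f g : 𝔼 → ℂ} {x : 𝔼} (hf : DifferentiableAt ℝ f x)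
    (hg : DifferentiableAt ℝ g x) (j : Fin n) :
    wirtBar j (f + g) x = wirtBar j f x + wirtBar j g x := by
  simp only [wirtBar, fderiv_add hf hg, _root_.add_apply]; ring

lemma wirtBar_smul_fun {f : 𝔼 → ℂ} {x : 𝔼} (hf : DifferentiableAt ℝ f x) (c : ℂ) (j : Fin n) :
    wirtBar j (c • f) x = c * wirtBar j f x := by
  simp only [wirtBar, fderiv_const_smul hf, _root_.smul_apply, smul_eq_mul]; ring

lemma IsTest.differentiable {v : 𝔼 → ℂ} (hv : IsTest D v) : Differentiable ℝ v :=
  hv.contDiff.differentiable (by norm_num)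

lemma memLp_div {b : 𝔼 → ℝ} (hD : IsOpen D) (hb : ContinuousOn b D) {V : Fin n → 𝔼 → ℂ}
    (hV : ∀ j, IsTest D (V j)) : MemLp (fun x => (b x : ℂ) * ∑ j, wirtBar j (V j) x) 2 := by
  simp only [Finset.mul_sum]
  exact memLp_finsetSum _ fun j _ => by
    have := (hV j).mul_wirtBar hD hb j
    exact this.1.memLp_of_hasCompactSupport this.2

/-- The weighted divergence of a tuple of test functions. -/
noncomputable def weightedDiv {b : 𝔼 → ℝ} (hD : IsOpen D) (hb : ContinuousOn b D) :
    testTuples D →ₗ[ℂ] Lp ℂ 2 (volume : Measure 𝔼) where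
  toFun V := (memLp_div hD hb V.2).toLp _
  map_add' V W := by
    rw [← MemLp.toLp_add]
    refine MemLp.toLp_congr _ _ (Filter.Eventually.of_forall fun x => ?_)
    simp only [Pi.add_apply, ← mul_add, ← Finset.sum_add_distrib]
    congr 1
    exact Finset.sum_congr rfl fun j _ =>
      wirtBar_add_fun ((V.2 j).differentiable x) ((W.2 j).differentiable x) j
  map_smul' c V := by
    rw [RingHom.id_apply, ← MemLp.toLp_const_smul]
    refine MemLp.toLp_congr _ _ (Filter.Eventually.of_forall fun x => ?_)
    simp only [Pi.smul_apply, smul_eq_mul]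
    rw [mul_left_comm, Finset.mul_sum _ _ c]
    congr 1
    exact Finset.sum_congr rfl fun j _ => wirtBar_smul_fun ((V.2 j).differentiable x) c j

lemma integrable_mul_isTest {a v : 𝔼 → ℂ} (hD : IsOpen D) (ha : ContinuousOn a D)
    (hv : IsTest D v) : Integrable (fun x => a x * v x) := by
  have := integrable_mul_test hD ha hv.contDiff.continuous hv.compact hv.subset
  exact this.1.integrable_of_hasCompactSupport this.2

/-- The pairing of a form with tuples of test functions. -/
noncomputable def testPairing (hD : IsOpen D) {α : Fin n → 𝔼 → ℂ}
    (hα : ∀ j, ContinuousOn (α j) D) : testTuples D →ₗ[ℂ] ℂ where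
  toFun V := ∑ j, ∫ x, α j x * V.1 j x
  map_add' V W := by
    rw [← Finset.sum_add_distrib]
    refine Finset.sum_congr rfl fun j _ => ?_
    rw [← integral_add (integrable_mul_isTest hD (hα j) (V.2 j))
      (integrable_mul_isTest hD (hα j) (W.2 j))]
    refine integral_congr_ae (Filter.Eventually.of_forall fun x => ?_)
    exact mul_add _ _ _
  map_smul' c V := by
    rw [RingHom.id_apply, smul_eq_mul, Finset.mul_sum]
    refine Finset.sum_congr rfl fun j _ => ?_
    rw [← integral_const_mul]
    refine integral_congr_ae (Filter.Eventually.of_forall fun x => ?_)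
    exact mul_left_comm _ _ _

/-- Bounded `∂̄`-closed forms on a bounded strictly pseudoconvex set are weakly exact. -/
lemma exists_weak_solution (h : IsDefining D r ε M) (hvol : volume D ≠ ⊤) {α : Fin n → 𝔼 → ℂ}
    (hα : ∀ j, ContDiffOn ℝ 1 (α j) D) {C : ℝ} (hαb : ∀ j, ∀ x ∈ D, ‖α j x‖ ≤ C)
    (hαc : ∀ j k, ∀ x ∈ D, wirtBar k (α j) x = wirtBar j (α k) x) :
    ∃ U : 𝔼 → ℂ, (∀ K, IsCompact K → K ⊆ D → MemLp (K.indicator U) 2) ∧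
      ∀ v, IsTest D v → ∀ j, ∫ x, α j x * v x = -∫ x, U x * wirtBar j v x := by
  have hD := h.isOpen
  set A : ℝ := (12 * n * M ^ 2 + 1) / ε with hAdef
  have hε := h.eps_pos
  have hA : 0 < A := by positivity
  have hAε : 1 ≤ A * ε - 12 * n * M ^ 2 := by
    rw [hAdef, div_mul_cancel₀ _ hε.ne']; linarith
  set m : 𝔼 → ℝ := fun x => Real.exp (weight A r x / 2) with hm
  have hm0 : ∀ x, (m x : ℂ) ≠ 0 := fun x => ofReal_ne_zero.2 (Real.exp_pos _).ne'
  have hmc : ContinuousOn m D := ((h.contDiffOn_weight A).continuousOn.div_const 2).rexp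
  set α' : Fin n → 𝔼 → ℂ := fun j => D.indicator fun x => α j x / (m x : ℂ) with hα'
  have hα'D : ∀ j, ∀ x ∈ D, α' j x = α j x / (m x : ℂ) := fun j x hx => by simp [hα', hx]
  have hα'0 : ∀ j, ∀ x ∉ D, α' j x = 0 := fun j x hx => by simp [hα', hx]
  haveI : IsFiniteMeasure (volume.restrict D) := ⟨by
    rw [Measure.restrict_apply_univ]; exact hvol.lt_top⟩
  have hLp : ∀ j, MemLp (α' j) 2 := fun j => by
    rw [hα', memLp_indicator_iff_restrict hD.measurableSet]
    have hc : ContinuousOn (fun x => α j x / (m x : ℂ)) D :=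
      (hα j).continuousOn.div (continuous_ofReal.comp_continuousOn hmc) fun x _ => hm0 x
    refine MemLp.of_bound (hc.aestronglyMeasurable hD.measurableSet) (C / (A / 2)) ?_
    filter_upwards [ae_restrict_mem hD.measurableSet] with x hx
    rw [norm_div, Complex.norm_real, Real.norm_of_nonneg (Real.exp_pos _).le]
    exact div_le_div₀ ((norm_nonneg _).trans (hαb j x hx)) (hαb j x hx) (by positivity)
      (le_exp_weight hA.le (h.pos x hx))
  have hcl : l2Tuple α' hLp ∈ closedForms D m := by
    refine (mem_closedForms_iff hD hmc hLp).2 fun j k v hv => ?_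
    rw [← integral_compat hD (hα j) (hα k) hv (hαc j k)]
    refine integral_congr_ae (Filter.Eventually.of_forall fun x => ?_)
    by_cases hx : x ∈ D
    · beta_reduce
      have := hm0 x
      rw [hα'D j x hx, hα'D k x hx]
      field_simp
    · have hx' : x ∉ tsupport v := fun h' => hx (hv.subset h')
      simp [wirtBar_eq_zero_of_notMem_tsupport hx']
  set b : 𝔼 → ℝ := fun x => r x * m x with hb
  have hbc : ContinuousOn b D := h.contDiff.continuous.continuousOn.mul hmc
  obtain ⟨u, hu⟩ := exists_inner_eq_of_norm_le (weightedDiv hD hbc)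
    (testPairing hD fun j => (hα j).continuousOn) (√(3 * ‖l2Tuple α' hLp‖ ^ 2)) fun V => by
      have h1 := duality_bound h hA.le hAε hLp hα'0 hcl V.2
      have h2 : ‖weightedDiv hD hbc V‖ ^ 2 =
          ∫ x, r x ^ 2 * Real.exp (weight A r x) * ‖∑ j, wirtBar j (V.1 j) x‖ ^ 2 := by
        refine (norm_toLp_sq (memLp_div hD hbc V.2)).trans (integral_congr_ae (Filter.Eventually.of_forall fun x => ?_))
        beta_reduce
        rw [norm_mul, Complex.norm_real, Real.norm_eq_abs, mul_pow, sq_abs, hb]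
        have : Real.exp (weight A r x) = m x ^ 2 := by
          rw [hm, ← Real.exp_nat_mul]; congr 1; push_cast; ring
        rw [this]; ring
      have h3 : testPairing hD (fun j => (hα j).continuousOn) V =
          ∑ j, ∫ x, α' j x * (m x : ℂ) * V.1 j x := by
        change ∑ j, ∫ x, α j x * V.1 j x = _
        refine Finset.sum_congr rfl fun j _ => integral_congr_ae (Filter.Eventually.of_forall fun x => ?_)
        beta_reduce
        by_cases hx : x ∈ D
        · rw [hα'D j x hx, div_mul_cancel₀ _ (hm0 x)]
        · have hx' : x ∉ tsupport (V.1 j) := fun h' => hx ((V.2 j).subset h')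
          simp [image_eq_zero_of_notMem_tsupport hx']
      rw [← h2, ← h3] at h1
      refine abs_le_of_sq_le_sq' ?_ (by positivity) |>.2
      rw [mul_pow, Real.sq_sqrt (by positivity)]
      exact h1
  refine ⟨fun x => -((starRingEnd ℂ) (u x) * (b x : ℂ)), fun K hK hKD => ?_, fun v hv j => ?_⟩
  · obtain ⟨B, hB0, hB⟩ := exists_nonneg_bound hK (hbc.mono hKD)
    refine (Lp.memLp u).of_le_mul (c := B) ?_ (Filter.Eventually.of_forall fun x => ?_)
    · rw [aestronglyMeasurable_indicator_iff hK.measurableSet]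
      exact (((continuous_conj.comp_aestronglyMeasurable (Lp.aestronglyMeasurable u)).restrict).mul
        ((continuous_ofReal.comp_continuousOn
          (hbc.mono hKD)).aestronglyMeasurable hK.measurableSet)).neg
    · by_cases hx : x ∈ K
      · have h1 := hB x hx
        rw [indicator_of_mem hx, norm_neg, norm_mul, RCLike.norm_conj, mul_comm, Complex.norm_real]
        exact mul_le_mul_of_nonneg_right h1 (norm_nonneg _)
      · rw [indicator_of_notMem hx, norm_zero]
        positivity
  · have hV : ∀ i, IsTest D ((Pi.single j v : Fin n → 𝔼 → ℂ) i) := fun i => by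
      by_cases hi : i = j
      · subst hi; simpa using hv
      · simpa [hi] using IsTest.zero
    have h1 := hu ⟨Pi.single j v, hV⟩
    have h2 : testPairing hD (fun j => (hα j).continuousOn) ⟨Pi.single j v, hV⟩ =
        ∫ x, α j x * v x := by
      change ∑ i, ∫ x, α i x * (Pi.single j v : Fin n → 𝔼 → ℂ) i x = _
      refine (Finset.sum_eq_single j (fun i _ hi => ?_) (by simp)).trans ?_
      · simp [hi]
      · simp
    rw [← h2, h1, L2.inner_def, ← integral_neg]
    refine integral_congr_ae ?_
    filter_upwards [(memLp_div hD hbc hV).coeFn_toLp] with x hx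
    have h3 : (weightedDiv hD hbc ⟨Pi.single j v, hV⟩ : 𝔼 → ℂ) x = (b x : ℂ) * wirtBar j v x := by
      refine hx.trans ?_
      congr 1
      change ∑ i, wirtBar i ((Pi.single j v : Fin n → 𝔼 → ℂ) i) x = _
      refine (Finset.sum_eq_single j (fun i _ hi => ?_) (by simp)).trans ?_
      · simp [hi, wirtBar]
      · simp
    rw [h3, RCLike.inner_apply]
    ring

end Solve

section Regularity

variable {n : ℕ}

local notation "𝔼" => EuclideanSpace ℂ (Fin n)

variable {D : Set (EuclideanSpace ℂ (Fin n))} {r : EuclideanSpace ℂ (Fin n) → ℝ} {ε M : ℝ}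
  {ρ : EuclideanSpace ℂ (Fin n) → ℝ} {δ : ℝ}

lemma IsMollifier.isTest (h : IsMollifier ρ δ) {x : 𝔼} (hx : closedBall x δ ⊆ D) :
    IsTest D (fun y => (ρ (x - y) : ℂ)) := by
  have hs : ∀ y ∉ closedBall x δ, (ρ (x - y) : ℂ) = 0 := fun y hy => by
    rw [mem_closedBall, not_le, dist_comm, dist_eq_norm] at hy
    rw [h.zero _ hy.le, ofReal_zero]
  refine ⟨contDiff_ofReal_comp (h.smooth.comp (contDiff_const.sub contDiff_id)),
    HasCompactSupport.intro (isCompact_closedBall x δ) hs, ?_⟩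
  refine (closure_minimal (fun y hy => ?_) isClosed_closedBall).trans hx
  by_contra hy'
  exact hy (hs y hy')

lemma wirtBar_smear_of_contDiffOn (h : IsMollifier ρ δ) {δ' : ℝ} (hδ : δ < δ') {f : 𝔼 → ℂ}
    (hfl : LocallyIntegrable f) {x : 𝔼} (hf : ContDiffOn ℝ 1 f (ball x δ')) (j : Fin n) :
    wirtBar j (smear ρ f) x = smear ρ (wirtBar j f) x := by
  rw [wirtBar_smear h hfl, integral_mul_wirtBar_test isOpen_ball hf
    (h.isTest (closedBall_subset_ball hδ)), neg_neg, smear]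

/-- Bounded `∂̄`-closed forms on a bounded strictly pseudoconvex set are exact on compact
subsets, up to regularization. -/
lemma exists_wirtBar_eq_smear (h : IsDefining D r ε M) (hvol : volume D ≠ ⊤)
    {α : Fin n → 𝔼 → ℂ} (hα : ∀ j, ContDiffOn ℝ 1 (α j) D) {C : ℝ}
    (hαb : ∀ j, ∀ x ∈ D, ‖α j x‖ ≤ C)
    (hαc : ∀ j k, ∀ x ∈ D, wirtBar k (α j) x = wirtBar j (α k) x) {K : Set 𝔼} (hK : IsCompact K)
    (hKD : K ⊆ D) : ∃ δ₀ > 0, ∀ ρ : 𝔼 → ℝ, ∀ δ ≤ δ₀, IsMollifier ρ δ →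
      ∃ w : 𝔼 → ℂ, ContDiff ℝ 2 w ∧ ∀ x ∈ K, ∀ j, wirtBar j w x = smear ρ (α j) x := by
  obtain ⟨U, hU, hUe⟩ := exists_weak_solution h hvol hα hαb hαc
  obtain ⟨δ₀, hδ₀, hsub⟩ := hK.exists_cthickening_subset_open h.isOpen hKD
  have hL := hU _ hK.cthickening hsub
  refine ⟨δ₀, hδ₀, fun ρ δ hδ hρ => ⟨smear ρ ((cthickening δ₀ K).indicator U),
    contDiff_smear hρ (hL.locallyIntegrable (by norm_num)), fun x hx j => ?_⟩⟩
  have hb : closedBall x δ ⊆ cthickening δ₀ K :=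
    (closedBall_subset_closedBall hδ).trans (closedBall_subset_cthickening hx δ₀)
  have hv := hρ.isTest (hb.trans hsub)
  have hv' := hρ.isTest hb
  rw [wirtBar_smear hρ (hL.locallyIntegrable (by norm_num)), smear, hUe _ hv j]
  congr 1
  refine integral_congr_ae (Filter.Eventually.of_forall fun y => ?_)
  beta_reduce
  by_cases hy : y ∈ cthickening δ₀ K
  · rw [indicator_of_mem hy]
  · rw [wirtBar_eq_zero_of_notMem_tsupport (fun h' => hy (hv'.subset h')), mul_zero, mul_zero]

lemma eq_sum_smul_stdVec (v : 𝔼) : v = ∑ j, v j • (stdVec j : 𝔼) := by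
  ext i
  simp [stdVec, Pi.single_apply]

lemma differentiableAt_of_wirtBar_eq_zero {f : 𝔼 → ℂ} {x : 𝔼} (hf : DifferentiableAt ℝ f x)
    (h : ∀ j, wirtBar j f x = 0) : DifferentiableAt ℂ f x := by
  have h1 : ∀ j, fderiv ℝ f x (I • stdVec j) = I * fderiv ℝ f x (stdVec j) := fun j => by
    have h2 := h j
    rw [wirtBar, mul_eq_zero, or_iff_right (by norm_num)] at h2
    have h3 := congrArg (I * ·) h2
    simp only [mul_add, ← mul_assoc, I_mul_I, mul_zero] at h3
    linear_combination -h3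
  have h2 : ∀ (a : ℂ) j, fderiv ℝ f x (a • stdVec j) = a * fderiv ℝ f x (stdVec j) := fun a j => by
    have e : a • (stdVec j : 𝔼) = a.re • stdVec j + a.im • (I • stdVec j : 𝔼) := by
      rw [← Complex.coe_smul, ← Complex.coe_smul, smul_smul, ← add_smul, re_add_im]
    rw [e, map_add, map_smul, map_smul, h1]
    conv_rhs => rw [← re_add_im a]
    simp only [real_smul]
    ring
  have h3 : ∀ (a : ℂ) v, fderiv ℝ f x (a • v) = a * fderiv ℝ f x v := fun a v => by
    conv_lhs => rw [eq_sum_smul_stdVec v]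
    conv_rhs => rw [eq_sum_smul_stdVec v]
    simp only [Finset.smul_sum, map_sum, smul_smul, h2, Finset.mul_sum, mul_assoc]
  rw [differentiableAt_iff_restrictScalars ℝ hf]
  refine ⟨⟨⟨⟨fderiv ℝ f x, map_add _⟩, fun a v => ?_⟩, (fderiv ℝ f x).continuous⟩, ?_⟩
  · exact h3 a v
  · ext v; rfl

lemma contDiffOn_two_of_differentiableOn {U : Set 𝔼} (hU : IsOpen U) {f : 𝔼 → ℂ}
    (hf : DifferentiableOn ℂ f U) : ContDiffOn ℝ 2 f U := by
  intro x hx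
  obtain ⟨δ, hδ, hsub⟩ := Metric.isOpen_iff.1 hU x hx
  obtain ⟨ρ, hρ⟩ := exists_isMollifier (n := n) (δ := δ / 4) (by positivity)
  set u : 𝔼 → ℂ := (closedBall x (3 * δ / 4)).indicator f with hu
  have hul : LocallyIntegrable u := by
    refine Integrable.locallyIntegrable ?_
    rw [hu, integrable_indicator_iff isClosed_closedBall.measurableSet]
    exact (hf.continuousOn.mono ((closedBall_subset_ball (by linarith)).trans
      hsub)).integrableOn_compact (isCompact_closedBall _ _)
  refine ((contDiff_smear hρ hul).contDiffAt.congr_of_eventuallyEq ?_).contDiffWithinAt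
  filter_upwards [ball_mem_nhds x (show 0 < δ / 4 by positivity)] with y hy
  have hyd : dist y x < δ / 4 := hy
  have hb : ball y (δ / 2) ⊆ closedBall x (3 * δ / 4) := fun z hz => by
    have hz' : dist z y < δ / 2 := hz
    exact mem_closedBall.2 ((dist_triangle z y x).trans (by linarith))
  have hb' : ball y (δ / 2) ⊆ U := (hb.trans (closedBall_subset_ball (by linarith))).trans hsub
  have h1 : smear ρ u y = u y := by
    refine smear_eq_self_of_differentiableOn hρ (δ' := δ / 2) (by linarith) ?_
    exact (hf.mono hb').congr fun z hz => by rw [hu, indicator_of_mem (hb hz)]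
  rw [h1, hu, indicator_of_mem (hb (mem_ball_self (by positivity)))]

end Regularity

section Taylor

variable {E F : Type*} [NormedAddCommGroup E] [NormedSpace ℝ E] [NormedAddCommGroup F]
  [NormedSpace ℝ F]

/-- Second order Taylor expansion, locally uniformly in the base point. -/
lemma ContDiffAt.exists_taylor_two {f : E → F} {p : E} (hf : ContDiffAt ℝ 2 f p) {ε : ℝ}
    (hε : 0 < ε) : ∃ δ > 0, ∀ x ∈ ball p δ, ∀ v : E, ‖v‖ < δ →
      DifferentiableAt ℝ f x ∧
      ‖fderiv ℝ f (x + v) - fderiv ℝ f x - fderiv ℝ (fderiv ℝ f) p v‖ ≤ ε * ‖v‖ ∧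
      ‖f (x + v) - f x - fderiv ℝ f x v - (1 / 2 : ℝ) • fderiv ℝ (fderiv ℝ f) p v v‖ ≤
        ε * ‖v‖ ^ 2 := by
  have h1 : ContDiffAt ℝ 1 (fderiv ℝ f) p := hf.fderiv_right (by norm_num)
  have h2 :=
    (h1.fderiv_right (m := 0) (by norm_num)).continuousAt
  have e1 : ∀ᶠ x in nhds p, DifferentiableAt ℝ f x :=
    (hf.eventually (by simp)).mono fun x hx => hx.differentiableAt (by norm_num)
  have e2 : ∀ᶠ x in nhds p, DifferentiableAt ℝ (fderiv ℝ f) x :=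
    (h1.eventually (by simp)).mono fun x hx => hx.differentiableAt (by norm_num)
  have e3 : ∀ᶠ x in nhds p, ‖fderiv ℝ (fderiv ℝ f) x - fderiv ℝ (fderiv ℝ f) p‖ < ε := by
    have h3 := (h2.sub (continuousAt_const (y := fderiv ℝ (fderiv ℝ f) p))).norm
    refine h3.eventually (gt_mem_nhds ?_)
    simpa using hε
  obtain ⟨δ, hδ, hall⟩ := Metric.eventually_nhds_iff.1 (e1.and (e2.and e3))
  set B := fderiv ℝ (fderiv ℝ f) p with hB
  have hsym : ∀ v w, B v w = B w v := fun v w => (hf.isSymmSndFDerivAt (by simp)) v w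
  have hmem : ∀ x ∈ ball p (δ / 2), ∀ v : E, ‖v‖ < δ / 2 → Dist.dist (x + v) p < δ :=
    fun x hx v hv => by
      have hx' : Dist.dist x p < δ / 2 := hx
      have := dist_triangle (x + v) x p
      rw [dist_self_add_left] at this
      linarith
  have key1 : ∀ x ∈ ball p (δ / 2), ∀ v : E, ‖v‖ < δ / 2 →
      ‖fderiv ℝ f (x + v) - fderiv ℝ f x - B v‖ ≤ ε * ‖v‖ := fun x hx v hv => by
    have hd : ∀ w ∈ ball (0 : E) (δ / 2), HasFDerivWithinAt (fun w => fderiv ℝ f (x + w) - B w)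
        (fderiv ℝ (fderiv ℝ f) (x + w) - B) (ball 0 (δ / 2)) w := fun w hw => by
      have hw' := hmem x hx w (by simpa using hw)
      have := (hall hw').2.1.hasFDerivAt.comp w ((hasFDerivAt_id w).const_add x)
      exact (this.sub B.hasFDerivAt).hasFDerivWithinAt
    have := (convex_ball (0 : E) (δ / 2)).norm_image_sub_le_of_norm_hasFDerivWithin_le hd
      (fun w hw => (hall (hmem x hx w (by simpa using hw))).2.2.le)
      (mem_ball_self (by positivity)) (y := v) (by simpa using hv)
    simp only [add_zero, map_zero, sub_zero] at this
    rwa [sub_right_comm] at this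
  refine ⟨δ / 2, by positivity, fun x hx v hv => ⟨?_, key1 x hx v hv, ?_⟩⟩
  · have := hmem x hx 0 (by simpa using (by positivity : 0 < δ / 2))
    rw [add_zero] at this
    exact (hall this).1
  have hd : ∀ w ∈ closedBall (0 : E) ‖v‖, HasFDerivWithinAt
      (fun w => f (x + w) - fderiv ℝ f x w - (1 / 2 : ℝ) • B w w)
      (fderiv ℝ f (x + w) - fderiv ℝ f x - B w) (closedBall 0 ‖v‖) w := fun w hw => by
    have hw' := hmem x hx w (lt_of_le_of_lt (by simpa using hw) hv)
    have h1 := (hall hw').1.hasFDerivAt.comp w ((hasFDerivAt_id w).const_add x)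
    have h2 : HasFDerivAt (fun w => B w w) ((2 : ℝ) • B w) w := by
      have h3 := B.hasFDerivAt (x := w) |>.clm_apply (hasFDerivAt_id w)
      refine h3.congr_fderiv (ContinuousLinearMap.ext fun u => ?_)
      simp [two_smul, hsym u w]
    have h3 := (h1.sub (fderiv ℝ f x).hasFDerivAt).sub (h2.const_smul (1 / 2 : ℝ))
    rw [smul_smul] at h3
    norm_num at h3
    convert h3.hasFDerivWithinAt using 1
    · funext w; simp
  have := (convex_closedBall (0 : E) ‖v‖).norm_image_sub_le_of_norm_hasFDerivWithin_le
    (C := ε * ‖v‖) hd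
    (fun w hw => by
      have hw1 : ‖w‖ ≤ ‖v‖ := by simpa using hw
      exact (key1 x hx w (lt_of_le_of_lt hw1 hv)).trans (mul_le_mul_of_nonneg_left hw1 hε.le))
    (x := 0) (y := v) (by simp) (by simp)
  simp only [add_zero, map_zero, sub_zero, smul_zero] at this
  rw [sq, ← mul_assoc]
  convert this using 2
  abel

end Taylor

section CubePlus

lemma hasDerivAt_max_pow (k : ℕ) (t : ℝ) :
    HasDerivAt (fun t : ℝ => max t 0 ^ (k + 2)) ((k + 2) * max t 0 ^ (k + 1)) t := by
  rcases lt_trichotomy t 0 with ht | rfl | ht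
  · have h1 : (fun t : ℝ => max t 0 ^ (k + 2)) =ᶠ[nhds t] fun _ => 0 := by
      filter_upwards [gt_mem_nhds ht] with s hs
      simp [max_eq_right (le_of_lt hs)]
    rw [max_eq_right ht.le]
    simpa using (hasDerivAt_const t (0 : ℝ)).congr_of_eventuallyEq h1
  · rw [hasDerivAt_iff_tendsto_slope_zero]
    have h1 : ContinuousAt (fun t : ℝ => max t 0 ^ (k + 1)) 0 := by fun_prop
    have h2 := h1.tendsto.mono_left (nhdsWithin_le_nhds (s := {0}ᶜ))
    simp only [max_self] at h2 ⊢
    refine Filter.Tendsto.congr' ?_ (by simpa using h2)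
    filter_upwards [self_mem_nhdsWithin] with s hs
    have hs' : s ≠ 0 := hs
    rcases le_total s 0 with h | h
    · simp [max_eq_right h]
    · simp [max_eq_left h]
      field_simp
      ring
  · have h1 : (fun t : ℝ => max t 0 ^ (k + 2)) =ᶠ[nhds t] fun t => t ^ (k + 2) := by
      filter_upwards [lt_mem_nhds ht] with s hs
      simp [max_eq_left (le_of_lt hs)]
    rw [max_eq_left ht.le]
    have := (hasDerivAt_pow (k + 2) t).congr_of_eventuallyEq h1
    simpa using this

lemma contDiff_max_cube : ContDiff ℝ 2 (fun t : ℝ => max t 0 ^ 3) := by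
  have h1 : deriv (fun t : ℝ => max t 0 ^ 3) = fun t => 3 * max t 0 ^ 2 := by
    funext t
    rw [(hasDerivAt_max_pow 1 t).deriv]; norm_num
  have h2 : deriv (fun t : ℝ => max t 0 ^ 2) = fun t => 2 * max t 0 := by
    funext t
    have := (hasDerivAt_max_pow 0 t).deriv
    simpa using this
  rw [show (2 : WithTop ℕ∞) = 1 + 1 by norm_num, contDiff_succ_iff_deriv]
  refine ⟨fun t => (hasDerivAt_max_pow 1 t).differentiableAt, by simp, ?_⟩
  rw [h1]
  refine contDiff_const.mul ?_
  rw [contDiff_one_iff_deriv, h2]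
  exact ⟨fun t => (hasDerivAt_max_pow 0 t).differentiableAt, by fun_prop⟩

end CubePlus

lemma IsCompact.exists_pos_le_add_mul {X : Type*} [TopologicalSpace X] {S : Set X}
    (hS : IsCompact S) {a g : X → ℝ} (ha : Continuous a) (hg : Continuous g)
    (hg0 : ∀ x, 0 ≤ g x) (h : ∀ x ∈ S, g x = 0 → 0 < a x) :
    ∃ N > 0, ∃ c > 0, ∀ x ∈ S, c ≤ a x + N * g x := by
  obtain ⟨N, hN⟩ := hS.elim_directed_cover (fun N : ℕ => {x | 0 < a x + N * g x})
    (fun N => isOpen_lt continuous_const (by fun_prop))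
    (fun x hx => by
      rcases (hg0 x).eq_or_lt with h0 | h0
      · exact mem_iUnion.2 ⟨0, by simpa using h x hx h0.symm⟩
      · obtain ⟨N, hN⟩ := exists_nat_gt (-a x / g x)
        refine mem_iUnion.2 ⟨N, ?_⟩
        change 0 < a x + N * g x
        rw [div_lt_iff₀ h0] at hN
        linarith)
    (directed_of_isDirected_le fun M N hMN x (hx : 0 < a x + M * g x) => by
      change 0 < a x + N * g x
      have : (M : ℝ) * g x ≤ N * g x := mul_le_mul_of_nonneg_right (by exact_mod_cast hMN) (hg0 x)
      linarith)
  have hpos : ∀ x ∈ S, 0 < a x + (N + 1) * g x := fun x hx => by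
    have h1 : 0 < a x + N * g x := hN hx
    nlinarith [hg0 x]
  obtain ⟨c, hc, hle⟩ := hS.exists_forall_le' (f := fun x => a x + (N + 1) * g x)
    (by fun_prop) (a := 0) hpos
  exact ⟨N + 1, by positivity, c, hc, hle⟩

section SPC

variable {n : ℕ}

local notation "𝔼" => EuclideanSpace ℂ (Fin n)

/-- Bounded sets `{ρ < 0}` with strongly pseudoconvex boundary of class `C²`. -/
structure IsSPC (Ω : Set 𝔼) (ρ : 𝔼 → ℝ) : Prop where
  contDiff : ContDiff ℝ 2 ρ
  eq_setOf : Ω = {x | ρ x < 0}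
  bounded : Bornology.IsBounded Ω
  frontier_eq : frontier Ω = {x | ρ x = 0}
  fderiv_ne : ∀ x, ρ x = 0 → fderiv ℝ ρ x ≠ 0
  levi_pos : ∀ x w, ρ x = 0 → w ≠ 0 → fderiv ℝ ρ x w = 0 → fderiv ℝ ρ x (I • w) = 0 →
    0 < leviForm ρ x w

lemma leviForm_smul (φ : 𝔼 → ℝ) (x w : 𝔼) (t : ℝ) :
    leviForm φ x (t • w) = t ^ 2 * leviForm φ x w := by
  simp only [leviForm, smul_comm I t w, map_smul, _root_.smul_apply, smul_eq_mul]
  ring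

lemma continuous_leviForm {φ : 𝔼 → ℝ} (hφ : ContDiff ℝ 2 φ) :
    Continuous fun q : 𝔼 × 𝔼 => leviForm φ q.1 q.2 := by
  have h : Continuous (fderiv ℝ (fderiv ℝ φ)) :=
    (hφ.fderiv_right (m := 1) (by norm_num)).continuous_fderiv (by norm_num)
  unfold leviForm
  fun_prop

namespace IsSPC

variable {Ω : Set (EuclideanSpace ℂ (Fin n))} {ρ : EuclideanSpace ℂ (Fin n) → ℝ}

lemma closure_eq (h : IsSPC Ω ρ) : closure Ω = {x | ρ x ≤ 0} := by
  rw [closure_eq_self_union_frontier, h.frontier_eq, h.eq_setOf]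
  ext x
  exact (le_iff_lt_or_eq (a := ρ x) (b := 0)).symm

lemma isCompact_closure (h : IsSPC Ω ρ) : IsCompact (closure Ω) :=
  h.bounded.isCompact_closure

lemma exists_levi_lower (h : IsSPC Ω ρ) (R : ℝ) :
    ∃ N > 0, ∃ c > 0, ∀ x ∈ closedBall (0 : 𝔼) R, |ρ x| ≤ c → ∀ w,
      c * ‖w‖ ^ 2 ≤ leviForm ρ x w +
        N * (fderiv ℝ ρ x w ^ 2 + fderiv ℝ ρ x (I • w) ^ 2) := by
  have hc1 : Continuous (fderiv ℝ ρ) := h.contDiff.continuous_fderiv (by norm_num)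
  have hc0 : Continuous ρ := h.contDiff.continuous
  obtain ⟨N, hN, c, hc, H⟩ := ((isCompact_closedBall (0 : 𝔼) R).prod
    (isCompact_sphere (0 : 𝔼) 1)).exists_pos_le_add_mul (continuous_leviForm h.contDiff)
    (g := fun q => fderiv ℝ ρ q.1 q.2 ^ 2 + fderiv ℝ ρ q.1 (I • q.2) ^ 2 + |ρ q.1|)
    (by fun_prop) (fun q => by positivity) (fun q hq h0 => by
      have h1 := sq_nonneg (fderiv ℝ ρ q.1 q.2)
      have h2 := sq_nonneg (fderiv ℝ ρ q.1 (I • q.2))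
      have h3 := abs_nonneg (ρ q.1)
      refine h.levi_pos _ _ (abs_eq_zero.1 (by linarith)) ?_ (pow_eq_zero_iff two_ne_zero |>.1
        (by linarith)) (pow_eq_zero_iff two_ne_zero |>.1 (by linarith))
      rintro h4
      have h5 := hq.2
      rw [h4] at h5
      simp at h5)
  refine ⟨N, hN, min (c / 2) (c / (2 * N)), by positivity, fun x hx hρ w => ?_⟩
  have hunit : ∀ u : 𝔼, ‖u‖ = 1 → c / 2 ≤ leviForm ρ x u +
      N * (fderiv ℝ ρ x u ^ 2 + fderiv ℝ ρ x (I • u) ^ 2) := fun u hu => by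
    have h1 := H (x, u) ⟨hx, by simpa using hu⟩
    have h2 : |ρ x| ≤ c / (2 * N) := hρ.trans (min_le_right _ _)
    rw [le_div_iff₀ (by positivity)] at h2
    dsimp only at h1
    linarith
  rcases eq_or_ne w 0 with rfl | hw
  · simp [leviForm]
  · have hw' : ‖w‖ ≠ 0 := norm_ne_zero_iff.2 hw
    have h1 := hunit (‖w‖⁻¹ • w) (by rw [norm_smul, norm_inv, norm_norm, inv_mul_cancel₀ hw'])
    rw [leviForm_smul, smul_comm I, map_smul, map_smul, smul_eq_mul, smul_eq_mul] at h1
    have h2 : min (c / 2) (c / (2 * N)) * ‖w‖ ^ 2 ≤ c / 2 * ‖w‖ ^ 2 :=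
      mul_le_mul_of_nonneg_right (min_le_left _ _) (by positivity)
    have h3 := mul_le_mul_of_nonneg_right h1 (sq_nonneg ‖w‖)
    field_simp at h3
    linarith

end IsSPC

end SPC

section SPC

variable {n : ℕ}

local notation "𝔼" => EuclideanSpace ℂ (Fin n)

lemma leviForm_norm_sq (x w : 𝔼) : leviForm (fun y : 𝔼 => ‖y‖ ^ 2) x w = ‖w‖ ^ 2 := by
  have h : ∀ v : 𝔼, fderiv ℝ (fderiv ℝ (fun y : 𝔼 => ‖y‖ ^ 2)) x v v = 2 * ‖v‖ ^ 2 := fun v => by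
    rw [← fderiv_fderiv_apply (contDiff_norm_sq ℝ)]
    have h1 : (fun y : 𝔼 => fderiv ℝ (fun y : 𝔼 => ‖y‖ ^ 2) y v) =
        fun y => 2 * inner ℝ v y := by
      funext y
      rw [(hasStrictFDerivAt_norm_sq y).hasFDerivAt.fderiv]
      simp [real_inner_comm]
    rw [h1]
    have h2 : HasFDerivAt (fun y : 𝔼 => 2 * inner ℝ v y) ((2 : ℝ) • innerSL ℝ v) x :=
      ((2 : ℝ) • innerSL ℝ v).hasFDerivAt
    rw [h2.fderiv]
    simp
  simp only [leviForm, h, norm_smul, norm_I, one_mul]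
  ring

lemma leviForm_add {φ ψ : 𝔼 → ℝ} (hφ : ContDiff ℝ 2 φ) (hψ : ContDiff ℝ 2 ψ) (x w : 𝔼) :
    leviForm (fun y => φ y + ψ y) x w = leviForm φ x w + leviForm ψ x w := by
  have h1 : fderiv ℝ (fun y => φ y + ψ y) = fun y => fderiv ℝ φ y + fderiv ℝ ψ y := by
    funext y
    exact fderiv_fun_add (hφ.differentiable (by norm_num) y) (hψ.differentiable (by norm_num) y)
  have h2 : fderiv ℝ (fderiv ℝ (fun y => φ y + ψ y)) x =
      fderiv ℝ (fderiv ℝ φ) x + fderiv ℝ (fderiv ℝ ψ) x := by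
    rw [h1]
    exact fderiv_fun_add
      (((hφ.fderiv_right (m := 1) (by norm_num)).differentiable (by norm_num)) x)
      (((hψ.fderiv_right (m := 1) (by norm_num)).differentiable (by norm_num)) x)
  simp only [leviForm, h2, _root_.add_apply]
  ring

lemma leviForm_const_mul {φ : 𝔼 → ℝ} (hφ : ContDiff ℝ 2 φ) (a b : ℝ) (x w : 𝔼) :
    leviForm (fun y => a + b * φ y) x w = b * leviForm φ x w := by
  have hd : ∀ t : ℝ, HasDerivAt (fun t => a + b * t) b t := fun t => by
    simpa using ((hasDerivAt_id t).const_mul b).const_add a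
  rw [leviForm_real_comp hφ (g := fun t => a + b * t) (g' := fun _ => b)
    (Filter.Eventually.of_forall hd) (hasDerivAt_const _ b)]
  ring

namespace IsSPC

variable {Ω : Set (EuclideanSpace ℂ (Fin n))} {ρ : EuclideanSpace ℂ (Fin n) → ℝ}

/-- Strongly pseudoconvex neighbourhoods of the closure. -/
lemma exists_isDefining (h : IsSPC Ω ρ) : ∃ t₁ > 0, ∀ t, 0 < t → t ≤ t₁ →
    ∃ D r ε M, IsDefining D r ε M ∧ closure Ω ⊆ D ∧ (∀ x ∈ D, ρ x < t) ∧
      Bornology.IsBounded D := by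
  obtain ⟨R, hR0, hR⟩ : ∃ R > 0, closure Ω ⊆ ball (0 : 𝔼) R := by
    obtain ⟨R, hR⟩ := h.isCompact_closure.isBounded.subset_ball (0 : 𝔼)
    exact ⟨max R 1, by positivity, hR.trans (ball_subset_ball (le_max_left _ _))⟩
  obtain ⟨N, hN, c, hc, H⟩ := h.exists_levi_lower R
  have hcont : Continuous ρ := h.contDiff.continuous
  obtain ⟨m, hm, hm'⟩ := (isCompact_sphere (0 : 𝔼) R).exists_forall_le' (f := ρ)
    hcont.continuousOn (a := 0) (fun x hx => by
      by_contra! h0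
      have h1 := hR (h.closure_eq ▸ h0 : x ∈ closure Ω)
      rw [mem_ball] at h1
      exact h1.ne hx)
  refine ⟨min m (min c (1 / (4 * N))), by positivity, fun t ht htt => ?_⟩
  have htm := htt.trans (min_le_left _ _)
  have htc := (htt.trans (min_le_right _ _)).trans (min_le_left _ _)
  have htN := (htt.trans (min_le_right _ _)).trans (min_le_right _ _)
  rw [le_div_iff₀ (by positivity)] at htN
  set ε := t ^ 3 / R ^ 2 with hε
  have hε0 : 0 < ε := by positivity
  have hεR : ε * R ^ 2 = t ^ 3 := by rw [hε]; field_simp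
  set G : 𝔼 → ℝ := fun x => max (ρ x + t) 0 ^ 3 with hG
  set τ : 𝔼 → ℝ := fun x => G x + (0 + ε * ‖x‖ ^ 2) with hτ
  set r : 𝔼 → ℝ := fun x => 4 * t ^ 3 + (-1) * τ x with hr
  have hGc : ContDiff ℝ 2 G := contDiff_max_cube.comp (h.contDiff.add contDiff_const)
  have hnc : ContDiff ℝ 2 fun x : 𝔼 => ‖x‖ ^ 2 := contDiff_norm_sq ℝ
  have hec : ContDiff ℝ 2 fun x : 𝔼 => 0 + ε * ‖x‖ ^ 2 :=
    contDiff_const.add (contDiff_const.mul hnc)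
  have hτc : ContDiff ℝ 2 τ := hGc.add hec
  have hrc : ContDiff ℝ 2 r := contDiff_const.add (contDiff_const.mul hτc)
  have hbig : ∀ x, t ≤ ρ x → r x ≤ 0 := fun x hx => by
    have h1 : (2 * t) ^ 3 ≤ G x :=
      pow_le_pow_left₀ (by positivity) (le_max_of_le_left (by linarith)) 3
    have h2 : 0 ≤ ε * ‖x‖ ^ 2 := by positivity
    have h3 : 0 < t ^ 3 := by positivity
    simp only [hr, hτ]
    nlinarith
  have hlt : ∀ x, 0 < r x → ρ x < t := fun x hx => by
    by_contra! h1
    exact (hbig x h1).not_gt hx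
  have hr0 : Continuous r := hrc.continuous
  obtain ⟨M, hM⟩ := (isCompact_closedBall (0 : 𝔼) R).exists_bound_of_continuousOn
    (hrc.continuous_fderiv (by norm_num)).continuousOn
  refine ⟨{x | x ∈ ball (0 : 𝔼) R ∧ 0 < r x}, r, ε, M, ⟨?_, hrc, fun x hx => hx.2, ?_, hε0, ?_,
    fun x hx => hM x (ball_subset_closedBall hx.1)⟩, ?_, fun x hx => hlt x hx.2,
    isBounded_ball.subset fun x hx => hx.1⟩
  · exact isOpen_ball.inter (isOpen_lt continuous_const hr0)
  · intro c' hc'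
    have : {x | x ∈ {x | x ∈ ball (0 : 𝔼) R ∧ 0 < r x} ∧ c' ≤ r x} =
        closedBall (0 : 𝔼) R ∩ {x | c' ≤ r x} := by
      ext x
      refine ⟨fun hx => ⟨ball_subset_closedBall hx.1.1, hx.2⟩, fun hx => ?_⟩
      have h0 : 0 < r x := hc'.trans_le hx.2
      refine ⟨⟨mem_ball.2 (lt_of_le_of_ne (mem_closedBall.1 hx.1) fun h1 => ?_), h0⟩, hx.2⟩
      exact (hbig x (htm.trans (hm' x h1))).not_gt h0
    rw [this]
    exact (isCompact_closedBall _ _).inter_right (isClosed_le continuous_const hr0)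
  · intro x hx w
    have hd : ∀ s : ℝ, HasDerivAt (fun s => max (s + t) 0 ^ 3) (3 * max (s + t) 0 ^ 2) s :=
      fun s => by
        have := (hasDerivAt_max_pow 1 (s + t)).comp_add_const s t
        norm_num at this
        exact this
    have hd' : HasDerivAt (fun s => 3 * max (s + t) 0 ^ 2) (3 * (2 * max (ρ x + t) 0)) (ρ x) := by
      have := ((hasDerivAt_max_pow 0 (ρ x + t)).comp_add_const (ρ x) t).const_mul 3
      norm_num at this
      exact this
    have hL : leviForm r x w = -1 * (leviForm G x w + ε * ‖w‖ ^ 2) := by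
      rw [leviForm_const_mul hτc, leviForm_add hGc hec, leviForm_const_mul hnc, leviForm_norm_sq]
    have hGL : 0 ≤ leviForm G x w := by
      rw [hG, leviForm_real_comp h.contDiff (g := fun s => max (s + t) 0 ^ 3)
        (Filter.Eventually.of_forall hd) hd' w]
      rcases le_total (ρ x + t) 0 with h0 | h0
      · simp [max_eq_right h0]
      · rw [max_eq_left h0]
        have h1 := hlt x hx.2
        have h2 := H x (ball_subset_closedBall hx.1) (abs_le.2 ⟨by linarith, by linarith⟩) w
        have h3 : 0 ≤ c * ‖w‖ ^ 2 := by positivity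
        set s := ρ x + t
        set b := fderiv ℝ ρ x w ^ 2 + fderiv ℝ ρ x (I • w) ^ 2 with hb
        have hb0 : 0 ≤ b := by positivity
        have hs : 2 * s * N ≤ 1 := by nlinarith
        have h4 : 3 * s ^ 2 * (-(N * b)) ≤ 3 * s ^ 2 * leviForm ρ x w :=
          mul_le_mul_of_nonneg_left (by linarith) (by positivity)
        have h5 : 0 ≤ (1 - 2 * s * N) * (s * b) := mul_nonneg (by linarith) (by positivity)
        nlinarith
    rw [hL]
    linarith
  · intro x hx
    have h1 := hR hx
    have h2 : ρ x ≤ 0 := by rw [h.closure_eq] at hx; exact hx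
    have h3 : G x ≤ t ^ 3 :=
      pow_le_pow_left₀ (le_max_right _ _) (max_le (by linarith) ht.le) 3
    have h4 : ε * ‖x‖ ^ 2 ≤ t ^ 3 := by
      rw [← hεR]
      have : ‖x‖ < R := by simpa using h1
      gcongr
    have h5 : 0 < t ^ 3 := by positivity
    refine ⟨h1, ?_⟩
    simp only [hr, hτ]
    linarith

end IsSPC

end SPC

section LeviPolynomial

variable {n : ℕ}

local notation "𝔼" => EuclideanSpace ℂ (Fin n)

/-- Twice the complex-linear part of the differential of a real function. -/
noncomputable def holoDeriv (φ : 𝔼 → ℝ) (p : 𝔼) : 𝔼 →L[ℂ] ℂ := StrongDual.extendRCLike (𝕜 := ℂ) (fderiv ℝ φ p)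

lemma holoDeriv_apply (φ : 𝔼 → ℝ) (p v : 𝔼) :
    holoDeriv φ p v = fderiv ℝ φ p v - I * fderiv ℝ φ p (I • v) :=
  StrongDual.extendRCLike_apply _ _

lemma re_holoDeriv (φ : 𝔼 → ℝ) (p v : 𝔼) : (holoDeriv φ p v).re = fderiv ℝ φ p v := by
  simp [holoDeriv_apply]

lemma holoDeriv_eq_zero_iff {φ : 𝔼 → ℝ} {p v : 𝔼} :
    holoDeriv φ p v = 0 ↔ fderiv ℝ φ p v = 0 ∧ fderiv ℝ φ p (I • v) = 0 := by
  simp [holoDeriv_apply, Complex.ext_iff]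

/-- The holomorphic part of the quadratic form of a real bilinear form. -/
noncomputable def holoQuad (B : 𝔼 →L[ℝ] 𝔼 →L[ℝ] ℝ) (v : 𝔼) : ℂ :=
  (1 / 4) * (B v v - B (I • v) (I • v) : ℝ) - I / 2 * B v (I • v)

lemma hasFDerivAt_holoQuad (B : 𝔼 →L[ℝ] 𝔼 →L[ℝ] ℝ) (hB : ∀ v w, B v w = B w v) (v : 𝔼) :
    HasFDerivAt (holoQuad B) ((1 / 2 : ℂ) • (StrongDual.extendRCLike (𝕜 := ℂ) (B v) -
      I • StrongDual.extendRCLike (𝕜 := ℂ) (B (I • v)))) v := by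
  have hI : HasFDerivAt (fun v : 𝔼 => I • v) (I • ContinuousLinearMap.id ℝ 𝔼) v :=
    (hasFDerivAt_id v).const_smul I
  have hid := hasFDerivAt_id (𝕜 := ℝ) v
  have h1 := (B.hasFDerivAt (x := v)).clm_apply hid
  have h2 := ((B.hasFDerivAt (x := I • v)).comp v hI).clm_apply hI
  have h3 := (B.hasFDerivAt (x := v)).clm_apply hI
  have h4 := ((ofRealCLM.hasFDerivAt.comp v (h1.sub h2)).const_mul (1 / 4 : ℂ)).sub
    ((ofRealCLM.hasFDerivAt.comp v h3).const_mul (I / 2))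
  refine hasFDerivAt_of_restrictScalars ℝ h4 (ContinuousLinearMap.ext fun u => ?_)
  simp [StrongDual.extendRCLike_apply]
  rw [hB u v, hB (I • u) (I • v), hB u (I • v)]
  ring_nf
  simp only [I_sq]
  ring

lemma holoQuad_smul (B : 𝔼 →L[ℝ] 𝔼 →L[ℝ] ℝ) (t : ℝ) (v : 𝔼) :
    holoQuad B (t • v) = t ^ 2 * holoQuad B v := by
  simp only [holoQuad, smul_comm I t v, map_smul, _root_.smul_apply, smul_eq_mul]
  push_cast
  ring

lemma re_holoQuad (φ : 𝔼 → ℝ) (p v : 𝔼) : (holoQuad (fderiv ℝ (fderiv ℝ φ) p) v).re =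
    1 / 2 * fderiv ℝ (fderiv ℝ φ) p v v - leviForm φ p v := by
  simp only [holoQuad, leviForm, sub_re, mul_re, ofReal_re, ofReal_im, div_re, one_re, I_re, I_im]
  norm_num
  ring

namespace IsSPC

variable {Ω : Set (EuclideanSpace ℂ (Fin n))} {ρ : EuclideanSpace ℂ (Fin n) → ℝ}

/-- A quadratic holomorphic polynomial with real part below `ρ` near a boundary point. -/
lemma exists_levi_polynomial (h : IsSPC Ω ρ) {p : 𝔼} (hp : ρ p = 0) :
    ∃ P : 𝔼 → ℂ, Differentiable ℂ P ∧ P p = 0 ∧ fderiv ℂ P p = holoDeriv ρ p ∧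
      (∀ v, holoDeriv ρ p v = 0 → ∀ t : ℝ,
        P (p + t • v) = t ^ 2 * holoQuad (fderiv ℝ (fderiv ℝ ρ) p) v) ∧
      ∃ c > 0, ∃ a > 0, ∀ z ∈ ball p a, (P z).re ≤ 2 * max (ρ z) 0 - c * ‖z - p‖ ^ 2 := by
  obtain ⟨N, hN, c, hc, H⟩ := h.exists_levi_lower ‖p‖
  have hlev := H p (by simp) (by simpa [hp] using hc.le)
  have hd : ∀ t : ℝ, HasDerivAt (fun t => t + 2 * N * t ^ 2) (1 + 4 * N * t) t := fun t => by
    refine ((hasDerivAt_id t).add ((hasDerivAt_pow 2 t).const_mul (2 * N))).congr_deriv ?_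
    norm_num; ring
  have hd' : HasDerivAt (fun t => 1 + 4 * N * t) (4 * N) (ρ p) := by
    simpa using ((hasDerivAt_id (ρ p)).const_mul (4 * N)).const_add 1
  set σ : 𝔼 → ℝ := fun z => ρ z + 2 * N * ρ z ^ 2 with hσ
  have hσc : ContDiff ℝ 2 σ :=
    h.contDiff.add (contDiff_const.mul (h.contDiff.pow 2))
  have hσL : ∀ w, c * ‖w‖ ^ 2 ≤ leviForm σ p w := fun w => by
    rw [hσ, leviForm_real_comp h.contDiff (g := fun t => t + 2 * N * t ^ 2)
      (Filter.Eventually.of_forall hd) hd' w, hp]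
    have := hlev w
    linarith
  have hσ1 : fderiv ℝ σ p = fderiv ℝ ρ p := by
    have h1 := (hd (ρ p)).comp_hasFDerivAt p
      (h.contDiff.differentiable (by norm_num) p).hasFDerivAt
    rw [hp] at h1
    have h2 : HasFDerivAt σ _ p := h1
    rw [h2.fderiv]
    simp
  have hσ2 : ∀ v w, fderiv ℝ (fderiv ℝ σ) p v w = fderiv ℝ (fderiv ℝ ρ) p v w +
      4 * N * (fderiv ℝ ρ p v * fderiv ℝ ρ p w) := fun v w => by
    rw [hσ, fderiv_fderiv_real_comp h.contDiff (g := fun t => t + 2 * N * t ^ 2)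
      (Filter.Eventually.of_forall hd) hd' v w, hp]
    ring
  set B := fderiv ℝ (fderiv ℝ σ) p with hB
  have hBs : ∀ v w, B v w = B w v := fun v w => fderiv_fderiv_comm hσc p v w
  have hsub : ∀ z : 𝔼, HasFDerivAt (fun z : 𝔼 => z - p) (ContinuousLinearMap.id ℂ 𝔼) z :=
    fun z => (hasFDerivAt_id z).sub_const p
  have hPd : ∀ z, HasFDerivAt (fun z => holoDeriv ρ p (z - p) + holoQuad B (z - p)) _ z := fun z =>
    ((holoDeriv ρ p).hasFDerivAt.comp z (hsub z)).add
      (HasFDerivAt.comp (g := holoQuad B) z (hasFDerivAt_holoQuad B hBs (z - p)) (hsub z))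
  refine ⟨fun z => holoDeriv ρ p (z - p) + holoQuad B (z - p), fun z => (hPd z).differentiableAt,
    by simp [holoQuad], ?_, fun v hv t => ?_, ?_⟩
  · rw [(hPd p).fderiv]
    ext u
    simp [StrongDual.extendRCLike_apply]
  · obtain ⟨h1, h2⟩ := holoDeriv_eq_zero_iff.1 hv
    beta_reduce
    rw [add_sub_cancel_left, holoQuad_smul]
    simp [holoQuad, hσ2, h1, h2, hv]
  · obtain ⟨a, ha, hT⟩ := hσc.contDiffAt.exists_taylor_two (p := p) (half_pos hc)
    have hnear : ∀ᶠ z in nhds p, |ρ z| < 1 / (2 * N) := by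
      have h1 : Continuous fun z => |ρ z| := h.contDiff.continuous.abs
      exact h1.continuousAt.eventually (gt_mem_nhds (by beta_reduce; rw [hp, abs_zero]; positivity))
    obtain ⟨b, hb, hb'⟩ := Metric.eventually_nhds_iff.1 hnear
    refine ⟨c / 2, by positivity, min a b, by positivity, fun z hz => ?_⟩
    have hza : ‖z - p‖ < a := by
      rw [← dist_eq_norm]; exact (mem_ball.1 hz).trans_le (min_le_left _ _)
    have h1 := (hT p (mem_ball_self ha) (z - p) hza).2.2
    rw [add_sub_cancel, Real.norm_eq_abs, hσ1] at h1
    have h2 := (abs_le.1 h1).1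
    have h3 := hσL (z - p)
    have h4 : σ p = 0 := by simp [hσ, hp]
    have h5 := re_holoQuad σ p (z - p)
    have h6 : σ z ≤ 2 * max (ρ z) 0 := by
      have h7 := hb' ((mem_ball.1 hz).trans_le (min_le_right _ _))
      rw [lt_div_iff₀ (by positivity)] at h7
      have h8 : 2 * N * ρ z ^ 2 ≤ |ρ z| := by
        rw [← sq_abs]; nlinarith [abs_nonneg (ρ z)]
      have h9 : σ z ≤ ρ z + |ρ z| := by simp only [hσ]; linarith
      rcases le_total (ρ z) 0 with h0 | h0
      · rw [abs_of_nonpos h0] at h9; rw [max_eq_right h0]; linarith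
      · rw [abs_of_nonneg h0] at h9; rw [max_eq_left h0]; linarith
    rw [add_re, re_holoDeriv, ← hB] at *
    simp only [smul_eq_mul] at h2
    linarith

end IsSPC

end LeviPolynomial

section Cousin

variable {n : ℕ}

local notation "𝔼" => EuclideanSpace ℂ (Fin n)

lemma wirtBar_congr {f g : 𝔼 → ℂ} {x : 𝔼} (h : f =ᶠ[nhds x] g) (j : Fin n) :
    wirtBar j f x = wirtBar j g x := by
  simp only [wirtBar, h.fderiv_eq]

lemma wirtBar_eq_zero_of_eventuallyEq_const {f : 𝔼 → ℂ} {x : 𝔼} {c : ℂ}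
    (h : f =ᶠ[nhds x] fun _ => c) (j : Fin n) : wirtBar j f x = 0 := by
  rw [wirtBar_congr h]
  simp [wirtBar]

lemma wirtBar_eq_zero_of_differentiableAt {f : 𝔼 → ℂ} {x : 𝔼} (hf : DifferentiableAt ℂ f x)
    (j : Fin n) : wirtBar j f x = 0 := by
  have h : fderiv ℝ f x = (fderiv ℂ f x).restrictScalars ℝ :=
    (hf.hasFDerivAt.restrictScalars ℝ).fderiv
  simp [wirtBar, h, ← mul_assoc]

lemma smear_congr {ρ : 𝔼 → ℝ} {δ : ℝ} (h : IsMollifier ρ δ) {u v : 𝔼 → ℂ} {x : 𝔼}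
    (huv : ∀ y ∈ ball x δ, u y = v y) : smear ρ u x = smear ρ v x := by
  refine integral_congr_ae (Filter.Eventually.of_forall fun y => ?_)
  beta_reduce
  by_cases hy : y ∈ ball x δ
  · rw [huv y hy]
  · rw [h.zero _ (by simpa [dist_eq_norm, norm_sub_rev] using hy)]
    simp

/-- Solution of the additive Cousin problem with the single local datum `1 / P` near `p`. -/
lemma IsDefining.exists_cousin {D : Set 𝔼} {r : 𝔼 → ℝ} {ε M : ℝ} (h : IsDefining D r ε M)
    (hDb : Bornology.IsBounded D) {K : Set 𝔼} (hK : IsCompact K) (hKD : K ⊆ D) {P : 𝔼 → ℂ}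
    (hP : Differentiable ℂ P) {p : 𝔼} {a m : ℝ} (ha : 0 < a) (hm : 0 < m)
    (hPm : ∀ z ∈ D, a / 2 ≤ Dist.dist z p → Dist.dist z p < 4 * a → m ≤ ‖P z‖) :
    ∃ V : Set 𝔼, IsOpen V ∧ K ⊆ V ∧ ∃ w f : 𝔼 → ℂ, ∃ B : ℝ, 0 < B ∧
      DifferentiableOn ℂ w (V ∩ ball p (3 * a / 2)) ∧
      DifferentiableOn ℂ f (V \ closedBall p a) ∧
      (∀ z ∈ V, a < Dist.dist z p → Dist.dist z p < 3 * a / 2 →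
        P z ≠ 0 ∧ f z = (P z)⁻¹ - w z) ∧
      ∀ z ∈ V, ‖w z‖ ≤ B ∧ ‖f z‖ ≤ B := by
  classical
  let χ : ContDiffBump p := ⟨2 * a, 3 * a, by linarith, by linarith⟩
  set X : 𝔼 → ℂ := fun z => ((χ z : ℝ) : ℂ) with hX
  have hXc : ContDiff ℝ 2 X := contDiff_ofReal_comp χ.contDiff
  have hXne : ∀ z, X z ≠ 0 → Dist.dist z p < 3 * a := fun z hz => by
    by_contra! h0
    exact hz (by simp [hX, χ.zero_of_le_dist h0])
  have hX1 : ∀ z, Dist.dist z p < 2 * a → X z = 1 := fun z hz => by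
    simp [hX, χ.one_of_mem_closedBall (x := z) (le_of_lt hz : Dist.dist z p ≤ 2 * a)]
  have hXle : ∀ z, ‖X z‖ ≤ 1 := fun z => by
    rw [hX, Complex.norm_real, Real.norm_of_nonneg χ.nonneg]
    exact χ.le_one
  have hdist : Continuous fun z : 𝔼 => Dist.dist z p := continuous_id.dist continuous_const
  have hXz : ∀ z, Dist.dist z p < 2 * a ∨ 3 * a < Dist.dist z p → ∀ j,
      wirtBar j X =ᶠ[nhds z] fun _ => 0 := fun z hz j => by
    rcases hz with hz | hz
    · filter_upwards [(isOpen_lt hdist continuous_const).mem_nhds hz] with y hy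
      refine wirtBar_eq_zero_of_eventuallyEq_const (c := 1) ?_ j
      filter_upwards [(isOpen_lt hdist continuous_const).mem_nhds hy] with x hx using hX1 x hx
    · filter_upwards [(isOpen_lt continuous_const hdist).mem_nhds hz] with y hy
      refine wirtBar_eq_zero_of_eventuallyEq_const (c := 0) ?_ j
      filter_upwards [(isOpen_lt continuous_const hdist).mem_nhds hy] with x hx
      by_contra h0
      exact (hXne x h0).not_gt hx
  set ψ : 𝔼 → ℂ := fun z => (P z)⁻¹ with hψ
  have hP0 : ∀ z ∈ D, a / 2 ≤ Dist.dist z p → Dist.dist z p < 4 * a → P z ≠ 0 := fun z hz h1 h2 h0 => by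
    have := hPm z hz h1 h2
    rw [h0, norm_zero] at this
    linarith
  have hψd : ∀ z, P z ≠ 0 → DifferentiableAt ℂ ψ z := fun z hz => (hP z).fun_inv hz
  have hPc : ContDiff ℝ 2 P := by
    rw [← contDiffOn_univ]
    exact contDiffOn_two_of_differentiableOn isOpen_univ hP.differentiableOn
  have hψc : ∀ z, P z ≠ 0 → ContDiffAt ℝ 2 ψ z := fun z hz => hPc.contDiffAt.inv hz
  set α : Fin n → 𝔼 → ℂ := fun j z => wirtBar j X z * ψ z with hα
  have hα0 : ∀ z, Dist.dist z p < 2 * a ∨ 3 * a < Dist.dist z p → ∀ j, α j =ᶠ[nhds z] fun _ => 0 :=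
    fun z hz j => (hXz z hz j).mono fun y hy => by simp only [hα, hy, zero_mul]
  have hcase : ∀ z, (Dist.dist z p < 2 * a ∨ 3 * a < Dist.dist z p) ∨
      (a / 2 ≤ Dist.dist z p ∧ Dist.dist z p < 4 * a) := fun z => by
    by_cases h1 : Dist.dist z p < 2 * a
    · exact Or.inl (Or.inl h1)
    · by_cases h2 : 3 * a < Dist.dist z p
      · exact Or.inl (Or.inr h2)
      · exact Or.inr ⟨by linarith, by linarith⟩
  have hα1 : ∀ j, ContDiffOn ℝ 1 (α j) D := fun j z hz => by
    rcases hcase z with hz1 | ⟨hz1, hz2⟩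
    · exact (contDiffAt_const.congr_of_eventuallyEq (hα0 z hz1 j)).contDiffWithinAt
    · exact ((contDiff_wirtBar hXc j).contDiffAt.mul
        ((hψc z (hP0 z hz hz1 hz2)).of_le (by norm_num))).contDiffWithinAt
  have hbound : ∀ j, ∃ B : ℝ, 0 ≤ B ∧ ∀ x ∈ closedBall p (3 * a), ‖wirtBar j X x‖ ≤ B :=
    fun j => exists_nonneg_bound (isCompact_closedBall p (3 * a))
      (contDiff_wirtBar hXc j).continuous.continuousOn
  choose b hb0 hb using hbound
  have hαb : ∀ j, ∀ x ∈ D, ‖α j x‖ ≤ ∑ i, b i * m⁻¹ := fun j x hx => by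
    have h1 : ‖α j x‖ ≤ b j * m⁻¹ := by
      rcases hcase x with hz1 | ⟨hz1, hz2⟩
      · rw [(hα0 x hz1 j).self_of_nhds, norm_zero]
        exact mul_nonneg (hb0 j) (by positivity)
      · by_cases h3 : 3 * a < Dist.dist x p
        · rw [(hα0 x (Or.inr h3) j).self_of_nhds, norm_zero]
          exact mul_nonneg (hb0 j) (by positivity)
        · simp only [hα, hψ, norm_mul, norm_inv]
          exact mul_le_mul (hb j x (not_lt.1 h3)) (inv_anti₀ hm (hPm x hx hz1 hz2))
            (by positivity) (hb0 j)
    exact h1.trans (Finset.single_le_sum (f := fun i => b i * m⁻¹)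
      (fun i _ => mul_nonneg (hb0 i) (by positivity)) (Finset.mem_univ j))
  have hαc : ∀ j k, ∀ x ∈ D, wirtBar k (α j) x = wirtBar j (α k) x := fun j k x hx => by
    rcases hcase x with hz1 | ⟨hz1, hz2⟩
    · rw [wirtBar_eq_zero_of_eventuallyEq_const (hα0 x hz1 j),
        wirtBar_eq_zero_of_eventuallyEq_const (hα0 x hz1 k)]
    · have h0 := hP0 x hx hz1 hz2
      have hd := ((hψc x h0).differentiableAt (by norm_num))
      have hw : ∀ j, DifferentiableAt ℝ (wirtBar j X) x := fun j =>
        (contDiff_wirtBar hXc j).differentiable (by norm_num) x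
      simp only [hα]
      rw [wirtBar_mul (hw j) hd, wirtBar_mul (hw k) hd,
        wirtBar_eq_zero_of_differentiableAt (hψd x h0),
        wirtBar_eq_zero_of_differentiableAt (hψd x h0), wirtBar_wirtBar_comm hXc]
      ring
  have hvol : volume D ≠ ⊤ := hDb.measure_lt_top.ne
  obtain ⟨η, hη, hηD⟩ := hK.exists_cthickening_subset_open h.isOpen hKD
  have hK1 : IsCompact (cthickening η K) := hK.cthickening
  obtain ⟨δ₀, hδ₀, H⟩ := exists_wirtBar_eq_smear h hvol hα1 hαb hαc
    (hK.cthickening (r := η / 2)) ((cthickening_mono (by linarith) _).trans hηD)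
  have hV : ∀ z ∈ thickening (η / 2) K, ball z (η / 2) ⊆ cthickening η K := fun z hz y hy => by
    obtain ⟨k, hk, hzk⟩ := mem_thickening_iff.1 hz
    refine thickening_subset_cthickening _ _ (mem_thickening_iff.2 ⟨k, hk, ?_⟩)
    have := dist_triangle y z k
    rw [mem_ball] at hy
    linarith
  set S : Set 𝔼 := cthickening η K \ ball p (a / 2) with hS
  set β : 𝔼 → ℂ := fun z => X z * ψ z with hβ
  have hβc : ∀ y ∈ D, a / 2 ≤ Dist.dist y p → ContDiffAt ℝ 1 β y ∧ ∀ j, wirtBar j β y = α j y :=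
    fun y hy hya => by
      by_cases h4 : Dist.dist y p < 4 * a
      · have h0 := hP0 y hy hya h4
        refine ⟨((hXc.contDiffAt.mul (hψc y h0)).of_le (by norm_num)), fun j => ?_⟩
        rw [hβ, wirtBar_mul (hXc.differentiable (by norm_num) y)
          ((hψc y h0).differentiableAt (by norm_num)),
          wirtBar_eq_zero_of_differentiableAt (hψd y h0), mul_zero, add_zero]
      · have h5 : 3 * a < Dist.dist y p := by linarith
        have h6 : β =ᶠ[nhds y] fun _ => 0 := by
          filter_upwards [(isOpen_lt continuous_const hdist).mem_nhds h5] with x hx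
          have : X x = 0 := by
            by_contra h0
            exact (hXne x h0).not_gt hx
          simp only [hβ, this, zero_mul]
        refine ⟨contDiffAt_const.congr_of_eventuallyEq h6, fun j => ?_⟩
        rw [wirtBar_eq_zero_of_eventuallyEq_const h6, (hα0 y (Or.inr h5) j).self_of_nhds]
  have hβb : ∀ z ∈ S, ‖β z‖ ≤ m⁻¹ := fun z hz => by
    have h1 : a / 2 ≤ Dist.dist z p := not_lt.1 hz.2
    by_cases h0 : X z = 0
    · simp only [hβ, h0, zero_mul, norm_zero]; positivity
    · have h2 := hPm z (hηD hz.1) h1 (by linarith [hXne z h0])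
      simp only [hβ, hψ, norm_mul, norm_inv]
      calc ‖X z‖ * ‖P z‖⁻¹ ≤ 1 * m⁻¹ :=
            mul_le_mul (hXle z) (inv_anti₀ hm h2) (by positivity) zero_le_one
        _ = m⁻¹ := one_mul _
  have hSm : MeasurableSet S := hK1.isClosed.measurableSet.diff measurableSet_ball
  have hfi : Integrable (S.indicator β) := by
    rw [integrable_indicator_iff hSm]
    refine Measure.integrableOn_of_bounded (M := m⁻¹)
      ((measure_mono sdiff_subset).trans_lt hK1.measure_lt_top).ne
      ((hXc.continuous.measurable.mul hPc.continuous.measurable.inv).aestronglyMeasurable) ?_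
    rw [ae_restrict_iff' hSm]
    exact Filter.Eventually.of_forall hβb
  set δ := min δ₀ (min (η / 4) (a / 4)) with hδdef
  have hδ : 0 < δ := by positivity
  have hδη : δ ≤ η / 4 := (min_le_right _ _).trans (min_le_left _ _)
  have hδa : δ ≤ a / 4 := (min_le_right _ _).trans (min_le_right _ _)
  obtain ⟨μ, hμ⟩ := exists_isMollifier (n := n) hδ
  obtain ⟨w, hwc, hw⟩ := H μ δ (min_le_left _ _) hμ
  set f := smear μ (S.indicator β) with hf
  have hfc : ContDiff ℝ 2 f := contDiff_smear hμ hfi.locallyIntegrable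
  obtain ⟨B₁, hB₁, hwB⟩ := exists_nonneg_bound (hK.cthickening (r := η / 2))
    hwc.continuous.continuousOn
  obtain ⟨B₂, hB₂, hfB⟩ := exists_nonneg_bound (hK.cthickening (r := η / 2))
    (hfc.continuous.sub hwc.continuous).continuousOn
  set δ' := min (η / 2) (a / 2) with hδ'def
  have hδδ' : δ < δ' := lt_min (by linarith) (by linarith)
  have hball : ∀ z ∈ thickening (η / 2) K, a < Dist.dist z p → ball z δ' ⊆ S := fun z hz hza y hy => by
    refine ⟨hV z hz (ball_subset_ball (min_le_left _ _) hy), fun hy' => ?_⟩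
    have h1 := (mem_ball.1 hy).trans_le (min_le_right _ _)
    have h2 := dist_triangle_left z p y
    rw [mem_ball] at hy'
    linarith
  have hsub : thickening (η / 2) K ⊆ cthickening (η / 2) K := thickening_subset_cthickening _ _
  refine ⟨thickening (η / 2) K, isOpen_thickening, self_subset_thickening (by positivity) K, w,
    fun z => f z - w z, B₁ + B₂ + 1, by positivity, fun z hz => ?_, fun z hz => ?_,
    fun z hz hza hza' => ?_, fun z hz => ⟨?_, ?_⟩⟩
  · refine (differentiableAt_of_wirtBar_eq_zero (hwc.differentiable (by norm_num) z)
      fun j => ?_).differentiableWithinAt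
    rw [hw z (hsub hz.1)]
    refine smear_eq_zero hμ fun y hy => (hα0 y (Or.inl ?_) j).self_of_nhds
    have h1 := mem_ball.1 hy
    have h2 := mem_ball.1 hz.2
    have h3 := dist_triangle y z p
    linarith
  · have hza : a < Dist.dist z p := not_le.1 hz.2
    refine (differentiableAt_of_wirtBar_eq_zero ((hfc.sub hwc).differentiable (by norm_num) z)
      fun j => ?_).differentiableWithinAt
    have hfS := hball z hz.1 hza
    have h1 : ∀ y ∈ ball z δ', S.indicator β =ᶠ[nhds y] β := fun y hy => by
      filter_upwards [isOpen_ball.mem_nhds hy] with x hx using indicator_of_mem (hfS hx) _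
    have h2 : ∀ y ∈ ball z δ', y ∈ D ∧ a / 2 ≤ Dist.dist y p := fun y hy =>
      ⟨hηD (hfS hy).1, not_lt.1 (hfS hy).2⟩
    rw [wirtBar_sub (hfc.differentiable (by norm_num) z) (hwc.differentiable (by norm_num) z),
      hw z (hsub hz.1), hf, wirtBar_smear_of_contDiffOn hμ hδδ' hfi.locallyIntegrable
        (fun y hy => ((hβc y (h2 y hy).1 (h2 y hy).2).1.congr_of_eventuallyEq
          (h1 y hy)).contDiffWithinAt), sub_eq_zero]
    refine smear_congr hμ fun y hy => ?_
    have hy' := ball_subset_ball hδδ'.le hy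
    rw [wirtBar_congr (h1 y hy'), (hβc y (h2 y hy').1 (h2 y hy').2).2]
  · refine ⟨hP0 z (hηD (cthickening_mono (by linarith) _ (hsub hz))) (by linarith)
      (by linarith), ?_⟩
    have hfS := hball z hz hza
    have h1 : ∀ y ∈ ball z δ, S.indicator β y = ψ y := fun y hy => by
      rw [indicator_of_mem (hfS (ball_subset_ball hδδ'.le hy))]
      have h3 := dist_triangle y z p
      rw [mem_ball] at hy
      simp only [hβ, hX1 y (by linarith), one_mul]
    beta_reduce
    rw [hf, smear_congr hμ h1, smear_eq_self_of_differentiableOn hμ hδδ' fun y hy => ?_]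
    have h3 := dist_triangle y z p
    have h4 := (mem_ball.1 hy).trans_le (min_le_right (η / 2) (a / 2))
    exact (hψd y (hP0 y (hηD (hfS hy).1) (not_lt.1 (hfS hy).2)
      (by linarith))).differentiableWithinAt
  · linarith [hwB z (hsub hz)]
  · have h1 : ‖f z - w z‖ ≤ B₂ := hfB z (hsub hz)
    change ‖f z - w z‖ ≤ _
    linarith

end Cousin

section Peak

variable {n : ℕ}

local notation "𝔼" => EuclideanSpace ℂ (Fin n)

lemma re_inv_le_of_re_le {G : ℂ} {κ : ℝ} (hG : G ≠ 0) (h : G.re ≤ -κ * ‖G‖ ^ 2) :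
    (G⁻¹).re ≤ -κ := by
  rw [inv_re, normSq_eq_norm_sq, div_le_iff₀ (by positivity)]
  exact h

lemma re_inv_inv_sub_le {P u : ℂ} {s κ M : ℝ} (hP : P ≠ 0) (hPs : P.re ≤ -s) (hs : 0 ≤ s)
    (hu : 1 ≤ u.re) (huM : ‖u‖ ≤ M) (hκ0 : 0 ≤ κ) (hκs : κ ≤ s / 2) (hκM : κ * (2 * M ^ 2) ≤ 1) :
    P⁻¹ - u ≠ 0 ∧ ((P⁻¹ - u)⁻¹).re ≤ -κ := by
  have h1 : (P⁻¹).re ≤ -(s * ‖P⁻¹‖ ^ 2) := by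
    rw [inv_re, normSq_eq_norm_sq, norm_inv, inv_pow, ← div_eq_mul_inv, ← neg_div]
    exact div_le_div_of_nonneg_right hPs (by positivity)
  have hre : (P⁻¹ - u).re ≤ -(s * ‖P⁻¹‖ ^ 2) - 1 := by
    rw [sub_re]; linarith
  have h0 : 0 ≤ s * ‖P⁻¹‖ ^ 2 := by positivity
  have hne : P⁻¹ - u ≠ 0 := fun h => by rw [h, zero_re] at hre; linarith
  refine ⟨hne, re_inv_le_of_re_le hne ?_⟩
  have h2 : ‖P⁻¹ - u‖ ≤ ‖P⁻¹‖ + M := (norm_sub_le _ _).trans (by linarith)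
  have h3 : ‖P⁻¹ - u‖ ^ 2 ≤ 2 * ‖P⁻¹‖ ^ 2 + 2 * M ^ 2 := by
    nlinarith [norm_nonneg (P⁻¹ - u), sq_nonneg (‖P⁻¹‖ - M), norm_nonneg P⁻¹]
  nlinarith [mul_le_mul_of_nonneg_left h3 hκ0,
    mul_le_mul_of_nonneg_right hκs (sq_nonneg ‖P⁻¹‖)]

namespace IsSPC

variable {Ω : Set (EuclideanSpace ℂ (Fin n))} {ρ : EuclideanSpace ℂ (Fin n) → ℝ}

/-- A holomorphic peak function on a neighbourhood of the closure, with prescribed second-order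
behaviour at the boundary point. -/
lemma exists_peak (h : IsSPC Ω ρ) {p : 𝔼} (hp : ρ p = 0) :
    ∃ V : Set 𝔼, IsOpen V ∧ closure Ω ⊆ V ∧ ∃ g : 𝔼 → ℂ, DifferentiableOn ℂ g V ∧ g p = 0 ∧
      fderiv ℂ g p = holoDeriv ρ p ∧
      (∀ v, holoDeriv ρ p v = 0 → Filter.Tendsto (fun t : ℝ => g (p + t • v) / (t : ℂ) ^ 2)
        (nhdsWithin 0 {0}ᶜ) (nhds (holoQuad (fderiv ℝ (fderiv ℝ ρ) p) v))) ∧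
      ∃ c > 0, ∀ z ∈ closure Ω, (g z).re ≤ -(c * ‖z - p‖ ^ 2) := by
  obtain ⟨P, hPd, hPp, hP', hPq, c, hc, a', ha', hPc⟩ := h.exists_levi_polynomial hp
  obtain ⟨t₁, ht₁, hD⟩ := h.exists_isDefining
  set a := a' / 4 with ha_def
  have ha : 0 < a := by positivity
  obtain ⟨D, r, ε, M, hdef, hΩD, hDt, hDb⟩ := hD (min t₁ (c * a ^ 2 / 32)) (by positivity)
    (min_le_left _ _)
  have hPm : ∀ z ∈ D, a / 2 ≤ Dist.dist z p → Dist.dist z p < 4 * a → c * a ^ 2 / 8 ≤ ‖P z‖ :=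
    fun z hz h1 h2 => by
      have h3 := hPc z (mem_ball.2 (by linarith))
      have h4 : ρ z ≤ c * a ^ 2 / 32 := (hDt z hz).le.trans (min_le_right _ _)
      have h5 : max (ρ z) 0 ≤ c * a ^ 2 / 32 := max_le h4 (by positivity)
      rw [dist_eq_norm] at h1
      have h6 : (a / 2) ^ 2 ≤ ‖z - p‖ ^ 2 := pow_le_pow_left₀ (by positivity) h1 2
      have h7 := mul_le_mul_of_nonneg_left h6 hc.le
      have h8 := (abs_le.1 (abs_re_le_norm (P z))).1
      nlinarith
  obtain ⟨V, hV, hΩV, w, f, B, hB, hw, hf, hfw, hbd⟩ := hdef.exists_cousin hDb h.isCompact_closure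
    hΩD hPd ha (m := c * a ^ 2 / 8) (by positivity) hPm
  set C : ℂ := ((B + 1 : ℝ) : ℂ) with hC
  have hCn : ‖C‖ = B + 1 := by rw [hC, Complex.norm_real, Real.norm_of_nonneg (by linarith)]
  set u : 𝔼 → ℂ := fun z => w z + C with hu
  have hure : ∀ z ∈ V, 1 ≤ (u z).re := fun z hz => by
    have h1 := (abs_le.1 ((abs_re_le_norm (w z)).trans (hbd z hz).1)).1
    simp only [hu, hC, add_re, ofReal_re]
    linarith
  have huM : ∀ z ∈ V, ‖u z‖ ≤ 2 * B + 1 := fun z hz => by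
    have := norm_add_le (w z) C
    have := (hbd z hz).1
    simp only [hu]
    linarith
  set G : 𝔼 → ℂ := fun z => f z - C with hG
  have hGre : ∀ z ∈ V, (G z).re ≤ -1 := fun z hz => by
    have h1 := (abs_le.1 ((abs_re_le_norm (f z)).trans (hbd z hz).2)).2
    simp only [hG, hC, sub_re, ofReal_re]
    linarith
  have hGne : ∀ z ∈ V, G z ≠ 0 := fun z hz h0 => by
    have := hGre z hz
    rw [h0, zero_re] at this
    linarith
  have hGM : ∀ z ∈ V, ‖G z‖ ≤ 2 * B + 1 := fun z hz => by
    have := norm_sub_le (f z) C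
    have := (hbd z hz).2
    simp only [hG]
    linarith
  set E : 𝔼 → ℂ := fun z => 1 - u z * P z with hE
  set N : Set 𝔼 := V ∩ ball p (3 * a / 2) with hN
  have hNo : IsOpen N := hV.inter isOpen_ball
  have hud : DifferentiableOn ℂ u N := hw.add_const C
  have hEd : DifferentiableOn ℂ E N := (hud.mul hPd.differentiableOn).const_sub 1
  set W₁ : Set 𝔼 := N ∩ E ⁻¹' {0}ᶜ with hW₁
  have hW₁o : IsOpen W₁ := hEd.continuousOn.isOpen_inter_preimage hNo isOpen_compl_singleton
  set W₂ : Set 𝔼 := V \ closedBall p a with hW₂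
  have hW₂o : IsOpen W₂ := hV.sdiff isClosed_closedBall
  classical
  set g : 𝔼 → ℂ := fun z => if Dist.dist z p < 3 * a / 2 then P z / E z else (G z)⁻¹ with hg
  have hg1 : ∀ z ∈ W₁, g z = P z / E z := fun z hz => if_pos hz.1.2
  have hg2 : ∀ z ∈ W₂, g z = (G z)⁻¹ := fun z hz => by
    by_cases h1 : Dist.dist z p < 3 * a / 2
    · obtain ⟨h3, h2⟩ := hfw z hz.1 (not_le.1 hz.2) h1
      simp only [hg, if_pos h1, hE, hG, hu, h2]
      rw [show 1 - (w z + C) * P z = P z * ((P z)⁻¹ - w z - C) by field_simp; ring, div_mul_eq_div_div,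
        div_self h3, one_div]
    · simp only [hg, if_neg h1]
  have hgd1 : DifferentiableOn ℂ g W₁ :=
    (hPd.differentiableOn.fun_mul ((hEd.mono inter_subset_left).fun_inv fun z hz => hz.2)).congr
      fun z hz => by rw [hg1 z hz, div_eq_mul_inv]
  have hgd2 : DifferentiableOn ℂ g W₂ :=
    ((hf.sub_const C).fun_inv fun z hz => hGne z hz.1).congr hg2
  have hpV : p ∈ V := hΩV (by rw [h.closure_eq]; exact hp.le)
  have hpW : p ∈ W₁ := ⟨⟨hpV, mem_ball_self (by positivity)⟩, by simp [hE, hPp]⟩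
  obtain ⟨R, hR⟩ := hDb.subset_ball p
  set R' := max R 1 with hR'
  have hdR : ∀ z ∈ closure Ω, ‖z - p‖ ≤ R' := fun z hz => by
    rw [← dist_eq_norm]
    exact (mem_ball.1 (hR (hΩD hz))).le.trans (le_max_left _ _)
  have hR'0 : 0 < R' := by positivity
  set c' := min (c / 2) (1 / (2 * (2 * B + 1) ^ 2 * R' ^ 2)) with hc'
  have hc'0 : 0 < c' := by positivity
  have hκ : ∀ z ∈ closure Ω, c' * ‖z - p‖ ^ 2 * (2 * (2 * B + 1) ^ 2) ≤ 1 := fun z hz => by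
    have h1 : c' ≤ 1 / (2 * (2 * B + 1) ^ 2 * R' ^ 2) := min_le_right _ _
    rw [le_div_iff₀ (by positivity)] at h1
    have h2 : ‖z - p‖ ^ 2 ≤ R' ^ 2 := pow_le_pow_left₀ (norm_nonneg _) (hdR z hz) 2
    have h3 := mul_le_mul_of_nonneg_left h2
      (by positivity : 0 ≤ c' * (2 * (2 * B + 1) ^ 2))
    linarith
  have hκs : ∀ z : 𝔼, c' * ‖z - p‖ ^ 2 ≤ c * ‖z - p‖ ^ 2 / 2 := fun z => by
    have := mul_le_mul_of_nonneg_right (min_le_left _ _ : c' ≤ c / 2) (sq_nonneg ‖z - p‖)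
    linarith
  have hin : ∀ z ∈ closure Ω, Dist.dist z p < 3 * a / 2 →
      E z ≠ 0 ∧ (P z / E z).re ≤ -(c' * ‖z - p‖ ^ 2) := fun z hz hza => by
    have h0 : ρ z ≤ 0 := by rw [h.closure_eq] at hz; exact hz
    have h1 := hPc z (mem_ball.2 (by linarith))
    rw [max_eq_right h0, mul_zero, zero_sub] at h1
    by_cases hP0 : P z = 0
    · rw [hP0, zero_re] at h1
      have h2 := hκs z
      simp only [hE, hP0, mul_zero, sub_zero, zero_div, zero_re]
      exact ⟨one_ne_zero, by linarith⟩
    · obtain ⟨h2, h3⟩ := re_inv_inv_sub_le hP0 h1 (by positivity) (hure z (hΩV hz))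
        (huM z (hΩV hz)) (by positivity) (hκs z) (hκ z hz)
      have h4 : E z = P z * ((P z)⁻¹ - u z) := by
        simp only [hE]; field_simp
      rw [h4, div_mul_eq_div_div, div_self hP0, one_div]
      exact ⟨mul_ne_zero hP0 h2, h3⟩
  refine ⟨W₁ ∪ W₂, hW₁o.union hW₂o, fun z hz => ?_, g, ?_, ?_, ?_, fun v hv => ?_, c', hc'0,
    fun z hz => ?_⟩
  · by_cases hza : Dist.dist z p < 3 * a / 2
    · exact Or.inl ⟨⟨hΩV hz, hza⟩, (hin z hz hza).1⟩
    · exact Or.inr ⟨hΩV hz, fun hza' => hza (by linarith [mem_closedBall.1 hza'])⟩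
  · exact hgd1.union_of_isOpen hgd2 hW₁o hW₂o
  · rw [hg1 p hpW, hPp, zero_div]
  · have h1 : g =ᶠ[nhds p] fun z => P z * (E z)⁻¹ := by
      filter_upwards [hW₁o.mem_nhds hpW] with z hz
      rw [hg1 z hz, div_eq_mul_inv]
    have h2 : DifferentiableAt ℂ (fun z => (E z)⁻¹) p :=
      (hEd.differentiableAt (hNo.mem_nhds hpW.1)).fun_inv hpW.2
    rw [h1.fderiv_eq, fderiv_fun_mul (hPd p) h2, hPp, hP']
    have h3 : E p = 1 := by simp [hE, hPp]
    rw [h3, inv_one]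
    ext v
    change (0 : ℂ) * _ + (1 : ℂ) * holoDeriv ρ p v = _
    rw [zero_mul, one_mul, zero_add]
  · have h1 : Continuous fun t : ℝ => p + t • v := by fun_prop
    have h2 : ContinuousAt (fun t : ℝ => (E (p + t • v))⁻¹) 0 := by
      have h3 : ContinuousAt E (p + (0 : ℝ) • v) := by
        rw [zero_smul, add_zero]
        exact (hEd.differentiableAt (hNo.mem_nhds hpW.1)).continuousAt
      refine ContinuousAt.inv₀ (h3.comp (f := fun t : ℝ => p + t • v) h1.continuousAt) ?_
      simp [hE, hPp]
    have h4 : Filter.Tendsto (fun t : ℝ => holoQuad (fderiv ℝ (fderiv ℝ ρ) p) v *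
        (E (p + t • v))⁻¹) (nhdsWithin 0 {0}ᶜ)
        (nhds (holoQuad (fderiv ℝ (fderiv ℝ ρ) p) v)) := by
      have h5 := (h2.tendsto.const_mul (holoQuad (fderiv ℝ (fderiv ℝ ρ) p) v)).mono_left
        (nhdsWithin_le_nhds (s := {0}ᶜ))
      simpa [hE, hPp] using h5
    refine h4.congr' ?_
    have h6 : ∀ᶠ t : ℝ in nhds 0, p + t • v ∈ W₁ :=
      h1.continuousAt.eventually (hW₁o.mem_nhds (by simpa using hpW))
    filter_upwards [nhdsWithin_le_nhds h6, self_mem_nhdsWithin] with t ht ht0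
    have ht0' : (t : ℂ) ≠ 0 := by exact_mod_cast ht0
    rw [hg1 _ ht, hPq v hv t]
    field_simp
  · by_cases hza : Dist.dist z p < 3 * a / 2
    · simp only [hg, if_pos hza]
      exact (hin z hz hza).2
    · simp only [hg, if_neg hza]
      refine (re_inv_le_of_re_le (hGne z (hΩV hz)) ?_)
      have h1 := hGM z (hΩV hz)
      have h2 := hGre z (hΩV hz)
      have h3 := hκ z hz
      have h4 : ‖G z‖ ^ 2 ≤ (2 * B + 1) ^ 2 := pow_le_pow_left₀ (norm_nonneg _) h1 2
      have h5 := mul_le_mul_of_nonneg_left h4 (by positivity : 0 ≤ c' * ‖z - p‖ ^ 2)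
      nlinarith

end IsSPC

end Peak

section Complement

lemma isPreconnected_setOf_lt_norm {E : Type*} [NormedAddCommGroup E] [NormedSpace ℝ E]
    (h : 1 < Module.rank ℝ E) {R : ℝ} (hR : 0 ≤ R) : IsPreconnected {z : E | R < ‖z‖} := by
  have h1 : {z : E | R < ‖z‖} = (fun q : ℝ × E => q.1 • q.2) '' (Ioi R ×ˢ sphere 0 1) := by
    ext z
    constructor
    · intro hz
      have hz0 : 0 < ‖z‖ := hR.trans_lt hz
      refine ⟨(‖z‖, ‖z‖⁻¹ • z), ⟨hz, ?_⟩, smul_inv_smul₀ hz0.ne' z⟩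
      rw [mem_sphere_zero_iff_norm, norm_smul, norm_inv, norm_norm, inv_mul_cancel₀ hz0.ne']
    · rintro ⟨⟨r, u⟩, ⟨hr, hu⟩, rfl⟩
      have hr' : R < r := hr
      change R < ‖r • u‖
      rw [norm_smul, mem_sphere_zero_iff_norm.1 hu, mul_one, Real.norm_of_nonneg (by linarith)]
      exact hr'
  rw [h1]
  exact (isPreconnected_Ioi.prod (isPreconnected_sphere h 0 1)).image _
    (by fun_prop)

variable {E : Type*} [NormedAddCommGroup E] [NormedSpace ℝ E]

/-- Near a regular zero, the positive side of a `C¹` function is connected inside `{0 < ρ}`. -/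
lemma exists_ball_subset_isPreconnected {ρ : E → ℝ} (hρ : ContDiff ℝ 1 ρ) {q : E} (hq : ρ q = 0)
    (hd : fderiv ℝ ρ q ≠ 0) : ∃ r > 0, ∃ C : Set E, IsPreconnected C ∧ C ⊆ {x | 0 < ρ x} ∧
      ∀ x ∈ ball q r, 0 < ρ x → x ∈ C := by
  obtain ⟨e, he⟩ : ∃ e, 0 < fderiv ℝ ρ q e := by
    obtain ⟨e, he⟩ := ContinuousLinearMap.exists_ne_zero hd
    rcases he.lt_or_gt with h | h
    · exact ⟨-e, by simpa using h⟩
    · exact ⟨e, h⟩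
  have hc : Continuous fun x => fderiv ℝ ρ x e :=
    (hρ.continuous_fderiv (by norm_num)).clm_apply continuous_const
  obtain ⟨a, ha, hpos⟩ := Metric.eventually_nhds_iff_ball.1
    (hc.continuousAt.eventually (lt_mem_nhds he))
  set r := a / (2 * (‖e‖ + 1)) with hr
  have he1 : 0 < ‖e‖ + 1 := by positivity
  have hr0 : 0 < r := by positivity
  have hra : r * (‖e‖ + 1) = a / 2 := by rw [hr]; field_simp
  have hmono : ∀ x ∈ ball q (a / 2), ∀ t ∈ Icc 0 r, ρ x ≤ ρ (x + t • e) ∧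
      (0 < t → ρ x < ρ (x + t • e)) := fun x hx t ht => by
    have hder : ∀ s : ℝ, HasDerivAt (fun s : ℝ => ρ (x + s • e)) (fderiv ℝ ρ (x + s • e) e) s :=
      fun s => by
        have h1 : HasDerivAt (fun s : ℝ => x + s • e) e s := by
          simpa using ((hasDerivAt_id s).smul_const e).const_add x
        exact ((hρ.differentiable (by norm_num)) (x + s • e)).hasFDerivAt.comp_hasDerivAt s h1
    have hin : ∀ s ∈ Icc 0 r, x + s • e ∈ ball q a := fun s hs => by
      rw [mem_ball, dist_eq_norm] at hx ⊢
      have h1 : ‖s • e‖ ≤ r * ‖e‖ := by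
        rw [norm_smul, Real.norm_of_nonneg hs.1]
        exact mul_le_mul_of_nonneg_right hs.2 (norm_nonneg e)
      have h2 : ‖x + s • e - q‖ ≤ ‖x - q‖ + ‖s • e‖ := by
        rw [add_sub_right_comm]; exact norm_add_le _ _
      nlinarith
    have hsm : StrictMonoOn (fun s : ℝ => ρ (x + s • e)) (Icc 0 r) := by
      refine strictMonoOn_of_deriv_pos (convex_Icc 0 r)
        (fun s _ => (hder s).continuousAt.continuousWithinAt) fun s hs => ?_
      rw [(hder s).deriv]
      exact hpos _ (hin s (interior_subset hs))
    have h0 : (0 : ℝ) ∈ Icc 0 r := ⟨le_rfl, hr0.le⟩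
    constructor
    · simpa using hsm.monotoneOn h0 ht ht.1
    · intro h
      simpa using hsm h0 ht h
  have hqr : 0 < ρ (q + r • e) := by
    have := (hmono q (mem_ball_self (by positivity)) r ⟨hr0.le, le_rfl⟩).2 hr0
    rwa [hq] at this
  obtain ⟨b, hb, hbpos⟩ := Metric.eventually_nhds_iff_ball.1
    (hρ.continuous.continuousAt.eventually (lt_mem_nhds hqr))
  refine ⟨min (a / 2) b, by positivity,
    ⋃ x ∈ {x | x ∈ ball q (min (a / 2) b) ∧ 0 < ρ x},
      ((fun t : ℝ => x + t • e) '' Icc 0 r ∪ ball (q + r • e) b), ?_, ?_, ?_⟩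
  · refine isPreconnected_of_forall (q + r • e) fun y hy => ?_
    obtain ⟨x, hx, hy⟩ := mem_iUnion₂.1 hy
    refine ⟨_, subset_iUnion₂ (s := fun x _ => (fun t : ℝ => x + t • e) '' Icc 0 r ∪
      ball (q + r • e) b) x hx, Or.inr (mem_ball_self hb), hy, ?_⟩
    refine IsPreconnected.union (x + r • e) ⟨r, ⟨hr0.le, le_rfl⟩, rfl⟩ ?_
      (isPreconnected_Icc.image _ (by fun_prop)) (convex_ball _ _).isPreconnected
    have := mem_ball.1 hx.1
    rw [mem_ball, dist_add_right]
    exact this.trans_le (min_le_right _ _)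
  · refine iUnion₂_subset fun x hx => union_subset ?_ fun y hy => hbpos y hy
    rintro _ ⟨t, ht, rfl⟩
    exact hx.2.trans_le (hmono x (ball_subset_ball (min_le_left _ _) hx.1) t ht).1
  · exact fun x hx h => mem_iUnion₂.2 ⟨x, ⟨hx, h⟩, Or.inl ⟨0, ⟨le_rfl, hr0.le⟩, by simp⟩⟩

/-- Necessary conditions for a one-sided local maximum along a line through a zero. -/
lemma fderiv_eq_zero_of_nonpos_line {ρ : E → ℝ} (hρ : ContDiff ℝ 2 ρ) {q w : E} {δ : ℝ}
    (hδ : 0 < δ) (hq : ρ q = 0) (h : ∀ t : ℝ, |t| < δ → ρ (q + t • w) ≤ 0) :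
    fderiv ℝ ρ q w = 0 ∧ fderiv ℝ (fderiv ℝ ρ) q w w ≤ 0 := by
  have h1 : fderiv ℝ ρ q w = 0 := by
    have h2 : HasDerivAt (fun s : ℝ => ρ (q + s • w)) (fderiv ℝ ρ q w) 0 := by
      have h1 : HasDerivAt (fun s : ℝ => q + s • w) w 0 := by
        simpa using ((hasDerivAt_id (0 : ℝ)).smul_const w).const_add q
      have h3 : HasFDerivAt ρ (fderiv ℝ ρ q) (q + (0 : ℝ) • w) := by
        rw [zero_smul, add_zero]
        exact (hρ.differentiable (by norm_num) q).hasFDerivAt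
      exact h3.comp_hasDerivAt (0 : ℝ) h1
    refine IsLocalMax.hasDerivAt_eq_zero ?_ h2
    filter_upwards [Metric.ball_mem_nhds (0 : ℝ) hδ] with t ht
    rw [zero_smul, add_zero, hq]
    exact h t (by simpa using ht)
  refine ⟨h1, ?_⟩
  refine le_of_forall_pos_le_add fun ε hε => ?_
  obtain ⟨d, hd, hT⟩ := hρ.contDiffAt.exists_taylor_two (p := q)
    (ε := ε / (2 * (‖w‖ ^ 2 + 1))) (by positivity)
  set t := min (δ / 2) (d / (2 * (‖w‖ + 1))) with ht
  have ht0 : 0 < t := by positivity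
  have h3 : ‖t • w‖ < d := by
    rw [norm_smul, Real.norm_of_nonneg ht0.le]
    have h4 : t ≤ d / (2 * (‖w‖ + 1)) := min_le_right _ _
    rw [le_div_iff₀ (by positivity)] at h4
    nlinarith [norm_nonneg w]
  have h5 := (hT q (mem_ball_self hd) (t • w) h3).2.2
  have h6 := h t (by rw [abs_of_pos ht0]; linarith [min_le_left (δ / 2) (d / (2 * (‖w‖ + 1)))])
  rw [hq, map_smul, h1, Real.norm_eq_abs, norm_smul, Real.norm_of_nonneg ht0.le] at h5
  simp only [map_smul, _root_.smul_apply, smul_eq_mul, mul_zero, sub_zero] at h5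
  have h7 := (abs_le.1 h5).1
  have h8 : ε / (2 * (‖w‖ ^ 2 + 1)) * (t * ‖w‖) ^ 2 ≤ t ^ 2 * (ε / 2) := by
    rw [div_mul_eq_mul_div, div_le_iff₀ (by positivity)]
    have : 0 ≤ ε * t ^ 2 := by positivity
    nlinarith
  have h9 : t ^ 2 * (1 / 2 * fderiv ℝ (fderiv ℝ ρ) q w w) ≤ t ^ 2 * (ε / 2) := by linarith
  have := le_of_mul_le_mul_left h9 (by positivity)
  linarith

end Complement

section

variable {n : ℕ}

local notation "𝔼" => EuclideanSpace ℂ (Fin n)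

lemma one_lt_rank_real_euclideanSpace (hn : 2 ≤ n) : 1 < Module.rank ℝ 𝔼 := by
  have h : Module.finrank ℝ 𝔼 = 2 * n := by
    rw [← Module.finrank_mul_finrank ℝ ℂ 𝔼]
    simp
  rw [← Module.finrank_eq_rank, h]
  exact_mod_cast (by omega)

lemma exists_ne_zero_inner_eq_zero (hn : 2 ≤ n) (q : 𝔼) : ∃ w : 𝔼, w ≠ 0 ∧ inner ℂ q w = 0 := by
  by_contra! h
  have h1 : LinearMap.ker (innerSL ℂ q).toLinearMap = ⊥ := by
    rw [LinearMap.ker_eq_bot']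
    intro w hw
    by_contra hw0
    exact h w hw0 hw
  have h2 := LinearMap.finrank_le_finrank_of_injective (LinearMap.ker_eq_bot.1 h1)
  simp at h2
  omega

namespace IsSPC

variable {Ω : Set (EuclideanSpace ℂ (Fin n))} {ρ : EuclideanSpace ℂ (Fin n) → ℝ}

lemma compl_closure_eq (h : IsSPC Ω ρ) : (closure Ω)ᶜ = {x | 0 < ρ x} := by
  rw [h.closure_eq]
  ext x
  simp

/-- In dimension at least two every component of the exterior is unbounded. -/
lemma mem_connectedComponentIn_of_lt_norm (h : IsSPC Ω ρ) (hn : 2 ≤ n) {R : ℝ} (hR : 0 ≤ R)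
    (hΩR : closure Ω ⊆ closedBall 0 R) {x y : 𝔼} (hx : 0 < ρ x) (hy : R < ‖y‖) :
    y ∈ connectedComponentIn {x | 0 < ρ x} x := by
  set U : Set 𝔼 := {x | 0 < ρ x} with hU
  set V := connectedComponentIn U x with hV
  have hUo : IsOpen U := isOpen_lt continuous_const h.contDiff.continuous
  have hVo : IsOpen V := hUo.connectedComponentIn
  have hxV : x ∈ V := mem_connectedComponentIn hx
  have hRU : {z : 𝔼 | R < ‖z‖} ⊆ U := fun z hz => by
    rw [hU, ← h.compl_closure_eq]
    intro hz'
    have h1 := mem_closedBall_zero_iff.1 (hΩR hz')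
    have h2 : R < ‖z‖ := hz
    linarith
  by_cases hex : ∃ z ∈ V, R < ‖z‖
  · obtain ⟨z, hz, hzR⟩ := hex
    rw [hV, connectedComponentIn_eq hz]
    exact (isPreconnected_setOf_lt_norm (one_lt_rank_real_euclideanSpace hn) hR).subset_connectedComponentIn
      (show z ∈ {z : 𝔼 | R < ‖z‖} from hzR) hRU hy
  · exfalso
    push Not at hex
    have hcl : closure V ⊆ closedBall 0 R :=
      closure_minimal (fun z hz => mem_closedBall_zero_iff.2 (hex z hz)) isClosed_closedBall
    have hcpt : IsCompact (closure V) := (isCompact_closedBall (0 : 𝔼) R).of_isClosed_subset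
      isClosed_closure hcl
    obtain ⟨q, hq, hmax⟩ := hcpt.exists_isMaxOn ⟨x, subset_closure hxV⟩ continuous_norm.continuousOn
    have hqmax : ∀ z ∈ closure V, ‖z‖ ≤ ‖q‖ := fun z hz => hmax hz
    obtain ⟨w₀, hw₀, hw₀q⟩ := exists_ne_zero_inner_eq_zero hn q
    have hnorm : ∀ w : 𝔼, inner ℂ q w = 0 → w ≠ 0 → ∀ t : ℝ, t ≠ 0 → ‖q‖ < ‖q + t • w‖ := by
      intro w hw hw0 t ht
      have h1 : inner ℂ q (t • w) = 0 := by
        rw [← Complex.coe_smul, inner_smul_right, hw, mul_zero]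
      have h2 := norm_add_sq_eq_norm_sq_add_norm_sq_of_inner_eq_zero q (t • w) h1
      have h3 : 0 < ‖t • w‖ := norm_pos_iff.2 (smul_ne_zero ht hw0)
      nlinarith [norm_nonneg (q + t • w), norm_nonneg q]
    have hqV : q ∉ V := fun hqV => by
      have hc : Continuous fun t : ℝ => q + t • w₀ := by fun_prop
      have h1 : ∀ᶠ t : ℝ in nhds 0, q + t • w₀ ∈ V :=
        hc.continuousAt.eventually (hVo.mem_nhds (by simpa using hqV))
      obtain ⟨δ, hδ, hb⟩ := Metric.eventually_nhds_iff_ball.1 h1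
      have h2 := hb (δ / 2) (by simp [abs_of_pos hδ, hδ])
      have h3 := hnorm w₀ hw₀q hw₀ (δ / 2) (by positivity)
      linarith [hqmax _ (subset_closure h2)]
    have hVU : V ⊆ U := connectedComponentIn_subset _ _
    have hq0 : ρ q = 0 := by
      have h1 : 0 ≤ ρ q := by
        have : closure V ⊆ {x | 0 ≤ ρ x} := closure_minimal (fun z hz => show 0 ≤ ρ z from le_of_lt (hVU hz))
          (isClosed_le continuous_const h.contDiff.continuous)
        exact this hq
      refine le_antisymm (not_lt.1 fun hpos => hqV ?_) h1
      obtain ⟨z, hz, hzV⟩ := _root_.mem_closure_iff.1 hq _ (hUo.connectedComponentIn (x := q))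
        (mem_connectedComponentIn hpos)
      rw [hV, connectedComponentIn_eq hzV, ← connectedComponentIn_eq hz]
      exact mem_connectedComponentIn hpos
    obtain ⟨r, hr, C, hC, hCU, hCx⟩ := exists_ball_subset_isPreconnected
      (h.contDiff.of_le (by norm_num)) hq0 (h.fderiv_ne q hq0)
    have hrV : ∀ z ∈ ball q r, 0 < ρ z → z ∈ V := fun z hz hpos => by
      obtain ⟨z', hz', hzV'⟩ := _root_.mem_closure_iff.1 hq _ isOpen_ball (mem_ball_self hr)
      rw [hV, connectedComponentIn_eq hzV']
      exact hC.subset_connectedComponentIn (hCx z' hz' (hVU hzV')) hCU (hCx z hz hpos)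
    have key : ∀ w : 𝔼, inner ℂ q w = 0 → w ≠ 0 →
        fderiv ℝ ρ q w = 0 ∧ fderiv ℝ (fderiv ℝ ρ) q w w ≤ 0 := by
      intro w hw hw0
      have hw1 : 0 < ‖w‖ := norm_pos_iff.2 hw0
      refine fderiv_eq_zero_of_nonpos_line h.contDiff (δ := r / ‖w‖) (by positivity) hq0
        fun t ht => ?_
      rcases eq_or_ne t 0 with rfl | ht0
      · rw [zero_smul, add_zero, hq0]
      · by_contra! hpos
        have h1 : q + t • w ∈ ball q r := by
          rw [mem_ball, dist_self_add_left, norm_smul, Real.norm_eq_abs]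
          rwa [lt_div_iff₀ hw1] at ht
        have h2 := hqmax _ (subset_closure (hrV _ h1 hpos))
        linarith [hnorm w hw hw0 t ht0]
    obtain ⟨h1, h2⟩ := key w₀ hw₀q hw₀
    obtain ⟨h3, h4⟩ := key (I • w₀) (by rw [inner_smul_right, hw₀q, mul_zero])
      (smul_ne_zero I_ne_zero hw₀)
    have h5 := h.levi_pos q w₀ hq0 hw₀ h1 h3
    simp only [leviForm] at h5
    linarith

end IsSPC

end

section Curve

variable {n : ℕ}

local notation "𝔼" => EuclideanSpace ℂ (Fin n)

lemma exists_entire_near_of_continuous {E : Type*} [NormedAddCommGroup E] [NormedSpace ℂ E]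
    {f : ℝ → E} (hf : Continuous f) {ε : ℝ} (hε : 0 < ε) :
    ∃ q : ℂ → E, ContDiff ℂ 2 q ∧ ∀ s ∈ Icc (0 : ℝ) 1, ‖q s - f s‖ ≤ ε := by
  letI : NormedSpace ℝ E := NormedSpace.restrictScalars ℝ ℂ E
  set F : C(unitInterval, E) := ⟨fun s => f s, by fun_prop⟩ with hF
  obtain ⟨N, hN⟩ := ((Metric.tendsto_nhds.1 (bernsteinApproximation_uniform F)) ε hε).exists
  refine ⟨fun z => ∑ k : Fin (N + 1), ((N.choose k : ℂ) * z ^ (k : ℕ) * (1 - z) ^ (N - k)) •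
    f ((bernstein.z k : unitInterval) : ℝ), ?_, fun s hs => ?_⟩
  · exact ContDiff.sum fun k _ => by fun_prop
  · have h1 := (ContinuousMap.dist_apply_le_dist (f := bernsteinApproximation N F) (g := F)
      ⟨s, hs⟩).trans hN.le
    rw [dist_eq_norm, bernsteinApproximation.apply] at h1
    refine le_of_eq_of_le ?_ h1
    congr 2
    refine Finset.sum_congr rfl fun k _ => ?_
    rw [bernstein_apply]
    change _ = ((N.choose k * s ^ (k : ℕ) * (1 - s) ^ (N - k) : ℝ) : ℂ) •
      f ((bernstein.z k : unitInterval) : ℝ)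
    push_cast
    rfl

lemma surjective_of_continuousLinearMap_ne_zero {θ : 𝔼 →L[ℂ] ℂ} (hθ : θ ≠ 0) :
    Function.Surjective θ := fun c => by
  obtain ⟨w, hw⟩ := ContinuousLinearMap.exists_ne_zero hθ
  exact ⟨(c / θ w) • w, by rw [map_smul, smul_eq_mul, div_mul_cancel₀ _ hw]⟩

lemma finrank_real_euclideanSpace : Module.finrank ℝ 𝔼 = 2 * n := by
  rw [← Module.finrank_mul_finrank ℝ ℂ 𝔼]
  simp

/-- A generic linear perturbation makes a holomorphic curve injective on the real line and
transversal to a given complex hyperplane direction. -/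
lemma exists_generic_direction (hn : 2 ≤ n) {θ : 𝔼 →L[ℂ] ℂ} (hθ : θ ≠ 0) {γ : ℂ → 𝔼}
    (hγ : ContDiff ℂ 2 γ) {ε : ℝ} (hε : 0 < ε) :
    ∃ v : 𝔼, ‖v‖ < ε ∧ (∀ s ∈ Icc (0 : ℝ) 1, θ (deriv γ s + v) ≠ 0) ∧
      ∀ s t : ℝ, t < s → γ s - γ t + (s - t) • v ≠ 0 := by
  set b : ℝ → ℂ := fun s => -θ (deriv γ s) with hb
  have hof : ContDiff ℝ 2 (fun s : ℝ => (s : ℂ)) := ofRealCLM.contDiff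
  have hbd : ContDiff ℝ 1 b := by
    have h1 : ContDiff ℂ 1 (deriv γ) := by
      rw [show (2 : WithTop ℕ∞) = 1 + 1 by norm_num, contDiff_succ_iff_deriv] at hγ
      exact hγ.2.2
    have h2 : ContDiff ℝ 1 fun s : ℝ => deriv γ s :=
      (h1.restrict_scalars ℝ).comp (hof.of_le (by norm_num))
    have h3 : ContDiff ℝ 1 θ := θ.contDiff.restrict_scalars ℝ
    exact (h3.comp h2).neg
  have hB : IsCompact (b '' Icc 0 1) := isCompact_Icc.image hbd.continuous
  have hBd : Dense (b '' Icc 0 1)ᶜ :=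
    (hbd.dense_compl_range_of_finrank_lt_finrank (by simp)).mono
      (compl_subset_compl.2 (image_subset_range _ _))
  have hθs : Function.Surjective θ :=
    surjective_of_continuousLinearMap_ne_zero hθ
  have hA : Dense (θ ⁻¹' (b '' Icc 0 1)ᶜ) := hBd.preimage (θ.isOpenMap hθs)
  have hAo : IsOpen (θ ⁻¹' (b '' Icc 0 1)ᶜ) := hB.isClosed.isOpen_compl.preimage θ.continuous
  set S : Set (ℝ × ℝ) := {q | q.2 < q.1} with hS
  have hSc : Convex ℝ S := by
    have : S = {q : ℝ × ℝ | ((ContinuousLinearMap.snd ℝ ℝ ℝ - ContinuousLinearMap.fst ℝ ℝ ℝ :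
        ℝ × ℝ →L[ℝ] ℝ)) q < 0} := by ext q; simp [hS]
    rw [this]
    exact convex_halfSpace_lt (LinearMap.isLinear (ContinuousLinearMap.toLinearMap _)) 0
  set D : ℝ × ℝ → 𝔼 := fun q => -((q.1 - q.2)⁻¹ • (γ q.1 - γ q.2)) with hD
  have hDd : ContDiffOn ℝ 1 D S := by
    have h1 : ContDiff ℝ 1 fun s : ℝ => γ s :=
      ((hγ.restrict_scalars ℝ).comp hof).of_le (by norm_num)
    refine (ContDiffOn.smul (ContDiffOn.inv (contDiff_fst.sub contDiff_snd).contDiffOn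
      fun q hq => ?_) ?_).neg
    · exact (sub_pos.2 (show q.2 < q.1 from hq)).ne'
    · exact ((h1.comp contDiff_fst).sub (h1.comp contDiff_snd)).contDiffOn
  have hDdense : Dense (D '' S)ᶜ := by
    refine hDd.dense_compl_image_of_dimH_lt_finrank hSc Subset.rfl ?_
    rw [finrank_real_euclideanSpace]
    refine (dimH_mono (subset_univ S)).trans_lt ?_
    rw [Real.dimH_univ_eq_finrank]
    simp only [Module.finrank_prod, Module.finrank_self]
    exact_mod_cast (by omega)
  obtain ⟨v, ⟨hv1, hv2⟩, hv3⟩ := (hA.inter_of_isOpen_left hDdense hAo).exists_dist_lt 0 hε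
  refine ⟨v, by simpa using hv3, fun s hs h0 => hv1 ⟨s, hs, ?_⟩, fun s t hst h0 =>
    hv2 ⟨(s, t), hst, ?_⟩⟩
  · rw [map_add] at h0
    exact (eq_neg_of_add_eq_zero_right h0).symm
  · have hne : s - t ≠ 0 := (sub_pos.2 hst).ne'
    simp only [hD]
    rw [eq_neg_of_add_eq_zero_left h0, smul_neg, neg_neg, inv_smul_smul₀ hne]

lemma exists_entire_curve {κ : ℝ → 𝔼} (hκ : Continuous κ) {e : 𝔼} {a R M : ℝ} (ha : 0 < a)
    (hκa : ∀ x ≤ a, κ x = x • e) (hκR : ∀ x ≥ R, κ x = x • e) (hR : 0 < R) (hM : R < M) {ε : ℝ}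
    (hε : 0 < ε) :
    ∃ γ : ℂ → 𝔼, ContDiff ℂ 2 γ ∧ γ 0 = 0 ∧ deriv γ 0 = M • e ∧
      ∀ s ∈ Icc (0 : ℝ) 1, ‖γ s - κ (M * s)‖ ≤ ε * s ∧ ‖γ s - κ (M * s)‖ ≤ ε * (1 - s) := by
  have hM0 : 0 < M := hR.trans hM
  set h : ℝ → 𝔼 := fun s => (s ^ 2 * (1 - s) ^ 2)⁻¹ • (κ (M * s) - (M * s) • e) with hh
  have hz : ∀ s : ℝ, M * s ≤ a ∨ R ≤ M * s → κ (M * s) - (M * s) • e = 0 := fun s hs => by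
    rcases hs with hs | hs
    · rw [hκa _ hs, sub_self]
    · rw [hκR _ hs, sub_self]
  have hcont : Continuous h := by
    rw [continuous_iff_continuousAt]
    intro s
    by_cases hs : M * s < a ∨ R < M * s
    · have h1 : ∀ᶠ x in nhds s, h x = 0 := by
        have : IsOpen {x : ℝ | M * x < a ∨ R < M * x} :=
          (isOpen_Iio.union isOpen_Ioi).preimage (continuous_const_mul M)
        filter_upwards [this.mem_nhds hs] with x hx
        simp only [hh]
        rw [hz x (hx.imp le_of_lt le_of_lt), smul_zero]
      exact (continuousAt_const (y := (0 : 𝔼))).congr (h1.mono fun x hx => hx.symm)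
    · push Not at hs
      have hs0 : s ≠ 0 := by rintro rfl; linarith [hs.1]
      have hs1 : 1 - s ≠ 0 := fun h0 => by
        have : s = 1 := by linarith
        subst this
        linarith [hs.2]
      have h1 : ContinuousAt (fun s : ℝ => s ^ 2 * (1 - s) ^ 2) s := by fun_prop
      have h2 : Continuous fun s : ℝ => κ (M * s) - (M * s) • e := by fun_prop
      exact (h1.inv₀ (by positivity)).smul h2.continuousAt
  obtain ⟨q, hq, hqh⟩ := exists_entire_near_of_continuous hcont hε
  refine ⟨fun z => (M * z) • e + (z ^ 2 * (1 - z) ^ 2) • q z, by fun_prop, by simp, ?_,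
    fun s hs => ?_⟩
  · have h1 : HasDerivAt (fun z : ℂ => ((M : ℂ) * z) • e) ((M : ℂ) • e) 0 := by
      simpa using ((hasDerivAt_id (0 : ℂ)).const_mul (M : ℂ)).smul_const e
    have h2 : HasDerivAt (fun z : ℂ => z ^ 2 * (1 - z) ^ 2) 0 0 := by
      have h3 := (hasDerivAt_pow 2 (0 : ℂ)).mul ((((hasDerivAt_id (0 : ℂ)).const_sub 1).pow 2))
      refine (h3.congr_deriv ?_)
      norm_num
    have h3 := h1.add (h2.smul (hq.differentiable (by norm_num) 0).hasDerivAt)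
    have h4 := h3.deriv
    refine h4.trans ?_
    simp
  · have h1 : (fun z : ℂ => (M * z) • e + (z ^ 2 * (1 - z) ^ 2) • q z) (s : ℂ) - κ (M * s) =
        (s ^ 2 * (1 - s) ^ 2) • (q s - h s) := by
      have h2 : (s ^ 2 * (1 - s) ^ 2) • h s = κ (M * s) - (M * s) • e := by
        by_cases h0 : s ^ 2 * (1 - s) ^ 2 = 0
        · rw [h0, zero_smul, hz]
          rcases mul_eq_zero.1 h0 with h3 | h3
          · left
            rw [pow_eq_zero_iff (by norm_num)] at h3
            rw [h3]; linarith
          · right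
            rw [pow_eq_zero_iff (by norm_num)] at h3
            rw [show s = 1 by linarith]; linarith
        · simp only [hh]
          rw [smul_inv_smul₀ h0]
      rw [smul_sub, h2]
      beta_reduce
      rw [← Complex.coe_smul, ← Complex.coe_smul]
      push_cast
      abel
    rw [h1, norm_smul, Real.norm_of_nonneg (by positivity)]
    have h3 := hqh s hs
    have h4 : 0 ≤ 1 - s := by linarith [hs.2]
    have h5 : s ^ 2 * (1 - s) ^ 2 ≤ s := by
      have : s * (1 - s) ^ 2 ≤ 1 := by nlinarith [hs.1, hs.2, mul_nonneg hs.1 h4]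
      nlinarith [hs.1]
    have h6 : s ^ 2 * (1 - s) ^ 2 ≤ 1 - s := by
      have : s ^ 2 * (1 - s) ≤ 1 := by nlinarith [hs.1, hs.2, mul_nonneg hs.1 h4]
      nlinarith [hs.1]
    constructor
    · rw [mul_comm ε]
      exact mul_le_mul h5 h3 (norm_nonneg _) hs.1
    · rw [mul_comm ε]
      exact mul_le_mul h6 h3 (norm_nonneg _) h4

namespace IsSPC

variable {Ω : Set (EuclideanSpace ℂ (Fin n))} {ρ : EuclideanSpace ℂ (Fin n) → ℝ}

lemma exists_outer_cone (h : IsSPC Ω ρ) {p e : 𝔼} (hp : ρ p = 0) (he : fderiv ℝ ρ p e = 1) :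
    ∃ a > 0, ∃ ε > 0, ∀ x : ℝ, 0 < x → x ≤ a → ∀ y : 𝔼, ‖y‖ ≤ ε * x →
      0 < ρ (p + (x • e + y)) := by
  set L := fderiv ℝ ρ p with hL
  have hd : HasFDerivAt ρ L p := (h.contDiff.differentiable (by norm_num) p).hasFDerivAt
  set ε := 1 / (4 * (‖L‖ + 1)) with hε
  set c := 1 / (4 * (‖e‖ + ε + 1)) with hc
  have hε0 : 0 < ε := by positivity
  have hc0 : 0 < c := by positivity
  have h1 := (hasFDerivAt_iff_isLittleO_nhds_zero.1 hd).def hc0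
  obtain ⟨δ, hδ, hb⟩ := Metric.eventually_nhds_iff_ball.1 h1
  refine ⟨δ / (2 * (‖e‖ + ε + 1)), by positivity, ε, hε0, fun x hx hxa y hy => ?_⟩
  have hn1 : ‖x • e + y‖ ≤ x * (‖e‖ + ε) := by
    refine (norm_add_le _ _).trans ?_
    rw [norm_smul, Real.norm_of_nonneg hx.le]
    linarith
  have hlt : ‖x • e + y‖ < δ := by
    rw [le_div_iff₀ (by positivity)] at hxa
    nlinarith
  have h2 := hb (x • e + y) (by simpa using hlt)
  rw [hp, map_add, map_smul, he, Real.norm_eq_abs] at h2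
  have h3 := (abs_le.1 h2).1
  have h4 : |L y| ≤ ‖L‖ * (ε * x) := (L.le_opNorm y).trans
    (mul_le_mul_of_nonneg_left hy (norm_nonneg L))
  have h5 : ‖L‖ * ε ≤ 1 / 4 := by
    rw [hε, mul_one_div, div_le_div_iff₀ (by positivity) (by norm_num)]
    linarith [norm_nonneg L]
  have h6 : c * (‖e‖ + ε) ≤ 1 / 4 := by
    rw [hc, div_mul_eq_mul_div, div_le_div_iff₀ (by positivity) (by norm_num)]
    linarith [norm_nonneg e]
  have h7 : c * ‖x • e + y‖ ≤ x / 4 := by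
    have := mul_le_mul_of_nonneg_left hn1 hc0.le
    nlinarith
  have h8 := (abs_le.1 h4).1
  simp only [smul_eq_mul, mul_one] at h3
  nlinarith

/-- An arc in the exterior from a boundary point to infinity, straight near both ends. -/
lemma exists_exterior_arc (h : IsSPC Ω ρ) (hn : 2 ≤ n) {p e : 𝔼} (he0 : e ≠ 0) {a₀ : ℝ}
    (ha₀ : 0 < a₀) (hpe : ∀ x : ℝ, 0 < x → x ≤ a₀ → 0 < ρ (p + x • e)) :
    ∃ κ : ℝ → 𝔼, Continuous κ ∧ (∀ x ≤ a₀, κ x = x • e) ∧ (∃ R > 0, ∀ x ≥ R, κ x = x • e) ∧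
      ∀ x > 0, 0 < ρ (p + κ x) := by
  obtain ⟨R, hR⟩ := h.isCompact_closure.isBounded.subset_closedBall (0 : 𝔼)
  set R' := max R 0 with hR'
  have hΩR : closure Ω ⊆ closedBall 0 R' := hR.trans (closedBall_subset_closedBall (le_max_left _ _))
  have hR0 : 0 ≤ R' := le_max_right _ _
  have he : 0 < ‖e‖ := norm_pos_iff.2 he0
  set R₁ := a₀ + (R' + ‖p‖ + 1) / ‖e‖ with hR₁
  have hR₁a : a₀ < R₁ := by
    have : 0 < (R' + ‖p‖ + 1) / ‖e‖ := by positivity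
    linarith
  have hfar : ∀ x ≥ R₁, R' < ‖p + x • e‖ := fun x hx => by
    have h1 : (R' + ‖p‖ + 1) / ‖e‖ ≤ x := by linarith
    rw [div_le_iff₀ he] at h1
    have h2 : ‖x • e‖ = x * ‖e‖ := by rw [norm_smul, Real.norm_of_nonneg (by linarith)]
    have h3 := norm_sub_norm_le (x • e) (-p)
    rw [sub_neg_eq_add, norm_neg, h2, add_comm (x • e)] at h3
    linarith
  have hfarU : ∀ x ≥ R₁, 0 < ρ (p + x • e) := fun x hx => by
    have : p + x • e ∈ (closure Ω)ᶜ := fun hz => by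
      have := mem_closedBall_zero_iff.1 (hΩR hz)
      linarith [hfar x hx]
    rwa [h.compl_closure_eq] at this
  have hstart : 0 < ρ (p + a₀ • e) := hpe a₀ ha₀ le_rfl
  set V := connectedComponentIn {x | 0 < ρ x} (p + a₀ • e) with hV
  have hVo : IsOpen V := (isOpen_lt continuous_const h.contDiff.continuous).connectedComponentIn
  have hVc : IsConnected V := isConnected_connectedComponentIn_iff.2 hstart
  obtain ⟨η, hη⟩ := ((hVo.isConnected_iff_isPathConnected).1 hVc).joinedIn (p + a₀ • e)
    (mem_connectedComponentIn hstart) (p + R₁ • e)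
    (h.mem_connectedComponentIn_of_lt_norm hn hR0 hΩR hstart (hfar R₁ le_rfl))
  set d := R₁ - a₀ with hd
  have hd0 : 0 < d := sub_pos.2 hR₁a
  set κ : ℝ → 𝔼 := fun x => η.extend ((x - a₀) / d) - p + (min x a₀ - a₀) • e +
    (max x R₁ - R₁) • e with hκ
  have h1 : ∀ x ≤ a₀, κ x = x • e := fun x hx => by
    simp only [hκ]
    rw [η.extend_of_le_zero (div_nonpos_of_nonpos_of_nonneg (by linarith) hd0.le), min_eq_left hx,
      max_eq_right (by linarith), sub_self, zero_smul, sub_smul]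
    abel
  have h2 : ∀ x ≥ R₁, κ x = x • e := fun x hx => by
    simp only [hκ]
    rw [η.extend_of_one_le (by rw [le_div_iff₀ hd0]; linarith), min_eq_right (by linarith),
      max_eq_left hx, sub_self, zero_smul, sub_smul]
    abel
  refine ⟨κ, ?_, h1, ⟨R₁, by linarith, h2⟩, fun x hx => ?_⟩
  · have := η.continuous_extend
    fun_prop
  · rcases le_or_gt x a₀ with hxa | hxa
    · rw [h1 x hxa]
      exact hpe x hx hxa
    rcases le_or_gt R₁ x with hxR | hxR
    · rw [h2 x hxR]
      exact hfarU x hxR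
    · have h3 : κ x = η.extend ((x - a₀) / d) - p := by
        simp only [hκ]
        rw [min_eq_right hxa.le, max_eq_right hxR.le, sub_self, sub_self, zero_smul, add_zero,
          add_zero]
      rw [h3, add_sub_cancel]
      have h4 : (x - a₀) / d ∈ unitInterval :=
        ⟨div_nonneg (by linarith) hd0.le, by rw [div_le_one hd0]; linarith⟩
      rw [η.extend_apply h4]
      exact connectedComponentIn_subset {x | 0 < ρ x} (p + a₀ • e) (hη _)

set_option maxHeartbeats 1000000 in
/-- An exposing curve at a boundary point. -/
lemma exists_exposing_curve (h : IsSPC Ω ρ) (hn : 2 ≤ n) {p : 𝔼} (hp : ρ p = 0) :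
    ∃ γ : ℂ → 𝔼, ContDiff ℂ 2 γ ∧ γ 0 = 0 ∧ 0 < (holoDeriv ρ p (deriv γ 0)).re ∧
      (∀ s ∈ Icc (0 : ℝ) 1, holoDeriv ρ p (deriv γ s) ≠ 0) ∧
      (∀ s ∈ Icc (0 : ℝ) 1, ∀ t ∈ Icc (0 : ℝ) 1, γ s = γ t → s = t) ∧
      (∀ s ∈ Ioc (0 : ℝ) 1, p + γ s ∉ closure Ω) ∧
      (∀ s ∈ Ico (0 : ℝ) 1, holoDeriv ρ p (γ s) ≠ holoDeriv ρ p (γ 1)) ∧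
      ∀ z ∈ closure Ω, holoDeriv ρ p (z - p) ≠ holoDeriv ρ p (γ 1) := by
  set θ := holoDeriv ρ p with hθ
  have hθ0 : θ ≠ 0 := fun h0 => h.fderiv_ne p hp (by
    ext v
    rw [← re_holoDeriv, ← hθ, h0]
    rfl)
  obtain ⟨e, he⟩ := surjective_of_continuousLinearMap_ne_zero hθ0 1
  have heR : fderiv ℝ ρ p e = 1 := by rw [← re_holoDeriv, ← hθ, he, one_re]
  have he0 : e ≠ 0 := by rintro rfl; simp at he
  obtain ⟨a, ha, ε₁, hε₁, hcone⟩ := h.exists_outer_cone hp heR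
  obtain ⟨κ, hκ, hκa, ⟨R, hR, hκR⟩, hκU⟩ := h.exists_exterior_arc hn he0 ha fun x hx hxa => by
    simpa using hcone x hx hxa 0 (by rw [norm_zero]; positivity)
  obtain ⟨R₂, hR₂0, hR₂⟩ := exists_nonneg_bound (isCompact_Icc (a := (0 : ℝ)) (b := R))
    (f := fun x => θ (κ x)) (by fun_prop)
  obtain ⟨S, hS0, hS⟩ := exists_nonneg_bound h.isCompact_closure
    (f := fun z => θ (z - p)) (by fun_prop)
  set M := R + R₂ + S + 2 with hM
  have hM0 : 0 < M := by positivity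
  obtain ⟨d, hd, hdU⟩ := ((isCompact_Icc (a := a) (b := M)).image
    (f := fun x => p + κ x) (by fun_prop)).exists_cthickening_subset_open
    (isOpen_lt continuous_const h.contDiff.continuous (f := fun _ : 𝔼 => (0 : ℝ)) (g := ρ)) (by
      rintro _ ⟨x, hx, rfl⟩
      exact hκU x (ha.trans_le hx.1))
  set ε := min (min (d / 2) (ε₁ * M / 2)) (1 / (4 * (‖θ‖ + 1))) with hε
  have hε0 : 0 < ε := by positivity
  obtain ⟨γ₀, hγ₀, hγ₀0, hγ₀', hγ₀κ⟩ := exists_entire_curve hκ ha hκa hκR hR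
    (show R < M by rw [hM]; linarith) hε0
  obtain ⟨v, hv, hvθ, hvinj⟩ := exists_generic_direction hn hθ0 hγ₀ hε0
  set γ : ℂ → 𝔼 := fun z => γ₀ z + z • v with hγ
  have hderiv : ∀ z, deriv γ z = deriv γ₀ z + v := fun z => by
    have h1 := (hγ₀.differentiable (by norm_num) z).hasDerivAt.add
      ((hasDerivAt_id z).smul_const v)
    rw [one_smul] at h1
    exact h1.deriv
  have hsv : ∀ s : ℝ, (s : ℂ) • v = s • v := fun s => Complex.coe_smul s v
  set β : ℝ → 𝔼 := fun s => γ s - κ (M * s) with hβ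
  have hγβ : ∀ s : ℝ, γ s = κ (M * s) + β s := fun s => by simp only [hβ]; abel
  have hβs : ∀ s ∈ Icc (0 : ℝ) 1, ‖β s‖ ≤ 2 * ε * s := fun s hs => by
    have h1 : β s = (γ₀ s - κ (M * s)) + s • v := by
      simp only [hβ, hγ, hsv]; abel
    rw [h1]
    refine (norm_add_le _ _).trans ?_
    rw [norm_smul, Real.norm_of_nonneg hs.1]
    nlinarith [(hγ₀κ s hs).1, mul_le_mul_of_nonneg_left hv.le hs.1]
  have hβ1 : ∀ s ∈ Icc (0 : ℝ) 1, ‖β 1 - β s‖ ≤ 2 * ε * (1 - s) := fun s hs => by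
    have h0 : γ₀ (1 : ℝ) - κ (M * 1) = 0 := by
      simpa using (hγ₀κ 1 ⟨zero_le_one, le_rfl⟩).2
    have h1 : β 1 - β s = (1 - s) • v - (γ₀ s - κ (M * s)) := by
      simp only [hβ, hγ, hsv, sub_smul]
      rw [sub_eq_zero.1 h0]
      abel
    rw [h1]
    refine (norm_sub_le _ _).trans ?_
    have hs1 : 0 ≤ 1 - s := by linarith [hs.2]
    rw [norm_smul, Real.norm_of_nonneg hs1]
    nlinarith [(hγ₀κ s hs).2, mul_le_mul_of_nonneg_left hv.le hs1]
  have hθε : ‖θ‖ * (2 * ε) ≤ 1 / 2 := by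
    have h1 : ε ≤ 1 / (4 * (‖θ‖ + 1)) := min_le_right _ _
    rw [le_div_iff₀ (by positivity)] at h1
    nlinarith [norm_nonneg θ]
  have hθβ : ∀ s ∈ Icc (0 : ℝ) 1, ‖θ (β s)‖ ≤ 1 / 2 := fun s hs => by
    refine (θ.le_opNorm _).trans ?_
    refine (mul_le_mul_of_nonneg_left (hβs s hs) (norm_nonneg θ)).trans ?_
    have := mul_le_mul hθε hs.2 hs.1 (by norm_num)
    linarith
  have h1I : (1 : ℝ) ∈ Icc (0 : ℝ) 1 := ⟨zero_le_one, le_rfl⟩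
  have hθx : ∀ x ≥ R, θ (κ x) = x := fun x hx => by
    rw [hκR x hx, ← Complex.coe_smul, map_smul, he, smul_eq_mul, mul_one]
  have hγ1 : θ (γ 1) = M + θ (β 1) := by
    have := hγβ 1
    rw [ofReal_one, mul_one] at this
    rw [this, map_add, hθx M (by rw [hM]; linarith)]
  have hγ1n : M - 1 / 2 ≤ ‖θ (γ 1)‖ := by
    rw [hγ1]
    have h2 := norm_sub_le ((M : ℂ) + θ (β 1)) (θ (β 1))
    rw [add_sub_cancel_right, Complex.norm_real, Real.norm_of_nonneg hM0.le] at h2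
    linarith [hθβ 1 h1I]
  have hinj : ∀ s ∈ Icc (0 : ℝ) 1, ∀ t ∈ Icc (0 : ℝ) 1, t < s → γ s ≠ γ t :=
    fun s hs t ht hts h0 => hvinj s t hts (by
      simp only [hγ, hsv] at h0
      rw [sub_smul, ← sub_eq_zero.2 h0]
      abel)
  refine ⟨γ, by fun_prop, by simp [hγ, hγ₀0], ?_, fun s hs => ?_, fun s hs t ht hst => ?_,
    fun s hs => ?_, fun s hs hs1 => ?_, fun z hz hz1 => ?_⟩
  · rw [hderiv, hγ₀', ← Complex.coe_smul, map_add, map_smul, he, smul_eq_mul, mul_one, add_re,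
      ofReal_re]
    have h2 := (abs_le.1 ((abs_re_le_norm (θ v)).trans (θ.le_opNorm v))).1
    have h3 := mul_le_mul_of_nonneg_left hv.le (norm_nonneg θ)
    nlinarith [norm_nonneg θ]
  · rw [hderiv]
    exact hvθ s hs
  · rcases lt_trichotomy s t with h2 | h2 | h2
    · exact absurd hst.symm (hinj t ht s hs h2)
    · exact h2
    · exact absurd hst (hinj s hs t ht h2)
  · have hs' : s ∈ Icc (0 : ℝ) 1 := ⟨hs.1.le, hs.2⟩
    have h2 : p + γ s ∈ (closure Ω)ᶜ := by
      rw [h.compl_closure_eq]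
      rw [hγβ s]
      rcases le_or_gt (M * s) a with h3 | h3
      · rw [hκa _ h3]
        refine hcone (M * s) (mul_pos hM0 hs.1) h3 _ ((hβs s hs').trans ?_)
        have : ε ≤ ε₁ * M / 2 := (min_le_left _ _).trans (min_le_right _ _)
        nlinarith [hs.1]
      · refine hdU (mem_cthickening_of_dist_le _ (p + κ (M * s)) _ _
          ⟨M * s, ⟨h3.le, by nlinarith [hs.2]⟩, rfl⟩ ?_)
        rw [← add_assoc, dist_self_add_left]
        refine (hβs s hs').trans ?_
        have : ε ≤ d / 2 := (min_le_left _ _).trans (min_le_left _ _)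
        nlinarith [hs.1, hs.2]
    exact h2
  · have hs' : s ∈ Icc (0 : ℝ) 1 := ⟨hs.1, hs.2.le⟩
    rcases le_or_gt R (M * s) with h3 | h3
    · have h4 : θ (β 1 - β s) = -(M * (1 - s) : ℝ) := by
        rw [hγ1, hγβ s, map_add, hθx _ h3] at hs1
        rw [map_sub]
        push_cast at hs1 ⊢
        linear_combination -hs1
      have h5 : ‖θ (β 1 - β s)‖ ≤ ‖θ‖ * (2 * ε * (1 - s)) := (θ.le_opNorm _).trans
        (mul_le_mul_of_nonneg_left (hβ1 s hs') (norm_nonneg θ))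
      have h6 : 0 < 1 - s := by linarith [hs.2]
      rw [h4, norm_neg, Complex.norm_real, Real.norm_of_nonneg (by positivity)] at h5
      have h7 : M * (1 - s) ≤ 1 / 2 * (1 - s) := by nlinarith
      have h8 := le_of_mul_le_mul_right h7 h6
      rw [hM] at h8
      linarith
    · have h4 : ‖θ (γ s)‖ ≤ R₂ + 1 / 2 := by
        rw [hγβ s, map_add]
        exact (norm_add_le _ _).trans (add_le_add
          (hR₂ _ ⟨mul_nonneg hM0.le hs.1, h3.le⟩) (hθβ s hs'))
      rw [hs1] at h4
      rw [hM] at hγ1n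
      linarith
  · have h2 := hS z hz
    beta_reduce at h2
    rw [hz1] at h2
    rw [hM] at hγ1n
    linarith

end IsSPC

end Curve

section LogEstimates

lemma hasDerivAt_log_of_re_pos {z : ℂ} (hz : 0 < z.re) : HasDerivAt Complex.log z⁻¹ z :=
  Complex.hasDerivAt_log (Or.inl hz)

lemma re_div_log_sub_log_pos {a b : ℂ} (ha : 0 < a.re) (hb : 0 < b.re) (hab : a ≠ b) :
    0 < ((a - b) / (Complex.log a - Complex.log b)).re := by
  have hab' : a - b ≠ 0 := sub_ne_zero.2 hab
  have hpos : ∀ t ∈ Icc (0 : ℝ) 1, 0 < (b + t * (a - b)).re := fun t ht => by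
    simp only [add_re, mul_re, ofReal_re, ofReal_im, zero_mul, sub_zero, sub_re]
    rcases eq_or_lt_of_le ht.1 with h | h
    · rw [← h]; simpa using hb
    · nlinarith [mul_pos h ha, mul_nonneg (sub_nonneg.2 ht.2) hb.le]
  set f : ℝ → ℝ := fun t => (Complex.log (b + t * (a - b)) / (a - b)).re with hf
  have hd : ∀ t ∈ Icc (0 : ℝ) 1, HasDerivAt f ((b + t * (a - b))⁻¹).re t := fun t ht => by
    have h1 : HasDerivAt (fun t : ℝ => b + t * (a - b)) (a - b) t := by
      simpa using ((Complex.ofRealCLM.hasDerivAt (x := t)).mul_const (a - b)).const_add b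
    have h2 := (hasDerivAt_log_of_re_pos (hpos t ht)).comp t h1
    have h3 := Complex.reCLM.hasFDerivAt.comp_hasDerivAt t (h2.div_const (a - b))
    rw [mul_div_cancel_right₀ _ hab'] at h3
    exact h3
  obtain ⟨t, ht, h1⟩ := exists_deriv_eq_slope f zero_lt_one
    (fun t ht => (hd t ht).continuousAt.continuousWithinAt)
    (fun t ht => (hd t (Ioo_subset_Icc_self ht)).differentiableAt.differentiableWithinAt)
  have ht' := Ioo_subset_Icc_self ht
  have h2 : 0 < ((Complex.log a - Complex.log b) / (a - b)).re := by
    have h3 : ((Complex.log a - Complex.log b) / (a - b)).re = f 1 - f 0 := by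
      simp only [hf]
      rw [← sub_re, ← sub_div]
      norm_num
    rw [h3, ← div_one (f 1 - f 0)]
    rw [sub_zero] at h1
    rw [← h1, (hd t ht').deriv, inv_re]
    exact div_pos (hpos t ht') (normSq_pos.2 fun h0 => by
      have := hpos t ht'
      rw [h0, zero_re] at this
      exact this.false)
  rw [← inv_div, inv_re]
  exact div_pos h2 (normSq_pos.2 fun h0 => by rw [h0, zero_re] at h2; exact h2.false)

lemma norm_sub_le_mul_norm_log_sub_log {a b : ℂ} {r : ℝ} (ha : 0 < a.re) (hb : 0 < b.re)
    (har : ‖a‖ ≤ r) (hbr : ‖b‖ ≤ r) : ‖a - b‖ ≤ r * ‖Complex.log a - Complex.log b‖ := by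
  have hne : ∀ {z : ℂ}, 0 < z.re → z ≠ 0 := fun hz h0 => by rw [h0, zero_re] at hz; exact hz.false
  have hr : 0 < r := (norm_pos_iff.2 (hne ha)).trans_le har
  have hmem : ∀ {z : ℂ}, 0 < z.re → ‖z‖ ≤ r → Complex.log z ∈ {u : ℂ | u.re ≤ Real.log r} :=
    fun {z} hz hzr => by
      change (Complex.log z).re ≤ _
      rw [Complex.log_re]
      exact Real.log_le_log (norm_pos_iff.2 (hne hz)) hzr
  have h := (convex_halfSpace_re_le (Real.log r)).norm_image_sub_le_of_norm_hasDerivWithin_le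
    (f := Complex.exp) (f' := Complex.exp) (C := r)
    (fun u _ => (Complex.hasDerivAt_exp u).hasDerivWithinAt)
    (fun u hu => by
      rw [Complex.norm_exp, ← Real.exp_log hr]
      exact Real.exp_le_exp.2 hu) (hmem hb hbr) (hmem ha har)
  rwa [Complex.exp_log (hne ha), Complex.exp_log (hne hb)] at h

lemma norm_log_sub_log_le {a b : ℂ} {m : ℝ} (hm : 0 < m) (ha : m ≤ a.re) (hb : m ≤ b.re) :
    ‖Complex.log a - Complex.log b‖ ≤ m⁻¹ * ‖a - b‖ :=
  (convex_halfSpace_re_ge m).norm_image_sub_le_of_norm_hasDerivWithin_le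
    (f := Complex.log) (f' := fun z => z⁻¹) (C := m⁻¹)
    (fun _ hu => (hasDerivAt_log_of_re_pos (hm.trans_le hu)).hasDerivWithinAt)
    (fun u hu => by
      rw [norm_inv]
      have hu' : m ≤ u.re := hu
      exact inv_anti₀ hm (hu'.trans ((le_abs_self _).trans (abs_re_le_norm u)))) hb ha

end LogEstimates

section Exposing

open Filter Topology

/-- The holomorphic time function pushing a boundary point along an exposing curve. -/
noncomputable def exposeTime (η : ℝ) (u : ℂ) : ℂ := -(η * Complex.log (Real.exp (-η⁻¹) - u))

lemma re_expose_arg {u : ℂ} (hu : u.re ≤ 0) (η : ℝ) :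
    Real.exp (-η⁻¹) ≤ ((Real.exp (-η⁻¹) : ℂ) - u).re := by
  rw [sub_re]
  have : ((Real.exp (-η⁻¹) : ℝ) : ℂ).re = Real.exp (-η⁻¹) := ofReal_re _
  simp only [Complex.ofReal_re]
  linarith

lemma exposeTime_zero {η : ℝ} (hη : 0 < η) : exposeTime η 0 = 1 := by
  rw [exposeTime, sub_zero, ← Complex.ofReal_log (Real.exp_pos _).le, Real.log_exp]
  push_cast
  have : (η : ℂ) ≠ 0 := by exact_mod_cast hη.ne'
  field_simp

lemma norm_expose_arg {η : ℝ} (hη : 0 < η) {u : ℂ} (hu : u.re ≤ 0) :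
    ‖(Real.exp (-η⁻¹) : ℂ) - u‖ = Real.exp (-((exposeTime η u).re / η)) := by
  have h1 : 0 < ((Real.exp (-η⁻¹) : ℂ) - u).re := (Real.exp_pos _).trans_le (re_expose_arg hu η)
  have hne : (Real.exp (-η⁻¹) : ℂ) - u ≠ 0 := fun h0 => by rw [h0, zero_re] at h1; exact h1.false
  have h2 : (exposeTime η u).re = -(η * Real.log ‖(Real.exp (-η⁻¹) : ℂ) - u‖) := by
    rw [exposeTime, neg_re, re_ofReal_mul, Complex.log_re]
  rw [h2, neg_div, neg_neg, mul_div_cancel_left₀ _ hη.ne', Real.exp_log (norm_pos_iff.2 hne)]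

lemma exposeTime_re_le {η : ℝ} (hη : 0 < η) {u : ℂ} (hu : u.re ≤ 0) :
    (exposeTime η u).re ≤ 1 := by
  have h1 := (re_expose_arg hu η).trans ((le_abs_self _).trans (abs_re_le_norm _))
  rw [norm_expose_arg hη hu, Real.exp_le_exp, neg_le_neg_iff, div_eq_mul_inv] at h1
  have h2 : 0 < η⁻¹ := inv_pos.2 hη
  by_contra! h3
  nlinarith

lemma le_exposeTime_re {η B : ℝ} (hη : 0 < η) {u : ℂ} (hu : u.re ≤ 0) (hB : 1 + ‖u‖ ≤ B) :
    -(η * Real.log B) ≤ (exposeTime η u).re := by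
  have h1 : ‖(Real.exp (-η⁻¹) : ℂ) - u‖ ≤ B := by
    refine (norm_sub_le _ _).trans (le_trans ?_ hB)
    rw [Complex.norm_real, Real.norm_of_nonneg (Real.exp_pos _).le]
    have : Real.exp (-η⁻¹) ≤ 1 := Real.exp_le_one_iff.2 (by simpa using hη.le)
    linarith
  have hB0 : 0 < B := by linarith [norm_nonneg u]
  rw [norm_expose_arg hη hu, ← Real.exp_log hB0, Real.exp_le_exp] at h1
  have h2 := mul_le_mul_of_nonneg_left h1 hη.le
  rw [mul_neg, mul_div_cancel₀ _ hη.ne'] at h2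
  linarith

lemma abs_exposeTime_im_le {η : ℝ} (hη : 0 < η) {u : ℂ} (hu : u.re ≤ 0) :
    |(exposeTime η u).im| ≤ η * (Real.pi / 2) := by
  rw [exposeTime, neg_im, im_ofReal_mul, abs_neg, abs_mul, abs_of_pos hη, Complex.log_im]
  exact mul_le_mul_of_nonneg_left (Complex.abs_arg_le_pi_div_two_iff.2
    ((Real.exp_pos _).le.trans (re_expose_arg hu η))) hη.le

lemma exists_tendsto_hyperfilter {X : Type*} [TopologicalSpace X] {K : Set X} (hK : IsCompact K)
    {x : ℕ → X} (hx : ∀ j, x j ∈ K) : ∃ a ∈ K, Tendsto x (hyperfilter ℕ) (𝓝 a) := by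
  obtain ⟨a, ha, h⟩ := hK.ultrafilter_le_nhds ((hyperfilter ℕ).map x)
    (le_principal_iff.2 (Filter.mem_map.2 (Eventually.of_forall hx)))
  exact ⟨a, ha, h⟩

lemma exists_tendsto_exposeTime {η : ℕ → ℝ} {u : ℕ → ℂ} {u₀ : ℂ}
    (hη : ∀ j, 0 < η j) (hη0 : Tendsto η (hyperfilter ℕ) (𝓝 0)) (hu : ∀ j, (u j).re ≤ 0)
    (hu0 : Tendsto u (hyperfilter ℕ) (𝓝 u₀)) {B : ℝ} (hB : ∀ j, ‖u j‖ ≤ B) :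
    ∃ σ ∈ Icc (0 : ℝ) 1, Tendsto (fun j => exposeTime (η j) (u j)) (hyperfilter ℕ) (𝓝 (σ : ℂ)) ∧
      (u₀.re < 0 → σ = 0) := by
  have hB0 : 0 ≤ B := (norm_nonneg _).trans (hB 0)
  have hlogB : 0 ≤ Real.log (1 + B) := Real.log_nonneg (by linarith)
  have him : Tendsto (fun j => (exposeTime (η j) (u j)).im) (hyperfilter ℕ) (𝓝 0) := by
    refine squeeze_zero_norm (fun j => abs_exposeTime_im_le (hη j) (hu j)) ?_
    simpa using hη0.mul_const (Real.pi / 2)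
  have hlow : Tendsto (fun j => -(η j * Real.log (1 + B))) (hyperfilter ℕ) (𝓝 0) := by
    simpa using (hη0.mul_const (Real.log (1 + B))).neg
  have hη1 : ∀ᶠ j in hyperfilter ℕ, η j < 1 := hη0.eventually (gt_mem_nhds zero_lt_one)
  obtain ⟨σ, -, hσ⟩ : ∃ σ ∈ Icc (-Real.log (1 + B)) 1,
      Tendsto (fun j => (exposeTime (η j) (u j)).re) (hyperfilter ℕ) (𝓝 σ) := by
    obtain ⟨a, ha, h⟩ := isCompact_Icc.ultrafilter_le_nhds
      ((hyperfilter ℕ).map fun j => (exposeTime (η j) (u j)).re)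
      (le_principal_iff.2 (Filter.mem_map.2 (by
        filter_upwards [hη1] with j hj
        refine ⟨?_, exposeTime_re_le (hη j) (hu j)⟩
        have := le_exposeTime_re (B := 1 + B) (hη j) (hu j) (by linarith [hB j])
        have h2 := mul_le_mul_of_nonneg_right hj.le hlogB
        change -Real.log (1 + B) ≤ _
        linarith)))
    exact ⟨a, ha, h⟩
  have hσ0 : 0 ≤ σ := le_of_tendsto_of_tendsto hlow hσ (Eventually.of_forall fun j =>
    le_exposeTime_re (hη j) (hu j) (by linarith [hB j]))
  have hσ1 : σ ≤ 1 := le_of_tendsto hσ (Eventually.of_forall fun j => exposeTime_re_le (hη j) (hu j))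
  have hlim : Tendsto (fun j => exposeTime (η j) (u j)) (hyperfilter ℕ) (𝓝 (σ : ℂ)) := by
    have h1 := (continuous_ofReal.tendsto σ).comp hσ
    have h2 := ((continuous_ofReal.tendsto 0).comp him).mul_const I
    have h3 := h1.add h2
    simp only [ofReal_zero, zero_mul, add_zero] at h3
    exact h3.congr fun j => Complex.re_add_im _
  refine ⟨σ, ⟨hσ0, hσ1⟩, hlim, fun hneg => ?_⟩
  have hδ : Tendsto (fun j => ((Real.exp (-(η j)⁻¹) : ℝ) : ℂ)) (hyperfilter ℕ) (𝓝 0) := by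
    have h1 : Tendsto η (hyperfilter ℕ) (𝓝[>] 0) :=
      tendsto_nhdsWithin_iff.2 ⟨hη0, Eventually.of_forall hη⟩
    have h2 := Real.tendsto_exp_atBot.comp
      (tendsto_neg_atTop_atBot.comp (tendsto_inv_nhdsGT_zero.comp h1))
    have h3 := (continuous_ofReal.tendsto 0).comp h2
    rwa [ofReal_zero] at h3
  have h1 : Tendsto (fun j => ((Real.exp (-(η j)⁻¹) : ℝ) : ℂ) - u j) (hyperfilter ℕ) (𝓝 (-u₀)) := by
    simpa using hδ.sub hu0
  have h2 := h1.clog (Or.inl (by simpa using hneg))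
  have h3 := (((continuous_ofReal.tendsto 0).comp hη0).mul h2).neg
  simp only [ofReal_zero, zero_mul, neg_zero] at h3
  have h4 := tendsto_nhds_unique hlim h3
  exact_mod_cast h4

/-- The quotient controlling differences of the time function. -/
lemma exposeTime_quotient {η : ℝ} (hη : 0 < η) {u v : ℂ} (hu : u.re ≤ 0) (hv : v.re ≤ 0)
    (huv : exposeTime η u ≠ exposeTime η v) :
    0 < ((u - v) / (exposeTime η u - exposeTime η v)).re ∧
    ∀ c, c ≤ (exposeTime η u).re → c ≤ (exposeTime η v).re →
      ‖(u - v) / (exposeTime η u - exposeTime η v)‖ ≤ Real.exp (-(c / η)) / η := by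
  have h1 := (Real.exp_pos _).trans_le (re_expose_arg hu η)
  have h2 := (Real.exp_pos _).trans_le (re_expose_arg hv η)
  set a : ℂ := (Real.exp (-η⁻¹) : ℂ) - u with ha
  set b : ℂ := (Real.exp (-η⁻¹) : ℂ) - v with hb
  have huva : u - v = -(a - b) := by rw [ha, hb]; ring
  have hst : exposeTime η u - exposeTime η v = -(η * (Complex.log a - Complex.log b)) := by
    rw [exposeTime, exposeTime]; ring
  have hlog : Complex.log a - Complex.log b ≠ 0 := fun h0 => huv (by
    rw [← sub_eq_zero, hst, h0, mul_zero, neg_zero])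
  have hab : a ≠ b := by rintro h0; exact hlog (by rw [h0, sub_self])
  have hη' : (η : ℂ) ≠ 0 := by exact_mod_cast hη.ne'
  have hq : (u - v) / (exposeTime η u - exposeTime η v) =
      ((η⁻¹ : ℝ) : ℂ) * ((a - b) / (Complex.log a - Complex.log b)) := by
    rw [huva, hst, neg_div_neg_eq]
    push_cast
    field_simp
  rw [hq]
  refine ⟨?_, fun c hcu hcv => ?_⟩
  · rw [re_ofReal_mul]
    exact mul_pos (inv_pos.2 hη) (re_div_log_sub_log_pos h1 h2 hab)
  · have hle : ∀ {x : ℝ}, c ≤ x → Real.exp (-(x / η)) ≤ Real.exp (-(c / η)) := fun hx =>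
      Real.exp_le_exp.2 (neg_le_neg (div_le_div_of_nonneg_right hx hη.le))
    have h3 := norm_sub_le_mul_norm_log_sub_log h1 h2
      ((norm_expose_arg hη hu).trans_le (hle hcu)) ((norm_expose_arg hη hv).trans_le (hle hcv))
    rw [norm_mul, norm_div, Complex.norm_real, Real.norm_of_nonneg (inv_pos.2 hη).le,
      mul_comm, ← div_eq_mul_inv]
    refine div_le_div_of_nonneg_right ?_ hη.le
    rwa [div_le_iff₀ (norm_pos_iff.2 hlog)]

lemma tendsto_exp_neg_div_div {c : ℝ} (hc : 0 < c) :
    Tendsto (fun η : ℝ => Real.exp (-(c / η)) / η) (𝓝[>] 0) (𝓝 0) := by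
  have h : Tendsto (fun η : ℝ => 2 * η / c ^ 2) (𝓝[>] 0) (𝓝 0) := by
    have : Tendsto (fun η : ℝ => 2 * η / c ^ 2) (𝓝 0) (𝓝 (2 * 0 / c ^ 2)) :=
      Continuous.tendsto (by fun_prop) 0
    simp only [mul_zero, zero_div] at this
    exact this.mono_left nhdsWithin_le_nhds
  refine squeeze_zero' ?_ ?_ h
  · filter_upwards [self_mem_nhdsWithin] with η hη
    exact div_nonneg (Real.exp_pos _).le (le_of_lt hη)
  · filter_upwards [self_mem_nhdsWithin] with η hη
    have hη' : 0 < η := hη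
    have h1 := Real.quadratic_le_exp_of_nonneg (div_pos hc hη').le
    have h2 : (c / η) ^ 2 / 2 ≤ Real.exp (c / η) := by
      have := div_pos hc hη'
      linarith
    rw [Real.exp_neg]
    have h3 := inv_anti₀ (by positivity) h2
    calc (Real.exp (c / η))⁻¹ / η ≤ ((c / η) ^ 2 / 2)⁻¹ / η := div_le_div_of_nonneg_right h3 hη'.le
      _ = 2 * η / c ^ 2 := by field_simp

end Exposing

section ExposingMap

open Filter Topology

variable {E : Type*} [NormedAddCommGroup E] [NormedSpace ℂ E]

lemma exists_seq_of_not_eventually_pos {P : ℝ → Prop} (h : ¬ ∀ᶠ η in 𝓝[>] (0 : ℝ), P η) :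
    ∃ η : ℕ → ℝ, (∀ j, 0 < η j) ∧ Tendsto η (hyperfilter ℕ) (𝓝 0) ∧ ∀ j, ¬ P (η j) := by
  have h1 : ∃ᶠ η in 𝓝[>] (0 : ℝ), ¬ P η ∧ 0 < η :=
    (not_eventually.1 h).and_eventually self_mem_nhdsWithin
  obtain ⟨η, hη, hP⟩ := exists_seq_forall_of_frequently h1
  exact ⟨η, fun j => (hP j).2, (tendsto_nhds_of_tendsto_nhdsWithin hη).mono_left
    Nat.hyperfilter_le_atTop, fun j => (hP j).1⟩

lemma re_neg_of_ne {K : Set E} {p : E} {g : E → ℂ} {c : ℝ} (hc : 0 < c)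
    (hg : ∀ z ∈ K, (g z).re ≤ -(c * ‖z - p‖ ^ 2)) {z : E} (hz : z ∈ K) (hzp : z ≠ p) :
    (g z).re < 0 := by
  have h1 : 0 < ‖z - p‖ := norm_pos_iff.2 (sub_ne_zero.2 hzp)
  have h2 : 0 < c * ‖z - p‖ ^ 2 := by positivity
  linarith [hg z hz]

lemma re_nonpos_of_peak {K : Set E} {p : E} {g : E → ℂ} {c : ℝ} (hc : 0 < c)
    (hg : ∀ z ∈ K, (g z).re ≤ -(c * ‖z - p‖ ^ 2)) {z : E} (hz : z ∈ K) : (g z).re ≤ 0 := by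
  have h2 : 0 ≤ c * ‖z - p‖ ^ 2 := by positivity
  linarith [hg z hz]

lemma exists_tendsto_exposeTime_comp {K : Set E} (hK : IsCompact K) {p : E} {g : E → ℂ}
    (hgc : ContinuousOn g K) {c : ℝ} (hc : 0 < c) (hg : ∀ z ∈ K, (g z).re ≤ -(c * ‖z - p‖ ^ 2))
    {η : ℕ → ℝ} (hη : ∀ j, 0 < η j) (hη0 : Tendsto η (hyperfilter ℕ) (𝓝 0)) {z : ℕ → E}
    (hz : ∀ j, z j ∈ K) {z₀ : E} (hz₀K : z₀ ∈ K) (hz₀ : Tendsto z (hyperfilter ℕ) (𝓝 z₀)) :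
    ∃ σ ∈ Icc (0 : ℝ) 1,
      Tendsto (fun j => exposeTime (η j) (g (z j))) (hyperfilter ℕ) (𝓝 (σ : ℂ)) ∧
      (z₀ ≠ p → σ = 0) := by
  obtain ⟨B, hB⟩ := hK.exists_bound_of_continuousOn hgc
  have h1 : Tendsto (fun j => g (z j)) (hyperfilter ℕ) (𝓝 (g z₀)) :=
    (hgc z₀ hz₀K).tendsto.comp (tendsto_nhdsWithin_iff.2 ⟨hz₀, Eventually.of_forall hz⟩)
  obtain ⟨σ, hσ, h2, h3⟩ := exists_tendsto_exposeTime hη hη0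
    (fun j => re_nonpos_of_peak hc hg (hz j)) h1 (fun j => hB _ (hz j))
  exact ⟨σ, hσ, h2, fun hne => h3 (re_neg_of_ne hc hg hz₀K hne)⟩

lemma tendsto_exp_neg_div_div_hyperfilter {η : ℕ → ℝ} (hη : ∀ j, 0 < η j)
    (hη0 : Tendsto η (hyperfilter ℕ) (𝓝 0)) {c : ℝ} (hc : 0 < c) :
    Tendsto (fun j => Real.exp (-(c / η j)) / η j) (hyperfilter ℕ) (𝓝 0) :=
  (tendsto_exp_neg_div_div hc).comp
    (tendsto_nhdsWithin_iff.2 ⟨hη0, Eventually.of_forall hη⟩)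

lemma tendsto_curve_quotient {γ : ℂ → E} (hγ : ContDiff ℂ 2 γ) {s t : ℕ → ℂ} {σ : ℂ}
    (hs : Tendsto s (hyperfilter ℕ) (𝓝 σ)) (ht : Tendsto t (hyperfilter ℕ) (𝓝 σ))
    (hst : ∀ j, s j ≠ t j) :
    Tendsto (fun j => (s j - t j)⁻¹ • (γ (s j) - γ (t j))) (hyperfilter ℕ) (𝓝 (deriv γ σ)) := by
  have h1 : HasStrictDerivAt γ (deriv γ σ) σ := hγ.contDiffAt.hasStrictDerivAt (by norm_num)
  have h2 := h1.hasStrictFDerivAt.isLittleO.comp_tendsto (hs.prodMk_nhds ht)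
  have h3 := h2.norm_left.norm_right.tendsto_div_nhds_zero
  rw [tendsto_iff_norm_sub_tendsto_zero]
  refine h3.congr fun j => ?_
  have hne : s j - t j ≠ 0 := sub_ne_zero.2 (hst j)
  have h4 : (s j - t j)⁻¹ • (γ (s j) - γ (t j)) - deriv γ σ =
      (s j - t j)⁻¹ • (γ (s j) - γ (t j) - (s j - t j) • deriv γ σ) := by
    rw [smul_sub _ (γ (s j) - γ (t j)), inv_smul_smul₀ hne]
  rw [h4, norm_smul, norm_inv, div_eq_inv_mul]
  rfl

lemma isBigO_of_tendsto_quotient {z w : ℕ → E} {s t : ℕ → ℂ} (hst : ∀ j, s j ≠ t j) {v : E}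
    (hq : Tendsto (fun j => (s j - t j)⁻¹ • (z j - w j)) (hyperfilter ℕ) (𝓝 v)) :
    (fun j => z j - w j) =O[hyperfilter ℕ] fun j => s j - t j := by
  have h2 : (fun j => (s j - t j) • ((s j - t j)⁻¹ • (z j - w j))) =O[hyperfilter ℕ]
      fun j => (s j - t j) • (1 : ℂ) :=
    (Asymptotics.isBigO_refl _ _).smul (hq.isBigO_one ℂ)
  refine (h2.congr (fun j => ?_) fun j => ?_)
  · exact smul_inv_smul₀ (sub_ne_zero.2 (hst j)) _
  · rw [smul_eq_mul, mul_one]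

lemma tendsto_peak_quotient {p : E} {g : E → ℂ} {θ : E →L[ℂ] ℂ}
    (hgp : HasStrictFDerivAt g (θ.restrictScalars ℝ) p) {z w : ℕ → E} {s t : ℕ → ℂ}
    (hz : Tendsto z (hyperfilter ℕ) (𝓝 p)) (hw : Tendsto w (hyperfilter ℕ) (𝓝 p))
    (hst : ∀ j, s j ≠ t j) {v : E}
    (hq : Tendsto (fun j => (s j - t j)⁻¹ • (z j - w j)) (hyperfilter ℕ) (𝓝 v)) :
    Tendsto (fun j => (g (z j) - g (w j)) / (s j - t j)) (hyperfilter ℕ) (𝓝 (θ v)) := by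
  have h1 := hgp.isLittleO.comp_tendsto (hz.prodMk_nhds hw)
  have hO := isBigO_of_tendsto_quotient hst hq
  have h3 := (h1.trans_isBigO hO).tendsto_div_nhds_zero
  have h4 := h3.add ((θ.continuous.tendsto _).comp hq)
  rw [zero_add] at h4
  refine h4.congr fun j => ?_
  have hne : s j - t j ≠ 0 := sub_ne_zero.2 (hst j)
  simp only [Function.comp_apply, map_smul, smul_eq_mul, ContinuousLinearMap.coe_restrictScalars']
  field_simp
  ring

lemma isLittleO_exposeTime_sub {g : E → ℂ} {z₀ : E} {L : E →L[ℝ] ℂ}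
    (hgs : HasStrictFDerivAt g L z₀) (hre : (g z₀).re < 0) {η : ℕ → ℝ} (hη : ∀ j, 0 < η j)
    (hη0 : Tendsto η (hyperfilter ℕ) (𝓝 0)) {z w : ℕ → E}
    (hz : Tendsto z (hyperfilter ℕ) (𝓝 z₀)) (hw : Tendsto w (hyperfilter ℕ) (𝓝 z₀)) :
    (fun j => exposeTime (η j) (g (z j)) - exposeTime (η j) (g (w j)))
      =o[hyperfilter ℕ] fun j => z j - w j := by
  have hO : (fun j => g (z j) - g (w j)) =O[hyperfilter ℕ] fun j => z j - w j :=
    hgs.isBigO_sub.comp_tendsto (hz.prodMk_nhds hw)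
  set m : ℝ := -(g z₀).re / 2 with hm
  have hm0 : 0 < m := by rw [hm]; linarith
  have hev : ∀ {z : ℕ → E}, Tendsto z (hyperfilter ℕ) (𝓝 z₀) →
      ∀ᶠ j in hyperfilter ℕ, m ≤ ((Real.exp (-(η j)⁻¹) : ℂ) - g (z j)).re := fun {z} hz => by
    have h1 : Tendsto (fun j => (g (z j)).re) (hyperfilter ℕ) (𝓝 (g z₀).re) :=
      (continuous_re.tendsto _).comp (hgs.continuousAt.tendsto.comp hz)
    filter_upwards [h1.eventually (gt_mem_nhds (show (g z₀).re < -m by rw [hm]; linarith))]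
      with j hj
    have := Real.exp_pos (-(η j)⁻¹)
    rw [sub_re, ofReal_re]
    linarith
  have h5 : (fun j => exposeTime (η j) (g (z j)) - exposeTime (η j) (g (w j)))
      =O[hyperfilter ℕ] fun j => (η j) • (g (z j) - g (w j)) := by
    refine Asymptotics.IsBigO.of_bound m⁻¹ ?_
    filter_upwards [hev hz, hev hw] with j h1 h2
    have h3 := norm_log_sub_log_le hm0 h1 h2
    have h4 : exposeTime (η j) (g (z j)) - exposeTime (η j) (g (w j)) =
        -((η j : ℂ) * (Complex.log (Real.exp (-(η j)⁻¹) - g (z j)) -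
          Complex.log (Real.exp (-(η j)⁻¹) - g (w j)))) := by
      rw [exposeTime, exposeTime]
      ring
    have h5 : ((Real.exp (-(η j)⁻¹) : ℂ) - g (z j)) - (Real.exp (-(η j)⁻¹) - g (w j)) =
        -(g (z j) - g (w j)) := by ring
    rw [h4, norm_neg, norm_mul, norm_real, norm_smul]
    rw [h5, norm_neg] at h3
    calc ‖η j‖ * _ ≤ ‖η j‖ * (m⁻¹ * ‖g (z j) - g (w j)‖) := by gcongr
      _ = _ := by ring
  have h6 : (fun j => (η j) • (g (z j) - g (w j))) =o[hyperfilter ℕ] fun j => (1:ℝ) • (z j - w j) :=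
    ((Asymptotics.isLittleO_one_iff ℝ).2 hη0).smul_isBigO hO
  simp only [one_smul] at h6
  exact h5.trans_isLittleO h6

lemma injOn_exposingMap {K : Set E} (hK : IsCompact K) {p : E} {g : E → ℂ}
    {θ : E →L[ℂ] ℂ} (hgs : ∀ z ∈ K, ∃ L : E →L[ℝ] ℂ, HasStrictFDerivAt g L z)
    (hgp : HasStrictFDerivAt g (θ.restrictScalars ℝ) p) {c : ℝ}
    (hc : 0 < c) (hg : ∀ z ∈ K, (g z).re ≤ -(c * ‖z - p‖ ^ 2)) {γ : ℂ → E}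
    (hγ : ContDiff ℂ 2 γ) (hγ0 : γ 0 = 0) (hγ1 : 0 < (θ (deriv γ 0)).re)
    (hγ2 : ∀ s ∈ Icc (0 : ℝ) 1, θ (deriv γ s) ≠ 0)
    (hγ3 : ∀ s ∈ Icc (0 : ℝ) 1, ∀ t ∈ Icc (0 : ℝ) 1, γ s = γ t → s = t)
    (hγ4 : ∀ s ∈ Ioc (0 : ℝ) 1, p + γ s ∉ K) :
    ∀ᶠ η in 𝓝[>] (0 : ℝ), InjOn (fun z => z + γ (exposeTime η (g z))) K := by
  by_contra hcon
  obtain ⟨η, hη, hη0, hP⟩ := exists_seq_of_not_eventually_pos hcon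
  have hex : ∀ j, ∃ z ∈ K, ∃ w ∈ K,
      z + γ (exposeTime (η j) (g z)) = w + γ (exposeTime (η j) (g w)) ∧ z ≠ w := fun j => by
    have := hP j
    simp only [InjOn] at this
    push Not at this
    exact this
  choose z hz w hw hzw hne using hex
  have hgc : ContinuousOn g K := fun z hz => by
    obtain ⟨L, hL⟩ := hgs z hz
    exact hL.continuousAt.continuousWithinAt
  obtain ⟨z₀, hz₀K, hz₀⟩ := exists_tendsto_hyperfilter hK hz
  obtain ⟨w₀, hw₀K, hw₀⟩ := exists_tendsto_hyperfilter hK hw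
  obtain ⟨σ, hσ, hσlim, hσ0⟩ := exists_tendsto_exposeTime_comp hK hgc hc hg hη hη0 hz hz₀K hz₀
  obtain ⟨τ, hτ, hτlim, hτ0⟩ := exists_tendsto_exposeTime_comp hK hgc hc hg hη hη0 hw hw₀K hw₀
  set s : ℕ → ℂ := fun j => exposeTime (η j) (g (z j)) with hs
  set t : ℕ → ℂ := fun j => exposeTime (η j) (g (w j)) with ht
  have hγc : Continuous γ := hγ.continuous
  have hlim : z₀ + γ σ = w₀ + γ τ := by
    refine tendsto_nhds_unique (hz₀.add ((hγc.tendsto _).comp hσlim)) ?_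
    exact (hw₀.add ((hγc.tendsto _).comp hτlim)).congr fun j => (hzw j).symm
  have hdiff : ∀ j, z j - w j = -(γ (s j) - γ (t j)) := fun j => by
    rw [neg_sub, sub_eq_sub_iff_add_eq_add, add_comm (γ (t j))]
    exact hzw j
  have hst : ∀ j, s j ≠ t j := fun j h0 => hne j (by
    rw [← sub_eq_zero, hdiff, h0, sub_self, neg_zero])
  by_cases hzp : z₀ = p
  · by_cases hwp : w₀ = p
    · rw [hzp, hwp] at hlim
      have hστ : σ = τ := hγ3 σ hσ τ hτ (add_left_cancel hlim)
      subst hστ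
      have hq := tendsto_curve_quotient hγ hσlim hτlim hst
      have hG : Tendsto (fun j => (g (z j) - g (w j)) / (s j - t j)) (hyperfilter ℕ)
          (𝓝 (-θ (deriv γ σ))) := by
        have h1 := tendsto_peak_quotient hgp (hzp ▸ hz₀) (hwp ▸ hw₀) hst
          (v := -deriv γ σ) (hq.neg.congr fun j => by rw [hdiff, smul_neg])
        rwa [map_neg] at h1
      have hQ := fun j => exposeTime_quotient (hη j) (re_nonpos_of_peak hc hg (hz j))
        (re_nonpos_of_peak hc hg (hw j)) (hst j)
      rcases hσ.1.eq_or_lt with h0 | h0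
      · have h1 : 0 ≤ (-θ (deriv γ σ)).re :=
          ge_of_tendsto ((continuous_re.tendsto _).comp hG)
            (Eventually.of_forall fun j => (hQ j).1.le)
        rw [← h0, ofReal_zero, neg_re] at h1
        linarith
      · have h1 : ∀ᶠ j in hyperfilter ℕ, σ / 2 ≤ (s j).re := by
          refine (((continuous_re.tendsto _).comp hσlim).eventually
            (lt_mem_nhds (show σ / 2 < _ by rw [ofReal_re]; linarith))).mono fun j hj => hj.le
        have h2 : ∀ᶠ j in hyperfilter ℕ, σ / 2 ≤ (t j).re := by
          refine (((continuous_re.tendsto _).comp hτlim).eventually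
            (lt_mem_nhds (show σ / 2 < _ by rw [ofReal_re]; linarith))).mono fun j hj => hj.le
        have h3 : Tendsto (fun j => (g (z j) - g (w j)) / (s j - t j)) (hyperfilter ℕ) (𝓝 0) :=
          squeeze_zero_norm' (by
            filter_upwards [h1, h2] with j hj1 hj2
            exact (hQ j).2 _ hj1 hj2)
            (tendsto_exp_neg_div_div_hyperfilter hη hη0 (half_pos h0))
        exact hγ2 σ hσ (neg_eq_zero.1 (tendsto_nhds_unique hG h3))
    · rw [hτ0 hwp, ofReal_zero, hγ0, add_zero, hzp] at hlim
      rcases hσ.1.eq_or_lt with h0 | h0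
      · rw [← h0, ofReal_zero, hγ0, add_zero] at hlim
        exact hwp hlim.symm
      · exact hγ4 σ ⟨h0, hσ.2⟩ (hlim ▸ hw₀K)
  · rw [hσ0 hzp, ofReal_zero, hγ0, add_zero] at hlim
    by_cases hwp : w₀ = p
    · rw [hwp] at hlim
      rcases hτ.1.eq_or_lt with h0 | h0
      · rw [← h0, ofReal_zero, hγ0, add_zero] at hlim
        exact hzp hlim
      · exact hγ4 τ ⟨h0, hτ.2⟩ (hlim ▸ hz₀K)
    · rw [hτ0 hwp, ofReal_zero, hγ0, add_zero] at hlim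
      rw [hσ0 hzp] at hσlim
      rw [hτ0 hwp] at hτlim
      have hq := tendsto_curve_quotient hγ hσlim hτlim hst
      have hO : (fun j => z j - w j) =O[hyperfilter ℕ] fun j => s j - t j :=
        isBigO_of_tendsto_quotient hst (v := -deriv γ (0 : ℝ))
          (hq.neg.congr fun j => by rw [hdiff, smul_neg])
      obtain ⟨L, hL⟩ := hgs z₀ hz₀K
      have hlo := (isLittleO_exposeTime_sub hL (re_neg_of_ne hc hg hz₀K hzp) hη hη0 hz₀
        (hlim ▸ hw₀)).trans_isBigO hO
      have h1 : (fun j => s j - t j) =o[hyperfilter ℕ] fun j => s j - t j := hlo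
      exact Asymptotics.isLittleO_irrefl
        (Eventually.of_forall fun j => sub_ne_zero.2 (hst j)).frequently h1

end ExposingMap

section ExposingMap

open Filter Topology

variable {E : Type*} [NormedAddCommGroup E] [NormedSpace ℂ E]

lemma eq_zero_of_exposeTime_eq_one {η : ℝ} (hη : 0 < η) {u : ℂ} (hu : u.re ≤ 0)
    (h : exposeTime η u = 1) : u = 0 := by
  have h1 := (Real.exp_pos _).trans_le (re_expose_arg hu η)
  have hne : (Real.exp (-η⁻¹) : ℂ) - u ≠ 0 := fun h0 => by
    rw [h0, zero_re] at h1
    exact h1.false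
  have hη' : (η : ℂ) ≠ 0 := ofReal_ne_zero.2 hη.ne'
  have h2 : Complex.log (Real.exp (-η⁻¹) - u) = ((-η⁻¹ : ℝ) : ℂ) := by
    rw [exposeTime] at h
    rw [ofReal_neg, ofReal_inv]
    generalize Complex.log (Real.exp (-η⁻¹) - u) = l at h
    field_simp
    linear_combination -h
  have h3 := Complex.exp_log hne
  rw [h2, ← ofReal_exp] at h3
  linear_combination h3

lemma exposingMap_ne {K : Set E} (hK : IsCompact K) {p : E} (hp : p ∈ K) {g : E → ℂ}
    {θ : E →L[ℂ] ℂ} (hgc : ContinuousOn g K) (hg0 : g p = 0) {c : ℝ}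
    (hc : 0 < c) (hg : ∀ z ∈ K, (g z).re ≤ -(c * ‖z - p‖ ^ 2)) {C : ℝ}
    (hC : ∀ᶠ z in 𝓝[K] p, ‖θ (z - p)‖ ≤ C * ‖g z‖) {γ : ℂ → E}
    (hγ : ContDiff ℂ 2 γ) (hγ0 : γ 0 = 0)
    (hγ2 : ∀ s ∈ Icc (0 : ℝ) 1, θ (deriv γ s) ≠ 0)
    (hγ5 : ∀ s ∈ Ico (0 : ℝ) 1, θ (γ s) ≠ θ (γ 1))
    (hγ6 : ∀ z ∈ K, θ (z - p) ≠ θ (γ 1)) :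
    ∀ᶠ η in 𝓝[>] (0 : ℝ), ∀ z ∈ K, z ≠ p → θ (z - p + γ (exposeTime η (g z))) ≠ θ (γ 1) := by
  by_contra hcon
  obtain ⟨η, hη, hη0, hP⟩ := exists_seq_of_not_eventually_pos hcon
  push Not at hP
  choose z hz hzp hzθ using hP
  obtain ⟨z₀, hz₀K, hz₀⟩ := exists_tendsto_hyperfilter hK hz
  obtain ⟨σ, hσ, hσlim, hσ0⟩ := exists_tendsto_exposeTime_comp hK hgc hc hg hη hη0 hz hz₀K hz₀
  set s : ℕ → ℂ := fun j => exposeTime (η j) (g (z j)) with hs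
  have hγc : Continuous γ := hγ.continuous
  have hlim : θ (z₀ - p + γ σ) = θ (γ 1) := by
    refine tendsto_nhds_unique ((θ.continuous.tendsto _).comp
      ((hz₀.sub_const p).add ((hγc.tendsto _).comp hσlim))) ?_
    exact tendsto_const_nhds.congr fun j => (hzθ j).symm
  by_cases hz₀p : z₀ = p
  · rw [hz₀p, sub_self, zero_add] at hlim
    have hσ1 : σ = 1 := by
      by_contra hne
      exact hγ5 σ ⟨hσ.1, lt_of_le_of_ne hσ.2 hne⟩ hlim
    rw [hσ1, ofReal_one] at hσlim
    have hg' : ∀ j, g (z j) ≠ 0 := fun j h0 => by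
      have := re_neg_of_ne hc hg (hz j) (hzp j)
      rw [h0, zero_re] at this
      exact this.false
    have hT : ∀ j, exposeTime (η j) 0 = 1 := fun j => exposeTime_zero (hη j)
    have hst : ∀ j, s j ≠ 1 := fun j h0 => by
      exact hg' j (eq_zero_of_exposeTime_eq_one (hη j) (re_nonpos_of_peak hc hg (hz j)) h0)
    have hq := tendsto_curve_quotient hγ hσlim tendsto_const_nhds hst
    have hQ := fun j => exposeTime_quotient (hη j) (re_nonpos_of_peak hc hg (hz j))
      (show (0 : ℂ).re ≤ 0 by simp) (by rw [hT]; exact hst j)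
    have h1 : ∀ᶠ j in hyperfilter ℕ, 1 / 2 ≤ (s j).re := by
      refine (((continuous_re.tendsto _).comp hσlim).eventually
        (lt_mem_nhds (show (1 / 2 : ℝ) < _ by rw [one_re]; norm_num))).mono fun j hj => hj.le
    have h3 : Tendsto (fun j => g (z j) / (s j - 1)) (hyperfilter ℕ) (𝓝 0) :=
      squeeze_zero_norm' (by
        filter_upwards [h1] with j hj1
        have := (hQ j).2 _ hj1 (by rw [hT, one_re]; norm_num)
        rwa [hT, sub_zero] at this)
        (tendsto_exp_neg_div_div_hyperfilter hη hη0 one_half_pos)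
    have h4 : ∀ᶠ j in hyperfilter ℕ, ‖θ (z j - p)‖ ≤ C * ‖g (z j)‖ :=
      (tendsto_nhdsWithin_iff.2 ⟨hz₀p ▸ hz₀, Eventually.of_forall hz⟩).eventually hC
    have h5 : Tendsto (fun j => θ ((s j - 1)⁻¹ • (γ (s j) - γ 1))) (hyperfilter ℕ) (𝓝 0) := by
      refine squeeze_zero_norm' ?_ (by simpa using h3.norm.const_mul C)
      filter_upwards [h4] with j hj
      have h6 : θ (γ (s j) - γ 1) = -θ (z j - p) := by
        have := hzθ j
        rw [map_add] at this
        rw [map_sub, ← this, sub_add_cancel_right]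
      rw [map_smul, h6, norm_smul, norm_neg, norm_inv]
      calc ‖s j - 1‖⁻¹ * ‖θ (z j - p)‖ ≤ ‖s j - 1‖⁻¹ * (C * ‖g (z j)‖) := by gcongr
        _ = _ := by ring
    have h6 := tendsto_nhds_unique ((θ.continuous.tendsto _).comp hq) h5
    exact hγ2 1 ⟨zero_le_one, le_rfl⟩ (by rw [ofReal_one]; exact h6)
  · rw [hσ0 hz₀p, ofReal_zero, hγ0, add_zero] at hlim
    exact hγ6 z₀ hz₀K hlim

end ExposingMap

section Model

variable {E : Type*} [NormedAddCommGroup E] [InnerProductSpace ℂ E]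

/-- The component of `w` orthogonal to `e`. -/
noncomputable def perpPart (e w : E) : E := w - inner ℂ e w • e

lemma perpPart_add_smul (e w : E) : perpPart e w + inner ℂ e w • e = w := by
  rw [perpPart, sub_add_cancel]

lemma inner_perpPart {e : E} (he : ‖e‖ = 1) (w : E) : inner ℂ e (perpPart e w) = 0 := by
  rw [perpPart, inner_sub_right, inner_smul_right, inner_self_eq_norm_sq_to_K, he]
  simp

lemma perpPart_smul (e : E) (c : ℂ) (w : E) : perpPart e (c • w) = c • perpPart e w := by
  rw [perpPart, perpPart, inner_smul_right, smul_sub, smul_smul]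

lemma inner_smul_perpPart_add {e : E} (he : ‖e‖ = 1) (w : E) (c x : ℂ) :
    inner ℂ e (c • perpPart e w + x • e) = x := by
  rw [inner_add_right, inner_smul_right, inner_smul_right, inner_perpPart he,
    inner_self_eq_norm_sq_to_K, he]
  simp

lemma perpPart_smul_perpPart_add {e : E} (he : ‖e‖ = 1) (w : E) (c x : ℂ) :
    perpPart e (c • perpPart e w + x • e) = c • perpPart e w := by
  rw [perpPart, inner_smul_perpPart_add he, add_sub_cancel_right]

lemma norm_smul_perpPart_add_sq {e : E} (he : ‖e‖ = 1) (w : E) (c x : ℂ) :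
    ‖c • perpPart e w + x • e‖ ^ 2 = ‖c‖ ^ 2 * ‖perpPart e w‖ ^ 2 + ‖x‖ ^ 2 := by
  have h : inner ℂ (c • perpPart e w) (x • e) = 0 := by
    rw [← inner_conj_symm, inner_smul_left, inner_smul_right, inner_perpPart he]
    simp
  have := norm_add_sq_eq_norm_sq_add_norm_sq_of_inner_eq_zero _ _ h
  rw [sq, this, norm_smul, norm_smul, he]
  ring

lemma norm_sq_eq_perpPart {e : E} (he : ‖e‖ = 1) (w : E) :
    ‖w‖ ^ 2 = ‖perpPart e w‖ ^ 2 + ‖inner ℂ e w‖ ^ 2 := by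
  have := norm_smul_perpPart_add_sq he w 1 (inner ℂ e w)
  rwa [one_smul, perpPart_add_smul, norm_one, one_pow, one_mul] at this

lemma differentiable_perpPart (e : E) : Differentiable ℂ (perpPart e) := by
  have h : Differentiable ℂ fun w : E => inner ℂ e w := (innerSL ℂ e).differentiable
  exact differentiable_id.sub (h.smul_const e)

/-- A projective transformation tangent to the identity at the origin. -/
noncomputable def projMap (e : E) (B : ℂ) (w : E) : E := (1 - B * inner ℂ e w)⁻¹ • w

lemma projMap_neg_projMap {e : E} {B : ℂ} {w : E} (h : 1 - B * inner ℂ e w ≠ 0) :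
    projMap e (-B) (projMap e B w) = w := by
  rw [projMap, projMap, inner_smul_right, smul_smul]
  generalize inner ℂ e w = x at h
  have h1 : 1 - -B * ((1 - B * x)⁻¹ * x) = (1 - B * x)⁻¹ := by
    field_simp
    ring
  rw [h1, inv_inv, mul_inv_cancel₀ h, one_smul]

lemma differentiableAt_projMap {e : E} {B : ℂ} {w : E} (h : 1 - B * inner ℂ e w ≠ 0) :
    DifferentiableAt ℂ (projMap e B) w := by
  have h1 : DifferentiableAt ℂ (fun w : E => inner ℂ e w) w := (innerSL ℂ e).differentiableAt
  exact (((h1.const_mul B).const_sub 1).inv h).smul differentiableAt_id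

/-- A Cayley transform mapping a Siegel domain to the ball and `-a • e` to the origin. -/
noncomputable def cayleyMap (e : E) (a : ℂ) (b : ℝ) (w : E) : E :=
  (2 * b / (starRingEnd ℂ a - inner ℂ e w)) • perpPart e w +
    ((a + inner ℂ e w) / (starRingEnd ℂ a - inner ℂ e w)) • e

/-- The inverse of `cayleyMap`. -/
noncomputable def cayleyInv (e : E) (a : ℂ) (b : ℝ) (ζ : E) : E :=
  ((a.re : ℂ) / b / (1 + inner ℂ e ζ)) • perpPart e ζ +
    ((starRingEnd ℂ a * inner ℂ e ζ - a) / (1 + inner ℂ e ζ)) • e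

lemma cayleyInv_cayleyMap {e : E} (he : ‖e‖ = 1) {a : ℂ} (ha : 0 < a.re) {b : ℝ} (hb : b ≠ 0)
    {w : E} (h : starRingEnd ℂ a - inner ℂ e w ≠ 0) :
    cayleyInv e a b (cayleyMap e a b w) = w := by
  rw [cayleyInv, cayleyMap, inner_smul_perpPart_add he, perpPart_smul_perpPart_add he, smul_smul]
  have hb' : (b : ℂ) ≠ 0 := ofReal_ne_zero.2 hb
  have ha' : (a.re : ℂ) ≠ 0 := ofReal_ne_zero.2 ha.ne'
  have hsum : (a + starRingEnd ℂ a) = 2 * a.re := by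
    rw [Complex.add_conj]
    push_cast
    ring
  set x := inner ℂ e w with hx
  have h1 : 1 + (a + x) / (starRingEnd ℂ a - x) = 2 * a.re / (starRingEnd ℂ a - x) := by
    rw [← hsum]
    field_simp
    ring
  rw [h1]
  conv_rhs => rw [← perpPart_add_smul e w, ← hx, ← one_smul ℂ (perpPart e w)]
  congr 2
  · field_simp
  · rw [div_eq_iff (div_ne_zero (mul_ne_zero two_ne_zero ha') h), ← hsum]
    field_simp
    ring

lemma cayleyMap_cayleyInv {e : E} (he : ‖e‖ = 1) {a : ℂ} (ha : 0 < a.re) {b : ℝ} (hb : b ≠ 0)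
    {ζ : E} (h : 1 + inner ℂ e ζ ≠ 0) :
    cayleyMap e a b (cayleyInv e a b ζ) = ζ := by
  rw [cayleyInv, cayleyMap, inner_smul_perpPart_add he, perpPart_smul_perpPart_add he, smul_smul]
  have hb' : (b : ℂ) ≠ 0 := ofReal_ne_zero.2 hb
  have ha' : (a.re : ℂ) ≠ 0 := ofReal_ne_zero.2 ha.ne'
  have hsum : (a + starRingEnd ℂ a) = 2 * a.re := by
    rw [Complex.add_conj]
    push_cast
    ring
  set x := inner ℂ e ζ with hx
  have h1 : starRingEnd ℂ a - (starRingEnd ℂ a * x - a) / (1 + x) = 2 * a.re / (1 + x) := by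
    rw [← hsum]
    field_simp
    ring
  rw [h1]
  conv_rhs => rw [← perpPart_add_smul e ζ, ← hx, ← one_smul ℂ (perpPart e ζ)]
  congr 2
  · field_simp
  · rw [div_eq_iff (div_ne_zero (mul_ne_zero two_ne_zero ha') h), ← hsum]
    field_simp
    ring

lemma norm_conj_sub_sq_sub (a x : ℂ) :
    ‖starRingEnd ℂ a - x‖ ^ 2 - ‖a + x‖ ^ 2 = -(4 * a.re * x.re) := by
  rw [← normSq_eq_norm_sq, ← normSq_eq_norm_sq, normSq_apply, normSq_apply]
  simp
  ring

lemma norm_cayleyMap_lt_one {e : E} (he : ‖e‖ = 1) {a : ℂ} (ha : 0 < a.re) {b : ℝ} {w : E}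
    (hw : (inner ℂ e w).re * a.re + b ^ 2 * ‖perpPart e w‖ ^ 2 < 0) :
    ‖cayleyMap e a b w‖ < 1 := by
  have h1 : (inner ℂ e w).re < 0 := by
    have : 0 ≤ b ^ 2 * ‖perpPart e w‖ ^ 2 := by positivity
    by_contra hcon
    nlinarith [mul_nonneg (not_lt.1 hcon) ha.le]
  have hne : 0 < ‖starRingEnd ℂ a - inner ℂ e w‖ := norm_pos_iff.2 fun h0 => by
    have := congrArg re h0
    rw [sub_re, conj_re, zero_re] at this
    linarith
  rw [← sq_lt_one_iff₀ (norm_nonneg _), cayleyMap, norm_smul_perpPart_add_sq he, norm_div,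
    norm_div, div_pow, div_pow, div_mul_eq_mul_div, ← add_div, div_lt_one (by positivity)]
  have h2 := norm_conj_sub_sq_sub a (inner ℂ e w)
  rw [norm_mul, norm_real, norm_ofNat, mul_pow, Real.norm_eq_abs, sq_abs]
  linarith

lemma differentiableAt_cayleyMap {e : E} {a : ℂ} {b : ℝ} {w : E}
    (h : starRingEnd ℂ a - inner ℂ e w ≠ 0) : DifferentiableAt ℂ (cayleyMap e a b) w := by
  have h1 : DifferentiableAt ℂ (fun w : E => inner ℂ e w) w := (innerSL ℂ e).differentiableAt
  have h2 : DifferentiableAt ℂ (fun w : E => (starRingEnd ℂ a - inner ℂ e w)⁻¹) w :=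
    (h1.const_sub _).inv h
  have h3 : cayleyMap e a b = fun w =>
      (2 * b * (starRingEnd ℂ a - inner ℂ e w)⁻¹) • perpPart e w +
        ((a + inner ℂ e w) * (starRingEnd ℂ a - inner ℂ e w)⁻¹) • e := by
    funext w
    rw [cayleyMap, div_eq_mul_inv, div_eq_mul_inv]
  rw [h3]
  exact ((h2.const_mul _).smul (differentiable_perpPart e w)).add
    (((h1.const_add a).mul h2).smul_const e)

end Model

section Model

open Filter Topology

variable {E : Type*} [NormedAddCommGroup E] [InnerProductSpace ℂ E]

lemma re_div_mul_norm_sq (x : ℂ) {y : ℂ} (hy : y ≠ 0) :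
    (x / y).re * ‖y‖ ^ 2 = (x * starRingEnd ℂ y).re := by
  have h : x * starRingEnd ℂ y = (x / y) * ((‖y‖ ^ 2 : ℝ) : ℂ) := by
    rw [← normSq_eq_norm_sq, ← mul_conj]
    field_simp
  rw [h, re_mul_ofReal]

lemma re_div_one_add_mul {x : ℂ} {B : ℝ} (h : 1 + B * x ≠ 0) :
    (x / (1 + B * x)).re * ‖1 + B * x‖ ^ 2 = x.re + B * ‖x‖ ^ 2 := by
  rw [re_div_mul_norm_sq x h, ← normSq_eq_norm_sq, normSq_apply]
  simp
  ring

lemma re_conj_mul_sub_div {a z : ℂ} (h : 1 + z ≠ 0) :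
    ((starRingEnd ℂ a * z - a) / (1 + z)).re * ‖1 + z‖ ^ 2 = -(a.re * (1 - ‖z‖ ^ 2)) := by
  rw [re_div_mul_norm_sq _ h, ← normSq_eq_norm_sq, normSq_apply]
  simp
  ring

set_option maxHeartbeats 1000000 in
/-- The ball is the limiting shape of a strongly pseudoconvex point: a set squeezed between two
perturbed Siegel domains has images close to the ball. -/
lemma exists_model_map {e : E} (he : ‖e‖ = 1) {ε ε₂ B C r : ℝ} (hε : 0 < ε) (hε1 : ε < 1)
    (hε₂ : 0 ≤ ε₂) (hε₂ε : 8 * ε₂ ≤ ε) (hB : 0 ≤ B) (hC : 0 ≤ C) (hr : 0 < r) :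
    ∃ s > 0, ∀ a : ℂ, ‖a‖ < s → ‖a‖ ≤ 2 * a.re → a ≠ 0 → ∃ Φ : E → E,
      (∀ w, (inner ℂ e w).re + (1 - ε₂) * ‖perpPart e w‖ ^ 2 - B * ‖inner ℂ e w‖ ^ 2 < 0 →
        DifferentiableAt ℂ Φ w ∧ ‖Φ w‖ < 1) ∧
      InjOn Φ {w | (inner ℂ e w).re + (1 - ε₂) * ‖perpPart e w‖ ^ 2
        - B * ‖inner ℂ e w‖ ^ 2 < 0} ∧
      Φ (-(a • e)) = 0 ∧
      ∀ ζ, ‖ζ‖ < 1 - ε → ∃ w, ‖w‖ < r ∧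
        (inner ℂ e w).re + (1 + ε₂) * ‖perpPart e w‖ ^ 2 + C * ‖inner ℂ e w‖ ^ 2 < 0 ∧
        Φ w = ζ := by
  -- the smallness requirements on the base point
  obtain ⟨s, hs0, hs1, hs2, hs3⟩ : ∃ s > 0, 8 * B * s ≤ ε ∧ 80 * (B + C) * s < ε / 2 ∧
      4 * ((4 * s / ε) ^ 2 + 4 * s / ε ^ 2) < r ^ 2 := by
    have h1 : ∀ᶠ s in 𝓝[>] (0 : ℝ), 8 * B * s < ε :=
      ((by fun_prop : Continuous fun s : ℝ => 8 * B * s).tendsto' 0 0 (by simp)).mono_left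
        nhdsWithin_le_nhds |>.eventually (gt_mem_nhds hε)
    have h2 : ∀ᶠ s in 𝓝[>] (0 : ℝ), 80 * (B + C) * s < ε / 2 :=
      ((by fun_prop : Continuous fun s : ℝ => 80 * (B + C) * s).tendsto' 0 0 (by simp)).mono_left
        nhdsWithin_le_nhds |>.eventually (gt_mem_nhds (half_pos hε))
    have h3 : ∀ᶠ s in 𝓝[>] (0 : ℝ), 4 * ((4 * s / ε) ^ 2 + 4 * s / ε ^ 2) < r ^ 2 :=
      ((by fun_prop : Continuous fun s : ℝ => 4 * ((4 * s / ε) ^ 2 + 4 * s / ε ^ 2)).tendsto' 0 0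
        (by simp)).mono_left nhdsWithin_le_nhds |>.eventually (gt_mem_nhds (by positivity))
    obtain ⟨s, h1, h2, h3, hs⟩ := (h1.and (h2.and (h3.and self_mem_nhdsWithin))).exists
    exact ⟨s, hs, h1.le, h2, h3⟩
  refine ⟨s, hs0, fun a has har ha0 => ?_⟩
  have hare : 0 < a.re := by
    have := norm_pos_iff.2 ha0
    linarith
  have hBa : B * ‖a‖ ≤ 1 / 8 := by nlinarith [norm_nonneg a]
  have hBan : ‖(B : ℂ) * a‖ ≤ 1 / 8 := by
    rwa [norm_mul, norm_real, Real.norm_of_nonneg hB]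
  have hden1 : 7 / 8 ≤ ‖1 + B * a‖ := by
    have := norm_sub_norm_le (1 : ℂ) (-(B * a))
    rw [sub_neg_eq_add, norm_neg, norm_one] at this
    linarith
  have hden2 : ‖1 + B * a‖ ≤ 9 / 8 := by
    have := norm_add_le (1 : ℂ) (B * a)
    rw [norm_one] at this
    linarith
  have hden0 : 1 + B * a ≠ 0 := norm_pos_iff.1 (by linarith)
  set A : ℂ := a / (1 + B * a) with hA
  have hAre : a.re ≤ A.re * (81 / 64) := by
    have h1 := re_div_one_add_mul hden0
    have h2 : 0 ≤ B * ‖a‖ ^ 2 := by positivity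
    have h3 : ‖1 + B * a‖ ^ 2 ≤ (9 / 8) ^ 2 := by gcongr
    have h4 : 0 ≤ A.re := by
      by_contra hcon
      have : 0 < ‖1 + B * a‖ ^ 2 := by positivity
      nlinarith [not_le.1 hcon]
    nlinarith
  have ht : 0 < A.re := by linarith
  have hAn : ‖A‖ ≤ 2 * ‖a‖ := by
    rw [hA, norm_div, div_le_iff₀ (by linarith)]
    nlinarith [norm_nonneg a]
  have hAt : ‖A‖ ≤ 6 * A.re := by linarith
  set b : ℝ := Real.sqrt (A.re * (1 - ε₂)) with hb
  have hε₂1 : ε₂ < 1 / 8 := by linarith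
  have hb2 : b ^ 2 = A.re * (1 - ε₂) := Real.sq_sqrt (mul_nonneg ht.le (by linarith))
  have hb0 : 0 < b := Real.sqrt_pos.2 (mul_pos ht (by linarith))
  -- the outer domain
  have hout : ∀ w, (inner ℂ e w).re + (1 - ε₂) * ‖perpPart e w‖ ^ 2
      - B * ‖inner ℂ e w‖ ^ 2 < 0 → 1 - B * inner ℂ e w ≠ 0 ∧
      starRingEnd ℂ A - inner ℂ e (projMap e B w) ≠ 0 ∧
      (inner ℂ e (projMap e B w)).re * A.re + b ^ 2 * ‖perpPart e (projMap e B w)‖ ^ 2 < 0 := by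
    intro w hw
    have h1 : 1 - B * inner ℂ e w ≠ 0 := fun h0 => by
      have h2 : 0 ≤ (1 - ε₂) * ‖perpPart e w‖ ^ 2 := mul_nonneg (by linarith) (by positivity)
      have h3 := congrArg re h0
      have h4 := congrArg im h0
      rw [sub_re, re_ofReal_mul, one_re, zero_re] at h3
      rw [sub_im, im_ofReal_mul, one_im, zero_im] at h4
      rw [← normSq_eq_norm_sq, normSq_apply] at hw
      have h5 : (inner ℂ e w).re - B * ((inner ℂ e w).re * (inner ℂ e w).re +
          (inner ℂ e w).im * (inner ℂ e w).im) = 0 := by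
        linear_combination (inner ℂ e w).re * h3 + (inner ℂ e w).im * h4
      linarith
    have h2 : (inner ℂ e (projMap e B w)).re * ‖1 - B * inner ℂ e w‖ ^ 2 =
        (inner ℂ e w).re - B * ‖inner ℂ e w‖ ^ 2 := by
      have := re_div_one_add_mul (x := inner ℂ e w) (B := -B) (by
        rwa [ofReal_neg, neg_mul, ← sub_eq_add_neg])
      rw [ofReal_neg, neg_mul, neg_mul, ← sub_eq_add_neg, ← sub_eq_add_neg] at this
      rw [projMap, inner_smul_right, ← this, div_eq_inv_mul]
    have h3 : ‖perpPart e (projMap e B w)‖ ^ 2 * ‖1 - B * inner ℂ e w‖ ^ 2 =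
        ‖perpPart e w‖ ^ 2 := by
      rw [projMap, perpPart_smul, norm_smul, norm_inv, mul_pow, inv_pow]
      have : ‖1 - B * inner ℂ e w‖ ≠ 0 := norm_ne_zero_iff.2 h1
      field_simp
    have h4 : 0 < ‖1 - B * inner ℂ e w‖ ^ 2 := by
      have := norm_pos_iff.2 h1
      positivity
    have h5 : (inner ℂ e (projMap e B w)).re + (1 - ε₂) * ‖perpPart e (projMap e B w)‖ ^ 2 < 0 := by
      by_contra hcon
      have := mul_nonneg (not_lt.1 hcon) h4.le
      rw [add_mul, h2, mul_assoc, h3] at this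
      linarith
    refine ⟨h1, fun h0 => ?_, ?_⟩
    · have h6 := congrArg re h0
      rw [sub_re, conj_re, zero_re] at h6
      have h7 : 0 ≤ (1 - ε₂) * ‖perpPart e (projMap e B w)‖ ^ 2 :=
        mul_nonneg (by linarith) (by positivity)
      linarith
    · rw [hb2]
      nlinarith
  refine ⟨cayleyMap e A b ∘ projMap e B, fun w hw => ?_, fun w hw w₂ hw₂ heq => ?_, ?_,
    fun ζ hζ => ?_⟩
  · obtain ⟨h1, h2, h3⟩ := hout w hw
    exact ⟨(differentiableAt_cayleyMap h2).comp w (differentiableAt_projMap h1),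
      norm_cayleyMap_lt_one he ht h3⟩
  · obtain ⟨h1, h2, h3⟩ := hout w hw
    obtain ⟨h1', h2', h3'⟩ := hout w₂ hw₂
    have h4 := congrArg (cayleyInv e A b) heq
    rw [Function.comp_apply, Function.comp_apply, cayleyInv_cayleyMap he ht hb0.ne' h2,
      cayleyInv_cayleyMap he ht hb0.ne' h2'] at h4
    rw [← projMap_neg_projMap h1, h4, projMap_neg_projMap h1']
  · have h1 : inner ℂ e (-(a • e)) = -a := by
      rw [inner_neg_right, inner_smul_right, inner_self_eq_norm_sq_to_K, he]
      simp
    have h2 : projMap e B (-(a • e)) = -(A • e) := by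
      rw [projMap, h1, mul_neg, sub_neg_eq_add, smul_neg, smul_smul, hA, div_eq_inv_mul]
    have h3 : inner ℂ e (-(A • e)) = -A := by
      rw [inner_neg_right, inner_smul_right, inner_self_eq_norm_sq_to_K, he]
      simp
    have h4 : perpPart e (-(A • e)) = 0 := by
      rw [perpPart, h3, neg_smul, sub_neg_eq_add, neg_add_cancel]
    rw [Function.comp_apply, h2, cayleyMap, h3, h4, smul_zero, add_neg_cancel, zero_div, zero_smul,
      add_zero]
  · have hζsq := norm_sq_eq_perpPart he ζ
    set z : ℂ := inner ℂ e ζ with hz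
    have hζ1 : ‖z‖ ^ 2 + ‖perpPart e ζ‖ ^ 2 ≤ 1 - ε := by nlinarith [norm_nonneg ζ]
    have hzn : ‖z‖ < 1 - ε := lt_of_le_of_lt (by
      rw [← sq_le_sq₀ (norm_nonneg _) (norm_nonneg _), hζsq]
      nlinarith [norm_nonneg (perpPart e ζ)]) hζ
    have hz1 : ε ≤ ‖1 + z‖ := by
      have := norm_sub_norm_le (1 : ℂ) (-z)
      rw [sub_neg_eq_add, norm_neg, norm_one] at this
      linarith
    have hz0 : 1 + z ≠ 0 := norm_pos_iff.1 (by linarith)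
    set u := cayleyInv e A b ζ with hu
    have hun : inner ℂ e u = (starRingEnd ℂ A * z - A) / (1 + z) := by
      rw [hu, cayleyInv, inner_smul_perpPart_add he]
    have hup : perpPart e u = ((A.re : ℂ) / b / (1 + z)) • perpPart e ζ := by
      rw [hu, cayleyInv, perpPart_smul_perpPart_add he]
    set x : ℂ := inner ℂ e u with hx
    have hx1 : ‖x‖ * ‖1 + z‖ ≤ 2 * ‖A‖ := by
      rw [hun, norm_div, div_mul_cancel₀ _ (norm_ne_zero_iff.2 hz0)]
      calc _ ≤ ‖starRingEnd ℂ A * z‖ + ‖A‖ := norm_sub_le _ _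
        _ = ‖A‖ * ‖z‖ + ‖A‖ := by rw [norm_mul, norm_conj]
        _ ≤ ‖A‖ * 1 + ‖A‖ := by gcongr; linarith
        _ = 2 * ‖A‖ := by ring
    have hx2 : ‖x‖ ≤ 4 * ‖a‖ / ε := by
      rw [le_div_iff₀ hε]
      nlinarith [norm_nonneg x]
    have hp1 : ‖perpPart e u‖ ^ 2 * ‖1 + z‖ ^ 2 * (1 - ε₂) = A.re * ‖perpPart e ζ‖ ^ 2 := by
      have hzz : ‖1 + z‖ ≠ 0 := norm_ne_zero_iff.2 hz0
      rw [hup, norm_smul, norm_div, norm_div, norm_real, norm_real, Real.norm_of_nonneg ht.le,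
        Real.norm_of_nonneg hb0.le]
      field_simp
      rw [hb2]
      ring
    have hBx : ‖(B : ℂ) * x‖ ≤ 1 / 2 := by
      rw [norm_mul, norm_real, Real.norm_of_nonneg hB]
      calc B * ‖x‖ ≤ B * (4 * s / ε) := by gcongr; exact hx2.trans (by gcongr)
        _ = (8 * B * s) / ε / 2 := by ring
        _ ≤ 1 / 2 := by
          gcongr
          exact (div_le_one hε).2 hs1
    have hm1 : 1 / 2 ≤ ‖1 + B * x‖ := by
      have := norm_sub_norm_le (1 : ℂ) (-(B * x))
      rw [sub_neg_eq_add, norm_neg, norm_one] at this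
      linarith
    have hm0 : 1 + B * x ≠ 0 := norm_pos_iff.1 (by linarith)
    have hm0' : 1 - (-B : ℂ) * x ≠ 0 := by rwa [neg_mul, sub_neg_eq_add]
    have hw1 : projMap e (-B) u = (1 + B * x)⁻¹ • u := by
      rw [projMap, ← hx, neg_mul, sub_neg_eq_add]
    refine ⟨projMap e (-B) u, ?_, ?_, ?_⟩
    · have h1 : ‖u‖ ^ 2 ≤ (4 * s / ε) ^ 2 + 4 * s / ε ^ 2 := by
        rw [norm_sq_eq_perpPart he u, ← hx, add_comm]
        gcongr
        · exact hx2.trans (by gcongr)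
        · rw [le_div_iff₀ (by positivity)]
          have h2 : ε ^ 2 ≤ ‖1 + z‖ ^ 2 := by gcongr
          have h3 : ‖perpPart e ζ‖ ^ 2 ≤ 1 := by linarith [sq_nonneg ‖z‖]
          have h4 : A.re ≤ ‖A‖ := re_le_norm A
          have h5 : 0 ≤ ‖perpPart e u‖ ^ 2 := by positivity
          have h6 : ‖perpPart e u‖ ^ 2 * ‖1 + z‖ ^ 2 * (1 - ε₂) ≤ 2 * s := by
            rw [hp1]
            nlinarith
          have h7 : 0 ≤ ‖perpPart e u‖ ^ 2 * ‖1 + z‖ ^ 2 := by positivity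
          nlinarith
      rw [← sq_lt_sq₀ (norm_nonneg _) hr.le, hw1, norm_smul, norm_inv, mul_pow]
      have h2 : ‖1 + B * x‖⁻¹ ^ 2 ≤ 4 := by
        have : ‖1 + B * x‖⁻¹ ≤ 2 := by
          rw [inv_le_comm₀ (by linarith) (by norm_num)]
          linarith
        nlinarith [inv_nonneg.2 (norm_nonneg (1 + B * x))]
      calc _ ≤ 4 * ((4 * s / ε) ^ 2 + 4 * s / ε ^ 2) := by gcongr
        _ < _ := hs3
    · have h1 : inner ℂ e (projMap e (-B) u) = x / (1 + B * x) := by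
        rw [hw1, inner_smul_right, ← hx, div_eq_inv_mul]
      have h2 := re_div_one_add_mul hm0
      have hm : 0 < ‖1 + B * x‖ ^ 2 := by positivity
      have hmz : 0 < ‖1 + z‖ ^ 2 := by
        have := norm_pos_iff.2 hz0
        positivity
      have h3 : ‖perpPart e (projMap e (-B) u)‖ ^ 2 * ‖1 + B * x‖ ^ 2 = ‖perpPart e u‖ ^ 2 := by
        rw [hw1, perpPart_smul, norm_smul, norm_inv, mul_pow, inv_pow]
        field_simp
      have h4 : ‖x / (1 + B * x)‖ ^ 2 * ‖1 + B * x‖ ^ 2 = ‖x‖ ^ 2 := by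
        rw [norm_div, div_pow]
        field_simp
      have h5 : x.re * ‖1 + z‖ ^ 2 = -(A.re * (1 - ‖z‖ ^ 2)) := by
        rw [hun]
        exact re_conj_mul_sub_div hz0
      have h6 : ‖x‖ ^ 2 * ‖1 + z‖ ^ 2 ≤ 4 * ‖A‖ ^ 2 := by
        rw [← mul_pow]
        calc _ ≤ (2 * ‖A‖) ^ 2 := by gcongr
          _ = _ := by ring
      rw [h1]
      suffices hkey : (x.re + B * ‖x‖ ^ 2 + (1 + ε₂) * ‖perpPart e u‖ ^ 2 + C * ‖x‖ ^ 2) *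
          ‖1 + z‖ ^ 2 < 0 by
        have h7 : x.re + B * ‖x‖ ^ 2 + (1 + ε₂) * ‖perpPart e u‖ ^ 2 + C * ‖x‖ ^ 2 < 0 := by
          by_contra hcon
          linarith [mul_nonneg (not_lt.1 hcon) hmz.le]
        by_contra hcon
        have := mul_nonneg (not_lt.1 hcon) hm.le
        rw [add_mul, add_mul, h2, mul_assoc, h3, mul_assoc, h4] at this
        linarith
      have h7 : (1 + ε₂) * (‖perpPart e u‖ ^ 2 * ‖1 + z‖ ^ 2) ≤
          (1 + 4 * ε₂) * (A.re * ‖perpPart e ζ‖ ^ 2) := by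
        rw [← hp1]
        have : 0 ≤ ‖perpPart e u‖ ^ 2 * ‖1 + z‖ ^ 2 := by positivity
        have h8 := mul_nonneg (mul_nonneg this hε₂) (show 0 ≤ 2 - 4 * ε₂ by linarith)
        linarith
      have h8 : (B + C) * (‖x‖ ^ 2 * ‖1 + z‖ ^ 2) < A.re * (ε / 2) := by
        calc (B + C) * (‖x‖ ^ 2 * ‖1 + z‖ ^ 2) ≤ (B + C) * (4 * ‖A‖ ^ 2) := by gcongr
          _ = (4 * (B + C) * ‖A‖) * ‖A‖ := by ring
          _ ≤ (4 * (B + C) * (2 * s)) * (6 * A.re) := by gcongr; linarith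
          _ = A.re * (48 * (B + C) * s) := by ring
          _ < _ := by
            gcongr
            have : 0 ≤ (B + C) * s := by positivity
            linarith
      have h9 : ‖perpPart e ζ‖ ^ 2 ≤ 1 := by linarith [sq_nonneg ‖z‖]
      have h10 : A.re * (-(1 - ‖z‖ ^ 2) + (1 + 4 * ε₂) * ‖perpPart e ζ‖ ^ 2 + ε / 2) ≤ 0 :=
        mul_nonpos_of_nonneg_of_nonpos ht.le (by
          have := mul_le_mul_of_nonneg_left h9 hε₂
          linarith)
      linarith
    · rw [Function.comp_apply]
      have := projMap_neg_projMap (e := e) (B := (-B : ℂ)) (w := u) hm0'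
      rw [neg_neg] at this
      rw [this, hu, cayleyMap_cayleyInv he ht hb0.ne' hz0]

end Model

section NormalForm

open Filter Topology

variable {n : ℕ}

local notation "𝔼" => EuclideanSpace ℂ (Fin n)

lemma norm_holoDeriv_sub_le (r : 𝔼 → ℝ) (p q v : 𝔼) :
    ‖holoDeriv r q v - holoDeriv r p v‖ ≤ 2 * ‖fderiv ℝ r q - fderiv ℝ r p‖ * ‖v‖ := by
  have h : holoDeriv r q v - holoDeriv r p v = ((fderiv ℝ r q - fderiv ℝ r p) v : ℝ) -
      I * ((fderiv ℝ r q - fderiv ℝ r p) (I • v) : ℝ) := by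
    rw [holoDeriv_apply, holoDeriv_apply, _root_.sub_apply, _root_.sub_apply]
    push_cast
    ring
  rw [h]
  refine (norm_sub_le _ _).trans ?_
  rw [norm_mul, norm_I, one_mul, norm_real, norm_real]
  have h1 := (fderiv ℝ r q - fderiv ℝ r p).le_opNorm v
  have h2 := (fderiv ℝ r q - fderiv ℝ r p).le_opNorm (I • v)
  rw [norm_smul, norm_I, one_mul] at h2
  linarith

lemma holoDeriv_eq_inner {r : 𝔼 → ℝ} {e p : 𝔼} (h : ∀ v, fderiv ℝ r p v = (inner ℂ e v).re)
    (v : 𝔼) : holoDeriv r p v = inner ℂ e v := by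
  rw [holoDeriv_apply, h, h, inner_smul_right]
  apply Complex.ext <;> simp

lemma eventually_norm_holoDeriv_sub_le {r : 𝔼 → ℝ} {e : 𝔼} (hr : ContDiffAt ℝ 2 r 0)
    (hDr : ∀ v, fderiv ℝ r 0 v = (inner ℂ e v).re) {ε : ℝ} (hε : 0 < ε) :
    ∀ᶠ q in 𝓝 (0 : 𝔼), ∀ v, ‖holoDeriv r q v - inner ℂ e v‖ ≤ ε * ‖v‖ := by
  have h1 : ContinuousAt (fderiv ℝ r) 0 :=
    (hr.fderiv_right (m := 1) (by norm_num)).continuousAt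
  filter_upwards [Metric.continuousAt_iff'.1 h1 (ε / 2) (half_pos hε)] with q hq v
  rw [dist_eq_norm] at hq
  rw [← holoDeriv_eq_inner hDr]
  refine (norm_holoDeriv_sub_le r 0 q v).trans ?_
  gcongr
  linarith

lemma abs_half_quadratic_sub_le {e : 𝔼} (he : ‖e‖ = 1) (B : 𝔼 →L[ℝ] 𝔼 →L[ℝ] ℝ) {ε₀ : ℝ}
    (hB : ∀ v, inner ℂ e v = 0 → |1 / 2 * B v v - ‖v‖ ^ 2| ≤ ε₀ * ‖v‖ ^ 2) {ε : ℝ} (hε : 0 < ε)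
    (v : 𝔼) : |1 / 2 * B v v - ‖perpPart e v‖ ^ 2| ≤
      (ε₀ + ε) * ‖perpPart e v‖ ^ 2 + (‖B‖ ^ 2 / ε + ‖B‖) * ‖inner ℂ e v‖ ^ 2 := by
  have h1 := hB (perpPart e v) (inner_perpPart he v)
  set w := perpPart e v with hw
  set x : ℂ := inner ℂ e v with hx
  have hv : v = w + x • e := (perpPart_add_smul e v).symm
  have hxe : ‖x • e‖ = ‖x‖ := by rw [norm_smul, he, mul_one]
  have h2 : B v v = B w w + B w (x • e) + B (x • e) w + B (x • e) (x • e) := by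
    conv_lhs => rw [hv]
    simp only [map_add, _root_.add_apply]
    ring
  have h3 := B.le_opNorm₂ w (x • e)
  have h4 := B.le_opNorm₂ (x • e) w
  have h5 := B.le_opNorm₂ (x • e) (x • e)
  rw [hxe, Real.norm_eq_abs, abs_le] at h3 h4 h5
  rw [abs_le] at h1
  have h6 : ‖B‖ * ‖w‖ * ‖x‖ ≤ ε * ‖w‖ ^ 2 + ‖B‖ ^ 2 / ε * ‖x‖ ^ 2 := by
    have h7 : ε * (ε * ‖w‖ ^ 2 + ‖B‖ ^ 2 / ε * ‖x‖ ^ 2 - ‖B‖ * ‖w‖ * ‖x‖) =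
        (ε * ‖w‖ - ‖B‖ * ‖x‖ / 2) ^ 2 + 3 / 4 * (‖B‖ * ‖x‖) ^ 2 := by
      field_simp
      ring
    have h8 : 0 ≤ ε * (ε * ‖w‖ ^ 2 + ‖B‖ ^ 2 / ε * ‖x‖ ^ 2 - ‖B‖ * ‖w‖ * ‖x‖) := by
      rw [h7]
      positivity
    linarith [nonneg_of_mul_nonneg_right h8 hε]
  have h9 : 0 ≤ ‖B‖ * ‖x‖ * ‖x‖ := by positivity
  rw [h2, abs_le]
  constructor <;> linarith

/-- A uniform quadratic expansion around all nearby zeros of a normalized defining function. -/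
lemma exists_normal_expansion {e : 𝔼} (he : ‖e‖ = 1) {r : 𝔼 → ℝ} (hr : ContDiffAt ℝ 2 r 0)
    (hDr : ∀ v, fderiv ℝ r 0 v = (inner ℂ e v).re) {ε₀ ε₂ : ℝ}
    (hquad : ∀ v, inner ℂ e v = 0 →
      |1 / 2 * fderiv ℝ (fderiv ℝ r) 0 v v - ‖v‖ ^ 2| ≤ ε₀ * ‖v‖ ^ 2) (hε : ε₀ < ε₂) :
    ∃ C ≥ 0, ∃ δ > 0, ∀ q, ‖q‖ < δ → r q = 0 → ∀ v, ‖v‖ < δ →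
      |r (q + v) - (holoDeriv r q v).re - ‖perpPart e v‖ ^ 2| ≤
        ε₂ * ‖perpPart e v‖ ^ 2 + C * ‖holoDeriv r q v‖ ^ 2 := by
  set B := fderiv ℝ (fderiv ℝ r) 0 with hBdef
  set μ : ℝ := (ε₂ - ε₀) / 3 with hμ
  have hμ0 : 0 < μ := by rw [hμ]; linarith
  set C : ℝ := ‖B‖ ^ 2 / μ + ‖B‖ + μ with hC
  have hC0 : 0 < C := by positivity
  obtain ⟨ν, hν0, hν1, hν2⟩ : ∃ ν > 0, 2 * ν ^ 2 ≤ 1 / 2 ∧ C * (4 * ν ^ 2) ≤ μ := by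
    have h1 : ∀ᶠ s in 𝓝[>] (0 : ℝ), 2 * s ^ 2 < 1 / 2 :=
      ((by fun_prop : Continuous fun s : ℝ => 2 * s ^ 2).tendsto' 0 0 (by simp)).mono_left
        nhdsWithin_le_nhds |>.eventually (gt_mem_nhds (by norm_num))
    have h2 : ∀ᶠ s in 𝓝[>] (0 : ℝ), C * (4 * s ^ 2) < μ :=
      ((by fun_prop : Continuous fun s : ℝ => C * (4 * s ^ 2)).tendsto' 0 0 (by simp)).mono_left
        nhdsWithin_le_nhds |>.eventually (gt_mem_nhds hμ0)
    obtain ⟨s, h1, h2, hs⟩ := (h1.and (h2.and self_mem_nhdsWithin)).exists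
    exact ⟨s, hs, h1.le, h2.le⟩
  obtain ⟨δ₁, hδ₁, h1⟩ := hr.exists_taylor_two hμ0
  obtain ⟨δ₂, hδ₂, h2⟩ := Metric.eventually_nhds_iff.1 (eventually_norm_holoDeriv_sub_le hr hDr hν0)
  refine ⟨C * 4, by positivity, min δ₁ δ₂, lt_min hδ₁ hδ₂, fun q hq hrq v hv => ?_⟩
  have h3 := (h1 q (mem_ball_zero_iff.2 (hq.trans_le (min_le_left _ _))) v
    (hv.trans_le (min_le_left _ _))).2.2
  have h4 := h2 (y := q) (by rw [dist_zero_right]; exact hq.trans_le (min_le_right _ _)) v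
  have h5 := abs_half_quadratic_sub_le he B hquad hμ0 v
  have h6 := norm_sq_eq_perpPart he v
  rw [hrq, sub_zero, ← re_holoDeriv, smul_eq_mul, Real.norm_eq_abs, h6] at h3
  set l := holoDeriv r q v
  set x : ℂ := inner ℂ e v
  have h7 : ‖x‖ ^ 2 ≤ 4 * ‖l‖ ^ 2 + 4 * ν ^ 2 * ‖perpPart e v‖ ^ 2 := by
    have h8 : ‖x‖ ≤ ‖l‖ + ν * ‖v‖ := by
      have := norm_sub_norm_le x l
      rw [norm_sub_rev] at this
      linarith
    have h9 : ‖x‖ ^ 2 ≤ 2 * ‖l‖ ^ 2 + 2 * ν ^ 2 * ‖v‖ ^ 2 := by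
      calc ‖x‖ ^ 2 ≤ (‖l‖ + ν * ‖v‖) ^ 2 := by gcongr
        _ ≤ _ := by nlinarith [sq_nonneg (‖l‖ - ν * ‖v‖)]
    rw [h6] at h9
    have h10 := mul_le_mul_of_nonneg_right hν1 (sq_nonneg ‖x‖)
    linarith
  have h8 := mul_le_mul_of_nonneg_left h7 hC0.le
  have h9 := mul_le_mul_of_nonneg_right hν2 (sq_nonneg ‖perpPart e v‖)
  have h10 : (ε₀ + 3 * μ) = ε₂ := by rw [hμ]; ring
  rw [abs_le] at h3 h5 ⊢
  rw [← h10]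
  simp only [hC] at h8 h9 ⊢
  constructor <;> linarith

end NormalForm

section NormalForm

open Filter Topology

variable {n : ℕ}

local notation "𝔼" => EuclideanSpace ℂ (Fin n)

lemma eventually_exists_zero_above {e : 𝔼} (he : ‖e‖ = 1) {r : 𝔼 → ℝ} (hr : ContDiffAt ℝ 2 r 0)
    (hr0 : r 0 = 0) (hDr : ∀ v, fderiv ℝ r 0 v = (inner ℂ e v).re) {σ : ℝ} (hσ : 0 < σ) :
    ∀ᶠ y in 𝓝 (0 : 𝔼), r y < 0 → ∃ s, 0 < s ∧ s < σ ∧ r (y + (s : ℂ) • e) = 0 := by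
  have h1 : ∀ᶠ x in 𝓝 (0 : 𝔼), ContinuousAt r x :=
    (hr.eventually (by norm_num)).mono fun x hx => hx.continuousAt
  obtain ⟨σ₀, hσ₀, h2⟩ := Metric.eventually_nhds_iff.1 h1
  have h3 : HasFDerivAt r (fderiv ℝ r 0) ((0 : ℝ) • e) := by
    rw [zero_smul]
    exact (hr.differentiableAt (by norm_num)).hasFDerivAt
  have h4 : HasDerivAt (fun s : ℝ => r (s • e)) (fderiv ℝ r 0 e) 0 := by
    have h5 : HasDerivAt (fun s : ℝ => s • e) e 0 := by
      simpa using (hasDerivAt_id (0 : ℝ)).smul_const e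
    exact h3.comp_hasDerivAt (0 : ℝ) h5
  have h5 : fderiv ℝ r 0 e = 1 := by
    rw [hDr, inner_self_eq_norm_sq_to_K, he]
    simp
  rw [h5] at h4
  have h6 : ∀ᶠ s in 𝓝[>] (0 : ℝ), 0 < r (s • e) := by
    have h7 := (hasDerivAt_iff_tendsto_slope.1 h4).mono_left
      (nhdsWithin_mono 0 (fun x (hx : 0 < x) => hx.ne') : 𝓝[>] (0 : ℝ) ≤ 𝓝[≠] 0)
    filter_upwards [h7.eventually (lt_mem_nhds zero_lt_one), self_mem_nhdsWithin] with s hs hs0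
    rw [slope_def_field, zero_smul, hr0, sub_zero, sub_zero] at hs
    exact (div_pos_iff_of_pos_right hs0).1 hs
  have h7 : ∀ᶠ s in 𝓝[>] (0 : ℝ), s < min σ (σ₀ / 2) :=
    nhdsWithin_le_nhds (gt_mem_nhds (lt_min hσ (half_pos hσ₀)))
  obtain ⟨s, hs1, hs2, hs0⟩ := (h6.and (h7.and self_mem_nhdsWithin)).exists
  have hs0' : 0 < s := hs0
  have hsn : ‖s • e‖ < σ₀ / 2 := by
    rw [norm_smul, he, mul_one, Real.norm_of_nonneg hs0'.le]
    exact hs2.trans_le (min_le_right _ _)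
  have h8 : ∀ᶠ y in 𝓝 (0 : 𝔼), 0 < r (y + s • e) := by
    have h9 : ContinuousAt (fun y : 𝔼 => r (y + s • e)) 0 := by
      refine ContinuousAt.comp (g := r) ?_ (by fun_prop)
      rw [zero_add]
      exact h2 (by rw [dist_zero_right]; linarith)
    refine h9.tendsto.eventually (lt_mem_nhds ?_)
    rw [zero_add]
    exact hs1
  filter_upwards [h8, ball_mem_nhds (0 : 𝔼) (half_pos hσ₀)] with y hy1 hy2 hy3
  rw [mem_ball_zero_iff] at hy2
  have hc : ContinuousOn (fun t : ℝ => r (y + t • e)) (Icc 0 s) := fun t ht => by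
    refine ContinuousAt.continuousWithinAt (ContinuousAt.comp (g := r) (h2 ?_) (by fun_prop))
    rw [dist_zero_right]
    refine (norm_add_le _ _).trans_lt ?_
    rw [norm_smul, he, mul_one, Real.norm_of_nonneg ht.1]
    have := hs2.trans_le (min_le_right _ _)
    linarith [ht.2]
  obtain ⟨t, ht, ht0⟩ := intermediate_value_Ioo hs0'.le hc
    (show (0 : ℝ) ∈ Ioo _ _ from ⟨by simpa using hy3, hy1⟩)
  refine ⟨t, ht.1, (ht.2.trans hs2).trans_le (min_le_left _ _), ?_⟩
  rw [Complex.coe_smul]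
  exact ht0

/-- The complex affine coordinates at a boundary point `q` adapted to the functional `l`. -/
noncomputable def adaptedMap (e q : 𝔼) (l : EuclideanSpace ℂ (Fin n) →L[ℂ] ℂ) (x : 𝔼) : 𝔼 :=
  perpPart e (x - q) + l (x - q) • e

lemma inner_adaptedMap {e : 𝔼} (he : ‖e‖ = 1) (q : 𝔼) (l : 𝔼 →L[ℂ] ℂ) (x : 𝔼) :
    inner ℂ e (adaptedMap e q l x) = l (x - q) := by
  have := inner_smul_perpPart_add he (x - q) 1 (l (x - q))
  rwa [one_smul] at this

lemma perpPart_adaptedMap {e : 𝔼} (he : ‖e‖ = 1) (q : 𝔼) (l : 𝔼 →L[ℂ] ℂ) (x : 𝔼) :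
    perpPart e (adaptedMap e q l x) = perpPart e (x - q) := by
  have := perpPart_smul_perpPart_add he (x - q) 1 (l (x - q))
  rwa [one_smul] at this

lemma differentiable_adaptedMap (e q : 𝔼) (l : 𝔼 →L[ℂ] ℂ) :
    Differentiable ℂ (adaptedMap e q l) := by
  have h : Differentiable ℂ fun x : 𝔼 => x - q := differentiable_id.sub_const q
  exact ((differentiable_perpPart e).comp h).add ((l.differentiable.comp h).smul_const e)

lemma adaptedMap_injective {e : 𝔼} (he : ‖e‖ = 1) (q : 𝔼) {l : 𝔼 →L[ℂ] ℂ} (hl : l e ≠ 0) :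
    Function.Injective (adaptedMap e q l) := fun x y hxy => by
  have h1 := congrArg (perpPart e) hxy
  have h2 := congrArg (fun w => inner ℂ e w) hxy
  simp only [inner_adaptedMap he] at h2
  rw [perpPart_adaptedMap he, perpPart_adaptedMap he] at h1
  have h3 : x - y = inner ℂ e (x - y) • e := by
    have : x - y = perpPart e (x - q) + inner ℂ e (x - q) • e -
        (perpPart e (y - q) + inner ℂ e (y - q) • e) := by
      rw [perpPart_add_smul, perpPart_add_smul, sub_sub_sub_cancel_right]
    rw [this, h1, add_sub_add_left_eq_sub, ← sub_smul, ← inner_sub_right, inner_smul_right,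
      inner_self_eq_norm_sq_to_K, he]
    simp
  have h4 : l (x - y) = 0 := by
    rw [← sub_sub_sub_cancel_right x y q, map_sub, h2, sub_self]
  rw [h3, map_smul, smul_eq_mul] at h4
  have h5 := (mul_eq_zero.1 h4).resolve_right hl
  rw [h5, zero_smul] at h3
  exact sub_eq_zero.1 h3

lemma exists_adaptedMap_eq {e : 𝔼} (he : ‖e‖ = 1) (q : 𝔼) {l : 𝔼 →L[ℂ] ℂ}
    (hl : ∀ v, ‖l v - inner ℂ e v‖ ≤ 1 / 4 * ‖v‖) (w : 𝔼) :
    ∃ x, adaptedMap e q l x = w ∧ ‖x - q‖ ≤ 4 * ‖w‖ := by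
  have hle : ‖l e - 1‖ ≤ 1 / 4 := by
    have := hl e
    rw [inner_self_eq_norm_sq_to_K, he] at this
    simpa using this
  have hle' : 3 / 4 ≤ ‖l e‖ := by
    have := norm_sub_norm_le (1 : ℂ) (1 - l e)
    rw [sub_sub_cancel, norm_one, norm_sub_rev] at this
    linarith
  have hle0 : l e ≠ 0 := norm_pos_iff.1 (by linarith)
  have h1 := hl (perpPart e w)
  rw [inner_perpPart he, sub_zero] at h1
  have h2 := norm_sq_eq_perpPart he w
  have h3 : ‖perpPart e w‖ ≤ ‖w‖ := by
    rw [← sq_le_sq₀ (norm_nonneg _) (norm_nonneg _)]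
    nlinarith [sq_nonneg ‖inner ℂ e w‖]
  have h4 : ‖inner ℂ e w‖ ≤ ‖w‖ := by
    rw [← sq_le_sq₀ (norm_nonneg _) (norm_nonneg _)]
    nlinarith [sq_nonneg ‖perpPart e w‖]
  set y : ℂ := (inner ℂ e w - l (perpPart e w)) / l e with hy
  have hyn : ‖y‖ ≤ 2 * ‖w‖ := by
    rw [hy, norm_div, div_le_iff₀ (by linarith)]
    calc _ ≤ ‖inner ℂ e w‖ + ‖l (perpPart e w)‖ := norm_sub_le _ _
      _ ≤ 2 * ‖w‖ * (3 / 4) := by linarith [norm_nonneg w]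
      _ ≤ _ := by gcongr
  refine ⟨q + (perpPart e w + y • e), ?_, ?_⟩
  · rw [adaptedMap, add_sub_cancel_left]
    have h5 := perpPart_smul_perpPart_add he w 1 y
    rw [one_smul] at h5
    rw [h5, map_add, map_smul, smul_eq_mul, hy, div_mul_cancel₀ _ hle0, add_sub_cancel,
      perpPart_add_smul]
  · rw [add_sub_cancel_left]
    refine (norm_add_le _ _).trans ?_
    rw [norm_smul, he, mul_one]
    linarith [norm_nonneg w]

set_option maxHeartbeats 1000000 in
/-- A bounded set which is strictly pseudoconvex and normalized at the origin, and which touches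
the complex tangent hyperplane at the origin only, can be squeezed near the origin. -/
lemma eventually_exists_squeezing_map {e : 𝔼} (he : ‖e‖ = 1) {D : Set 𝔼} {r : 𝔼 → ℝ}
    (hr : ContDiffAt ℝ 2 r 0) (hr0 : r 0 = 0) (hDr : ∀ v, fderiv ℝ r 0 v = (inner ℂ e v).re)
    {ε₀ ε : ℝ} (hquad : ∀ v, inner ℂ e v = 0 →
      |1 / 2 * fderiv ℝ (fderiv ℝ r) 0 v v - ‖v‖ ^ 2| ≤ ε₀ * ‖v‖ ^ 2)
    (hε : 0 < ε) (hε1 : ε < 1) (hε₀ : ε₀ < ε / 8) (hbd : Bornology.IsBounded D)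
    (hD : ∀ᶠ y in 𝓝 (0 : 𝔼), y ∈ D ↔ r y < 0)
    (hfar : ∀ δ > 0, ∃ c > 0, ∀ y ∈ D, δ ≤ ‖y‖ → c ≤ ‖inner ℂ e y‖) :
    ∀ᶠ y in 𝓝 (0 : 𝔼), y ∈ D → ∃ Φ : 𝔼 → 𝔼,
      (∀ x ∈ D, DifferentiableAt ℂ Φ x ∧ ‖Φ x‖ < 1) ∧ InjOn Φ D ∧ Φ y = 0 ∧
      ball 0 (1 - ε) ⊆ Φ '' D := by
  obtain ⟨C, hC, δ₁, hδ₁, hexp⟩ := exists_normal_expansion he hr hDr hquad hε₀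
  obtain ⟨δ₀, hδ₀, hD'⟩ := Metric.eventually_nhds_iff.1 hD
  simp only [dist_zero_right] at hD'
  obtain ⟨R, hR, hDR⟩ := hbd.exists_pos_norm_le
  set δ : ℝ := min δ₁ (δ₀ / 2) with hδ
  have hδ0 : 0 < δ := lt_min hδ₁ (half_pos hδ₀)
  have hδδ₁ : δ ≤ δ₁ := min_le_left _ _
  have hδδ₀ : δ ≤ δ₀ / 2 := min_le_right _ _
  obtain ⟨c, hc, hfarc⟩ := hfar (δ / 2) (half_pos hδ0)
  set B : ℝ := C + 2 / c + 4 * (R + 1) ^ 2 / c ^ 2 + 1 with hB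
  have hB0 : 0 ≤ B := by positivity
  obtain ⟨s₀, hs₀, hmodel⟩ := exists_model_map (E := 𝔼) he hε hε1 (show 0 ≤ ε / 8 by positivity)
    (show 8 * (ε / 8) ≤ ε by linarith) hB0 hC (show 0 < δ / 8 by positivity)
  set ν : ℝ := min (1 / 4) (c / (4 * (R + 1))) with hν
  have hν0 : 0 < ν := lt_min (by norm_num) (by positivity)
  obtain ⟨δ₂, hδ₂, hlam⟩ := Metric.eventually_nhds_iff.1
    (eventually_norm_holoDeriv_sub_le hr hDr hν0)
  set m : ℝ := min (min (δ / 2) (c / 4)) (min δ₂ (min 1 s₀)) with hm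
  have hm0 : 0 < m := by positivity
  have hm1 : m ≤ δ / 2 := (min_le_left _ _).trans (min_le_left _ _)
  have hm2 : m ≤ c / 4 := (min_le_left _ _).trans (min_le_right _ _)
  have hm3 : m ≤ δ₂ := (min_le_right _ _).trans (min_le_left _ _)
  have hm4 : m ≤ 1 := (min_le_right _ _).trans ((min_le_right _ _).trans (min_le_left _ _))
  have hm5 : m ≤ s₀ := (min_le_right _ _).trans ((min_le_right _ _).trans (min_le_right _ _))
  filter_upwards [eventually_exists_zero_above he hr hr0 hDr (half_pos hm0), hD,
    ball_mem_nhds (0 : 𝔼) (half_pos hm0)] with y hy1 hy2 hy3 hyD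
  obtain ⟨s, hs0, hsm, hrq⟩ := hy1 (hy2.1 hyD)
  set q : 𝔼 := y + (s : ℂ) • e with hq
  have hqn : ‖q‖ < m := by
    rw [mem_ball_zero_iff] at hy3
    refine (norm_add_le _ _).trans_lt ?_
    rw [norm_smul, he, mul_one, norm_real, Real.norm_of_nonneg hs0.le]
    linarith
  set l := holoDeriv r q with hl
  have hl1 : ∀ v, ‖l v - inner ℂ e v‖ ≤ ν * ‖v‖ :=
    hlam (by rw [dist_zero_right]; exact hqn.trans_le hm3)
  have hl2 : ∀ v, ‖l v - inner ℂ e v‖ ≤ 1 / 4 * ‖v‖ := fun v =>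
    (hl1 v).trans (by gcongr; exact min_le_left _ _)
  have hle : ‖l e - 1‖ ≤ 1 / 4 := by
    have := hl2 e
    rw [inner_self_eq_norm_sq_to_K, he] at this
    simpa using this
  have hre : 3 / 4 ≤ (l e).re := by
    have := (abs_le.1 ((abs_re_le_norm _).trans hle)).1
    rw [sub_re, one_re] at this
    linarith
  have hle2 : ‖l e‖ ≤ 5 / 4 := by
    have := norm_sub_norm_le (l e) 1
    rw [norm_one] at this
    linarith
  have hle0 : l e ≠ 0 := fun h0 => by
    rw [h0, zero_re] at hre
    linarith
  obtain ⟨Φ, hΦ1, hΦ2, hΦ3, hΦ4⟩ := hmodel (s * l e)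
    (by
      rw [norm_mul, norm_real, Real.norm_of_nonneg hs0.le]
      nlinarith [norm_nonneg (l e)])
    (by
      rw [norm_mul, norm_real, Real.norm_of_nonneg hs0.le, re_ofReal_mul]
      nlinarith)
    (mul_ne_zero (ofReal_ne_zero.2 hs0.ne') hle0)
  have hnear : ∀ x, ‖x - q‖ < δ → |r x - (l (x - q)).re - ‖perpPart e (x - q)‖ ^ 2| ≤
      ε / 8 * ‖perpPart e (x - q)‖ ^ 2 + C * ‖l (x - q)‖ ^ 2 := fun x hx => by
    have := hexp q (by linarith) hrq (x - q) (by linarith)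
    rwa [add_sub_cancel] at this
  have hout : ∀ x ∈ D, (inner ℂ e (adaptedMap e q l x)).re +
      (1 - ε / 8) * ‖perpPart e (adaptedMap e q l x)‖ ^ 2 -
      B * ‖inner ℂ e (adaptedMap e q l x)‖ ^ 2 < 0 := by
    intro x hx
    rw [inner_adaptedMap he, perpPart_adaptedMap he]
    rcases lt_or_ge ‖x - q‖ δ with h | h
    · have h1 := (abs_le.1 (hnear x h)).1
      have h2 : ‖x‖ < δ₀ := by
        have := norm_add_le (x - q) q
        rw [sub_add_cancel] at this
        linarith
      have h3 := (hD' h2).1 hx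
      have h4 : C * ‖l (x - q)‖ ^ 2 ≤ B * ‖l (x - q)‖ ^ 2 := by
        gcongr
        rw [hB]
        have : 0 ≤ 2 / c := by positivity
        have : 0 ≤ 4 * (R + 1) ^ 2 / c ^ 2 := by positivity
        linarith
      linarith
    · have h1 : δ / 2 ≤ ‖x‖ := by
        have := norm_sub_le x q
        linarith
      have h2 := hfarc x hx h1
      have h3 : ‖x - q‖ ≤ R + 1 := by
        have := norm_sub_le x q
        linarith [hDR x hx]
      have h4 : c / 2 ≤ ‖l (x - q)‖ := by
        have h5 := hl1 (x - q)
        have h6 : ν * ‖x - q‖ ≤ c / 4 := by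
          calc ν * ‖x - q‖ ≤ c / (4 * (R + 1)) * (R + 1) := by
                gcongr
                exact min_le_right _ _
            _ = c / 4 := by field_simp
        have h7 : ‖inner ℂ e q‖ ≤ ‖q‖ := by
          have := norm_inner_le_norm (𝕜 := ℂ) e q
          rwa [he, one_mul] at this
        have h8 : inner ℂ e x = inner ℂ e q + (l (x - q) - (l (x - q) - inner ℂ e (x - q))) := by
          rw [sub_sub_cancel, inner_sub_right, add_sub_cancel]
        have h9 : ‖inner ℂ e x‖ ≤ ‖q‖ + (‖l (x - q)‖ + c / 4) := by
          rw [h8]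
          refine (norm_add_le _ _).trans (add_le_add h7 ((norm_sub_le _ _).trans ?_))
          linarith
        linarith
      set t := ‖l (x - q)‖ with ht
      have ht0 : 0 < t := by linarith
      have h5 : t ≤ 2 / c * t ^ 2 := by
        have : t = 2 / c * (c / 2) * t := by field_simp
        calc t = 2 / c * (c / 2 * t) := by linarith
          _ ≤ 2 / c * (t * t) := by gcongr
          _ = _ := by ring
      have h6 : ‖perpPart e (x - q)‖ ^ 2 ≤ 4 * (R + 1) ^ 2 / c ^ 2 * t ^ 2 := by
        have h7 := norm_sq_eq_perpPart he (x - q)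
        calc _ ≤ ‖x - q‖ ^ 2 := by rw [h7]; linarith [sq_nonneg ‖inner ℂ e (x - q)‖]
          _ ≤ (R + 1) ^ 2 := by gcongr
          _ = 4 * (R + 1) ^ 2 / c ^ 2 * (c / 2) ^ 2 := by field_simp; ring
          _ ≤ _ := by gcongr
      have h7 : 0 ≤ ε / 8 * ‖perpPart e (x - q)‖ ^ 2 := by positivity
      have h8 := re_le_norm (l (x - q))
      have h9 : 0 ≤ C * t ^ 2 := by positivity
      have h10 : 0 < t ^ 2 := by positivity
      rw [hB]
      linarith
  refine ⟨Φ ∘ adaptedMap e q l, fun x hx => ?_, fun x hx x' hx' heq => ?_, ?_, fun ζ hζ => ?_⟩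
  · have := hΦ1 _ (hout x hx)
    exact ⟨this.1.comp x (differentiable_adaptedMap e q l x), this.2⟩
  · exact adaptedMap_injective he q hle0 (hΦ2 (hout x hx) (hout x' hx') heq)
  · have h1 : y - q = -((s : ℂ) • e) := by rw [hq]; abel
    have h2 : adaptedMap e q l y = -((s * l e) • e) := by
      have h3 : perpPart e (-((s : ℂ) • e)) = 0 := by
        rw [perpPart, inner_neg_right, inner_smul_right, inner_self_eq_norm_sq_to_K, he]
        simp
      rw [adaptedMap, h1, h3, map_neg, map_smul, smul_eq_mul, zero_add, neg_smul]
    rw [Function.comp_apply, h2, hΦ3]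
  · rw [mem_ball_zero_iff] at hζ
    obtain ⟨w, hw1, hw2, hw3⟩ := hΦ4 ζ hζ
    obtain ⟨x, hx1, hx2⟩ := exists_adaptedMap_eq he q hl2 w
    refine ⟨x, ?_, by rw [Function.comp_apply, hx1, hw3]⟩
    have h1 : ‖x - q‖ < δ := by linarith
    have h2 : ‖x‖ < δ₀ := by
      have := norm_add_le (x - q) q
      rw [sub_add_cancel] at this
      linarith
    refine (hD' h2).2 ?_
    rw [← hx1, inner_adaptedMap he, perpPart_adaptedMap he] at hw2
    have h3 := (abs_le.1 (hnear x h1)).2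
    linarith

end NormalForm

section LinearNormalization

variable {n : ℕ}

local notation "𝔼" => EuclideanSpace ℂ (Fin n)

lemma exists_norm_sq_eq {S : 𝔼 →L[ℝ] 𝔼 →L[ℝ] ℝ} (hS : ∀ v w, S v w = S w v)
    (hI : ∀ v w, S (I • v) (I • w) = S v w) (h0 : ∀ v, 0 ≤ S v v) :
    ∃ T : 𝔼 →L[ℂ] 𝔼, ∀ v, ‖T v‖ ^ 2 = S v v := by
  have hI2 : ∀ v w, S (I • v) w = -S v (I • w) := fun v w => by
    rw [← hI v (I • w), smul_smul, I_mul_I, neg_one_smul, map_neg, neg_neg]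
  have hI3 : ∀ v, S v (I • v) = 0 := fun v => by
    have h1 := hI2 v v
    rw [hS] at h1
    linarith
  let D := InnerProductSpace.toDual ℂ 𝔼
  let f : 𝔼 → 𝔼 := fun v => D.symm (StrongDual.extendRCLike (𝕜 := ℂ) (S v))
  have hf : ∀ v w, inner ℂ (f v) w = (S v w : ℂ) - I * (S v (I • w) : ℂ) := fun v w => by
    rw [InnerProductSpace.toDual_symm_apply]
    exact StrongDual.extendRCLike_apply _ _
  have hsmul : ∀ (a : ℂ) v w, S (a • v) w = a.re * S v w - a.im * S v (I • w) := fun a v w => by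
    have h1 : a • v = a.re • v + a.im • (I • v) := by
      conv_lhs => rw [← re_add_im a]
      rw [add_smul, mul_smul, Complex.coe_smul, Complex.coe_smul]
    rw [h1, map_add, map_smul, map_smul, _root_.add_apply, _root_.smul_apply, _root_.smul_apply,
      hI2, smul_eq_mul, smul_eq_mul]
    ring
  let A : 𝔼 →ₗ[ℂ] 𝔼 :=
    { toFun := f
      map_add' := fun v w => ext_inner_right ℂ fun x => by
        rw [inner_add_left, hf, hf, hf, map_add, _root_.add_apply, _root_.add_apply]
        push_cast
        ring
      map_smul' := fun a v => ext_inner_right ℂ fun x => by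
        rw [RingHom.id_apply, inner_smul_left, hf, hf, hsmul, hsmul, smul_smul, I_mul_I,
          neg_one_smul, map_neg]
        apply Complex.ext <;> simp <;> ring }
  have hA : (LinearMap.toContinuousLinearMap A).IsPositive := by
    rw [ContinuousLinearMap.isPositive_iff_complex]
    intro v
    have h1 : inner ℂ (LinearMap.toContinuousLinearMap A v) v = (S v v : ℂ) := by
      change inner ℂ (f v) v = _
      rw [hf, hI3]
      simp
    rw [h1]
    simpa using h0 v
  obtain ⟨T, hT⟩ := CStarAlgebra.nonneg_iff_eq_star_mul_self.1
    ((ContinuousLinearMap.nonneg_iff_isPositive _).2 hA)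
  refine ⟨T, fun v => ?_⟩
  have h1 : inner ℂ (LinearMap.toContinuousLinearMap A v) v = (S v v : ℂ) := by
    change inner ℂ (f v) v = _
    rw [hf, hI3]
    simp
  rw [hT, ContinuousLinearMap.star_eq_adjoint, mul_apply_eq_comp,
    ContinuousLinearMap.adjoint_inner_left, inner_self_eq_norm_sq_to_K] at h1
  exact Complex.ofReal_injective (by simpa using h1)

lemma exists_normalizing_equiv {B : 𝔼 →L[ℝ] 𝔼 →L[ℝ] ℝ} (hB : ∀ v w, B v w = B w v)
    {θ : 𝔼 →L[ℂ] ℂ} {v₁ : 𝔼} (hv₁ : θ v₁ ≠ 0)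
    (hL : ∀ v, θ v = 0 → v ≠ 0 → 0 < 1 / 4 * (B v v + B (I • v) (I • v))) :
    ∃ e : 𝔼, ‖e‖ = 1 ∧ ∃ T : 𝔼 ≃L[ℂ] 𝔼, (∀ v, inner ℂ e (T v) = θ v) ∧
      ∀ v, θ v = 0 → ‖T v‖ ^ 2 = 1 / 4 * (B v v + B (I • v) (I • v)) := by
  let π : 𝔼 →L[ℂ] 𝔼 := ContinuousLinearMap.id ℂ 𝔼 - (((θ v₁)⁻¹ • θ).smulRight v₁)
  have hπ : ∀ v, θ (π v) = 0 := fun v => by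
    simp only [π, _root_.sub_apply, ContinuousLinearMap.id_apply,
      ContinuousLinearMap.smulRight_apply, _root_.smul_apply, map_sub, map_smul, smul_eq_mul]
    field_simp
    simp
  have hπ0 : ∀ v, θ v = 0 → π v = v := fun v hv => by simp [π, hv]
  have hπ1 : π v₁ = 0 := by simp [π, hv₁]
  let R : 𝔼 →L[ℝ] 𝔼 := π.restrictScalars ℝ
  let J : 𝔼 →L[ℝ] 𝔼 := (I • π).restrictScalars ℝ
  let S : 𝔼 →L[ℝ] 𝔼 →L[ℝ] ℝ := (1 / 4 : ℝ) • (B.bilinearComp R R + B.bilinearComp J J)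
  have hS : ∀ v w, S v w = 1 / 4 * (B (π v) (π w) + B (I • π v) (I • π w)) := fun v w => rfl
  obtain ⟨T₀, hT₀⟩ := exists_norm_sq_eq (S := S)
    (fun v w => by rw [hS, hS, hB, hB (I • π v)])
    (fun v w => by
      rw [hS, hS, π.map_smul, π.map_smul, smul_smul, smul_smul, I_mul_I, neg_one_smul, neg_one_smul,
        map_neg, map_neg, _root_.neg_apply, neg_neg, add_comm])
    (fun v => by
      rw [hS]
      by_cases hv : π v = 0
      · simp [hv]
      · exact (hL _ (hπ v) hv).le)
  have hT₁ : T₀ v₁ = 0 := by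
    have h1 := hT₀ v₁
    rw [hS, hπ1] at h1
    simpa using h1
  have hv₁0 : v₁ ≠ 0 := fun h => hv₁ (by rw [h, map_zero])
  have hrange : (T₀ : 𝔼 →ₗ[ℂ] 𝔼).range ≠ ⊤ := fun h => by
    rw [LinearMap.range_eq_top, ← LinearMap.injective_iff_surjective] at h
    exact hv₁0 (h (by simpa using hT₁))
  obtain ⟨x, hx, hx0⟩ := Submodule.exists_mem_ne_zero_of_ne_bot
    (fun h => hrange (Submodule.orthogonal_eq_bot_iff.1 h))
  have hx1 : ‖x‖ ≠ 0 := norm_ne_zero_iff.2 hx0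
  let e : 𝔼 := ((‖x‖⁻¹ : ℝ) : ℂ) • x
  have he : ‖e‖ = 1 := by
    rw [norm_smul, norm_real, norm_inv, norm_norm, inv_mul_cancel₀ hx1]
  have heT : ∀ v, inner ℂ e (T₀ v) = 0 := fun v => by
    have h1 : inner ℂ x (T₀ v) = 0 := Submodule.inner_left_of_mem_orthogonal
      (LinearMap.mem_range_self (T₀ : 𝔼 →ₗ[ℂ] 𝔼) v) hx
    rw [inner_smul_left, h1, mul_zero]
  let T : 𝔼 →ₗ[ℂ] 𝔼 := ((T₀ + θ.smulRight e : 𝔼 →L[ℂ] 𝔼) : 𝔼 →ₗ[ℂ] 𝔼)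
  have hTv : ∀ v, T v = T₀ v + θ v • e := fun v => rfl
  have hTe : ∀ v, inner ℂ e (T v) = θ v := fun v => by
    rw [hTv, inner_add_right, heT, inner_smul_right, inner_self_eq_norm_sq_to_K, he]
    simp
  have hTn : ∀ v, θ v = 0 → ‖T v‖ ^ 2 = 1 / 4 * (B v v + B (I • v) (I • v)) := fun v hv => by
    rw [hTv, hv, zero_smul, add_zero, hT₀, hS, hπ0 v hv]
  have hinj : Function.Injective T := by
    rw [← LinearMap.ker_eq_bot, LinearMap.ker_eq_bot']
    intro v hv
    have h1 : θ v = 0 := by rw [← hTe, hv, inner_zero_right]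
    by_contra hv0
    have h2 := hL v h1 hv0
    rw [← hTn v h1, hv] at h2
    simp at h2
  exact ⟨e, he, (LinearEquiv.ofInjectiveEndo T hinj).toContinuousLinearEquiv, hTe, hTn⟩

end LinearNormalization

section Tip

open Filter Topology

lemma ContDiffAt.tendsto_taylor_two {E : Type*} [NormedAddCommGroup E] [NormedSpace ℝ E]
    {f : E → ℝ} {p : E} (hf : ContDiffAt ℝ 2 f p) {y : ℝ → E} {v : E}
    (hy : Tendsto (fun t => t⁻¹ • (y t - p)) (𝓝[≠] 0) (𝓝 v)) :
    Tendsto (fun t => (f (y t) - f p - fderiv ℝ f p (y t - p)) / t ^ 2) (𝓝[≠] 0)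
      (𝓝 (1 / 2 * fderiv ℝ (fderiv ℝ f) p v v)) := by
  have h0 : Tendsto (fun t => y t - p) (𝓝[≠] 0) (𝓝 0) := by
    have h1 := (tendsto_id.mono_left (nhdsWithin_le_nhds (s := {(0 : ℝ)}ᶜ))).smul hy
    rw [zero_smul] at h1
    refine h1.congr' ?_
    filter_upwards [self_mem_nhdsWithin] with t (ht : t ≠ 0)
    exact smul_inv_smul₀ ht _
  have h2 : Tendsto (fun t => 1 / 2 * fderiv ℝ (fderiv ℝ f) p (t⁻¹ • (y t - p))
      (t⁻¹ • (y t - p))) (𝓝[≠] 0) (𝓝 (1 / 2 * fderiv ℝ (fderiv ℝ f) p v v)) :=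
    ((Continuous.tendsto (f := fun w => 1 / 2 * fderiv ℝ (fderiv ℝ f) p w w) (by fun_prop) v).comp
      hy)
  have h3 : Tendsto (fun t => (f (y t) - f p - fderiv ℝ f p (y t - p)) / t ^ 2 -
      1 / 2 * fderiv ℝ (fderiv ℝ f) p (t⁻¹ • (y t - p)) (t⁻¹ • (y t - p))) (𝓝[≠] 0) (𝓝 0) := by
    rw [Metric.tendsto_nhds]
    intro ε hε
    set c := ‖v‖ ^ 2 + 1
    have hc : 0 < c := by positivity
    obtain ⟨δ, hδ, hT⟩ := hf.exists_taylor_two (show 0 < ε / (2 * c) by positivity)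
    have hn : ∀ᶠ t in 𝓝[≠] (0 : ℝ), ‖t⁻¹ • (y t - p)‖ ^ 2 < c :=
      (hy.norm.pow 2).eventually (gt_mem_nhds (lt_add_one _))
    have h0' : ∀ᶠ t in 𝓝[≠] (0 : ℝ), ‖y t - p‖ < δ :=
      h0.norm.eventually (gt_mem_nhds (by simpa using hδ))
    filter_upwards [self_mem_nhdsWithin, hn, h0'] with t (ht : t ≠ 0) h4 h5
    obtain ⟨-, -, h6⟩ := hT p (mem_ball_self hδ) (y t - p) h5
    rw [add_sub_cancel] at h6
    have h7 : (f (y t) - f p - fderiv ℝ f p (y t - p)) / t ^ 2 -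
        1 / 2 * fderiv ℝ (fderiv ℝ f) p (t⁻¹ • (y t - p)) (t⁻¹ • (y t - p)) =
        (f (y t) - f p - fderiv ℝ f p (y t - p) -
          (1 / 2 : ℝ) • fderiv ℝ (fderiv ℝ f) p (y t - p) (y t - p)) * (t⁻¹) ^ 2 := by
      simp only [map_smul, _root_.smul_apply, smul_eq_mul]
      field_simp
    rw [dist_zero_right, h7, norm_mul, norm_pow]
    calc _ ≤ ε / (2 * c) * ‖y t - p‖ ^ 2 * ‖t⁻¹‖ ^ 2 := by gcongr
      _ = ε / (2 * c) * ‖t⁻¹ • (y t - p)‖ ^ 2 := by rw [norm_smul]; ring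
      _ ≤ ε / (2 * c) * c := by gcongr
      _ < ε := by field_simp; linarith
  simpa using h3.add h2

variable {n : ℕ}

local notation "𝔼" => EuclideanSpace ℂ (Fin n)

namespace IsSPC

variable {Ω : Set (EuclideanSpace ℂ (Fin n))} {ρ : EuclideanSpace ℂ (Fin n) → ℝ}

lemma eventually_exists_squeezing (h : IsSPC Ω ρ) {p : 𝔼} (hp : ρ p = 0) {V : Set 𝔼}
    (hV : IsOpen V) (hΩV : closure Ω ⊆ V) {F : 𝔼 → 𝔼} (hF : DifferentiableOn ℂ F V)
    (hinj : InjOn F (closure Ω)) (hFp : F p = 0) (hFd : HasFDerivAt F (ContinuousLinearMap.id ℂ 𝔼) p)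
    (hne : ∀ z ∈ closure Ω, z ≠ p → holoDeriv ρ p (F z) ≠ 0) {b : 𝔼 → ℂ}
    (hb : ∀ v, holoDeriv ρ p v = 0 →
      Tendsto (fun t : ℝ => holoDeriv ρ p (F (p + t • v)) / (t : ℂ) ^ 2) (𝓝[≠] 0) (𝓝 (b v)))
    {ε₀ ε : ℝ} (hbL : ∀ v, holoDeriv ρ p v = 0 →
      |1 / 2 * fderiv ℝ (fderiv ℝ ρ) p v v - (b v).re - leviForm ρ p v| ≤ ε₀ * leviForm ρ p v)
    (hε : 0 < ε) (hε1 : ε < 1) (hε₀ : ε₀ < ε / 8) :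
    ∀ᶠ z in 𝓝 p, z ∈ Ω → ∃ f : 𝔼 → 𝔼, (∀ x ∈ Ω, DifferentiableAt ℂ f x ∧ ‖f x‖ < 1) ∧
      InjOn f Ω ∧ f z = 0 ∧ ball 0 (1 - ε) ⊆ f '' Ω := by
  have hpc : p ∈ closure Ω := by rw [h.closure_eq]; exact hp.le
  have hsub := subset_closure (s := Ω)
  set θ := holoDeriv ρ p with hθ
  obtain ⟨v₁, hv₁⟩ : ∃ v₁, θ v₁ ≠ 0 := by
    by_contra! h1
    exact h.fderiv_ne p hp (ContinuousLinearMap.ext fun v => (holoDeriv_eq_zero_iff.1 (h1 v)).1)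
  obtain ⟨e, he, T, hTe, hTn⟩ := exists_normalizing_equiv (B := fderiv ℝ (fderiv ℝ ρ) p)
    (fun v w => (h.contDiff.contDiffAt.isSymmSndFDerivAt (by simp)) v w) hv₁
    (fun v hv hv0 => h.levi_pos p v hp hv0 (holoDeriv_eq_zero_iff.1 hv).1
      (holoDeriv_eq_zero_iff.1 hv).2)
  set G : 𝔼 → 𝔼 := fun z => T (F z) with hG
  have hGp : G p = 0 := by simp [hG, hFp]
  have hGV : ∀ z ∈ V, DifferentiableAt ℂ G z := fun z hz =>
    T.differentiableAt.comp z (hF.differentiableAt (hV.mem_nhds hz))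
  have hGinj : InjOn G (closure Ω) := fun x hx y hy hxy => hinj hx hy (T.injective hxy)
  have hGc : ContinuousOn G (closure Ω) := fun z hz =>
    (hGV z (hΩV hz)).continuousAt.continuousWithinAt
  let TR : 𝔼 ≃L[ℝ] 𝔼 := T.restrictScalars ℝ
  have hGd : HasFDerivAt G (TR : 𝔼 →L[ℝ] 𝔼) p :=
    ((T : 𝔼 →L[ℂ] 𝔼).hasFDerivAt.comp p hFd).restrictScalars ℝ
  have hG2 : ContDiffAt ℝ 2 G p := (contDiffAt_piLp 2).2 fun i =>
    (contDiffOn_two_of_differentiableOn hV fun z hz =>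
      (((EuclideanSpace.proj i : 𝔼 →L[ℂ] ℂ).differentiableAt).comp z
        (hGV z hz)).differentiableWithinAt).contDiffAt (hV.mem_nhds (hΩV hpc))
  have hGe : ∀ z, inner ℂ e (G z) = θ (F z) := fun z => hTe _
  have hcpt : ∀ N ∈ 𝓝 p, ∃ c > 0, ∀ z ∈ closure Ω, z ∉ N → c ≤ ‖inner ℂ e (G z)‖ := by
    intro N hN
    obtain ⟨c, hc, hle⟩ := (h.isCompact_closure.diff isOpen_interior).exists_forall_le'
      (s := closure Ω \ interior N) (f := fun z => ‖inner ℂ e (G z)‖) (a := 0)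
      ((ContinuousOn.inner continuousOn_const (hGc.mono sdiff_subset)).norm)
      (fun z hz => by
        rw [hGe, norm_pos_iff]
        refine hne z hz.1 fun hzp => hz.2 ?_
        rw [hzp]
        exact mem_interior_iff_mem_nhds.2 hN)
    exact ⟨c, hc, fun z hz hzN => hle z ⟨hz, fun h1 => hzN (interior_subset h1)⟩⟩
  let Φ := hG2.toOpenPartialHomeomorph G hGd two_ne_zero
  have hpS : p ∈ Φ.source := hG2.mem_toOpenPartialHomeomorph_source hGd two_ne_zero
  have h0T : (0 : 𝔼) ∈ Φ.target := by
    rw [← hGp]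
    exact hG2.image_mem_toOpenPartialHomeomorph_target hGd two_ne_zero
  set H : 𝔼 → 𝔼 := ⇑Φ.symm with hHdef
  have hHG : ∀ᶠ x in 𝓝 p, H (G x) = x :=
    by
    filter_upwards [Φ.open_source.mem_nhds hpS] with x hx using Φ.left_inv hx
  have hGH : ∀ᶠ y in 𝓝 (0 : 𝔼), G (H y) = y :=
    by
    filter_upwards [Φ.open_target.mem_nhds h0T] with y hy using Φ.right_inv hy
  have hH0 : H 0 = p := by rw [← hGp]; exact hHG.self_of_nhds
  have hΦp : HasFDerivAt Φ (TR : 𝔼 →L[ℝ] 𝔼) (Φ.symm 0) := by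
    change HasFDerivAt G _ (H 0)
    rw [hH0]
    exact hGd
  have hH2 : ContDiffAt ℝ 2 H 0 := Φ.contDiffAt_symm h0T hΦp (by
    change ContDiffAt ℝ 2 G (H 0)
    rw [hH0]
    exact hG2)
  have hHd : HasFDerivAt H (TR.symm : 𝔼 →L[ℝ] 𝔼) 0 := Φ.hasFDerivAt_symm h0T hΦp
  set r : 𝔼 → ℝ := fun y => ρ (H y) with hr
  have hr2 : ContDiffAt ℝ 2 r 0 := h.contDiff.contDiffAt.comp 0 hH2
  have hr0 : r 0 = 0 := by simp [hr, hH0, hp]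
  have hDr : ∀ v, fderiv ℝ r 0 v = (inner ℂ e v).re := fun v => by
    have h1 : HasFDerivAt ρ (fderiv ℝ ρ p) (H 0) := by
      rw [hH0]
      exact (h.contDiff.differentiable (by norm_num) p).hasFDerivAt
    have h2 : T (T.symm v) = v := T.apply_symm_apply v
    have h3 : HasFDerivAt r _ 0 := h1.comp 0 hHd
    rw [h3.fderiv, ← h2, hTe, re_holoDeriv, h2]
    rfl
  have hquad : ∀ v, inner ℂ e v = 0 →
      |1 / 2 * fderiv ℝ (fderiv ℝ r) 0 v v - ‖v‖ ^ 2| ≤ ε₀ * ‖v‖ ^ 2 := by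
    intro v hv
    obtain ⟨u, rfl⟩ := T.surjective v
    rw [hTe] at hv
    have hL : ‖T u‖ ^ 2 = leviForm ρ p u := hTn u hv
    have hline : HasDerivAt (fun t : ℝ => p + t • u) u 0 := by
      simpa using ((hasDerivAt_id (0 : ℝ)).smul_const u).const_add p
    have hGt : HasDerivAt (fun t : ℝ => G (p + t • u)) (T u) 0 := by
      have h1 : HasFDerivAt G (TR : 𝔼 →L[ℝ] 𝔼) (p + (0 : ℝ) • u) := by simpa using hGd
      exact h1.comp_hasDerivAt 0 hline
    have h1 := hr2.tendsto_taylor_two (y := fun t : ℝ => G (p + t • u)) (v := T u) (by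
      simpa [hGp] using hGt.tendsto_slope_zero)
    have h2 := h.contDiff.contDiffAt.tendsto_taylor_two (p := p) (y := fun t : ℝ => p + t • u)
      (v := u) (by simpa using hline.tendsto_slope_zero)
    have h3 := (Complex.continuous_re.tendsto _).comp (hb u hv)
    have hnear : ∀ᶠ t in 𝓝[≠] (0 : ℝ), H (G (p + t • u)) = p + t • u :=
      (Continuous.tendsto' (by fun_prop) 0 p (by simp)).mono_left nhdsWithin_le_nhds
        |>.eventually hHG
    have h4 := tendsto_nhds_unique_of_eventuallyEq h1 (h2.sub h3) (by
      filter_upwards [hnear] with t ht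
      have h5 : fderiv ℝ ρ p u = 0 := (holoDeriv_eq_zero_iff.1 hv).1
      have h6 : (θ (F (p + t • u)) / (t : ℂ) ^ 2).re = (θ (F (p + t • u))).re / t ^ 2 := by
        rw [← ofReal_pow, div_ofReal_re]
      simp only [Function.comp_apply, hr0, sub_zero, hDr, hGe, add_sub_cancel_left, hp, h6,
        map_smul, h5, smul_zero, ← sub_div]
      simp only [hr, ht])
    rw [h4, hL]
    exact hbL u hv
  have hD : ∀ᶠ y in 𝓝 (0 : 𝔼), y ∈ G '' Ω ↔ r y < 0 := by
    obtain ⟨c, hc, hcG⟩ := hcpt _ hHG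
    filter_upwards [hGH, ball_mem_nhds 0 hc] with y hy hyc
    constructor
    · rintro ⟨x, hx, rfl⟩
      have h1 : H (G x) = x := by
        by_contra h2
        have h3 := hcG x (hsub hx) h2
        have h4 := norm_inner_le_norm (𝕜 := ℂ) e (G x)
        rw [he, one_mul] at h4
        rw [mem_ball_zero_iff] at hyc
        linarith
      rw [hr]
      beta_reduce
      rw [h1]
      rwa [h.eq_setOf] at hx
    · intro hry
      refine ⟨H y, ?_, hy⟩
      rw [h.eq_setOf]
      exact hry
  have hfar : ∀ δ > 0, ∃ c > 0, ∀ y ∈ G '' Ω, δ ≤ ‖y‖ → c ≤ ‖inner ℂ e y‖ := by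
    intro δ hδ
    obtain ⟨c, hc, hcG⟩ := hcpt {x | ‖G x‖ < δ} (by
      have h1 := hGd.continuousAt.norm
      exact h1.eventually (gt_mem_nhds (by simpa [hGp] using hδ)))
    refine ⟨c, hc, ?_⟩
    rintro _ ⟨x, hx, rfl⟩ hxδ
    exact hcG x (hsub hx) fun h1 => absurd hxδ (not_le.2 h1)
  have hfin := eventually_exists_squeezing_map he hr2 hr0 hDr hquad hε hε1 hε₀
    ((h.isCompact_closure.image_of_continuousOn hGc).isBounded.subset (image_mono hsub)) hD hfar
  have h1 : Tendsto G (𝓝 p) (𝓝 0) := by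
    rw [← hGp]
    exact hGd.continuousAt
  filter_upwards [h1.eventually hfin] with z hz hzΩ
  obtain ⟨Ψ, hΨ, hΨi, hΨz, hΨb⟩ := hz (mem_image_of_mem G hzΩ)
  refine ⟨Ψ ∘ G, fun x hx => ?_, hΨi.comp (hGinj.mono hsub) (mapsTo_image _ _), hΨz, ?_⟩
  · obtain ⟨h2, h3⟩ := hΨ _ (mem_image_of_mem G hx)
    exact ⟨h2.comp x (hGV x (hΩV (hsub hx))), h3⟩
  · rwa [image_comp]

end IsSPC

end Tip

section Exposing

open Filter Topology

variable {n : ℕ}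

local notation "𝔼" => EuclideanSpace ℂ (Fin n)

lemma hasDerivAt_exposeTime (η : ℝ) :
    HasDerivAt (exposeTime η) ((η / Real.exp (-η⁻¹) : ℝ) : ℂ) 0 := by
  have h1 : HasDerivAt (fun u : ℂ => (Real.exp (-η⁻¹) : ℂ) - u) (-1) 0 := by
    simpa using (hasDerivAt_id (0 : ℂ)).const_sub (Real.exp (-η⁻¹) : ℂ)
  have h2 : 0 < ((Real.exp (-η⁻¹) : ℂ) - 0).re := by
    rw [sub_zero]
    exact Real.exp_pos _
  have h3 := (((hasDerivAt_log_of_re_pos h2).comp 0 h1).const_mul (η : ℂ)).neg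
  refine h3.congr_deriv ?_
  rw [sub_zero, ofReal_div]
  ring

lemma differentiableAt_exposeTime {η : ℝ} {u : ℂ} (hu : 0 < ((Real.exp (-η⁻¹) : ℂ) - u).re) :
    DifferentiableAt ℂ (exposeTime η) u := by
  have h1 : DifferentiableAt ℂ (fun u : ℂ => (Real.exp (-η⁻¹) : ℂ) - u) u := by fun_prop
  exact (((hasDerivAt_log_of_re_pos hu).differentiableAt.comp u h1).const_mul (η : ℂ)).neg

lemma norm_holoQuad_le (B : 𝔼 →L[ℝ] 𝔼 →L[ℝ] ℝ) (v : 𝔼) : ‖holoQuad B v‖ ≤ ‖B‖ * ‖v‖ ^ 2 := by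
  have hI : ‖I • v‖ = ‖v‖ := by rw [norm_smul, norm_I, one_mul]
  have h1 := B.le_opNorm₂ v v
  have h2 := B.le_opNorm₂ (I • v) (I • v)
  have h3 := B.le_opNorm₂ v (I • v)
  rw [hI] at h2 h3
  rw [holoQuad]
  refine (norm_sub_le _ _).trans ?_
  rw [norm_mul, norm_mul, norm_div, norm_div, norm_I, norm_real, norm_real]
  have h4 := norm_sub_le (B v v) (B (I • v) (I • v))
  norm_num
  simp only [Real.norm_eq_abs] at *
  nlinarith

namespace IsSPC

variable {Ω : Set (EuclideanSpace ℂ (Fin n))} {ρ : EuclideanSpace ℂ (Fin n) → ℝ}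

set_option maxHeartbeats 1000000 in
lemma exists_exposing_map (h : IsSPC Ω ρ) (hn : 2 ≤ n) {p : 𝔼} (hp : ρ p = 0) {ε₀ : ℝ}
    (hε₀ : 0 < ε₀) : ∃ V : Set 𝔼, IsOpen V ∧ closure Ω ⊆ V ∧ ∃ F : 𝔼 → 𝔼,
      DifferentiableOn ℂ F V ∧ InjOn F (closure Ω) ∧ F p = 0 ∧
      HasFDerivAt F (ContinuousLinearMap.id ℂ 𝔼) p ∧
      (∀ z ∈ closure Ω, z ≠ p → holoDeriv ρ p (F z) ≠ 0) ∧ ∃ b : 𝔼 → ℂ,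
      (∀ v, holoDeriv ρ p v = 0 →
        Tendsto (fun t : ℝ => holoDeriv ρ p (F (p + t • v)) / (t : ℂ) ^ 2) (𝓝[≠] 0) (𝓝 (b v))) ∧
      ∀ v, holoDeriv ρ p v = 0 →
        |1 / 2 * fderiv ℝ (fderiv ℝ ρ) p v v - (b v).re - leviForm ρ p v| ≤
          ε₀ * leviForm ρ p v := by
  have hpc : p ∈ closure Ω := by rw [h.closure_eq]; exact hp.le
  obtain ⟨V, hV, hΩV, g, hg, hgp, hgd, hgq, c, hc, hgc⟩ := h.exists_peak hp
  obtain ⟨γ, hγ, hγ0, hγ1, hγ2, hγ3, hγ4, hγ5, hγ6⟩ := h.exists_exposing_curve hn hp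
  set θ := holoDeriv ρ p with hθ
  set B := fderiv ℝ (fderiv ℝ ρ) p with hB
  obtain ⟨N, -, c₁, hc₁, hlow⟩ := h.exists_levi_lower ‖p‖
  have hq : ∀ v, θ v = 0 → ‖holoQuad B v‖ ≤ ‖B‖ / c₁ * leviForm ρ p v := fun v hv => by
    obtain ⟨h1, h2⟩ := holoDeriv_eq_zero_iff.1 hv
    have h3 := hlow p (by simp) (by rw [hp, abs_zero]; exact hc₁.le) v
    rw [h1, h2] at h3
    simp only [ne_eq, OfNat.ofNat_ne_zero, not_false_eq_true, zero_pow, add_zero, mul_zero] at h3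
    refine (norm_holoQuad_le B v).trans ?_
    rw [div_mul_eq_mul_div, le_div_iff₀ hc₁, mul_assoc]
    gcongr
    linarith
  have hg2 : ∀ z ∈ closure Ω, ContDiffAt ℝ 2 g z := fun z hz =>
    (contDiffOn_two_of_differentiableOn hV hg).contDiffAt (hV.mem_nhds (hΩV hz))
  have hgdp : HasFDerivAt g θ p := by
    rw [← hgd]
    exact (hg.differentiableAt (hV.mem_nhds (hΩV hpc))).hasFDerivAt
  have hgR : fderiv ℝ g p = θ.restrictScalars ℝ := (hgdp.restrictScalars ℝ).fderiv
  have hgsp : HasStrictFDerivAt g (θ.restrictScalars ℝ) p := by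
    rw [← hgR]
    exact (hg2 p hpc).hasStrictFDerivAt (by norm_num)
  have hgcont : ContinuousOn g (closure Ω) := hg.continuousOn.mono hΩV
  have hC : ∀ᶠ z in 𝓝[closure Ω] p,
      ‖θ (z - p)‖ ≤ (1 + (1 + ‖fderiv ℝ (fderiv ℝ g) p‖) / c) * ‖g z‖ := by
    obtain ⟨δ, hδ, hT⟩ := (hg2 p hpc).exists_taylor_two one_pos
    filter_upwards [self_mem_nhdsWithin, mem_nhdsWithin_of_mem_nhds (ball_mem_nhds p hδ)]
      with z hz hzδ
    obtain ⟨-, -, h1⟩ := hT p (mem_ball_self hδ) (z - p) (mem_ball_iff_norm.1 hzδ)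
    rw [add_sub_cancel, hgp, sub_zero, one_mul, hgR] at h1
    have h2 := (fderiv ℝ (fderiv ℝ g) p).le_opNorm₂ (z - p) (z - p)
    set b := fderiv ℝ (fderiv ℝ g) p (z - p) (z - p)
    have h3 : θ (z - p) = g z - (g z - θ (z - p) - (1 / 2 : ℝ) • b) - (1 / 2 : ℝ) • b := by
      abel
    have h4 : ‖(1 / 2 : ℝ) • b‖ = 1 / 2 * ‖b‖ := by rw [norm_smul]; norm_num
    have h5 : ‖θ (z - p)‖ ≤ ‖g z‖ + ‖z - p‖ ^ 2 + 1 / 2 * ‖b‖ := by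
      rw [h3, ← h4]
      exact (norm_sub_le _ _).trans (add_le_add_left ((norm_sub_le _ _).trans
        (add_le_add_right h1 _)) _)
    have h6 : ‖z - p‖ ^ 2 ≤ ‖g z‖ / c := by
      rw [le_div_iff₀ hc]
      have := (abs_le.1 (abs_re_le_norm (g z))).1
      linarith [hgc z hz]
    have h7 : ‖θ (z - p)‖ ≤ ‖g z‖ + (1 + ‖fderiv ℝ (fderiv ℝ g) p‖) * ‖z - p‖ ^ 2 := by
      nlinarith [norm_nonneg b]
    calc _ ≤ _ := h7
      _ ≤ ‖g z‖ + (1 + ‖fderiv ℝ (fderiv ℝ g) p‖) * (‖g z‖ / c) := by gcongr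
      _ = _ := by ring
  have hγ1' : θ (deriv γ 1) ≠ 0 := by simpa using hγ2 1 (by simp)
  set a := θ (deriv γ 1) with ha
  have hna : 0 < ‖a‖ := norm_pos_iff.2 hγ1'
  set R : ℝ := ‖B‖ / c₁ / ε₀ + 1 with hR
  have hR0 : 0 < R := by positivity
  have hev1 := injOn_exposingMap h.isCompact_closure
    (fun z hz => ⟨_, (hg2 z hz).hasStrictFDerivAt (by norm_num)⟩) hgsp hc hgc hγ hγ0 hγ1 hγ2 hγ3 hγ4
  have hev2 := exposingMap_ne h.isCompact_closure hpc hgcont hgp hc hgc hC hγ hγ0 hγ2 hγ5 hγ6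
  have hev3 : ∀ᶠ η in 𝓝[>] (0 : ℝ), Real.exp (-(1 / η)) / η < ‖a‖ / (1 + R) :=
    (tendsto_exp_neg_div_div one_pos).eventually (gt_mem_nhds (by positivity))
  obtain ⟨η, hinj, hne, hηR, hη⟩ := (hev1.and (hev2.and (hev3.and self_mem_nhdsWithin))).exists
  change 0 < η at hη
  set m : ℝ := η / Real.exp (-η⁻¹) with hm
  have hm0 : 0 < m := div_pos hη (Real.exp_pos _)
  have hma : 1 + R ≤ m * ‖a‖ := by
    rw [one_div, lt_div_iff₀ (by positivity), div_mul_eq_mul_div, div_lt_iff₀ hη] at hηR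
    rw [hm, div_mul_eq_mul_div, le_div_iff₀ (Real.exp_pos _)]
    linarith
  have hKR : R ≤ ‖1 + m * a‖ := by
    have h1 := norm_sub_norm_le (m * a : ℂ) (-1)
    rw [norm_mul, norm_real, Real.norm_of_nonneg hm0.le, norm_neg, norm_one, sub_neg_eq_add,
      add_comm (m * a : ℂ)] at h1
    linarith
  have hK0 : 1 + m * a ≠ 0 := norm_pos_iff.1 (hR0.trans_le hKR)
  set W : 𝔼 → 𝔼 := fun z => z - p + γ (exposeTime η (g z)) - γ 1 with hW
  set F : 𝔼 → 𝔼 := fun z => W z - (m / (1 + m * a) * θ (W z)) • deriv γ 1 with hF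
  have hθF : ∀ z, θ (F z) = θ (W z) / (1 + m * a) := fun z => by
    rw [hF]
    simp only [map_sub θ, map_smul θ, smul_eq_mul, ← ha]
    field_simp
    ring
  have hWp : W p = 0 := by simp [hW, hgp, exposeTime_zero hη]
  have hγd : HasDerivAt γ (deriv γ 1) (exposeTime η 0) := by
    rw [exposeTime_zero hη]
    exact (hγ.differentiable (by norm_num) 1).hasDerivAt
  have hγt : HasDerivAt (fun u => γ (exposeTime η u)) ((m : ℂ) • deriv γ 1) 0 :=
    hγd.scomp 0 (hasDerivAt_exposeTime η)
  have hWd : HasFDerivAt W (ContinuousLinearMap.id ℂ 𝔼 + θ.smulRight ((m : ℂ) • deriv γ 1)) p := by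
    have h1 : HasDerivAt (fun u => γ (exposeTime η u)) ((m : ℂ) • deriv γ 1) (g p) := by
      rw [hgp]
      exact hγt
    exact (((hasFDerivAt_id p).sub_const p).add (h1.hasFDerivAt.comp p hgdp)).sub_const (γ 1)
  refine ⟨V ∩ {z | 0 < ((Real.exp (-η⁻¹) : ℂ) - g z).re}, ?_, ?_, F, ?_, ?_, ?_, ?_, ?_,
    fun v => m * a * holoQuad B v / (1 + m * a), ?_, ?_⟩
  · exact ((Complex.continuous_re.comp_continuousOn
      (continuousOn_const.sub hg.continuousOn)).isOpen_inter_preimage hV isOpen_Ioi)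
  · intro z hz
    refine ⟨hΩV hz, (Real.exp_pos _).trans_le (re_expose_arg ?_ η)⟩
    have := hgc z hz
    nlinarith [sq_nonneg ‖z - p‖]
  · intro z hz
    have h1 : DifferentiableAt ℂ g z := hg.differentiableAt (hV.mem_nhds hz.1)
    have h2 : DifferentiableAt ℂ (fun z => exposeTime η (g z)) z :=
      (differentiableAt_exposeTime hz.2).comp z h1
    have h3 : DifferentiableAt ℂ (fun z => γ (exposeTime η (g z))) z :=
      (hγ.differentiable (by norm_num) _).comp z h2
    have h4 : DifferentiableAt ℂ W z :=
      ((differentiableAt_id.sub_const p).add h3).sub_const (γ 1)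
    have h5 : DifferentiableAt ℂ F z :=
      h4.sub (((θ.differentiableAt.comp z h4).const_mul _).smul_const _)
    exact h5.differentiableWithinAt
  · intro x hx y hy hxy
    have h1 : θ (W x) = θ (W y) := by
      have := hθF y
      rw [← hxy, hθF, div_left_inj' hK0] at this
      exact this
    have h2 : W x = W y := by
      simp only [hF, h1] at hxy
      exact sub_left_injective hxy
    refine hinj hx hy ?_
    have h3 := sub_left_injective h2
    simp only [sub_add_eq_add_sub] at h3
    exact sub_left_injective h3
  · simp [hF, hWp]
  · have h1 : HasFDerivAt F _ p :=
      hWd.sub (((θ.hasFDerivAt.comp p hWd).const_mul (m / (1 + m * a))).smul_const (deriv γ 1))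
    refine h1.congr_fderiv ?_
    ext1 v
    simp only [_root_.sub_apply, _root_.add_apply, ContinuousLinearMap.id_apply,
      ContinuousLinearMap.smulRight_apply, _root_.smul_apply, ContinuousLinearMap.comp_apply,
      map_add, map_smul, smul_eq_mul, ← ha, add_sub_assoc, smul_smul, ← sub_smul]
    have h2 : θ v * m - m / (1 + m * a) * (θ v + θ v * m * a) = 0 := by
      field_simp
      ring
    rw [h2, zero_smul, add_zero]
  · intro z hz hzp
    rw [hθF]
    refine div_ne_zero ?_ hK0
    rw [hW]
    beta_reduce
    rw [map_sub, sub_ne_zero]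
    exact hne z hz hzp
  · intro v hv
    set ψ : ℂ → ℂ := fun u => θ (γ (exposeTime η u)) with hψ
    have hψd : HasDerivAt ψ (m * a) 0 := by
      have := θ.hasFDerivAt.comp_hasDerivAt (0 : ℂ) hγt
      rw [map_smul, smul_eq_mul] at this
      exact this
    have h1 : Tendsto (fun t : ℝ => g (p + t • v)) (𝓝[≠] 0) (𝓝 0) := by
      have h2 : Tendsto (fun t : ℝ => p + t • v) (𝓝[≠] 0) (𝓝 p) :=
        (Continuous.tendsto' (by fun_prop) 0 p (by simp)).mono_left nhdsWithin_le_nhds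
      have h3 := hgdp.continuousAt.tendsto.comp h2
      rw [hgp] at h3
      exact h3
    have h2 := ((continuousAt_dslope_same.2 hψd.differentiableAt).tendsto.comp h1)
    rw [dslope_same, hψd.deriv] at h2
    refine ((h2.mul (hgq v hv)).div_const (1 + m * a)).congr fun t => ?_
    have h3 : θ (W (p + t • v)) = ψ (g (p + t • v)) - ψ 0 := by
      rw [hW, hψ]
      simp only [add_sub_cancel_left, map_sub, map_add, exposeTime_zero hη,
        ← Complex.coe_smul t v, map_smul, hv, smul_zero, zero_add]
    rw [hθF, h3, ← sub_smul_dslope, sub_zero, smul_eq_mul, Function.comp_apply]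
    ring
  · intro v hv
    have h1 := re_holoQuad ρ p v
    have h2 : 1 / 2 * B v v - (m * a * holoQuad B v / (1 + m * a)).re - leviForm ρ p v =
        (holoQuad B v / (1 + m * a)).re := by
      have h3 : holoQuad B v / (1 + m * a) =
          holoQuad B v - m * a * holoQuad B v / (1 + m * a) := by
        field_simp
        ring
      rw [h3, sub_re, h1]
      ring
    rw [h2]
    refine (abs_re_le_norm _).trans ?_
    rw [norm_div, div_le_iff₀ (hR0.trans_le hKR)]
    have h3 := hq v hv
    have h4 : 0 ≤ leviForm ρ p v := by
      obtain ⟨h5, h6⟩ := holoDeriv_eq_zero_iff.1 hv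
      by_cases h0 : v = 0
      · simp [h0, leviForm]
      · exact (h.levi_pos p v hp h0 h5 h6).le
    have h5 : ‖B‖ / c₁ ≤ ε₀ * R := by
      rw [hR, mul_add, mul_div_cancel₀ _ hε₀.ne']
      linarith
    calc _ ≤ _ := h3
      _ ≤ ε₀ * R * leviForm ρ p v := by gcongr
      _ ≤ ε₀ * ‖1 + m * a‖ * leviForm ρ p v := by gcongr
      _ = _ := by ring

end IsSPC

end Exposing

section Main

open Filter Topology

variable {n : ℕ}

local notation "𝔼" => EuclideanSpace ℂ (Fin n)

lemma le_squeezingFun (hn : n ≠ 0) {Ω : Set 𝔼} {z : 𝔼} {r : ℝ} (hr : 0 < r) {f : 𝔼 → 𝔼}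
    (hf : ∀ x ∈ Ω, DifferentiableAt ℂ f x ∧ ‖f x‖ < 1) (hinj : InjOn f Ω) (hfz : f z = 0)
    (hb : ball 0 r ⊆ f '' Ω) : r ≤ squeezingFun n Ω z := by
  refine le_csSup ⟨1, ?_⟩ ⟨hr, f, fun x hx => (hf x hx).1.differentiableWithinAt, hinj, ?_, hfz, hb⟩
  · rintro s ⟨-, f', -, -, hf', -, hs⟩
    by_contra! h1
    let e : 𝔼 := EuclideanSpace.single ⟨0, Nat.pos_of_ne_zero hn⟩ 1
    have he : ‖e‖ = 1 := by simp [e]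
    have h2 := hf' (hs (mem_ball_zero_iff.2 (he.trans_lt h1)))
    rw [mem_ball_zero_iff, he] at h2
    exact h2.false
  · rintro _ ⟨x, hx, rfl⟩
    exact mem_ball_zero_iff.2 (hf x hx).2

namespace IsSPC

variable {Ω : Set (EuclideanSpace ℂ (Fin n))} {ρ : EuclideanSpace ℂ (Fin n) → ℝ}

lemma eventually_le_squeezingFun (h : IsSPC Ω ρ) (hn : n ≠ 0) {p : 𝔼} (hp : ρ p = 0) {ε : ℝ}
    (hε : 0 < ε) (hε1 : ε < 1) : ∀ᶠ z in 𝓝 p, z ∈ Ω → 1 - ε ≤ squeezingFun n Ω z := by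
  have key : ∀ᶠ z in 𝓝 p, z ∈ Ω → ∃ f : 𝔼 → 𝔼, (∀ x ∈ Ω, DifferentiableAt ℂ f x ∧ ‖f x‖ < 1) ∧
      InjOn f Ω ∧ f z = 0 ∧ ball 0 (1 - ε) ⊆ f '' Ω := by
    rcases Nat.lt_or_ge n 2 with hn2 | hn2
    · obtain rfl : n = 1 := by omega
      have hθ : holoDeriv ρ p ≠ 0 := fun h0 => h.fderiv_ne p hp (ContinuousLinearMap.ext fun v =>
        (holoDeriv_eq_zero_iff.1 (by rw [h0]; rfl)).1)
      have hinj : ∀ v, holoDeriv ρ p v = 0 → v = 0 := by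
        have h1 : Function.Surjective (holoDeriv ρ p : EuclideanSpace ℂ (Fin 1) →ₗ[ℂ] ℂ) :=
          surjective_of_continuousLinearMap_ne_zero hθ
        have h2 := (LinearMap.injective_iff_surjective_of_finrank_eq_finrank (by simp)).2 h1
        exact fun v hv => h2 (by simpa using hv)
      refine h.eventually_exists_squeezing hp isOpen_univ (subset_univ _) (F := fun z => z - p)
        (b := fun _ => 0) (ε₀ := 0) (by fun_prop) (fun x _ y _ hxy => sub_left_injective hxy)
        (sub_self p) ((hasFDerivAt_id p).sub_const p)
        (fun z _ hzp h0 => hzp (sub_eq_zero.1 (hinj _ h0))) ?_ ?_ hε hε1 (by positivity)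
      · intro v hv
        simp [hinj v hv]
      · intro v hv
        simp [hinj v hv, leviForm]
    · obtain ⟨V, hV, hΩV, F, hF, hinj, hFp, hFd, hne, b, hb, hbL⟩ :=
        h.exists_exposing_map hn2 hp (show 0 < ε / 16 by positivity)
      exact h.eventually_exists_squeezing hp hV hΩV hF hinj hFp hFd hne hb hbL hε hε1 (by linarith)
  filter_upwards [key] with z hz hzΩ
  obtain ⟨f, hf, hfi, hfz, hfb⟩ := hz hzΩ
  exact le_squeezingFun hn (by linarith) hf hfi hfz hfb

end IsSPC

end Main

end StronglyPseudoconvex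

/-- If `Ω ⊆ ℂⁿ` is a bounded domain with `C²` strongly pseudoconvex
boundary, then `σ_Ω(z) → 1` as `z → ∂Ω`: for every `ε > 0` there is a compact
`K ⊆ Ω` with `σ_Ω(z) > 1 - ε` on `Ω \ K`. -/
theorem squeezing_tendsto_one_strongly_pseudoconvex (n : ℕ)
    (Ω : Set (EuclideanSpace ℂ (Fin n)))
    (hopen : IsOpen Ω) (hconn : IsConnected Ω) (hbdd : Bornology.IsBounded Ω)
    (ρ : EuclideanSpace ℂ (Fin n) → ℝ) (hρ : ContDiff ℝ 2 ρ)
    (hΩeq : Ω = {x | ρ x < 0})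
    (hbd : frontier Ω = {x | ρ x = 0})
    (hgrad : ∀ x ∈ frontier Ω, fderiv ℝ ρ x ≠ 0)
    (hlevi : ∀ x ∈ frontier Ω, ∀ w : EuclideanSpace ℂ (Fin n), w ≠ 0 →
      fderiv ℝ ρ x w = 0 → fderiv ℝ ρ x (Complex.I • w) = 0 →
      0 < (1 / 4 : ℝ) * (iteratedFDeriv ℝ 2 ρ x ![w, w] +
        iteratedFDeriv ℝ 2 ρ x ![Complex.I • w, Complex.I • w])) :
    ∀ ε > (0 : ℝ), ∃ K : Set (EuclideanSpace ℂ (Fin n)), IsCompact K ∧ K ⊆ Ω ∧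
      ∀ z ∈ Ω \ K, 1 - ε < squeezingFun n Ω z := by
  intro ε hε
  rcases eq_or_ne n 0 with rfl | hn
  · exact ⟨Ω, (Set.subsingleton_of_subsingleton).finite.isCompact, Subset.rfl,
      fun z hz => absurd hz.1 hz.2⟩
  have hfr : ∀ x, ρ x = 0 → x ∈ frontier Ω := fun x hx => by rw [hbd]; exact hx
  have h : IsSPC Ω ρ :=
    { contDiff := hρ
      eq_setOf := hΩeq
      bounded := hbdd
      frontier_eq := hbd
      fderiv_ne := fun x hx => hgrad x (hfr x hx)
      levi_pos := fun x w hx hw h1 h2 => by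
        have h3 := hlevi x (hfr x hx) w hw h1 h2
        simpa [iteratedFDeriv_two_apply, leviForm] using h3 }
  set δ := min (ε / 2) (1 / 2) with hδ
  have hδ0 : 0 < δ := by positivity
  have hδε : δ < ε := (min_le_left _ _).trans_lt (by linarith)
  have hδ1 : δ < 1 := (min_le_right _ _).trans_lt (by norm_num)
  set N := {z | z ∈ Ω → 1 - δ ≤ squeezingFun n Ω z} with hN
  refine ⟨closure Ω \ interior N, h.isCompact_closure.diff isOpen_interior, ?_, ?_⟩
  · rintro z ⟨hz, hzN⟩
    by_contra hzΩ
    have h1 : ρ z = 0 := by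
      have h2 : z ∈ frontier Ω := ⟨hz, fun h3 => hzΩ (interior_subset h3)⟩
      rw [hbd] at h2
      exact h2
    exact hzN (mem_interior_iff_mem_nhds.2 (h.eventually_le_squeezingFun hn h1 hδ0 hδ1))
  · rintro z ⟨hz, hzK⟩
    have h1 : z ∈ N := by
      by_contra h2
      exact hzK ⟨subset_closure hz, fun h3 => h2 (interior_subset h3)⟩
    have h2 := h1 hz
    linarith
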